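/- For every integer n ≥ 55, the prime counting function satisfies n/(ln n + 2) < π(n) < n/(ln n − 4). -/

import Mathlib

namespace PNT
open Complex MeasureTheory Set Filter Topology
open scoped Real
open Finset (sum_range_succ sum_congr mul_sum sum_le_sum sum_add_distrib sum_insert)
open ArithmeticFunction (vonMangoldt vonMangoldt_nonneg)
open Chebyshev (psi theta)
open intervalIntegral (integral_eq_sub_of_hasDerivAt)
open Nat (shiftRight shiftLeft ble factorial)
open Real (pi_pos norm_of_nonneg add_one_le_exp log_le_sub_one_of_pos log_two_lt_d9 rpow_natCast log_le_log)
local notation "ln" => Real.log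

/-- `(s-1)ζ(s)`, continued to `s = 1`. -/
noncomputable def Z : ℂ → ℂ := Function.update (fun s => (s - 1) * riemannZeta s) 1 1

lemma Z_one : Z 1 = 1 := by simp [Z]

lemma Z_ne {s : ℂ} (hs : s ≠ 1) : Z s = (s - 1) * riemannZeta s := by
  simp [Z, Function.update_of_ne hs]

lemma Z_eventuallyEq {s : ℂ} (hs : s ≠ 1) : Z =ᶠ[𝓝 s] fun s => (s - 1) * riemannZeta s := by
  filter_upwards [isOpen_ne.mem_nhds hs] with w hw using Z_ne hw

lemma Z_differentiable : Differentiable ℂ Z := by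
  intro s
  by_cases hs : s = 1
  · subst hs
    apply AnalyticAt.differentiableAt
    apply analyticAt_of_differentiable_on_punctured_nhds_of_continuousAt
    · filter_upwards [self_mem_nhdsWithin] with z hz
      have hz : z ≠ 1 := hz
      refine (DifferentiableAt.congr_of_eventuallyEq ?_ (Z_eventuallyEq hz))
      exact ((differentiableAt_id.sub_const 1).mul (differentiableAt_riemannZeta hz))
    · rw [Z, continuousAt_update_same]
      exact riemannZeta_residue_one
  · refine (DifferentiableAt.congr_of_eventuallyEq ?_ (Z_eventuallyEq hs))
    exact ((differentiableAt_id.sub_const 1).mul (differentiableAt_riemannZeta hs))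

lemma Z_ne_zero_of_one_le {s : ℂ} (hs : 1 ≤ s.re) : Z s ≠ 0 := by
  by_cases h : s = 1
  · rw [h, Z_one]; exact one_ne_zero
  · rw [Z_ne h]
    exact mul_ne_zero (sub_ne_zero.2 h) (riemannZeta_ne_zero_of_one_le_re hs)

lemma deriv_Z {s : ℂ} (hs : s ≠ 1) :
    deriv Z s = riemannZeta s + (s - 1) * deriv riemannZeta s := by
  rw [(Z_eventuallyEq hs).deriv_eq]
  have h1 : HasDerivAt (fun s : ℂ => s - 1) 1 s := (hasDerivAt_id s).sub_const 1
  have h2 := (differentiableAt_riemannZeta hs).hasDerivAt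
  have := (h1.mul h2).deriv
  rw [one_mul] at this
  exact this

/-- The function `-(ζ'/ζ)(s)/s - 1/(s-1)`. -/
noncomputable def Gf (s : ℂ) : ℂ := -(1 + deriv Z s / Z s) / s

lemma Gf_eq {s : ℂ} (hs : s ≠ 1) (h0 : s ≠ 0) (hz : riemannZeta s ≠ 0) :
    Gf s = (-deriv riemannZeta s / riemannZeta s) / s - 1 / (s - 1) := by
  have h1 : s - 1 ≠ 0 := sub_ne_zero.2 hs
  rw [Gf, deriv_Z hs, Z_ne hs]
  field_simp
  ring

/-- `ψ(e^u)/e^u`. -/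
noncomputable def W (u : ℝ) : ℝ := psi (rexp u) * rexp (-u)

lemma W_nonneg (u : ℝ) : 0 ≤ W u := mul_nonneg (Chebyshev.psi_nonneg _) (Real.exp_pos _).le

lemma W_le (u : ℝ) : W u ≤ 6 := by
  have h := Chebyshev.psi_le_const_mul_self (Real.exp_pos u).le
  have h4 : ln 4 ≤ 2 := by
    have : ln 4 = 2 * ln 2 := by
      rw [show (4:ℝ) = 2 ^ 2 by norm_num, Real.log_pow]; norm_num
    have := log_two_lt_d9
    linarith
  have h2 : psi (rexp u) ≤ 6 * rexp u := by
    nlinarith [Real.exp_pos u]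
  calc W u ≤ 6 * rexp u * rexp (-u) := by
        unfold W; gcongr
    _ = 6 := by rw [mul_assoc, ← Real.exp_add]; simp

lemma W_measurable : Measurable W := by
  unfold W
  exact ((Chebyshev.psi_mono.measurable).comp Real.measurable_exp).mul
    (Real.measurable_exp.comp measurable_neg)

lemma W_sub_abs_le (u : ℝ) : |W u - 1| ≤ 5 := by
  rw [abs_le]; constructor <;> linarith [W_nonneg u, W_le u]

lemma W_mono_ge {u v : ℝ} (h : u ≤ v) : W u * rexp (u - v) ≤ W v := by
  have : W u * rexp (u - v) = psi (rexp u) * rexp (-v) := by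
    unfold W; rw [mul_assoc, ← Real.exp_add]; congr 2; ring
  rw [this]
  unfold W
  exact mul_le_mul_of_nonneg_right (Chebyshev.psi_mono (Real.exp_le_exp.2 h)) (Real.exp_pos _).le

lemma psi_LSeries {s : ℂ} (hs : 1 < s.re) :
    -deriv riemannZeta s / riemannZeta s =
      s * ∫ t in Ioi (1:ℝ), (psi t : ℂ) * (t : ℂ) ^ (-(s + 1)) := by
  rw [← ArithmeticFunction.LSeries_vonMangoldt_eq_deriv_riemannZeta_div hs]
  rw [LSeries_eq_mul_integral_of_nonneg (fun n => vonMangoldt n) zero_le_one hs]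
  · congr 1
    apply integral_congr_ae
    filter_upwards with t
    congr 1
    simp only [psi]
    push_cast
    rfl
  · simp only [Real.rpow_one]
    refine Asymptotics.IsBigO.of_bound (ln 4 + 4) ?_
    filter_upwards with n
    have h := Chebyshev.psi_le_const_mul_self (x := n) (by positivity)
    have h2 : ∑ k ∈ Finset.Icc 1 n, vonMangoldt k = psi n := by
      simp only [psi, Nat.floor_natCast]
      rfl
    rw [h2, norm_of_nonneg (Chebyshev.psi_nonneg _), norm_of_nonneg (by positivity)]
    exact h
  · intro n; exact vonMangoldt_nonneg

lemma exp_image : rexp '' (Ioi 0) = Ioi 1 := by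
  ext x
  simp only [mem_image, mem_Ioi]
  constructor
  · rintro ⟨u, hu, rfl⟩; exact Real.one_lt_exp_iff.2 hu
  · intro hx
    exact ⟨ln x, Real.log_pos hx, Real.exp_log (by linarith)⟩

lemma psi_laplace {s : ℂ} :
    ∫ t in Ioi (1:ℝ), (psi t : ℂ) * (t : ℂ) ^ (-(s + 1)) =
      ∫ u in Ioi (0:ℝ), (W u : ℂ) * cexp (-(s - 1) * u) := by
  rw [← exp_image, integral_image_eq_integral_abs_deriv_smul measurableSet_Ioi
    (fun x _ => (Real.hasDerivAt_exp x).hasDerivWithinAt) (Real.exp_injective.injOn)]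
  apply setIntegral_congr_fun measurableSet_Ioi
  intro u _
  simp only [W, abs_of_pos (Real.exp_pos u), real_smul]
  rw [Complex.cpow_def_of_ne_zero (by exact_mod_cast (Real.exp_pos u).ne'),
    ← Complex.ofReal_log (Real.exp_pos u).le, Real.log_exp]
  push_cast
  have : cexp (u) * (↑(psi (rexp u)) * cexp (u * -(s + 1)))
    = ↑(psi (rexp u)) * (cexp u * cexp (u * -(s+1))) := by ring
  rw [this, mul_assoc, ← Complex.exp_add, ← Complex.exp_add]
  congr 2
  ring

lemma exp_integrable {c : ℂ} (hc : 0 < c.re) :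
    IntegrableOn (fun u : ℝ => cexp (-c * u)) (Ioi 0) :=
  integrableOn_exp_mul_complex_Ioi (by simpa using hc) 0

lemma W_exp_integrable {c : ℂ} (hc : 0 < c.re) :
    IntegrableOn (fun u : ℝ => (W u : ℂ) * cexp (-c * u)) (Ioi 0) := by
  refine (exp_integrable hc).bdd_mul (c := 6) ?_ ?_
  · exact (Complex.measurable_ofReal.comp W_measurable).aestronglyMeasurable
  · filter_upwards with u
    rw [Complex.norm_real, norm_of_nonneg (W_nonneg u)]
    exact W_le u

lemma laplace {s : ℂ} (hs : 1 < s.re) :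
    ∫ u in Ioi (0:ℝ), ((W u : ℂ) - 1) * cexp (-(s - 1) * u) = Gf s := by
  have hc : 0 < (s - 1).re := by simpa using hs
  have h0 : s ≠ 0 := by rintro rfl; simp at hs; linarith
  have h1 : s ≠ 1 := by rintro rfl; simp at hs
  simp_rw [sub_mul, one_mul]
  rw [integral_sub (W_exp_integrable hc) (exp_integrable hc), ← psi_laplace,
    Gf_eq h1 h0 (riemannZeta_ne_zero_of_one_le_re hs.le), psi_LSeries hs,
    mul_div_cancel_left₀ _ h0]
  congr 1
  rw [integral_exp_mul_complex_Ioi (by simpa using hc)]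
  have h2 : s - 1 ≠ 0 := sub_ne_zero.2 h1
  simp only [Complex.ofReal_zero, mul_zero, Complex.exp_zero]
  rw [neg_div_neg_eq]

/-- Fejér kernel. -/
noncomputable def kf (T w : ℝ) : ℝ := (1 - Real.cos (T * w)) / (π * T * w ^ 2)

lemma kf_nonneg {T : ℝ} (hT : 0 < T) (w : ℝ) : 0 ≤ kf T w := by
  unfold kf
  have := Real.cos_le_one (T * w)
  have := pi_pos
  apply div_nonneg (by linarith) (by positivity)

lemma kf_even (T w : ℝ) : kf T (-w) = kf T w := by simp [kf]

lemma kf_le_tail {T : ℝ} (hT : 0 < T) (w : ℝ) : kf T w ≤ 2 / (π * T) * (w ^ 2)⁻¹ := by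
  unfold kf
  have := Real.neg_one_le_cos (T * w)
  have := pi_pos
  rw [div_mul_eq_div_div, div_eq_mul_inv]
  gcongr
  linarith

lemma kf_le_const {T : ℝ} (hT : 0 < T) (w : ℝ) : kf T w ≤ T / (2 * π) := by
  have hp := pi_pos
  unfold kf
  by_cases hw : w = 0
  · subst hw; simp; positivity
  · have := Real.one_sub_sq_div_two_le_cos (x := T * w)
    rw [div_le_div_iff₀ (by positivity) (by positivity)]
    have : 1 - Real.cos (T * w) ≤ (T * w) ^ 2 / 2 := by linarith
    calc (1 - Real.cos (T * w)) * (2 * π) ≤ (T * w) ^ 2 / 2 * (2 * π) := by gcongr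
      _ = T * (π * T * w ^ 2) := by ring

lemma kf_measurable (T : ℝ) : Measurable (kf T) := by unfold kf; fun_prop

lemma kf_integrable {T : ℝ} (hT : 0 < T) : Integrable (kf T) := by
  have h := (integrable_inv_one_add_sq).const_mul (T / (2 * π) + 2 / (π * T))
  refine h.mono' (kf_measurable T).aestronglyMeasurable ?_
  filter_upwards with w
  rw [norm_of_nonneg (kf_nonneg hT w)]
  have hp := pi_pos
  by_cases hw : w = 0
  · subst hw; simp [kf]; positivity
  · rw [← div_eq_mul_inv, le_div_iff₀ (by positivity), mul_add, mul_one]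
    have h1 := kf_le_const hT w
    have h2 := kf_le_tail hT w
    have h3 : kf T w * w ^ 2 ≤ 2 / (π * T) * (w ^ 2)⁻¹ * w ^ 2 := by gcongr
    rw [mul_assoc, inv_mul_cancel₀ (by positivity), mul_one] at h3
    linarith

lemma kf_integral {T : ℝ} (hT : 0 < T) {w : ℝ} (hw : w ≠ 0) :
    ∫ t in (0:ℝ)..T, (1 - t / T) * Real.cos (t * w) = π * kf T w := by
  have hd : ∀ t ∈ uIcc 0 T, HasDerivAt
      (fun t => (1 - t / T) * (Real.sin (t * w) / w) - Real.cos (t * w) / (T * w ^ 2))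
      ((1 - t / T) * Real.cos (t * w)) t := by
    intro t _
    have e1 : HasDerivAt (fun t : ℝ => 1 - t / T) (-(1 / T)) t := by
      simpa using ((hasDerivAt_id t).div_const T).const_sub 1
    have e0 : HasDerivAt (fun t : ℝ => t * w) w t := by
      simpa using (hasDerivAt_id t).mul_const w
    have e2 := (e0.sin).div_const w
    have e3 := (e0.cos).div_const (T * w ^ 2)
    refine ((e1.mul e2).sub e3).congr_deriv ?_
    field_simp
    ring
  rw [integral_eq_sub_of_hasDerivAt hd]
  · have hp := pi_pos
    unfold kf
    simp only [div_self hT.ne', sub_self, zero_mul, Real.sin_zero, Real.cos_zero, zero_div, mul_zero]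
    field_simp
    ring
  · apply Continuous.intervalIntegrable; fun_prop

/-- Fubini step. -/
lemma fubini_step {f : ℝ → ℝ} (hf : Measurable f) {C : ℝ} (hC : ∀ u, |f u| ≤ C)
    {T : ℝ} (hT : 0 < T) (L : ℝ) {ε : ℝ} (hε : 0 < ε) :
    (∫ t in (0:ℝ)..T, ((1 - t / T : ℝ) : ℂ) * cexp (t * L * I) *
      ∫ u in Ioi (0:ℝ), (f u : ℂ) * cexp (-(ε + t * I) * u)).re =
    π * ∫ u in Ioi (0:ℝ), f u * rexp (-ε * u) * kf T (L - u) := by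
  have hCn : 0 ≤ C := (abs_nonneg _).trans (hC 0)
  set F : ℝ → ℝ → ℂ := fun t u => ((1 - t / T : ℝ) : ℂ) * cexp (t * L * I) *
      ((f u : ℂ) * cexp (-(ε + t * I) * u)) with hF
  have hFre : ∀ t u, (F t u).re =
      f u * rexp (-ε * u) * ((1 - t / T) * Real.cos (t * (L - u))) := by
    intro t u
    have : F t u = ((f u * rexp (-ε * u) * (1 - t / T) : ℝ) : ℂ) *
        cexp ((t * (L - u) : ℝ) * I) := by
      simp only [hF]
      push_cast
      have : cexp (t * L * I) * cexp (-(ε + t * I) * u) = cexp (-ε * u) * cexp (t * (L - u) * I) := by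
        rw [← Complex.exp_add, ← Complex.exp_add]; congr 1; ring
      linear_combination ((1 - t / T : ℂ) * f u) * this
    rw [this, re_ofReal_mul, exp_ofReal_mul_I_re]
    ring
  have hint : Integrable (Function.uncurry F)
      ((volume.restrict (Ioc 0 T)).prod (volume.restrict (Ioi 0))) := by
    have h1 : Integrable (fun p : ℝ × ℝ => (C : ℝ) * rexp (-ε * p.2))
      ((volume.restrict (Ioc 0 T)).prod (volume.restrict (Ioi 0))) := by
      have a1 : Integrable (fun _ : ℝ => C) (volume.restrict (Ioc 0 T)) := by
        simp
      have a2 : Integrable (fun u : ℝ => rexp (-ε * u)) (volume.restrict (Ioi 0)) :=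
        integrableOn_exp_mul_Ioi (by linarith) 0
      exact a1.mul_prod a2
    refine h1.mono' ?_ ?_
    · apply Measurable.aestronglyMeasurable
      simp only [hF]
      fun_prop
    · rw [Measure.prod_restrict]
      filter_upwards [ae_restrict_mem (measurableSet_Ioc.prod measurableSet_Ioi)] with p hp
      obtain ⟨ht, hu⟩ := hp
      simp only [mem_Ioc] at ht
      simp only [hF, Function.uncurry, norm_mul, Complex.norm_real]
      have n1 : ‖cexp (p.1 * L * I)‖ = 1 := by
        rw [← ofReal_mul]; exact norm_exp_ofReal_mul_I _
      have n2 : ‖cexp (-(ε + p.1 * I) * p.2)‖ = rexp (-ε * p.2) := by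
        rw [norm_exp]; congr 1; simp
      rw [n1, n2, mul_one]
      have n3 : ‖1 - p.1 / T‖ ≤ 1 := by
        have : p.1 / T ≤ 1 := (div_le_one hT).2 ht.2
        have : 0 ≤ p.1 / T := div_nonneg ht.1.le hT.le
        rw [Real.norm_eq_abs, abs_le]; constructor <;> linarith
      calc ‖1 - p.1 / T‖ * (‖f p.2‖ * rexp (-ε * p.2)) ≤ 1 * (C * rexp (-ε * p.2)) := by
            gcongr; exact hC _
        _ = _ := one_mul _
  have e1 : (∫ t in (0:ℝ)..T, ((1 - t / T : ℝ) : ℂ) * cexp (t * L * I) *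
      ∫ u in Ioi (0:ℝ), (f u : ℂ) * cexp (-(ε + t * I) * u)) =
      ∫ u in Ioi (0:ℝ), ∫ t in Ioc 0 T, F t u := by
    rw [← integral_integral_swap hint, intervalIntegral.integral_of_le hT.le]
    simp only [hF, integral_const_mul]
  have hint' : Integrable (fun u => ∫ t in Ioc 0 T, F t u) (volume.restrict (Ioi 0)) :=
    hint.swap.integral_prod_left
  have hint2 : ∀ᵐ u ∂(volume.restrict (Ioi (0:ℝ))), Integrable (fun t => F t u) (volume.restrict (Ioc 0 T)) :=
    hint.prod_left_ae
  rw [e1, ← reCLM_apply, ← ContinuousLinearMap.integral_comp_comm _ hint', ← integral_const_mul]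
  apply integral_congr_ae
  have hL : ∀ᵐ u ∂(volume.restrict (Ioi (0:ℝ))), u ≠ L := by
    apply ae_restrict_of_ae
    exact Measure.ae_ne volume L
  filter_upwards [hint2, hL] with u hu huL
  rw [← ContinuousLinearMap.integral_comp_comm _ hu]
  simp only [reCLM_apply, hFre]
  rw [integral_const_mul, ← intervalIntegral.integral_of_le hT.le,
    kf_integral hT (sub_ne_zero.2 (Ne.symm huL))]
  ring

lemma tendsto_damp {f : ℝ → ℝ} (hf : Measurable f) {C : ℝ} (hC : ∀ u, |f u| ≤ C)
    {T : ℝ} (hT : 0 < T) (L : ℝ) :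
    Tendsto (fun ε : ℝ => ∫ u in Ioi (0:ℝ), f u * rexp (-ε * u) * kf T (L - u)) (𝓝[>] 0)
      (𝓝 (∫ u in Ioi (0:ℝ), f u * kf T (L - u))) := by
  have hCn : 0 ≤ C := (abs_nonneg _).trans (hC 0)
  apply tendsto_integral_filter_of_dominated_convergence (fun u => C * kf T (L - u))
  · filter_upwards with ε
    apply Measurable.aestronglyMeasurable
    have := kf_measurable T
    fun_prop
  · filter_upwards [self_mem_nhdsWithin] with ε hε
    filter_upwards [ae_restrict_mem measurableSet_Ioi] with u hu
    simp only [mem_Ioi] at hε hu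
    rw [norm_mul, norm_mul, norm_of_nonneg (kf_nonneg hT _), norm_of_nonneg (Real.exp_pos _).le]
    have h1 : rexp (-ε * u) ≤ 1 := by
      rw [Real.exp_le_one_iff]; nlinarith
    have := kf_nonneg hT (L - u)
    have h2 : ‖f u‖ * rexp (-ε * u) ≤ C * 1 :=
      mul_le_mul (hC u) h1 (Real.exp_pos _).le hCn
    rw [mul_one] at h2
    gcongr
  · have := ((kf_integrable hT).comp_sub_left L).const_mul C
    exact this.restrict
  · filter_upwards with u
    have : Tendsto (fun ε : ℝ => f u * rexp (-ε * u) * kf T (L - u)) (𝓝 0)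
      (𝓝 (f u * rexp (-0 * u) * kf T (L - u))) := by
      apply Continuous.tendsto
      fun_prop
    simp only [neg_zero, zero_mul, Real.exp_zero, mul_one] at this
    exact this.mono_left nhdsWithin_le_nhds

lemma half_mass {T : ℝ} (hT : 0 < T) : ∫ u in Ioi (0:ℝ), kf T u ≤ 1 / 2 := by
  have hp := pi_pos
  have h := tendsto_damp (f := fun _ => 1) measurable_const (C := 1) (by simp) hT 0
  simp only [one_mul, zero_sub, kf_even] at h
  refine le_of_tendsto h ?_
  filter_upwards [self_mem_nhdsWithin] with ε hε
  simp only [mem_Ioi] at hε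
  have h2 := fubini_step (f := fun _ => 1) measurable_const (C := 1) (by simp) hT 0 hε
  simp only [one_mul, zero_sub, kf_even, ofReal_zero, mul_zero, zero_mul, Complex.exp_zero,
    mul_one, ofReal_one] at h2
  have h3 : ∀ t : ℝ, ∫ u in Ioi (0:ℝ), cexp (-(ε + t * I) * u) = 1 / (ε + t * I) := by
    intro t
    rw [integral_exp_mul_complex_Ioi (by simpa using hε)]
    simp only [Complex.ofReal_zero, mul_zero, Complex.exp_zero]
    rw [neg_div_neg_eq]
  simp only [h3] at h2
  have hne : ∀ t : ℝ, (ε : ℂ) + t * I ≠ 0 := by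
    intro t h0
    have := congrArg Complex.re h0
    simp at this
    linarith
  have hre : ∀ t : ℝ, (((1 - t / T : ℝ) : ℂ) * (1 / (ε + t * I))).re
      = (1 - t / T) * (ε / (ε ^ 2 + t ^ 2)) := by
    intro t
    rw [re_ofReal_mul]
    congr 1
    rw [one_div, Complex.inv_re]
    simp [normSq_apply, sq]
  have hcont : Continuous fun t : ℝ => ((1 - t / T : ℝ) : ℂ) * (1 / (ε + t * I)) := by
    have : Continuous fun t : ℝ => (1 / ((ε:ℂ) + t * I)) :=
      continuous_const.div (by fun_prop) hne
    fun_prop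
  rw [← reCLM_apply, ← ContinuousLinearMap.intervalIntegral_comp_comm _
    (hcont.intervalIntegrable _ _)] at h2
  simp only [reCLM_apply, hre] at h2
  have hpos : ∀ t : ℝ, 0 < ε ^ 2 + t ^ 2 := fun t => by positivity
  have hat : ∫ t in (0:ℝ)..T, ε / (ε ^ 2 + t ^ 2) = Real.arctan (T / ε) := by
    have hd : ∀ t ∈ uIcc 0 T, HasDerivAt (fun t => Real.arctan (t / ε)) (ε / (ε ^ 2 + t ^ 2)) t := by
      intro t _
      have := ((hasDerivAt_id t).div_const ε).arctan
      refine this.congr_deriv ?_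
      have := hpos t
      simp only [id]
      field_simp
    rw [integral_eq_sub_of_hasDerivAt hd]
    · simp
    · apply Continuous.intervalIntegrable
      exact continuous_const.div (by fun_prop) (fun t => (hpos t).ne')
  have hle : ∫ t in (0:ℝ)..T, (1 - t / T) * (ε / (ε ^ 2 + t ^ 2)) ≤ ∫ t in (0:ℝ)..T, ε / (ε ^ 2 + t ^ 2) := by
    have c1 : Continuous fun t : ℝ => ε / (ε ^ 2 + t ^ 2) :=
      continuous_const.div (by fun_prop) (fun t => (hpos t).ne')
    apply intervalIntegral.integral_mono_on hT.le
    · exact Continuous.intervalIntegrable (by fun_prop) _ _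
    · exact c1.intervalIntegrable _ _
    · intro t ht
      have : 0 ≤ t / T := div_nonneg ht.1 hT.le
      have h5 : 0 ≤ ε / (ε ^ 2 + t ^ 2) := (div_pos hε (hpos t)).le
      nlinarith
  rw [h2, hat] at hle
  have := Real.arctan_lt_pi_div_two (T / ε)
  rw [← mul_le_mul_iff_right₀ hp]
  linarith

/-- `J(L,T)`. -/
noncomputable def Jf (L T : ℝ) : ℝ :=
  (∫ t in (0:ℝ)..T, ((1 - t / T : ℝ) : ℂ) * cexp (t * L * I) * Gf (1 + t * I)).re / π

lemma Z_deriv_continuous : Continuous (deriv Z) :=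
  (Z_differentiable.contDiff (n := 1)).continuous_deriv le_rfl

lemma Jf_eq {T : ℝ} (hT : 0 < T) (L : ℝ) :
    ∫ u in Ioi (0:ℝ), (W u - 1) * kf T (L - u) = Jf L T := by
  have hp := pi_pos
  have h := tendsto_damp (f := fun u => W u - 1) (W_measurable.sub_const 1) (C := 5) W_sub_abs_le hT L
  refine tendsto_nhds_unique h ?_
  have hcont : Continuous fun p : ℝ × ℝ => ((1 - p.2 / T : ℝ) : ℂ) * cexp (p.2 * L * I) *
      Gf (1 + |p.1| + p.2 * I) := by
    have hG : Continuous fun p : ℝ × ℝ => Gf (1 + |p.1| + p.2 * I) := by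
      have hb : Continuous fun p : ℝ × ℝ => (1 + |p.1| + p.2 * I : ℂ) := by fun_prop
      have hre : ∀ p : ℝ × ℝ, 1 ≤ (1 + |p.1| + p.2 * I : ℂ).re := by intro p; simp
      unfold Gf
      refine Continuous.div ?_ hb ?_
      · refine (continuous_const.add (Continuous.div ?_ ?_ ?_)).neg
        · exact Z_deriv_continuous.comp hb
        · exact Z_differentiable.continuous.comp hb
        · intro p; exact Z_ne_zero_of_one_le (hre p)
      · intro p h0
        have := hre p
        rw [h0] at this; simp at this; linarith
    fun_prop
  have h2 := intervalIntegral.continuous_parametric_intervalIntegral_of_continuous'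
    (μ := volume) (f := fun (x t : ℝ) => ((1 - t / T : ℝ) : ℂ) * cexp (t * L * I) *
      Gf (1 + |x| + t * I)) hcont 0 T
  have h3 := ((Complex.continuous_re.comp h2).div_const π).tendsto 0
  simp only [Function.comp, abs_zero, ofReal_zero, add_zero] at h3
  refine (h3.mono_left (nhdsWithin_le_nhds (s := Ioi 0))).congr' ?_
  filter_upwards [self_mem_nhdsWithin] with ε hε
  simp only [mem_Ioi] at hε
  have h4 := fubini_step (f := fun u => W u - 1) (W_measurable.sub_const 1) (C := 5) W_sub_abs_le hT L hε
  rw [eq_comm, eq_div_iff hp.ne', mul_comm, ← h4]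
  congr 1
  apply intervalIntegral.integral_congr
  intro t _
  simp only
  rw [abs_of_pos hε, ← laplace (s := 1 + ε + t * I) (by simpa using hε)]
  congr 1
  apply integral_congr_ae
  filter_upwards with u
  push_cast
  congr 3
  ring

lemma cos_upper8 (x : ℝ) (hx : 0 ≤ x) :
    Real.cos x ≤ 1 - x^2/2 + x^4/24 - x^6/720 + x^8/40320 := by
  have mono : ∀ f f' : ℝ → ℝ, (∀ x, HasDerivAt f (f' x) x) → (∀ x, 0 ≤ x → 0 ≤ f' x) → f 0 = 0 →
      ∀ x, 0 ≤ x → 0 ≤ f x := by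
    intro f f' h1 h2 h0 x hx
    have : MonotoneOn f (Ici 0) := by
      apply monotoneOn_of_deriv_nonneg (convex_Ici 0)
        (fun x _ => (h1 x).continuousAt.continuousWithinAt)
        (fun x _ => (h1 x).differentiableAt.differentiableWithinAt)
      intro y hy
      rw [(h1 y).deriv]; rw [interior_Ici] at hy; exact h2 y (le_of_lt hy)
    have := this (mem_Ici.2 le_rfl) (mem_Ici.2 hx) hx
    linarith
  have c := fun x => Real.hasDerivAt_cos x
  have s := fun x => Real.hasDerivAt_sin x
  have pw := fun (n : ℕ) (x : ℝ) => hasDerivAt_pow n x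
  have e0 : ∀ x : ℝ, 0 ≤ x → 0 ≤ x - Real.sin x := by
    intro x hx; linarith [Real.sin_le hx]
  have e1 := mono (fun x => Real.cos x - 1 + x^2/2) (fun x => x - Real.sin x)
    (fun x => by
      have := ((c x).sub_const 1).add ((pw 2 x).div_const 2)
      exact this.congr_deriv (by norm_num; try ring)) e0 (by norm_num)
  have e2 := mono (fun x => Real.sin x - x + x^3/6) (fun x => Real.cos x - 1 + x^2/2)
    (fun x => by
      have := ((s x).sub (hasDerivAt_id x)).add ((pw 3 x).div_const 6)
      exact this.congr_deriv (by norm_num; try ring)) e1 (by norm_num)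
  have e3 := mono (fun x => 1 - x^2/2 + x^4/24 - Real.cos x) (fun x => Real.sin x - x + x^3/6)
    (fun x => by
      have := ((((pw 2 x).div_const 2).const_sub 1).add ((pw 4 x).div_const 24)).sub (c x)
      exact this.congr_deriv (by norm_num; try ring)) e2 (by norm_num)
  have e4 := mono (fun x => x - x^3/6 + x^5/120 - Real.sin x) (fun x => 1 - x^2/2 + x^4/24 - Real.cos x)
    (fun x => by
      have := (((hasDerivAt_id x).sub ((pw 3 x).div_const 6)).add ((pw 5 x).div_const 120)).sub (s x)
      exact this.congr_deriv (by norm_num; try ring)) e3 (by norm_num)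
  have e5 := mono (fun x => Real.cos x - 1 + x^2/2 - x^4/24 + x^6/720) (fun x => x - x^3/6 + x^5/120 - Real.sin x)
    (fun x => by
      have := ((((c x).sub_const 1).add ((pw 2 x).div_const 2)).sub ((pw 4 x).div_const 24)).add ((pw 6 x).div_const 720)
      exact this.congr_deriv (by norm_num; try ring)) e4 (by norm_num)
  have e6 := mono (fun x => Real.sin x - x + x^3/6 - x^5/120 + x^7/5040) (fun x => Real.cos x - 1 + x^2/2 - x^4/24 + x^6/720)
    (fun x => by
      have := ((((s x).sub (hasDerivAt_id x)).add ((pw 3 x).div_const 6)).sub ((pw 5 x).div_const 120)).add ((pw 7 x).div_const 5040)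
      exact this.congr_deriv (by norm_num; try ring)) e5 (by norm_num)
  have e7 := mono (fun x => 1 - x^2/2 + x^4/24 - x^6/720 + x^8/40320 - Real.cos x) (fun x => Real.sin x - x + x^3/6 - x^5/120 + x^7/5040)
    (fun x => by
      have := ((((((pw 2 x).div_const 2).const_sub 1).add ((pw 4 x).div_const 24)).sub ((pw 6 x).div_const 720)).add ((pw 8 x).div_const 40320)).sub (c x)
      exact this.congr_deriv (by norm_num; try ring)) e6 (by norm_num)
  linarith [e7 x hx]

noncomputable def mass (T : ℝ) : ℝ := ∫ w in (-(π/T))..(π/T), kf T w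

lemma mass_ge {T : ℝ} (hT : 0 < T) : 0.773 ≤ mass T := by
  have hp := pi_pos
  have key : ∀ w : ℝ, w ≠ 0 → T/π * (1/2 - T^2*w^2/24 + T^4*w^4/720 - T^6*w^6/40320) ≤ kf T w := by
    intro w hw
    have h := cos_upper8 (|T*w|) (abs_nonneg _)
    rw [Real.cos_abs] at h
    have e2 : |T*w|^2 = (T*w)^2 := sq_abs _
    have e4 : |T*w|^4 = (T*w)^4 := by rw [show |T*w|^4 = (|T*w|^2)^2 by ring, e2]; ring
    have e6 : |T*w|^6 = (T*w)^6 := by rw [show |T*w|^6 = (|T*w|^2)^3 by ring, e2]; ring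
    have e8 : |T*w|^8 = (T*w)^8 := by rw [show |T*w|^8 = (|T*w|^2)^4 by ring, e2]; ring
    rw [e2, e4, e6, e8] at h
    have hw2 : 0 < w^2 := by positivity
    unfold kf
    rw [le_div_iff₀ (by positivity)]
    have : T / π * (1 / 2 - T ^ 2 * w ^ 2 / 24 + T ^ 4 * w ^ 4 / 720 - T^6*w^6/40320) * (π * T * w ^ 2)
      = (T*w)^2/2 - (T*w)^4/24 + (T*w)^6/720 - (T*w)^8/40320 := by
      field_simp
    rw [this]; linarith
  have hint : IntervalIntegrable (kf T) volume (-(π/T)) (π/T) :=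
    (kf_integrable hT).intervalIntegrable
  have hle : -(π/T) ≤ π/T := by
    have : 0 < π/T := by positivity
    linarith
  have h1 : ∫ w in (-(π/T))..(π/T), T/π * (1/2 - T^2*w^2/24 + T^4*w^4/720 - T^6*w^6/40320) ≤ mass T := by
    unfold mass
    apply intervalIntegral.integral_mono_ae hle _ hint
    · have : ∀ᵐ w : ℝ, w ≠ 0 := by simp [ae_iff, measure_singleton]
      filter_upwards [this] with w hw using key w hw
    · apply Continuous.intervalIntegrable; fun_prop
  have h2 : ∫ w in (-(π/T))..(π/T), T/π * (1/2 - T^2*w^2/24 + T^4*w^4/720 - T^6*w^6/40320)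
     = 1 - π^2/36 + π^4/1800 - π^6/141120 := by
    have hd : ∀ w : ℝ, HasDerivAt (fun w => T/π * (w/2 - T^2*(w^3/3)/24 + T^4*(w^5/5)/720 - T^6*(w^7/7)/40320))
       (T/π * (1/2 - T^2*w^2/24 + T^4*w^4/720 - T^6*w^6/40320)) w := by
      intro w
      have := ((((hasDerivAt_id w).div_const 2).sub ((((hasDerivAt_pow 3 w).div_const 3).const_mul (T^2)).div_const 24)).add
        ((((hasDerivAt_pow 5 w).div_const 5).const_mul (T^4)).div_const 720)).sub ((((hasDerivAt_pow 7 w).div_const 7).const_mul (T^6)).div_const 40320)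
      have := this.const_mul (T/π)
      exact this.congr_deriv (by norm_num; try ring)
    rw [integral_eq_sub_of_hasDerivAt (fun w _ => hd w)]
    · field_simp; ring
    · apply Continuous.intervalIntegrable; fun_prop
  rw [h2] at h1
  have p1 := Real.pi_gt_d6
  have p2 := Real.pi_lt_d6
  have q1 : π^2 ≤ 9.86961 := by nlinarith
  have q2 : 9.8695 ≤ π^2 := by nlinarith
  have q4 : 97.40 ≤ π^4 := by nlinarith
  have q6 : π^6 ≤ 961.5 := by
    have : π^4 ≤ 97.4092 := by nlinarith
    nlinarith
  norm_num at *
  linarith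

lemma kf_tail {T : ℝ} (hT : 0 < T) {b : ℝ} (hb : 0 < b) :
    ∫ w in Ioi b, kf T w ≤ 2 / (π * T * b) := by
  have hp := pi_pos
  have hi : IntegrableOn (fun w : ℝ => 2 / (π * T) * (w ^ 2)⁻¹) (Ioi b) := by
    have := (integrableOn_Ioi_rpow_of_lt (a := -2) (by norm_num) hb).const_mul (2/(π*T))
    apply IntegrableOn.congr_fun this _ measurableSet_Ioi
    intro w hw
    have : 0 < w := hb.trans hw
    simp only [Real.rpow_neg this.le]
    norm_num
  have h1 : ∫ w in Ioi b, kf T w ≤ ∫ w in Ioi b, 2 / (π * T) * (w ^ 2)⁻¹ :=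
    setIntegral_mono (kf_integrable hT).integrableOn hi (fun w => kf_le_tail hT w)
  have h2 : ∫ w in Ioi b, 2 / (π * T) * (w ^ 2)⁻¹ = 2 / (π * T * b) := by
    have h3 := integral_Ioi_rpow_of_lt (a := -2) (by norm_num) hb
    have : ∫ w in Ioi b, 2 / (π * T) * (w ^ 2)⁻¹ = ∫ w in Ioi b, 2 / (π * T) * w ^ (-2:ℝ) := by
      apply setIntegral_congr_fun measurableSet_Ioi
      intro w hw
      have : 0 < w := hb.trans hw
      simp only [Real.rpow_neg this.le]
      norm_num
    rw [this, integral_const_mul, h3]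
    norm_num
    rw [Real.rpow_neg hb.le, Real.rpow_one]
    field_simp
  linarith

lemma kf_total {T : ℝ} (hT : 0 < T) : ∫ w, kf T w ≤ 1 := by
  rw [← intervalIntegral.integral_Iic_add_Ioi (b := 0) (kf_integrable hT).integrableOn (kf_integrable hT).integrableOn]
  have h := half_mass hT
  have : ∫ u in Iic (0:ℝ), kf T u = ∫ u in Ioi (0:ℝ), kf T u := by
    have := integral_comp_neg_Ioi (0:ℝ) (kf T)
    simp only [kf_even, neg_zero] at this
    exact this.symm
  linarith

lemma taub_core {T : ℝ} (hT : 0 < T) {f : ℝ → ℝ} (hf : Measurable f) {L p q ε ε2 b b2 : ℝ}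
    (hb : π / T ≤ b) (hb2 : 0 < b2) (hε : 0 ≤ ε) (hε2 : 0 ≤ ε2) (hL : π / T < L)
    (hC : ∀ u, |f u| ≤ 5)
    (hnear : ∀ u, |u - L| ≤ π / T → p + q * (L - u) ≤ f u)
    (h1 : ∀ u, L - b ≤ u → -ε ≤ f u) (h2 : ∀ u, L - b2 ≤ u → -ε2 ≤ f u) :
    p * mass T - ε * (1 - mass T) - 2 * ε2 / (π * T * b) - 10 / (π * T * b2)
      ≤ ∫ u in Ioi (0:ℝ), f u * kf T (L - u) := by
  have hp := pi_pos
  set a := π / T with ha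
  have ha0 : 0 < a := by positivity
  have hk := kf_integrable hT
  let ℓ : ℝ → ℝ := fun w => (Ioc (-a) a).indicator (fun w => (p + q * w + ε) * kf T w) w - ε * kf T w
      - ε2 * (Ioi b).indicator (kf T) w - 5 * (Ioi b2).indicator (kf T) w
  have i1 : Integrable ((Ioc (-a) a).indicator (fun w => (p + q * w + ε) * kf T w)) := by
    rw [integrable_indicator_iff measurableSet_Ioc]
    rw [← intervalIntegrable_iff_integrableOn_Ioc_of_le (by linarith)]
    exact hk.intervalIntegrable.continuousOn_mul (by fun_prop)
  have i2 : Integrable ((Ioi b).indicator (kf T)) := hk.indicator measurableSet_Ioi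
  have i3 : Integrable ((Ioi b2).indicator (kf T)) := hk.indicator measurableSet_Ioi
  have iℓ : Integrable ℓ := ((i1.sub (hk.const_mul _)).sub (i2.const_mul _)).sub (i3.const_mul _)
  have hkn := fun w => kf_nonneg hT w
  have hℓ0 : ∀ u, u ≤ 0 → ℓ (L - u) ≤ 0 := by
    intro u hu
    have e1 : 0 ≤ (Ioi b).indicator (kf T) (L-u) := indicator_nonneg (fun w _ => hkn w) _
    have e2 : 0 ≤ (Ioi b2).indicator (kf T) (L-u) := indicator_nonneg (fun w _ => hkn w) _
    have e3 := hkn (L-u)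
    simp only [ℓ]
    by_cases hm : L - u ∈ Ioc (-a) a
    · exfalso; have := hm.2; linarith
    · rw [indicator_of_notMem hm]
      nlinarith [mul_nonneg hε e3, mul_nonneg hε2 e1]
  have hℓf : ∀ u, ℓ (L - u) ≤ f u * kf T (L - u) := by
    intro u
    have e1 : 0 ≤ (Ioi b).indicator (kf T) (L-u) := indicator_nonneg (fun w _ => hkn w) _
    have e2 : 0 ≤ (Ioi b2).indicator (kf T) (L-u) := indicator_nonneg (fun w _ => hkn w) _
    have e3 := hkn (L-u)
    simp only [ℓ]
    by_cases hm : L - u ∈ Ioc (-a) a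
    · rw [indicator_of_mem hm]
      have := hnear u (by rw [abs_le]; constructor <;> linarith [hm.1, hm.2])
      nlinarith [mul_nonneg hε2 e1, mul_le_mul_of_nonneg_right this e3]
    · rw [indicator_of_notMem hm]
      by_cases h3 : L - b ≤ u
      · nlinarith [mul_nonneg hε2 e1, mul_le_mul_of_nonneg_right (h1 u h3) e3]
      · push Not at h3
        have : L - u ∈ Ioi b := by simp only [mem_Ioi]; linarith
        rw [indicator_of_mem this]
        by_cases h4 : L - b2 ≤ u
        · nlinarith [mul_nonneg hε e3, mul_le_mul_of_nonneg_right (h2 u h4) e3]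
        · push Not at h4
          have : L - u ∈ Ioi b2 := by simp only [mem_Ioi]; linarith
          rw [indicator_of_mem this]
          have h5 : -5 ≤ f u := (abs_le.1 (hC u)).1
          nlinarith [mul_nonneg hε e3, mul_nonneg hε2 e3, mul_le_mul_of_nonneg_right h5 e3]
  have iℓ' : Integrable (fun u => ℓ (L - u)) := iℓ.comp_sub_left L
  have ifk : Integrable (fun u => f u * kf T (L - u)) := by
    apply (hk.comp_sub_left L).bdd_mul (c := 5) hf.aestronglyMeasurable
    exact Eventually.of_forall hC
  have s1 : ∫ u in Ioi (0:ℝ), ℓ (L - u) ≤ ∫ u in Ioi (0:ℝ), f u * kf T (L - u) :=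
    setIntegral_mono iℓ'.integrableOn ifk.integrableOn hℓf
  have s2 : ∫ u in Iic (0:ℝ), ℓ (L - u) ≤ 0 := setIntegral_nonpos measurableSet_Iic hℓ0
  have s3 := intervalIntegral.integral_Iic_add_Ioi (b := 0) iℓ'.integrableOn iℓ'.integrableOn
  have s4 : ∫ u, ℓ (L - u) = ∫ w, ℓ w := integral_sub_left_eq_self ℓ volume L
  have s5 : ∫ w, ℓ w = (∫ w in (-a)..a, (p + q * w + ε) * kf T w) - ε * (∫ w, kf T w)
      - ε2 * (∫ w in Ioi b, kf T w) - 5 * (∫ w in Ioi b2, kf T w) := by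
    simp only [ℓ]
    have j1 : Integrable (fun w => (Ioc (-a) a).indicator (fun w => (p + q * w + ε) * kf T w) w - ε * kf T w) :=
      i1.sub (hk.const_mul _)
    have j2 : Integrable (fun w => (Ioc (-a) a).indicator (fun w => (p + q * w + ε) * kf T w) w - ε * kf T w
        - ε2 * (Ioi b).indicator (kf T) w) := j1.sub (i2.const_mul _)
    rw [integral_sub j2 (i3.const_mul _),
      integral_sub j1 (i2.const_mul _), integral_sub i1 (hk.const_mul _),
      integral_const_mul, integral_const_mul, integral_const_mul, integral_indicator measurableSet_Ioc,
      integral_indicator measurableSet_Ioi, integral_indicator measurableSet_Ioi,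
      intervalIntegral.integral_of_le (by linarith)]
  have hi : IntervalIntegrable (kf T) volume (-a) a := hk.intervalIntegrable
  have s6 : (∫ w in (-a)..a, (p + q * w + ε) * kf T w) = (p + ε) * mass T := by
    have hodd : ∫ w in (-a)..a, w * kf T w = 0 := by
      have h := intervalIntegral.integral_comp_neg (a := -a) (b := a) (fun w => w * kf T w)
      simp only [kf_even, neg_neg, neg_mul, intervalIntegral.integral_neg] at h
      linarith
    have : ∀ w, (p + q * w + ε) * kf T w = (p + ε) * kf T w + q * (w * kf T w) := fun w => by ring
    simp only [this]
    rw [intervalIntegral.integral_add (hi.const_mul _), intervalIntegral.integral_const_mul,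
      intervalIntegral.integral_const_mul, hodd, mass]
    · ring
    · exact (hi.continuousOn_mul (by fun_prop)).const_mul _
  have t1 := kf_tail hT (lt_of_lt_of_le ha0 hb)
  have t2 := kf_tail hT hb2
  have t3 := kf_total hT
  have u1 := mul_le_mul_of_nonneg_left t1 hε2
  have u3 := mul_le_mul_of_nonneg_left t3 hε
  have v1 : ε2 * (2 / (π * T * b)) = 2 * ε2 / (π * T * b) := by ring
  have v2 : 10 / (π * T * b2) = 5 * (2 / (π * T * b2)) := by ring
  rw [v2, ← v1]
  nlinarith

lemma taub_upper {T L E ε ε2 b b2 : ℝ} (hT : 4 ≤ T) (hL : 0 < L)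
    (hb : π / T ≤ b) (hb2 : 0 < b2) (hε : 0 ≤ ε) (hε2 : 0 ≤ ε2)
    (h1 : ∀ u, L + π / T - b ≤ u → |W u - 1| ≤ ε)
    (h2 : ∀ u, L + π / T - b2 ≤ u → |W u - 1| ≤ ε2)
    (hE : |Jf (L + π / T) T| ≤ E) :
    W L * (1 - π / T) ≤
      1 + (E + ε * 0.227 + 2 * ε2 / (π * T * b) + 10 / (π * T * b2)) / 0.773 := by
  have hp := pi_pos
  have hT0 : 0 < T := by linarith
  have ha0 : 0 < π / T := by positivity
  have hW := W_nonneg L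
  have key := taub_core (f := fun u => W u - 1) hT0 (W_measurable.sub_const 1) (L := L + π / T)
    (p := W L * (1 - π / T) - 1) (q := W L) hb hb2 hε hε2 (by linarith) W_sub_abs_le
    (by
      intro u hu
      rw [abs_le] at hu
      have h := W_mono_ge (u := L) (v := u) (by linarith)
      have := add_one_le_exp (L - u)
      nlinarith [mul_le_mul_of_nonneg_left this hW])
    (fun u hu => (abs_le.1 (h1 u hu)).1) (fun u hu => (abs_le.1 (h2 u hu)).1)
  rw [Jf_eq hT0] at key
  have hm := mass_ge hT0
  have hJ := (abs_le.1 hE).2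
  have k1 : 0 ≤ 2 * ε2 / (π * T * b) := by
    have : 0 ≤ b := ha0.le.trans hb
    positivity
  have k2 : 0 ≤ 10 / (π * T * b2) := by positivity
  have hE0 : 0 ≤ E := (abs_nonneg _).trans hE
  by_contra hcon
  push Not at hcon
  set X := W L * (1 - π / T)
  set κ := 2 * ε2 / (π * T * b)
  set κ2 := 10 / (π * T * b2)
  have h3 : (E + ε * 0.227 + κ + κ2) < (X - 1) * 0.773 := by
    have : (E + ε * 0.227 + κ + κ2) / 0.773 < X - 1 := by linarith
    rwa [div_lt_iff₀ (by norm_num)] at this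
  have h4 : 0 ≤ X - 1 := by
    by_contra h; push Not at h
    have : 0 ≤ E + ε * 0.227 + κ + κ2 := by positivity
    nlinarith
  nlinarith [mul_le_mul_of_nonneg_left hm h4, mul_le_mul_of_nonneg_left hm hε]

lemma taub_lower {T L E ε ε2 b b2 : ℝ} (hT : 4 ≤ T) (hL : 2 * (π / T) < L)
    (hb : π / T ≤ b) (hb2 : 0 < b2) (hε : 0 ≤ ε) (hε2 : 0 ≤ ε2)
    (h1 : ∀ u, L - π / T - b ≤ u → |W u - 1| ≤ ε)
    (h2 : ∀ u, L - π / T - b2 ≤ u → |W u - 1| ≤ ε2)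
    (hE : |Jf (L - π / T) T| ≤ E) :
    1 - (E + ε * 0.227 + 2 * ε2 / (π * T * b) + 10 / (π * T * b2)) / 0.773 ≤
     W L * rexp (π / T) * (1 + (π / T) ^ 2) := by
  have hp := pi_pos
  have hT0 : 0 < T := by linarith
  have ha0 : 0 < π / T := by positivity
  have ha1 : π / T ≤ 1 := by rw [div_le_one hT0]; linarith [Real.pi_le_four]
  have hW := W_nonneg L
  have hV : 0 ≤ W L * rexp (π / T) := by positivity
  have key := taub_core (f := fun u => 1 - W u) hT0 (measurable_const.sub W_measurable) (L := L - π / T)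
    (p := 1 - W L * rexp (π / T) * (1 + (π / T) ^ 2)) (q := - (W L * rexp (π / T)))
    hb hb2 hε hε2 (by linarith) (fun u => by rw [abs_sub_comm]; exact W_sub_abs_le u)
    (by
      intro u hu
      have hw : |L - π / T - u| ≤ π / T := by rw [abs_sub_comm]; exact hu
      rw [abs_le] at hu
      have h := W_mono_ge (u := u) (v := L) (by linarith)
      have h5 : W u ≤ W L * rexp (π / T) * rexp (L - π / T - u) := by
        rw [mul_assoc, ← Real.exp_add]
        have : π / T + (L - π / T - u) = -(u - L) := by ring
        rw [this, Real.exp_neg, ← div_eq_mul_inv, le_div_iff₀ (Real.exp_pos _)]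
        exact h
      have h6 := Real.abs_exp_sub_one_sub_id_le (x := L - π / T - u) (hw.trans ha1)
      have h7 := (abs_le.1 h6).2
      have h8 : (L - π / T - u)^2 ≤ (π / T)^2 := sq_le_sq' (by linarith [(abs_le.1 hw).1]) (abs_le.1 hw).2
      have h9 : rexp (L - π / T - u) ≤ 1 + (L - π / T - u) + (π / T)^2 := by linarith
      nlinarith [mul_le_mul_of_nonneg_left h9 hV])
    (fun u hu => by linarith [(abs_le.1 (h1 u hu)).2]) (fun u hu => by linarith [(abs_le.1 (h2 u hu)).2])
  have hneg : ∫ u in Ioi (0:ℝ), (1 - W u) * kf T (L - π / T - u) = - Jf (L - π / T) T := by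
    rw [← Jf_eq hT0, ← integral_neg]
    congr 1; ext u; ring
  rw [hneg] at key
  have hm := mass_ge hT0
  have hJ := (abs_le.1 hE).1
  have k1 : 0 ≤ 2 * ε2 / (π * T * b) := by
    have : 0 ≤ b := ha0.le.trans hb
    positivity
  have k2 : 0 ≤ 10 / (π * T * b2) := by positivity
  have hE0 : 0 ≤ E := (abs_nonneg _).trans hE
  by_contra hcon
  push Not at hcon
  set X := W L * rexp (π / T) * (1 + (π / T) ^ 2)
  set κ := 2 * ε2 / (π * T * b)
  set κ2 := 10 / (π * T * b2)
  have h3 : (E + ε * 0.227 + κ + κ2) < (1 - X) * 0.773 := by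
    have : (E + ε * 0.227 + κ + κ2) / 0.773 < 1 - X := by linarith
    rwa [div_lt_iff₀ (by norm_num)] at this
  have h4 : 0 ≤ 1 - X := by
    by_contra h; push Not at h
    have : 0 ≤ E + ε * 0.227 + κ + κ2 := by positivity
    nlinarith
  nlinarith [mul_le_mul_of_nonneg_left hm h4, mul_le_mul_of_nonneg_left hm hε]

noncomputable def poch (s : ℂ) (k : ℕ) : ℂ := ∏ i ∈ Finset.range k, (s + i)

noncomputable def emT (m : ℕ) (s : ℂ) (y x : ℝ) : ℂ :=
  ∑ k ∈ Finset.range m, poch s k * ((bernoulliFun (k+1) y / (k+1).factorial : ℝ) : ℂ) * (x : ℂ) ^ (-s - k)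

/-- `(s-1)` times the Euler-Maclaurin tail main term -/
noncomputable def emA (m : ℕ) (s : ℂ) (x : ℝ) : ℂ := (x : ℂ) ^ (1 - s) + (s - 1) * emT m s 1 x

lemma cpow_hasDeriv (c : ℂ) {x : ℝ} (hx : 0 < x) (y : ℝ) (hy : 0 ≤ y) :
    HasDerivAt (fun y : ℝ => ((x + y : ℝ) : ℂ) ^ c) (c * ((x + y : ℝ) : ℂ) ^ (c - 1)) y := by
  have h1 : HasDerivAt (fun y : ℝ => ((x + y : ℝ) : ℂ)) 1 y := by
    have := ((hasDerivAt_id y).const_add x).ofReal_comp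
    simpa using this
  have h2 : ((x + y : ℝ) : ℂ) ∈ slitPlane := by
    rw [ofReal_mem_slitPlane]; linarith
  have h3 : HasDerivAt (fun z : ℂ => z ^ c) (c * ((x + y : ℝ) : ℂ) ^ (c - 1)) ((x + y : ℝ) : ℂ) := by
    simpa using (hasDerivAt_id ((x + y : ℝ) : ℂ)).cpow_const (c := c) h2
  have := HasDerivAt.comp (h := fun y : ℝ => ((x + y : ℝ) : ℂ)) y h3 h1
  exact this.congr_deriv (by simp)

lemma poch_succ (s : ℂ) (k : ℕ) : poch s (k+1) = poch s k * (s + k) := by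
  simp [poch, Finset.prod_range_succ]

lemma emT_deriv (m : ℕ) (s : ℂ) {x : ℝ} (hx : 0 < x) (y : ℝ) (hy : 0 ≤ y) :
    HasDerivAt (fun y : ℝ => emT m s y (x + y))
      (((x + y : ℝ) : ℂ) ^ (-s) - poch s m * ((bernoulliFun m y / m.factorial : ℝ) : ℂ) * ((x + y : ℝ) : ℂ) ^ (-s - m)) y := by
  induction m with
  | zero =>
    simp [emT, poch, bernoulliFun_zero]
    exact hasDerivAt_const _ _
  | succ m ih =>
    simp only [emT, sum_range_succ]
    have hb : HasDerivAt (fun y : ℝ => ((bernoulliFun (m+1) y / (m+1).factorial : ℝ) : ℂ))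
        ((bernoulliFun m y / m.factorial : ℝ) : ℂ) y := by
      have := ((hasDerivAt_bernoulliFun (m+1) y).div_const ((m+1).factorial : ℝ)).ofReal_comp
      convert this using 2
      rw [Nat.factorial_succ]; push_cast
      field_simp
    have h2 := cpow_hasDeriv (-s - m) hx y hy
    have h3 := ((hb.const_mul (poch s m)).mul h2)
    have := ih.add h3
    refine this.congr_deriv ?_
    rw [poch_succ]
    have e : -s - ((m+1 : ℕ) : ℂ) = -s - m - 1 := by push_cast; ring
    rw [e]
    ring

lemma emT_one_sub_zero (m : ℕ) (hm : 1 ≤ m) (s : ℂ) (x : ℝ) :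
    emT m s 1 x - emT m s 0 x = (x : ℂ) ^ (-s) := by
  unfold emT
  rw [← Finset.sum_sub_distrib, Finset.sum_eq_single 0]
  · simp [poch, bernoulliFun_one]
    ring
  · intro k _ hk
    rw [bernoulliFun_endpoints_eq_of_ne_one (by omega)]; ring
  · intro h; simp at h; omega

noncomputable def emr (m : ℕ) (s : ℂ) (x : ℝ) : ℂ :=
  (s - 1) * (x : ℂ) ^ (-s) - emA m s x + emA m s (x + 1)

lemma emr_bound (m : ℕ) (hm : 1 ≤ m) {β : ℝ} (hβ : ∀ y ∈ Icc (0:ℝ) 1, |bernoulliFun m y| ≤ β)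
    (s : ℂ) (hs : 0 ≤ s.re + m) {x : ℝ} (hx : 0 < x) :
    ‖emr m s x‖ ≤ ‖s - 1‖ * ‖poch s m‖ * (β / m.factorial) * x ^ (-s.re - m) := by
  have hβ0 : 0 ≤ β := (abs_nonneg _).trans (hβ 0 (by simp))
  let F : ℝ → ℂ := fun y => ((x + y : ℝ) : ℂ) ^ (1 - s) + (s - 1) * emT m s y (x + y)
  have hd : ∀ y ∈ Icc (0:ℝ) 1, HasDerivAt F (-((s - 1) * (poch s m * ((bernoulliFun m y / m.factorial : ℝ) : ℂ) * ((x + y : ℝ) : ℂ) ^ (-s - m)))) y := by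
    intro y hy
    have h1 := cpow_hasDeriv (1 - s) hx y hy.1
    have h2 := (emT_deriv m s hx y hy.1).const_mul (s - 1)
    refine (h1.add h2).congr_deriv ?_
    rw [show 1 - s - 1 = -s by ring]; ring
  have hb : ∀ y ∈ Ico (0:ℝ) 1, ‖-((s - 1) * (poch s m * ((bernoulliFun m y / m.factorial : ℝ) : ℂ) * ((x + y : ℝ) : ℂ) ^ (-s - m)))‖
      ≤ ‖s - 1‖ * ‖poch s m‖ * (β / m.factorial) * x ^ (-s.re - m) := by
    intro y hy
    rw [norm_neg, norm_mul, norm_mul, norm_mul, norm_real, Real.norm_eq_abs, abs_div, Nat.abs_cast]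
    rw [norm_cpow_eq_rpow_re_of_pos (by linarith [hy.1])]
    have e1 : (-s - (m:ℂ)).re = -s.re - m := by simp
    rw [e1]
    have e2 : (x + y) ^ (-s.re - m) ≤ x ^ (-s.re - m) :=
      Real.rpow_le_rpow_of_nonpos hx (by linarith [hy.1]) (by linarith)
    have e3 := hβ y ⟨hy.1, hy.2.le⟩
    have e4 : 0 ≤ (x + y) ^ (-s.re - m) := Real.rpow_nonneg (by linarith [hy.1]) _
    rw [mul_assoc, mul_assoc, mul_assoc]
    gcongr
  have := norm_image_sub_le_of_norm_deriv_le_segment' (fun y hy => (hd y hy).hasDerivWithinAt) hb 1 (by simp)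
  have e : F 1 - F 0 = emr m s x := by
    have h0 := emT_one_sub_zero m hm s x
    simp only [F, emr, emA, add_zero]
    rw [← h0]; push_cast; ring
  rw [e] at this
  simpa using this

lemma poch_differentiable (k : ℕ) : Differentiable ℂ (fun s => poch s k) := by
  unfold poch; fun_prop

lemma cpow_differentiable {x : ℝ} (hx : 0 < x) {f : ℂ → ℂ} (hf : Differentiable ℂ f) :
    Differentiable ℂ (fun s => (x : ℂ) ^ (f s)) := by
  intro s
  exact (hf s).const_cpow (Or.inl (by exact_mod_cast hx.ne'))

lemma emA_differentiable (m : ℕ) {x : ℝ} (hx : 0 < x) : Differentiable ℂ (fun s => emA m s x) := by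
  unfold emA emT
  have h1 := cpow_differentiable hx (f := fun s => 1 - s) (by fun_prop)
  have h2 : Differentiable ℂ (fun s : ℂ => ∑ k ∈ Finset.range m, poch s k * ((bernoulliFun (k+1) 1 / (k+1).factorial : ℝ) : ℂ) * (x : ℂ) ^ (-s - k)) := by
    refine Differentiable.fun_sum fun k _ => ?_
    have := poch_differentiable k
    have h3 := cpow_differentiable hx (f := fun s : ℂ => -s - k) (by fun_prop)
    fun_prop
  fun_prop

lemma emr_differentiable (m : ℕ) {x : ℝ} (hx : 0 < x) : Differentiable ℂ (fun s => emr m s x) := by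
  unfold emr
  have h1 := cpow_differentiable hx (f := fun s => - s) (by fun_prop)
  have h2 := emA_differentiable m hx
  have h3 := emA_differentiable m (x := x + 1) (by linarith)
  fun_prop

/-- the remainder series -/
noncomputable def emR (m : ℕ) (s : ℂ) (x : ℝ) : ℂ := ∑' n : ℕ, emr m s (n + x)

noncomputable def emH (m : ℕ) (s : ℂ) (x : ℝ) : ℂ := emA m s x + emR m s x

lemma emr_summable (m : ℕ) (hm : 1 ≤ m) {β : ℝ} (hβ : ∀ y ∈ Icc (0:ℝ) 1, |bernoulliFun m y| ≤ β)
    (s : ℂ) (hs : 1 < s.re + m) {x : ℝ} (hx : 0 < x) : Summable (fun n : ℕ => emr m s (n + x)) := by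
  have h0 : Summable (fun n : ℕ => ‖s - 1‖ * ‖poch s m‖ * (β / m.factorial) * (n + x) ^ (-s.re - m)) := by
    refine Summable.mul_left _ ?_
    have := (Real.summable_one_div_nat_add_rpow x (s.re + m)).2 hs
    refine this.congr fun n => ?_
    have hn : (0:ℝ) < n + x := by positivity
    rw [abs_of_pos hn, one_div, ← Real.rpow_neg hn.le]
    congr 1; ring
  exact Summable.of_norm_bounded h0 (fun n => emr_bound m hm hβ s (by linarith) (by positivity))

lemma emH_succ (m : ℕ) (hm : 1 ≤ m) {β : ℝ} (hβ : ∀ y ∈ Icc (0:ℝ) 1, |bernoulliFun m y| ≤ β)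
    (s : ℂ) (hs : 1 < s.re + m) {x : ℝ} (hx : 0 < x) :
    emH m s x = (s - 1) * (x : ℂ) ^ (-s) + emH m s (x + 1) := by
  unfold emH emR
  rw [(emr_summable m hm hβ s hs hx).tsum_eq_zero_add]
  have : ∀ n : ℕ, ((n + 1 : ℕ) : ℝ) + x = n + (x + 1) := by intro n; push_cast; ring
  simp only [this]
  simp [emr]; ring

lemma emH_add (m : ℕ) (hm : 1 ≤ m) {β : ℝ} (hβ : ∀ y ∈ Icc (0:ℝ) 1, |bernoulliFun m y| ≤ β)
    (s : ℂ) (hs : 1 < s.re + m) {x : ℝ} (hx : 0 < x) (K : ℕ) :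
    emH m s x = (s - 1) * ∑ k ∈ Finset.range K, ((k + x : ℝ) : ℂ) ^ (-s) + emH m s (K + x) := by
  induction K with
  | zero => simp
  | succ K ih =>
    rw [ih, emH_succ m hm hβ s hs (x := K + x) (by positivity), sum_range_succ]
    have : ((K + 1 : ℕ) : ℝ) + x = K + x + 1 := by push_cast; ring
    rw [this]; ring

lemma emA_tendsto (m : ℕ) (s : ℂ) (hs : 1 < s.re) (x : ℝ) :
    Tendsto (fun K : ℕ => emA m s (K + x)) atTop (𝓝 0) := by
  have hx : Tendsto (fun K : ℕ => (K + x : ℝ)) atTop atTop :=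
    tendsto_atTop_add_const_right _ _ tendsto_natCast_atTop_atTop
  have key : ∀ c : ℂ, c.re < 0 → Tendsto (fun K : ℕ => ((K + x : ℝ) : ℂ) ^ c) atTop (𝓝 0) := by
    intro c hc
    rw [tendsto_zero_iff_norm_tendsto_zero]
    have := (tendsto_rpow_neg_atTop (y := -c.re) (by linarith)).comp hx
    refine this.congr' ?_
    filter_upwards [hx.eventually_gt_atTop 0] with K hK
    simp only [Function.comp]
    rw [norm_cpow_eq_rpow_re_of_pos hK]; simp
  unfold emA emT
  have h1 := key (1 - s) (by simp; linarith)
  have h2 : Tendsto (fun K : ℕ => ∑ k ∈ Finset.range m, poch s k * ((bernoulliFun (k+1) 1 / (k+1).factorial : ℝ) : ℂ) * ((K + x : ℝ) : ℂ) ^ (-s - k)) atTop (𝓝 (∑ k ∈ Finset.range m, poch s k * ((bernoulliFun (k+1) 1 / (k+1).factorial : ℝ) : ℂ) * 0)) := by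
    refine tendsto_finsetSum _ fun k _ => (key _ ?_).const_mul _
    simp
    have : (0:ℝ) ≤ k := Nat.cast_nonneg k
    linarith
  simpa using h1.add (h2.const_mul (s - 1))

lemma emH_hasSum (m : ℕ) (hm : 1 ≤ m) {β : ℝ} (hβ : ∀ y ∈ Icc (0:ℝ) 1, |bernoulliFun m y| ≤ β)
    (s : ℂ) (hs : 1 < s.re) {x : ℝ} (hx : 0 < x) :
    Tendsto (fun K : ℕ => (s - 1) * ∑ k ∈ Finset.range K, ((k + x : ℝ) : ℂ) ^ (-s)) atTop (𝓝 (emH m s x)) := by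
  have hm' : (1:ℝ) ≤ m := by exact_mod_cast hm
  have h1 : Tendsto (fun K : ℕ => emH m s (K + x)) atTop (𝓝 0) := by
    unfold emH
    have h2 := emA_tendsto m s hs x
    have h3 := tendsto_sum_nat_add (fun n : ℕ => emr m s (n + x))
    have h4 : Tendsto (fun K : ℕ => emR m s (K + x)) atTop (𝓝 0) := by
      refine h3.congr fun K => ?_
      unfold emR
      refine tsum_congr fun n => ?_
      congr 1; push_cast; ring
    simpa using h2.add h4
  have h2 : ∀ K : ℕ, (s - 1) * ∑ k ∈ Finset.range K, ((k + x : ℝ) : ℂ) ^ (-s) = emH m s x - emH m s (K + x) := by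
    intro K; rw [emH_add m hm hβ s (by linarith) hx K]; ring
  simp only [h2]
  simpa using h1.const_sub (emH m s x)

lemma emR_bound (m : ℕ) (hm : 1 ≤ m) {β : ℝ} (hβ : ∀ y ∈ Icc (0:ℝ) 1, |bernoulliFun m y| ≤ β)
    (s : ℂ) (hs : 1 < s.re + m) {x : ℝ} (hx : 0 < x) :
    ‖emR m s x‖ ≤ ‖s - 1‖ * ‖poch s m‖ * (β / m.factorial) * (x ^ (-s.re - m) + x ^ (1 - s.re - m) / (s.re + m - 1)) := by
  have hβ0 : 0 ≤ β := (abs_nonneg _).trans (hβ 0 (by simp))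
  set a := s.re + m with ha
  have ea : -s.re - m = -a := by rw [ha]; ring
  have ea' : 1 - s.re - m = 1 - a := by rw [ha]; ring
  rw [ea, ea']
  have hs0 : Summable (fun n : ℕ => ((n:ℝ) + x) ^ (-a)) := by
    have := (Real.summable_one_div_nat_add_rpow x a).2 hs
    refine this.congr fun n => ?_
    have hn : (0:ℝ) < n + x := by positivity
    rw [abs_of_pos hn, one_div, ← Real.rpow_neg hn.le]
  have h1 : ‖emR m s x‖ ≤ ∑' n : ℕ, ‖s - 1‖ * ‖poch s m‖ * (β / m.factorial) * ((n:ℝ) + x) ^ (-a) := by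
    refine tsum_of_norm_bounded ((hs0.mul_left _).hasSum) fun n => ?_
    rw [← ea]
    exact emr_bound m hm hβ s (by linarith) (by positivity)
  rw [tsum_mul_left] at h1
  refine h1.trans ?_
  gcongr
  rw [hs0.tsum_eq_zero_add]
  simp only [Nat.cast_zero, zero_add]
  gcongr
  refine Real.tsum_le_of_sum_range_le (fun n => by positivity) fun n => ?_
  -- telescoping
  have step : ∀ k : ℕ, (((k+1 : ℕ):ℝ) + x) ^ (-a) ≤ ((k + x) ^ (1 - a) - (((k+1:ℕ):ℝ) + x) ^ (1 - a)) / (a - 1) := by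
    intro k
    have hk : (0:ℝ) < k + x := by positivity
    have hk1 : (0:ℝ) < ((k+1:ℕ):ℝ) + x := by positivity
    set q := ((k+1:ℕ):ℝ) + x with hq
    have hq1 : (k:ℝ) + x = q - 1 := by rw [hq]; push_cast; ring
    have e : (k:ℝ) + x = q * (1 + (-1/q)) := by rw [hq1]; field_simp; ring
    have hy : 0 < 1 + (-1/q) := by
      have : 0 < q * (1 + (-1/q)) := e ▸ hk
      exact (pos_iff_pos_of_mul_pos this).1 hk1
    have hb : 1 + (1 - a) * (-1/q) ≤ (1 + (-1/q)) ^ (1 - a) := by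
      rw [Real.rpow_def_of_pos hy]
      have h1 := add_one_le_exp (ln (1 + -1/q) * (1 - a))
      have h2 := log_le_sub_one_of_pos hy
      nlinarith
    rw [e, Real.mul_rpow hk1.le hy.le, le_div_iff₀ (by linarith)]
    have e5 : q ^ (-a) = q ^ (1 - a) * q⁻¹ := by
      rw [show -a = (1 - a) + (-1) by ring, Real.rpow_add hk1, Real.rpow_neg_one]
    have hp : 0 < q ^ (1 - a) := by positivity
    rw [e5]
    have : q ^ (1 - a) * (1 + (1 - a) * (-1/q)) ≤ q ^ (1 - a) * (1 + -1/q) ^ (1 - a) := by gcongr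
    have e6 : q ^ (1 - a) * (1 + (1 - a) * (-1/q)) = q ^ (1 - a) + q ^ (1 - a) * q⁻¹ * (a - 1) := by
      field_simp; ring
    linarith
  have hsum : ∀ n : ℕ, ∑ k ∈ Finset.range n, (((k+1 : ℕ):ℝ) + x) ^ (-a) ≤ (x ^ (1 - a) - ((n:ℝ) + x) ^ (1 - a)) / (a - 1) := by
    intro n
    induction n with
    | zero => simp
    | succ n ih =>
      rw [sum_range_succ]
      refine (add_le_add ih (step n)).trans (le_of_eq ?_)
      ring
  refine (hsum n).trans ?_
  have : 0 < a - 1 := by linarith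
  gcongr
  have : 0 ≤ ((n:ℝ) + x) ^ (1 - a) := by positivity
  linarith

lemma emR_differentiableOn (m : ℕ) (hm : 1 ≤ m) {β : ℝ} (hβ : ∀ y ∈ Icc (0:ℝ) 1, |bernoulliFun m y| ≤ β)
    {x : ℝ} (hx : 0 < x) : DifferentiableOn ℂ (fun s => emR m s x) {s | 1 - (m:ℝ) < s.re} := by
  have hβ0 : 0 ≤ β := (abs_nonneg _).trans (hβ 0 (by simp))
  have ho : IsOpen {s : ℂ | 1 - (m:ℝ) < s.re} := isOpen_lt continuous_const continuous_re
  intro s₀ hs₀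
  simp only [mem_ofPred_eq] at hs₀
  obtain ⟨a, ha1, ha2⟩ := exists_between hs₀
  -- local domain
  let U : Set ℂ := {s | a < s.re} ∩ {s | ‖s - 1‖ * ‖poch s m‖ < ‖s₀ - 1‖ * ‖poch s₀ m‖ + 1}
  have hU : IsOpen U := by
    refine (isOpen_lt continuous_const continuous_re).inter (isOpen_lt ?_ continuous_const)
    have := (poch_differentiable m).continuous
    fun_prop
  have hmem : s₀ ∈ U := ⟨ha2, by simp⟩
  set C := ‖s₀ - 1‖ * ‖poch s₀ m‖ + 1 with hC
  have hC0 : 0 < C := by positivity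
  have hD : DifferentiableOn ℂ (fun s => ∑' n : ℕ, emr m s ((n + 1 : ℕ) + x)) U := by
    refine differentiableOn_tsum_of_summable_norm (u := fun n : ℕ => C * (β / m.factorial) * ((n + 1 : ℕ) + x) ^ (-a - m))
      ?_ (fun n => (emr_differentiable m (by positivity)).differentiableOn) hU ?_
    · refine Summable.mul_left _ ?_
      have := (summable_nat_add_iff 1).2 ((Real.summable_one_div_nat_add_rpow x (a + m)).2 (by linarith))
      refine this.congr fun n => ?_
      have hn : (0:ℝ) < ((n + 1 : ℕ) : ℝ) + x := by positivity
      rw [abs_of_pos hn, one_div, ← Real.rpow_neg hn.le]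
      congr 1; ring
    · intro n s hs
      refine (emr_bound m hm hβ s (by have := hs.1; simp only [mem_ofPred_eq] at this; linarith) (by positivity)).trans ?_
      have h1 := hs.1
      have h2 := hs.2
      simp only [mem_ofPred_eq] at h1 h2
      have h3 : (((n + 1 : ℕ):ℝ) + x) ^ (-s.re - m) ≤ (((n + 1 : ℕ):ℝ) + x) ^ (-a - m) := by
        refine Real.rpow_le_rpow_of_exponent_le ?_ (by linarith)
        push_cast
        have : (0:ℝ) ≤ n := Nat.cast_nonneg n
        linarith
      gcongr
  have hE : DifferentiableOn ℂ (fun s => emr m s x + ∑' n : ℕ, emr m s ((n + 1 : ℕ) + x)) U :=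
    (emr_differentiable m hx).differentiableOn.add hD
  have h5 : DifferentiableAt ℂ (fun s => emr m s x + ∑' n : ℕ, emr m s ((n + 1 : ℕ) + x)) s₀ :=
    hE.differentiableAt (hU.mem_nhds hmem)
  refine (h5.congr_of_eventuallyEq ?_).differentiableWithinAt
  filter_upwards [hU.mem_nhds hmem] with s hs
  have h1 := hs.1
  simp only [mem_ofPred_eq] at h1
  unfold emR
  rw [(emr_summable m hm hβ s (by linarith) hx).tsum_eq_zero_add]
  simp

lemma emH_differentiableOn (m : ℕ) (hm : 1 ≤ m) {β : ℝ} (hβ : ∀ y ∈ Icc (0:ℝ) 1, |bernoulliFun m y| ≤ β)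
    {x : ℝ} (hx : 0 < x) : DifferentiableOn ℂ (fun s => emH m s x) {s | 1 - (m:ℝ) < s.re} :=
  (emA_differentiable m hx).differentiableOn.add (emR_differentiableOn m hm hβ hx)

lemma half_plane_identity {f g : ℂ → ℂ} {a : ℝ} (ha : a < 2) (hf : DifferentiableOn ℂ f {s | a < s.re})
    (hg : DifferentiableOn ℂ g {s | a < s.re}) (h : ∀ s : ℂ, 1 < s.re → f s = g s) :
    ∀ s : ℂ, a < s.re → f s = g s := by
  have ho : IsOpen {s : ℂ | a < s.re} := isOpen_lt continuous_const continuous_re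
  have hc : IsPreconnected {s : ℂ | a < s.re} := (convex_halfSpace_re_gt a).isPreconnected
  have hz : (2:ℂ) ∈ {s : ℂ | a < s.re} := by simpa using ha
  have := (hf.analyticOnNhd ho).eqOn_of_preconnected_of_eventuallyEq (hg.analyticOnNhd ho) hc hz ?_
  · intro s hs; exact this hs
  · have h1 : IsOpen {s : ℂ | 1 < s.re} := isOpen_lt continuous_const continuous_re
    filter_upwards [h1.mem_nhds (by simp : (2:ℂ) ∈ {s : ℂ | 1 < s.re})] with s hs
    exact h s hs

lemma Z_eq_emH (m : ℕ) (hm : 1 ≤ m) {β : ℝ} (hβ : ∀ y ∈ Icc (0:ℝ) 1, |bernoulliFun m y| ≤ β)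
    (s : ℂ) (hs : 1 < s.re + m) : Z s = emH m s 1 := by
  have hm' : (1:ℝ) ≤ m := by exact_mod_cast hm
  refine half_plane_identity (a := 1 - m) (by linarith) Z_differentiable.differentiableOn
    (emH_differentiableOn m hm hβ one_pos) ?_ s (by linarith)
  intro s hs
  have h1 := emH_hasSum m hm hβ s hs one_pos
  have hne : s ≠ 1 := by rintro rfl; simp at hs
  refine tendsto_nhds_unique ?_ h1
  rw [Z_ne hne, zeta_eq_tsum_one_div_nat_add_one_cpow hs]
  refine Tendsto.const_mul _ ?_
  have h3 : Summable (fun n : ℕ => 1 / ((n:ℂ) + 1) ^ s) := by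
    have := (summable_nat_add_iff 1).2 (Complex.summable_one_div_nat_cpow.2 hs)
    simpa using this
  refine h3.hasSum.tendsto_sum_nat.congr fun K => sum_congr rfl fun k _ => ?_
  rw [cpow_neg]; simp

lemma Z_odd_eq_emH (m : ℕ) (hm : 1 ≤ m) {β : ℝ} (hβ : ∀ y ∈ Icc (0:ℝ) 1, |bernoulliFun m y| ≤ β)
    (s : ℂ) (hs : 1 < s.re + m) : (1 - (2:ℂ) ^ (-s)) * Z s = (2:ℂ) ^ (-s) * emH m s (1/2) := by
  have hm' : (1:ℝ) ≤ m := by exact_mod_cast hm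
  have hd2 : Differentiable ℂ (fun s : ℂ => (2:ℂ) ^ (-s)) := by
    have := cpow_differentiable (x := 2) (by norm_num) (f := fun s => -s) (by fun_prop)
    simpa using this
  refine half_plane_identity (a := 1 - m) (f := fun s => (1 - (2:ℂ) ^ (-s)) * Z s)
    (g := fun s => (2:ℂ) ^ (-s) * emH m s (1/2)) (by linarith) ?_ ?_ ?_ s (by linarith)
  · exact ((differentiable_const _).sub hd2 |>.mul Z_differentiable).differentiableOn
  · exact hd2.differentiableOn.mul (emH_differentiableOn m hm hβ (by norm_num))
  intro s hs
  have h1 := (emH_hasSum m hm hβ s hs (x := 1/2) (by norm_num)).const_mul ((2:ℂ) ^ (-s))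
  have hne : s ≠ 1 := by rintro rfl; simp at hs
  refine tendsto_nhds_unique ?_ h1
  -- partial sums of zeta up to 2K minus even ones
  have h3 : Summable (fun n : ℕ => 1 / ((n:ℂ) + 1) ^ s) := by
    have := (summable_nat_add_iff 1).2 (Complex.summable_one_div_nat_cpow.2 hs)
    simpa using this
  have hz : HasSum (fun n : ℕ => 1 / ((n:ℂ) + 1) ^ s) (riemannZeta s) := by
    rw [zeta_eq_tsum_one_div_nat_add_one_cpow hs]; exact h3.hasSum
  have t1 := hz.tendsto_sum_nat
  have t2 : Tendsto (fun K : ℕ => ∑ i ∈ Finset.range (2 * K), 1 / ((i:ℂ) + 1) ^ s) atTop (𝓝 (riemannZeta s)) :=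
    t1.comp (tendsto_id.const_mul_atTop' (by norm_num : 0 < 2))
  have t3 := t2.sub (t1.const_mul ((2:ℂ) ^ (-s)))
  have t4 := t3.const_mul (s - 1)
  rw [Z_ne hne]
  have e : (1 - (2:ℂ) ^ (-s)) * ((s - 1) * riemannZeta s) = (s - 1) * (riemannZeta s - (2:ℂ) ^ (-s) * riemannZeta s) := by ring
  rw [e]
  refine t4.congr fun K => ?_
  rw [mul_left_comm]
  congr 1
  induction K with
  | zero => simp
  | succ K ih =>
    rw [show 2 * (K + 1) = 2 * K + 1 + 1 by ring, sum_range_succ, sum_range_succ, sum_range_succ, sum_range_succ, mul_add, mul_add, ← ih]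
    have a1 : (2:ℂ) ^ (-s) * (1 / ((K:ℂ) + 1) ^ s) = 1 / (((2 * K + 1 : ℕ) : ℂ) + 1) ^ s := by
      have : (((2 * K + 1 : ℕ) : ℂ) + 1) = ((2:ℝ) : ℂ) * (((K:ℝ) + 1 : ℝ) : ℂ) := by push_cast; ring
      rw [this, mul_cpow_ofReal_nonneg (by norm_num) (by positivity), cpow_neg]
      push_cast
      rw [one_div, one_div, mul_inv]
    have a2 : (2:ℂ) ^ (-s) * (((K:ℝ) + 1/2 : ℝ) : ℂ) ^ (-s) = 1 / (((2 * K : ℕ) : ℂ) + 1) ^ s := by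
      have : (((2 * K : ℕ) : ℂ) + 1) = ((2:ℝ) : ℂ) * (((K:ℝ) + 1/2 : ℝ) : ℂ) := by push_cast; ring
      rw [this, one_div (_ ^ s), ← cpow_neg, mul_cpow_ofReal_nonneg (by norm_num) (by positivity)]
      push_cast; rfl
    rw [a1, a2]; ring

/-- real zeta sum -/
noncomputable def zr (σ : ℝ) : ℝ := ∑' n : ℕ, 1 / (n : ℝ) ^ σ

lemma zr_summable {σ : ℝ} (hσ : 1 < σ) : Summable (fun n : ℕ => 1 / (n : ℝ) ^ σ) :=
  Real.summable_one_div_nat_rpow.2 hσ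

lemma zr_anti {σ σ' : ℝ} (hσ : 1 < σ) (h : σ ≤ σ') : zr σ' ≤ zr σ := by
  refine (zr_summable (by linarith)).tsum_le_tsum ?_ (zr_summable hσ)
  intro n
  rcases Nat.eq_zero_or_pos n with rfl | hn
  · simp [Real.zero_rpow (show σ ≠ 0 by linarith), Real.zero_rpow (show σ' ≠ 0 by linarith)]
  · have h1 : (1:ℝ) ≤ n := by exact_mod_cast hn
    have : (0:ℝ) < n := by linarith
    gcongr

lemma LSeries_norm_le {f : ℕ → ℂ} (hf : ∀ n, ‖f n‖ ≤ 1) {s : ℂ} (hs : 1 < s.re) : ‖LSeries f s‖ ≤ zr s.re := by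
  refine tsum_of_norm_bounded (zr_summable hs).hasSum ?_
  intro n
  rcases Nat.eq_zero_or_pos n with rfl | hn
  · simp [LSeries.term_zero]; positivity
  · rw [LSeries.norm_term_eq, if_neg (by omega)]
    gcongr
    exact hf n

lemma zeta_norm_le {s : ℂ} (hs : 1 < s.re) : ‖riemannZeta s‖ ≤ zr s.re := by
  rw [← LSeries_one_eq_riemannZeta hs]
  exact LSeries_norm_le (by intro n; simp) hs

lemma zeta_inv_norm_le {s : ℂ} (hs : 1 < s.re) : ‖(riemannZeta s)⁻¹‖ ≤ zr s.re := by
  have h := LSeries_one_mul_Lseries_moebius hs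
  rw [LSeries_one_eq_riemannZeta hs] at h
  rw [← eq_inv_of_mul_eq_one_right h]
  refine LSeries_norm_le ?_ hs
  intro n
  have := ArithmeticFunction.abs_moebius_le_one (n := n)
  rw [norm_intCast]
  exact_mod_cast this

lemma zr_two : zr 2 = π ^ 2 / 6 := by
  have := hasSum_zeta_two.tsum_eq
  rw [← this, zr]
  congr 1; ext n
  norm_cast

lemma zr_three_le : zr 3 ≤ 1 + (zr 2 - 1) / 2 := by
  have h2 := zr_summable (σ := 2) (by norm_num)
  have h3 := zr_summable (σ := 3) (by norm_num)
  have e2 : zr 2 = 1 + ∑' n : ℕ, 1 / ((n + 2 : ℕ) : ℝ) ^ (2:ℝ) := by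
    rw [zr, ← h2.sum_add_tsum_nat_add 2]; simp [sum_range_succ]
  have e3 : zr 3 = 1 + ∑' n : ℕ, 1 / ((n + 2 : ℕ) : ℝ) ^ (3:ℝ) := by
    rw [zr, ← h3.sum_add_tsum_nat_add 2]; simp [sum_range_succ]
  rw [e2, e3]
  have : ∑' n : ℕ, 1 / ((n + 2 : ℕ) : ℝ) ^ (3:ℝ) ≤ (∑' n : ℕ, 1 / ((n + 2 : ℕ) : ℝ) ^ (2:ℝ)) / 2 := by
    rw [← tsum_div_const]
    refine Summable.tsum_le_tsum ?_ ((summable_nat_add_iff (f := fun n : ℕ => 1 / (n : ℝ) ^ (3:ℝ)) 2).2 h3) (((summable_nat_add_iff (f := fun n : ℕ => 1 / (n : ℝ) ^ (2:ℝ)) 2).2 h2).div_const 2)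
    intro n
    have : (0:ℝ) ≤ n := by positivity
    push_cast
    rw [show (3:ℝ) = ((3:ℕ):ℝ) by norm_num, rpow_natCast, Real.rpow_two, div_div]
    apply one_div_le_one_div_of_le (by positivity)
    nlinarith [sq_nonneg ((n:ℝ)+2)]
  linarith

/-- `ζ(σ) ≤ 1 + 1/(σ-1)` -/
lemma zr_le {σ : ℝ} (hσ : 1 < σ) : zr σ ≤ 1 + 1 / (σ - 1) := by
  have h2 := zr_summable hσ
  have e2 : zr σ = 1 + ∑' n : ℕ, 1 / ((n + 2 : ℕ) : ℝ) ^ σ := by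
    rw [zr, ← h2.sum_add_tsum_nat_add 2]; simp [sum_range_succ, Real.zero_rpow (show σ ≠ 0 by linarith)]
  rw [e2]
  gcongr
  refine ((summable_nat_add_iff 2).2 h2).tsum_le_of_sum_range_le ?_
  intro N
  have hanti : AntitoneOn (fun x : ℝ => x ^ (-σ)) (Icc (1:ℝ) (1 + (N:ℕ))) := by
    intro x hx y hy hxy
    exact Real.rpow_le_rpow_of_nonpos (by linarith [hx.1]) hxy (by linarith)
  have := hanti.sum_le_integral
  have e : ∑ i ∈ Finset.range N, 1 / ((i + 2 : ℕ) : ℝ) ^ σ = ∑ i ∈ Finset.range N, (1 + ((i + 1 : ℕ) : ℝ)) ^ (-σ) := by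
    refine sum_congr rfl fun i _ => ?_
    rw [Real.rpow_neg (by positivity), one_div]
    push_cast; ring_nf
  rw [e]
  refine this.trans ?_
  rw [integral_rpow (Or.inr ⟨by linarith, by rw [uIcc_of_le (by linarith [Nat.cast_nonneg (α := ℝ) N])]; intro h; linarith [h.1]⟩)]
  rw [Real.one_rpow]
  have : (0:ℝ) ≤ (1 + (N:ℝ)) ^ (-σ + 1) := by positivity
  rw [show -σ + 1 = -(σ - 1) by ring] at *
  rw [div_neg, ← neg_div]
  have h0 : 0 < σ - 1 := by linarith
  gcongr
  linarith

lemma bern1 (y : ℝ) : bernoulliFun 1 y = y - 1/2 := by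
  simp [bernoulliFun, Polynomial.bernoulli, sum_range_succ, Polynomial.eval_add]
  norm_num [bernoulli_one]; ring

lemma bern2 (y : ℝ) : bernoulliFun 2 y = y^2 - y + 1/6 := by
  simp [bernoulliFun, Polynomial.bernoulli, sum_range_succ, Polynomial.eval_add, bernoulli, bernoulli'_two]
  norm_num [Nat.choose]; ring

lemma bern3 (y : ℝ) : bernoulliFun 3 y = y^3 - 3/2*y^2 + y/2 := by
  simp [bernoulliFun, Polynomial.bernoulli, sum_range_succ, Polynomial.eval_add, bernoulli, bernoulli'_two, bernoulli'_three]
  norm_num [Nat.choose]; ring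

lemma bern4 (y : ℝ) : bernoulliFun 4 y = y^4 - 2*y^3 + y^2 - 1/30 := by
  simp [bernoulliFun, Polynomial.bernoulli, sum_range_succ, Polynomial.eval_add, bernoulli, bernoulli'_two, bernoulli'_three, bernoulli'_four]
  norm_num [Nat.choose]; ring

lemma bern1_le : ∀ y ∈ Icc (0:ℝ) 1, |bernoulliFun 1 y| ≤ 1/2 := by
  intro y hy; rw [bern1, abs_le]; constructor <;> linarith [hy.1, hy.2]

lemma bern2_le : ∀ y ∈ Icc (0:ℝ) 1, |bernoulliFun 2 y| ≤ 1/6 := by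
  intro y hy; rw [bern2, abs_le]; constructor <;> nlinarith [hy.1, hy.2, sq_nonneg (y-1/2)]

lemma bern4_le : ∀ y ∈ Icc (0:ℝ) 1, |bernoulliFun 4 y| ≤ 1/30 := by
  intro y hy
  have h1 : bernoulliFun 4 y = (y*(1-y))^2 - 1/30 := by rw [bern4]; ring
  have h2 : 0 ≤ y*(1-y) := mul_nonneg hy.1 (by linarith [hy.2])
  have h3 : y*(1-y) ≤ 1/4 := by nlinarith [sq_nonneg (y-1/2)]
  rw [h1, abs_le]; constructor <;> nlinarith

/-- crude growth, right of `σ ≥ -2` -/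
lemma zeta_crude {s : ℂ} (hs : -2 ≤ s.re) (h1 : 1 ≤ ‖s - 1‖) : ‖riemannZeta s‖ ≤ 4 * (‖s‖ + 3) ^ 4 := by
  have hs1 : s ≠ 1 := by rintro rfl; norm_num at h1
  have e := Z_eq_emH 4 (by norm_num) bern4_le s (by push_cast; linarith)
  have hR := emR_bound 4 (by norm_num) bern4_le s (by push_cast; linarith) one_pos
  rw [Z_ne hs1] at e
  set a := ‖s‖ with ha
  have ha0 : 0 ≤ a := norm_nonneg _
  have hq : ∀ i : ℕ, i ≤ 3 → ‖s + i‖ ≤ a + 3 := by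
    intro i hi
    refine (norm_add_le _ _).trans ?_
    have : ‖(i:ℂ)‖ ≤ 3 := by rw [norm_natCast]; exact_mod_cast hi
    linarith
  have hp : ∀ k : ℕ, k ≤ 4 → ‖poch s k‖ ≤ (a + 3) ^ k := by
    intro k hk
    rw [poch, norm_prod]
    calc _ ≤ ∏ i ∈ Finset.range k, (a + 3) :=
          Finset.prod_le_prod (fun _ _ => norm_nonneg _)
            (fun i hi => hq i (by have := Finset.mem_range.1 hi; omega))
      _ = _ := by simp
  have hA : emA 4 s 1 = 1 + (s - 1) * (1/2 + s/12 + 0 + poch s 3 * (-1/720)) := by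
    rw [emA, emT]
    simp only [sum_range_succ, Finset.sum_range_zero, ofReal_one, one_cpow]
    have b3 : bernoulliFun 3 1 = 0 := by rw [bern3]; norm_num
    have b4 : bernoulliFun 4 1 = -1/30 := by rw [bern4]; norm_num
    norm_num [poch, Finset.prod_range_succ, factorial, b3, b4]
    left; ring
  have hrr : (1:ℝ) ^ (-s.re - (4:ℕ)) + (1:ℝ) ^ (1 - s.re - (4:ℕ)) / (s.re + (4:ℕ) - 1) ≤ 2 := by
    rw [Real.one_rpow, Real.one_rpow]
    have : 1 / (s.re + (4:ℕ) - 1) ≤ 1 := by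
      rw [div_le_one] <;> push_cast <;> linarith
    linarith
  have hb : ‖(s-1) * riemannZeta s‖ ≤ ‖s - 1‖ * (4 * (a+3)^4) := by
    rw [e, emH, hA]
    have h3 := hp 3 (by norm_num)
    have h4 := hp 4 (by norm_num)
    have hin : ‖(1/2 + s/12 + 0 + poch s 3 * (-1/720) : ℂ)‖ ≤ 1/2 + a/12 + (a+3)^3/720 := by
      refine (norm_add_le _ _).trans ?_
      refine add_le_add ?_ ?_
      · rw [add_zero]
        refine (norm_add_le _ _).trans ?_
        simp [← ha]
      · rw [norm_mul]; norm_num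
        linarith
    have hR2 : ‖emR 4 s 1‖ ≤ ‖s-1‖ * (a+3)^4 := by
      refine hR.trans ?_
      have : (0:ℝ) ≤ ‖s-1‖ * ‖poch s 4‖ * (1/30 / (factorial 4)) := by positivity
      calc _ ≤ ‖s-1‖ * ‖poch s 4‖ * (1/30 / (factorial 4)) * 2 := mul_le_mul_of_nonneg_left hrr this
        _ ≤ ‖s-1‖ * (a+3)^4 * (1/30 / (factorial 4)) * 2 := by gcongr
        _ ≤ _ := by
          have : 0 ≤ ‖s-1‖ * (a+3)^4 := by positivity
          norm_num [factorial]; linarith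
    have hx : 1 ≤ (a+3)^4 := one_le_pow₀ (by linarith)
    have h5 : 1/2 + a/12 + (a+3)^3/720 ≤ 2*(a+3)^4 := by
      have : (0:ℝ) ≤ (a+3)^3 := by positivity
      have h6 : (a+3)^3 ≤ (a+3)^4 := by
        rw [pow_succ (a+3) 3]; nlinarith
      have h7 : (1 : ℝ)≤ (a+3)^3 := one_le_pow₀ (by linarith)
      have h8 : a + 3 ≤ (a+3)^4 := by
        calc a + 3 = (a+3)^1 := by ring
          _ ≤ _ := pow_le_pow_right₀ (by linarith) (by norm_num)
      linarith
    calc _ ≤ ‖(1:ℂ)‖ + ‖s-1‖ * (1/2 + a/12 + (a+3)^3/720) + ‖s-1‖ * (a+3)^4 := by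
          refine (norm_add_le _ _).trans ?_
          refine add_le_add ((norm_add_le _ _).trans ?_) hR2
          rw [norm_mul]; gcongr
      _ ≤ ‖s-1‖ * (a+3)^4 + ‖s-1‖ * (2*(a+3)^4) + ‖s-1‖ * (a+3)^4 := by
          rw [norm_one]; gcongr; nlinarith
      _ = _ := by ring
  rw [norm_mul] at hb
  exact le_of_mul_le_mul_left hb (by linarith)

/-- bound near the one-line -/
lemma zeta_near {s : ℂ} (hs : 9/10 ≤ s.re) (h1 : 1 ≤ ‖s - 1‖) : ‖riemannZeta s‖ ≤ 2 + 11/10 * ‖s‖ := by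
  have hs1 : s ≠ 1 := by rintro rfl; norm_num at h1
  have e := Z_eq_emH 1 (by norm_num) bern1_le s (by push_cast; linarith)
  have hR := emR_bound 1 (by norm_num) bern1_le s (by push_cast; linarith) one_pos
  rw [Z_ne hs1] at e
  have hA : emA 1 s 1 = 1 + (s - 1) * (1/2) := by
    rw [emA, emT]
    simp only [sum_range_succ, Finset.sum_range_zero, ofReal_one, one_cpow]
    norm_num [poch]
  have hrr : (1:ℝ) ^ (-s.re - (1:ℕ)) + (1:ℝ) ^ (1 - s.re - (1:ℕ)) / (s.re + (1:ℕ) - 1) ≤ 22/10 := by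
    rw [Real.one_rpow, Real.one_rpow]
    have : 1 / (s.re + (1:ℕ) - 1) ≤ 10/9 := by
      rw [div_le_iff₀] <;> push_cast <;> linarith
    linarith
  have hp : poch s 1 = s := by simp [poch]
  rw [hp] at hR
  have hb : ‖(s-1) * riemannZeta s‖ ≤ ‖s - 1‖ * (2 + 11/10*‖s‖) := by
    rw [e, emH, hA]
    have hR2 : ‖emR 1 s 1‖ ≤ ‖s-1‖ * (11/10*‖s‖) := by
      refine hR.trans ?_
      have : (0:ℝ) ≤ ‖s-1‖ * ‖s‖ * (1/2 / (factorial 1)) := by positivity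
      calc _ ≤ ‖s-1‖ * ‖s‖ * (1/2 / (factorial 1)) * (22/10) := mul_le_mul_of_nonneg_left hrr this
        _ ≤ _ := by norm_num [factorial]; nlinarith
    calc _ ≤ ‖(1:ℂ)‖ + ‖s-1‖ * (1/2) + ‖s-1‖ * (11/10*‖s‖) := by
          refine (norm_add_le _ _).trans ?_
          refine add_le_add ((norm_add_le _ _).trans ?_) hR2
          rw [norm_mul]; norm_num
      _ ≤ _ := by rw [norm_one]; nlinarith
  rw [norm_mul] at hb
  exact le_of_mul_le_mul_left hb (by linarith)

lemma gamma_one_sq (v : ℝ) (hv : 0 < v) :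
    ‖Gamma (1 + v * I)‖ ^ 2 = π * v / Real.sinh (π * v) := by
  have h1 : Gamma (1 + v * I) = (v * I) * Gamma (v * I) := by
    rw [add_comm, Gamma_add_one]; simp [hv.ne']
  have h2 := Gamma_mul_Gamma_one_sub (v * I)
  have h3 : Gamma (1 - v * I) = (starRingEnd ℂ) (Gamma (1 + v * I)) := by
    rw [← Gamma_conj]; simp [sub_eq_add_neg]
  have h4 : ((‖Gamma (1 + v * I)‖ ^ 2 : ℝ) : ℂ) = π * v / Real.sinh (π * v) := by
    have hsin : sin (π * (v * I)) = Real.sinh (π * v) * I := by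
      rw [← mul_assoc, sin_mul_I]; push_cast; ring
    rw [← normSq_eq_norm_sq, ← mul_conj, ← h3]
    nth_rewrite 1 [h1]
    rw [mul_assoc, h2, hsin]
    have : (Real.sinh (π * v) : ℂ) ≠ 0 := by
      rw [ofReal_ne_zero]; exact (Real.sinh_pos_iff.2 (by positivity)).ne'
    field_simp
  exact_mod_cast h4

lemma zeta_neg_one (v : ℝ) (hv : 1 ≤ v) :
    ‖riemannZeta (-1 + v * I)‖ ≤ ((v + 1) / (2 * π)) ^ (3/2 : ℝ) * zr 2 := by
  have hv0 : 0 < v := by linarith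
  have h1 := riemannZeta_one_sub (s := 2 - v * I)
    (by intro n h; have := congrArg im h; simp at this; linarith)
    (by intro h; have := congrArg im h; simp at this; linarith)
  rw [show 1 - (2 - (v:ℂ) * I) = -1 + v * I by ring] at h1
  rw [h1]
  have hG : ‖Gamma (2 - v * I)‖ ^ 2 = (1 + v^2) * (π * v / Real.sinh (π * v)) := by
    rw [← gamma_one_sq v hv0]
    have : Gamma (2 - v * I) = (starRingEnd ℂ) ((1 + v * I) * Gamma (1 + v * I)) := by
      rw [← Gamma_add_one _ (by intro h; have := congrArg re h; simp at this), ← Gamma_conj]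
      congr 1; simp; ring
    rw [this, norm_conj, norm_mul, mul_pow]
    congr 1
    rw [← normSq_eq_norm_sq]; simp [normSq_apply]; ring
  have hc : ‖cos (π * (2 - v * I) / 2)‖ = Real.cosh (π * v / 2) := by
    rw [show (π : ℂ) * (2 - v * I) / 2 = π - (π * v / 2 : ℝ) * I by push_cast; ring,
      cos_pi_sub, norm_neg, cos_mul_I, ← ofReal_cosh, norm_real, norm_of_nonneg (Real.cosh_pos _).le]
  have h2p : ‖(2 * π : ℂ) ^ (-(2 - v * I))‖ = ((2 * π) ^ 2)⁻¹ := by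
    rw [show (2 * π : ℂ) = ((2 * π : ℝ) : ℂ) by push_cast; rfl,
      norm_cpow_eq_rpow_re_of_pos (by positivity)]
    simp [Real.rpow_neg Real.pi_pos.le, Real.rpow_neg (by positivity : (0:ℝ) ≤ 2 * π)]
  have hz : ‖riemannZeta (2 - v * I)‖ ≤ zr 2 := by
    have := zeta_norm_le (s := 2 - v * I) (by simp)
    simpa using this
  have hzr : 0 ≤ zr 2 := (norm_nonneg _).trans hz
  rw [norm_mul, norm_mul, norm_mul, norm_mul, hc, h2p]
  have key : 2 * ((2 * π) ^ 2)⁻¹ * ‖Gamma (2 - v * I)‖ * Real.cosh (π * v / 2) ≤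
      ((v + 1) / (2 * π)) ^ (3/2 : ℝ) := by
    have hsh : π * v / 2 ≤ Real.sinh (π * v / 2) :=
      (Real.self_le_sinh_iff).2 (by positivity)
    have hpi := Real.pi_gt_three
    have hsp : 0 < Real.sinh (π * v / 2) := lt_of_lt_of_le (by positivity) hsh
    have hcp := Real.cosh_pos (π * v / 2)
    have h5 : Real.sinh (π * v) =
        2 * Real.sinh (π * v / 2) * Real.cosh (π * v / 2) := by
      rw [← Real.sinh_two_mul]; congr 1; ring
    have h6 : v * Real.cosh (π * v / 2) ≤ (v + 1) * Real.sinh (π * v / 2) := by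
      have e1 := Real.cosh_sub_sinh (π * v / 2)
      have e2 : rexp (-(π * v / 2)) ≤ 1 := Real.exp_le_one_iff.2 (by
        have : 0 < π * v / 2 := by positivity
        linarith)
      nlinarith
    have h7 : (((v + 1) / (2 * π)) ^ (3/2 : ℝ)) ^ 2 = ((v + 1) / (2 * π)) ^ 3 := by
      rw [← rpow_natCast, ← Real.rpow_mul (by positivity), ← rpow_natCast]
      norm_num
    refine (pow_le_pow_iff_left₀ (by positivity) (by positivity) (two_ne_zero)).1 ?_
    rw [h7, mul_pow, mul_pow, hG, h5]
    set S := Real.sinh (π * v / 2)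
    set C := Real.cosh (π * v / 2)
    have h8 : (2 * ((2 * π) ^ 2)⁻¹) ^ 2 * ((1 + v ^ 2) * (π * v / (2 * S * C))) * C ^ 2
        = (1 + v ^ 2) * (v * C) / S / (2 * π) ^ 3 := by
      field_simp
    rw [h8, div_pow]
    gcongr
    rw [div_le_iff₀ hsp]
    calc (1 + v ^ 2) * (v * C) ≤ (1 + v ^ 2) * ((v + 1) * S) := by gcongr
      _ ≤ _ := by nlinarith [mul_pos hsp hv0, mul_pos (mul_pos hsp hv0) hv0]
  calc _ = 2 * ((2 * π) ^ 2)⁻¹ * ‖Gamma (2 - v * I)‖ * Real.cosh (π * v / 2) * ‖riemannZeta (2 - v * I)‖ := by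
        norm_num
    _ ≤ _ := by gcongr

lemma sin_ge_third {x : ℝ} (h0 : 0 ≤ x) (h1 : x ≤ 2.1) : 0.3 * x ≤ Real.sin x := by
  have hp := Real.pi_gt_d2
  have hp2 := Real.pi_lt_d2
  rcases le_total x (π/2) with h | h
  · have := Real.mul_le_sin h0 h
    refine le_trans ?_ this
    gcongr
    rw [le_div_iff₀ pi_pos]; linarith
  · have := Real.mul_le_sin (x := π - x) (by linarith) (by linarith)
    rw [Real.sin_pi_sub] at this
    refine le_trans ?_ this
    have : (0.63:ℝ) ≤ 2 / π := by
      rw [le_div_iff₀ pi_pos]; linarith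
    nlinarith

/-- one sided derivative test -/
lemma deriv_nonpos_of_le {φ : ℝ → ℝ} {d A : ℝ} (hA : 0 < A) (hd : HasDerivAt φ d 0)
    (h : ∀ x, 0 < x → x < A → φ x ≤ φ 0) : d ≤ 0 := by
  have h1 := hd.hasDerivWithinAt (s := Ioi 0)
  rw [hasDerivWithinAt_iff_tendsto_slope' (by simp)] at h1
  refine le_of_tendsto h1 ?_
  have : ∀ᶠ x in 𝓝[>] (0:ℝ), x ∈ Ioo (0:ℝ) A := Ioo_mem_nhdsGT hA
  filter_upwards [this] with x hx
  rw [slope_def_field]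
  apply div_nonpos_of_nonpos_of_nonneg
  · linarith [h x hx.1 hx.2]
  · linarith [hx.1]

lemma rect_max {h : ℂ → ℂ} {x0 x1 y0 y1 C : ℝ} (hx : x0 < x1) (hy : y0 < y1)
    (hd : ∀ z : ℂ, x0 ≤ z.re → z.re ≤ x1 → y0 ≤ z.im → z.im ≤ y1 → DifferentiableAt ℂ h z)
    (hl : ∀ z : ℂ, z.re = x0 → y0 ≤ z.im → z.im ≤ y1 → ‖h z‖ ≤ C)
    (hr : ∀ z : ℂ, z.re = x1 → y0 ≤ z.im → z.im ≤ y1 → ‖h z‖ ≤ C)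
    (hb : ∀ z : ℂ, z.im = y0 → x0 ≤ z.re → z.re ≤ x1 → ‖h z‖ ≤ C)
    (ht : ∀ z : ℂ, z.im = y1 → x0 ≤ z.re → z.re ≤ x1 → ‖h z‖ ≤ C)
    {z : ℂ} (h1 : x0 ≤ z.re) (h2 : z.re ≤ x1) (h3 : y0 ≤ z.im) (h4 : z.im ≤ y1) : ‖h z‖ ≤ C := by
  have hcl : closure (Ioo x0 x1 ×ℂ Ioo y0 y1) = Icc x0 x1 ×ℂ Icc y0 y1 := by
    rw [closure_reProdIm, closure_Ioo hx.ne, closure_Ioo hy.ne]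
  have hdiff : DiffContOnCl ℂ h (Ioo x0 x1 ×ℂ Ioo y0 y1) := by
    apply DifferentiableOn.diffContOnCl
    rw [hcl]
    intro w hw
    rw [mem_reProdIm] at hw
    exact (hd w hw.1.1 hw.1.2 hw.2.1 hw.2.2).differentiableWithinAt
  refine Complex.norm_le_of_forall_mem_frontier_norm_le
    (U := Ioo x0 x1 ×ℂ Ioo y0 y1) ?_ hdiff ?_ ?_
  · exact (Metric.isBounded_Ioo _ _).reProdIm (Metric.isBounded_Ioo _ _)
  · intro w hw
    rw [frontier_reProdIm, closure_Ioo hx.ne, closure_Ioo hy.ne, frontier_Ioo hx, frontier_Ioo hy] at hw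
    rcases hw with hw | hw
    · obtain ⟨hw1, hw2⟩ := mem_reProdIm.1 hw
      rcases hw2 with e | e
      · exact hb w e hw1.1 hw1.2
      · exact ht w e hw1.1 hw1.2
    · obtain ⟨hw1, hw2⟩ := mem_reProdIm.1 hw
      rcases hw1 with e | e
      · exact hl w e hw2.1 hw2.2
      · exact hr w e hw2.1 hw2.2
  · rw [hcl]; exact mem_reProdIm.2 ⟨⟨h1, h2⟩, ⟨h3, h4⟩⟩

lemma strip_slope {h : ℂ → ℂ} {h' : ℂ} {A Y N K : ℝ} (hA0 : 0 < A) (hA : A ≤ 2.1) (hY : 0 < Y)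
    (hK : 0 ≤ K)
    (hN : 0 ≤ N)
    (hd : ∀ z : ℂ, 0 ≤ z.re → z.re ≤ A → -Y ≤ z.im → z.im ≤ Y → DifferentiableAt ℂ h z)
    (hl : ∀ z : ℂ, z.re = 0 → -Y ≤ z.im → z.im ≤ Y → ‖h z‖ ≤ 1)
    (hr : ∀ z : ℂ, z.re = A → -Y ≤ z.im → z.im ≤ Y → ‖h z‖ ≤ rexp N)
    (ht : ∀ z : ℂ, |z.im| = Y → 0 ≤ z.re → z.re ≤ A → ‖h z‖ ≤ rexp (K * z.re))
    (h00 : ‖h 0‖ = 1) (hder : HasDerivAt h h' 0) :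
    (h' / h 0).re ≤ N / A + K / (0.3 * Real.cosh Y) := by
  set lam := K / (0.3 * Real.cosh Y) with hlam
  have hc := Real.cosh_pos Y
  have hlam0 : 0 ≤ lam := by positivity
  set e : ℂ → ℂ := fun z => cexp (-((N / A : ℝ) * z + lam * sin z)) with he
  have hen : ∀ z, ‖e z‖ = rexp (-(N / A * z.re + lam * (Real.sin z.re * Real.cosh z.im))) := by
    intro z
    rw [he]; simp only [norm_exp]
    congr 1
    have : (sin z).re = Real.sin z.re * Real.cosh z.im := by
      conv_lhs => rw [Complex.sin_eq z]
      simp [← ofReal_sin, ← ofReal_cos, ← ofReal_cosh, ← ofReal_sinh, mul_re, mul_im]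
    rw [neg_re, add_re, re_ofReal_mul, re_ofReal_mul, this]
  have hsin : ∀ x, 0 ≤ x → x ≤ A → 0.3 * x ≤ Real.sin x := fun x h1 h2 =>
    sin_ge_third h1 (h2.trans hA)
  have hΨ : ∀ z : ℂ, 0 ≤ z.re → z.re ≤ A → -Y ≤ z.im → z.im ≤ Y → ‖h z * e z‖ ≤ 1 := by
    intro z a1 a2 a3 a4
    have htb : ∀ z : ℂ, |z.im| = Y → 0 ≤ z.re → z.re ≤ A → ‖h z * e z‖ ≤ 1 := by
      intro z b1 b2 b3
      rw [norm_mul, hen]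
      calc _ ≤ rexp (K * z.re) * rexp (-(N / A * z.re + lam * (Real.sin z.re * Real.cosh z.im))) := by
            gcongr; exact ht z b1 b2 b3
        _ ≤ 1 := by
          rw [← Real.exp_add, Real.exp_le_one_iff]
          rw [← Real.cosh_abs, b1]
          have : lam * (0.3 * z.re * Real.cosh Y) = K * z.re := by
            rw [hlam]; field_simp
          have h2 : lam * (0.3 * z.re * Real.cosh Y) ≤ lam * (Real.sin z.re * Real.cosh Y) := by
            gcongr; exact hsin _ b2 b3
          have h3 : 0 ≤ N / A * z.re := by positivity
          linarith
    refine rect_max (h := fun z => h z * e z) (C := 1) hA0 (by linarith : -Y < Y) ?_ ?_ ?_ ?_ ?_ a1 a2 a3 a4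
    · intro w b1 b2 b3 b4
      refine (hd w b1 b2 b3 b4).mul ?_
      rw [he]
      fun_prop
    · intro w b1 b2 b3
      rw [norm_mul, hen, b1]; simpa using hl w b1 b2 b3
    · intro w b1 b2 b3
      rw [norm_mul, hen, b1]
      calc _ ≤ rexp N * rexp (-(N / A * A + lam * (Real.sin A * Real.cosh w.im))) := by
            gcongr; exact hr w b1 b2 b3
        _ ≤ 1 := by
          rw [← Real.exp_add, Real.exp_le_one_iff, div_mul_cancel₀ _ hA0.ne']
          have := hsin A hA0.le le_rfl
          have : 0 ≤ lam * (Real.sin A * Real.cosh w.im) := by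
            apply mul_nonneg hlam0 (mul_nonneg (by linarith) (Real.cosh_pos _).le)
          linarith
    · intro w b1; exact htb w (by rw [b1, abs_neg, abs_of_pos hY])
    · intro w b1; exact htb w (by rw [b1, abs_of_pos hY])
  have h0 : h 0 ≠ 0 := by intro h; rw [h] at h00; simp at h00
  have he0 : e 0 = 1 := by simp [he]
  have hed : HasDerivAt e (-((N / A : ℝ) + lam)) 0 := by
    have h1 : HasDerivAt (fun z : ℂ => -((N / A : ℝ) * z + lam * sin z)) (-((N / A : ℝ) * 1 + lam * cos 0)) 0 :=
      (((hasDerivAt_id (0:ℂ)).const_mul ((N / A : ℝ):ℂ)).add ((hasDerivAt_sin 0).const_mul (lam : ℂ))).neg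
    have := h1.cexp
    refine this.congr_deriv ?_
    simp
  have hD := ((hder.mul hed).div_const (h 0)).comp_ofReal
  have hD2 := (Complex.reCLM.hasFDerivAt.comp_hasDerivAt (0:ℝ) hD)
  have := deriv_nonpos_of_le hA0 hD2 (by
    intro x hx1 hx2
    have h3 := hΨ x (by simpa using hx1.le) (by simpa using hx2.le) (by simpa using hY.le) (by simpa using hY.le)
    have h4 : ‖h x * e x / h 0‖ ≤ 1 := by rw [norm_div, h00, div_one]; exact h3
    have h5 := (re_le_norm _).trans h4
    simpa [he0, h0] using h5)
  rw [he0] at this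
  have e2 : (h' * 1 + h 0 * -(((N / A : ℝ):ℂ) + lam)) / h 0 = h' / h 0 - ((N / A + lam : ℝ) : ℂ) := by
    rw [ofReal_add]; generalize ((N / A : ℝ):ℂ) = q; field_simp; ring
  rw [e2] at this
  simp only [reCLM_apply, sub_re, ofReal_re] at this
  linarith

lemma exp_big {τ : ℝ} (hτ : 3000 ≤ τ) : 10 ^ 5 * τ ^ 5 ≤ rexp (τ / 50) := by
  have h1 : τ / 3000 ≤ rexp (τ / 3000 - 1) := by
    have := add_one_le_exp (τ / 3000 - 1); linarith
  have h2 : τ ^ 5 ≤ 3000 ^ 5 * rexp (5 * (τ / 3000 - 1)) := by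
    have : (τ / 3000) ^ 5 ≤ (rexp (τ / 3000 - 1)) ^ 5 := by gcongr
    rw [← Real.exp_nat_mul, div_pow, div_le_iff₀ (by norm_num)] at this
    push_cast at this; linarith
  have h3 : (10:ℝ) ^ 5 * 3000 ^ 5 ≤ rexp 60 := by
    have : rexp 60 = rexp 1 ^ 60 := by rw [← Real.exp_nat_mul]; norm_num
    rw [this]
    calc (10:ℝ) ^ 5 * 3000 ^ 5 ≤ 2.7 ^ 60 := by norm_num
      _ ≤ _ := by gcongr; linarith [Real.exp_one_gt_d9]
  calc 10 ^ 5 * τ ^ 5 ≤ 10 ^ 5 * (3000 ^ 5 * rexp (5 * (τ / 3000 - 1))) := by gcongr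
    _ ≤ rexp 60 * rexp (5 * (τ / 3000 - 1)) := by rw [← mul_assoc]; gcongr
    _ ≤ _ := by rw [← Real.exp_add]; gcongr; linarith

noncomputable def ft (c z : ℂ) : ℂ := (starRingEnd ℂ) (riemannZeta (c - (starRingEnd ℂ) z))

lemma ft_hasDeriv {c z : ℂ} (h : c - (starRingEnd ℂ) z ≠ 1) :
    HasDerivAt (ft c) (-(starRingEnd ℂ) (deriv riemannZeta (c - (starRingEnd ℂ) z))) z := by
  have h1 : HasDerivAt (fun w => riemannZeta (c - w)) (-(deriv riemannZeta (c - (starRingEnd ℂ) z))) ((starRingEnd ℂ) z) := by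
    have := (differentiableAt_riemannZeta h).hasDerivAt.scomp ((starRingEnd ℂ) z) ((hasDerivAt_id ((starRingEnd ℂ) z)).const_sub c)
    refine this.congr_deriv ?_
    simp
  have h2 := h1.conj_conj
  simp only [RingHomCompTriple.comp_apply, RingHom.id_apply, map_neg] at h2
  exact h2

lemma zeta_deriv_crude {s : ℂ} {V : ℝ} (h1 : -1 ≤ s.re) (h2 : s.re ≤ 4) (h3 : 3 ≤ s.im)
    (h4 : s.im ≤ V) : ‖deriv riemannZeta s‖ ≤ 4 * (V + 9) ^ 4 := by
  have hne : ∀ w ∈ Metric.closedBall s 1, 1 ≤ ‖w - 1‖ ∧ -2 ≤ w.re ∧ ‖w‖ ≤ V + 6 := by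
    intro w hw
    rw [mem_closedBall_iff_norm] at hw
    have a1 := (abs_le.1 ((abs_re_le_norm (w - s)).trans hw))
    have a2 := (abs_le.1 ((abs_im_le_norm (w - s)).trans hw))
    simp only [sub_re, sub_im] at a1 a2
    refine ⟨?_, by linarith, ?_⟩
    · refine le_trans ?_ (abs_im_le_norm (w - 1))
      simp; rw [abs_of_nonneg (by linarith)]; linarith
    · have b := norm_le_abs_re_add_abs_im w
      rw [abs_of_nonneg (by linarith : 0 ≤ w.im)] at b
      have : |w.re| ≤ 5 := abs_le.2 ⟨by linarith, by linarith⟩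
      linarith
  have := norm_deriv_le_of_forall_mem_sphere_norm_le (f := riemannZeta) (c := s) (R := 1)
    (C := 4 * (V + 9) ^ 4) one_pos ?_ ?_
  · simpa using this
  · apply DifferentiableOn.diffContOnCl
    rw [closure_ball _ one_ne_zero]
    intro w hw
    refine (differentiableAt_riemannZeta ?_).differentiableWithinAt
    rintro rfl
    have := (hne 1 hw).1
    norm_num at this
  · intro w hw
    obtain ⟨b1, b2, b3⟩ := hne w (Metric.sphere_subset_closedBall hw)
    refine (zeta_crude b2 b1).trans ?_
    gcongr 4 * ?_ ^ 4
    linarith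

lemma edge_top {σ τ : ℝ} (hσ : 1 < σ) (hσ2 : σ ≤ 1.05) (hτ : 3000 ≤ τ) (hη : 1 + 1 / (σ - 1) ≤ τ)
    {z : ℂ} (h0 : 0 ≤ z.re) (h1 : z.re ≤ σ + 1) (hy : |z.im| ≤ τ / 50) :
    ‖ft (σ + τ * I) z / riemannZeta (σ + τ * I + z)‖ ≤ rexp (12 * τ ^ 5 * z.re) := by
  obtain ⟨y1, y2⟩ := abs_le.1 hy
  set w1 := σ + τ * I + z with hw1
  set w0 := σ + τ * I - (starRingEnd ℂ) z with hw0
  have r1 : w1.re = σ + z.re := by simp [hw1]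
  have i1 : w1.im = τ + z.im := by simp [hw1]
  have r0 : w0.re = σ - z.re := by simp [hw0]
  have i0 : w0.im = τ + z.im := by simp [hw0]
  have hd := Convex.norm_image_sub_le_of_norm_deriv_le (𝕜 := ℂ) (f := riemannZeta)
    (s := {w | -1 ≤ w.re ∧ w.re ≤ 4 ∧ w.im = τ + z.im}) (C := 4 * (1.02 * τ + 9) ^ 4) (x := w1) (y := w0) ?_ ?_ ?_ ?_ ?_
  · have hdiff : ‖w0 - w1‖ = 2 * z.re := by
      have : w0 - w1 = ((-(2 * z.re) : ℝ) : ℂ) := by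
        apply Complex.ext
        · rw [sub_re, r0, r1, ofReal_re]; ring
        · rw [sub_im, i0, i1, ofReal_im]; ring
      rw [this, norm_real, norm_neg, norm_of_nonneg (by linarith)]
    rw [hdiff] at hd
    have hinv := (zeta_inv_norm_le (s := w1) (by rw [r1]; linarith)).trans
      ((zr_anti hσ (by rw [r1]; linarith)).trans ((zr_le hσ).trans hη))
    have hne : riemannZeta w1 ≠ 0 := riemannZeta_ne_zero_of_one_le_re (by rw [r1]; linarith)
    have e : riemannZeta w0 / riemannZeta w1 = 1 + (riemannZeta w0 - riemannZeta w1) * (riemannZeta w1)⁻¹ := by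
      field_simp; ring
    rw [norm_div, ft, norm_conj, ← norm_div, e]
    calc _ ≤ 1 + ‖riemannZeta w0 - riemannZeta w1‖ * ‖(riemannZeta w1)⁻¹‖ := by
          refine (norm_add_le _ _).trans ?_
          rw [norm_mul, norm_one]
      _ ≤ 1 + 4 * (1.02 * τ + 9) ^ 4 * (2 * z.re) * τ := by gcongr
      _ ≤ 1 + 12 * τ ^ 5 * z.re := by
        have : (1.02 * τ + 9) ^ 4 ≤ (1.1 * τ) ^ 4 := by gcongr; linarith
        have h2 : (1.1 * τ) ^ 4 ≤ 1.5 * τ ^ 4 := by rw [mul_pow]; gcongr; norm_num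
        have h3 : (1.02 * τ + 9) ^ 4 * (8 * z.re * τ) ≤ 1.5 * τ ^ 4 * (8 * z.re * τ) := by
          gcongr; exact this.trans h2
        linarith
      _ ≤ _ := by linarith [add_one_le_exp (12 * τ ^ 5 * z.re)]
  · intro w hw
    apply differentiableAt_riemannZeta
    rintro rfl
    have := hw.2.2
    simp at this; linarith
  · intro w hw
    refine zeta_deriv_crude hw.1 hw.2.1 ?_ ?_ <;> rw [hw.2.2] <;> linarith
  · intro a ha b hb p q hp hq hpq
    refine ⟨?_, ?_, ?_⟩
    · simp; nlinarith [ha.1, hb.1]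
    · simp; nlinarith [ha.2.1, hb.2.1]
    · simp [ha.2.2, hb.2.2]; rw [← add_mul, hpq, one_mul]
  · exact ⟨by rw [r1]; linarith, by rw [r1]; linarith, i1⟩
  · exact ⟨by rw [r0]; linarith, by rw [r0]; linarith, i0⟩

lemma edge_right {σ τ : ℝ} (hσ : 1 < σ) (hτ : 3000 ≤ τ)
    {z : ℂ} (h1 : z.re = σ + 1) (hy : |z.im| ≤ τ / 50) :
    ‖ft (σ + τ * I) z / riemannZeta (σ + τ * I + z)‖ ≤ rexp (1.5 * ln τ - 1.94) := by
  obtain ⟨y1, y2⟩ := abs_le.1 hy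
  have hp := Real.pi_gt_d6
  have hp2 := Real.pi_lt_d6
  have e0 : σ + τ * I - (starRingEnd ℂ) z = -1 + (τ + z.im : ℝ) * I := by
    apply Complex.ext <;> simp [h1]
  have hz := zeta_neg_one (τ + z.im) (by linarith)
  have hinv := (zeta_inv_norm_le (s := σ + τ * I + z) (by simp; linarith)).trans
      ((zr_anti (σ := 3) (by norm_num) (by simp; linarith)).trans zr_three_le)
  have hz2 : zr 2 ≤ 1.64494 := by rw [zr_two]; nlinarith
  rw [ft, div_eq_mul_inv, norm_mul, norm_conj, e0]
  have hrp : ((τ + z.im + 1) / (2 * π)) ^ (3/2:ℝ) ≤ 0.0655 * τ ^ (3/2 : ℝ) := by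
    calc _ ≤ (0.1624 * τ) ^ (3/2:ℝ) := by
          gcongr
          · apply div_nonneg <;> linarith
          · rw [div_le_iff₀ (by positivity)]; nlinarith
      _ = 0.1624 ^ (3/2:ℝ) * τ ^ (3/2 : ℝ) := Real.mul_rpow (by norm_num) (by linarith)
      _ ≤ _ := by
        gcongr
        refine (pow_le_pow_iff_left₀ (by positivity) (by positivity) (two_ne_zero)).1 ?_
        rw [← rpow_natCast, ← Real.rpow_mul (by positivity)]
        norm_num
  have hlog : rexp (1.5 * ln τ - 1.94) = τ ^ (3/2:ℝ) * rexp (-1.94) := by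
    rw [Real.rpow_def_of_pos (by linarith), ← Real.exp_add]; congr 1; ring
  have he : 0.1426 ≤ rexp (-1.94) := by
    have : rexp (-1.94) = rexp (-1) ^ 2 * rexp 0.06 := by
      rw [← Real.exp_nat_mul, ← Real.exp_add]; norm_num
    rw [this]
    have h1 := Real.exp_neg_one_gt_d9
    have h2 := add_one_le_exp 0.06
    calc (0.1426:ℝ) ≤ 0.3678 ^ 2 * (0.06 + 1) := by norm_num
      _ ≤ _ := by gcongr; linarith
  have hτp : 0 ≤ τ ^ (3/2:ℝ) := Real.rpow_nonneg (by linarith) _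
  have hz20 : 0 ≤ zr 2 := by rw [zr_two]; positivity
  calc _ ≤ (0.0655 * τ ^ (3/2 : ℝ) * 1.64494) * (1 + (1.64494 - 1) / 2) := by
        gcongr
        · refine hz.trans ?_
          gcongr
        · refine hinv.trans ?_
          gcongr
    _ ≤ _ := by rw [hlog]; nlinarith

lemma edge_left {σ τ : ℝ} (hσ : 1 < σ) {z : ℂ} (h1 : z.re = 0) :
    ‖ft (σ + τ * I) z / riemannZeta (σ + τ * I + z)‖ = 1 := by
  have e0 : σ + τ * I - (starRingEnd ℂ) z = σ + τ * I + z := by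
    apply Complex.ext <;> simp [h1]
  have hne : riemannZeta (σ + τ * I + z) ≠ 0 := riemannZeta_ne_zero_of_one_le_re (by simp [h1]; linarith)
  rw [ft, norm_div, norm_conj, e0, div_self (by simpa using hne)]

lemma q_hasDeriv {c : ℂ} (hc : 1 < c.re) : ∃ q', HasDerivAt (fun z => ft c z / riemannZeta (c + z)) q' 0 ∧
    (q' / (ft c 0 / riemannZeta (c + 0))).re = -2 * (deriv riemannZeta c / riemannZeta c).re := by
  have hc1 : c ≠ 1 := by rintro rfl; simp at hc
  have hne : riemannZeta c ≠ 0 := riemannZeta_ne_zero_of_one_le_re hc.le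
  have h1 := ft_hasDeriv (c := c) (z := 0) (by simpa using hc1)
  have h2 : HasDerivAt (fun z => riemannZeta (c + z)) (deriv riemannZeta c) 0 := by
    have h3 : HasDerivAt riemannZeta (deriv riemannZeta c) (c + 0) := by
      rw [add_zero]; exact (differentiableAt_riemannZeta hc1).hasDerivAt
    have := HasDerivAt.scomp (0:ℂ) (h3) ((hasDerivAt_id (0:ℂ)).const_add c)
    refine this.congr_deriv ?_
    simp
  refine ⟨_, h1.div h2 (by simpa using hne), ?_⟩
  have hne' : (starRingEnd ℂ) (riemannZeta c) ≠ 0 := by simpa using hne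
  have e : ft c 0 = (starRingEnd ℂ) (riemannZeta c) := by simp [ft]
  rw [e]
  simp only [map_zero, sub_zero, add_zero]
  have : (-(starRingEnd ℂ) (deriv riemannZeta c) * riemannZeta c - (starRingEnd ℂ) (riemannZeta c) * deriv riemannZeta c) /
        riemannZeta c ^ 2 / ((starRingEnd ℂ) (riemannZeta c) / riemannZeta c) =
      -((starRingEnd ℂ) (deriv riemannZeta c / riemannZeta c) + deriv riemannZeta c / riemannZeta c) := by
    rw [map_div₀]; field_simp; ring
  rw [this]
  simp only [neg_re, add_re, conj_re]; ring

lemma lam_small {τ K : ℝ} (hτ : 3000 ≤ τ) (hK : K ≤ 13 * τ ^ 5) :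
    K / (0.3 * Real.cosh (τ / 50)) ≤ 0.001 := by
  have h1 := exp_big hτ
  have h2 := Real.exp_pos (-(τ/50))
  have h3 := Real.cosh_eq (τ / 50)
  have hc := Real.cosh_pos (τ / 50)
  rw [div_le_iff₀ (by positivity), h3]
  nlinarith

lemma log_big {τ : ℝ} (hτ : 3000 ≤ τ) : 8 ≤ ln τ := by
  rw [Real.le_log_iff_exp_le (by linarith)]
  have : rexp 8 = rexp 1 ^ 8 := by rw [← Real.exp_nat_mul]; norm_num
  rw [this]
  calc _ ≤ (2.7182818286:ℝ)^8 := by gcongr; exact Real.exp_one_lt_d9.le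
    _ ≤ _ := by norm_num; linarith

lemma slope_nozero {σ τ : ℝ} (hσ : 1 < σ) (hσ2 : σ ≤ 1.05) (hτ : 3000 ≤ τ) (hη : 1 + 1 / (σ - 1) ≤ τ) :
    -(deriv riemannZeta (σ + τ * I) / riemannZeta (σ + τ * I)).re ≤ 0.375 * ln τ - 0.484 := by
  obtain ⟨q', hq, hq'⟩ := q_hasDeriv (c := σ + τ * I) (by simpa using hσ)
  have hlog := log_big hτ
  have hN : 0 ≤ 1.5 * ln τ - 1.94 := by linarith
  have key := strip_slope (h := fun z => ft (σ + τ * I) z / riemannZeta (σ + τ * I + z))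
    (A := σ + 1) (Y := τ / 50) (N := 1.5 * ln τ - 1.94) (K := 12 * τ ^ 5)
    (by linarith) (by linarith) (by linarith) (by positivity) hN
    ?_ ?_ ?_ ?_ ?_ hq
  · rw [hq'] at key
    have h1 := lam_small (K := 12 * τ ^ 5) hτ (by gcongr; norm_num)
    have h2 : (1.5 * ln τ - 1.94) / (σ + 1) ≤ (1.5 * ln τ - 1.94) / 2 := by
      gcongr; linarith
    linarith
  · intro z h1 h2 h3 h4
    apply DifferentiableAt.div
    · refine (ft_hasDeriv ?_).differentiableAt
      intro h; have := congrArg im h; simp at this; linarith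
    · refine DifferentiableAt.fun_comp' z (differentiableAt_riemannZeta ?_) (by fun_prop)
      intro h; have := congrArg im h; simp at this; linarith
    · apply riemannZeta_ne_zero_of_one_le_re; simp; linarith
  · intro z h1 h2 h3; exact (edge_left hσ h1).le
  · intro z h1 h2 h3; exact edge_right hσ hτ h1 (abs_le.2 ⟨h2, h3⟩)
  · intro z h1 h2 h3; exact edge_top hσ hσ2 hτ hη h2 h3 h1.le
  · exact edge_left hσ (by simp)

lemma ratio_le {z : ℂ} {a m : ℝ} (ha : 0 < a) (hx : 0 ≤ z.re) (hm : 0 < m) (h : m ≤ ‖z - a‖ ^ 2) :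
    ‖(z + a) / (z - a)‖ ≤ rexp (2 * a * z.re / m) := by
  have e1 : ‖z + a‖ ^ 2 = ‖z - a‖ ^ 2 + 4 * a * z.re := by
    rw [← normSq_eq_norm_sq, ← normSq_eq_norm_sq, normSq_apply, normSq_apply]; simp; ring
  refine (pow_le_pow_iff_left₀ (by positivity) (by positivity) (two_ne_zero)).1 ?_
  rw [norm_div, div_pow, e1, ← Real.exp_nat_mul]
  have h0 : 0 < ‖z - a‖ ^ 2 := by linarith
  calc _ = 1 + 4 * a * z.re / ‖z - a‖ ^ 2 := by rw [add_div, div_self h0.ne']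
    _ ≤ 1 + 4 * a * z.re / m := by gcongr
    _ ≤ rexp (4 * a * z.re / m) := by linarith [add_one_le_exp (4 * a * z.re / m)]
    _ = _ := by congr 1; push_cast; ring

lemma slope_zero {σ τ β : ℝ} (hσ : 1 < σ) (hσ2 : σ ≤ 1.05) (hτ : 3000 ≤ τ) (hη : 1 + 1 / (σ - 1) ≤ τ)
    (hz : riemannZeta (β + τ * I) = 0) (hβ : β < 1) (hβ2 : σ - β ≤ 0.05) :
    -(deriv riemannZeta (σ + τ * I) / riemannZeta (σ + τ * I)).re ≤
      0.375 * ln τ - 0.47 - 1 / (σ - β) := by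
  obtain ⟨q', hq, hq'⟩ := q_hasDeriv (c := σ + τ * I) (by simpa using hσ)
  have hlog := log_big hτ
  set a := σ - β with ha
  have ha0 : 0 < a := by linarith
  have haC : (a : ℂ) ≠ 0 := by exact_mod_cast ha0.ne'
  set c : ℂ := σ + τ * I with hc
  have hfa : ft c a = 0 := by
    rw [ft, conj_ofReal, show c - (a:ℂ) = β + τ * I by rw [hc, ha]; push_cast; ring, hz, map_zero]
  have hds : ∀ z : ℂ, z ≠ a → dslope (ft c) a z * (z + a) / riemannZeta (c + z) =
      (ft c z / riemannZeta (c + z)) * ((z + a) / (z - a)) := by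
    intro z hza
    rw [dslope_of_ne _ hza, slope_def_field, hfa, sub_zero]
    ring
  have hN : 0 ≤ 1.5 * ln τ - 1.94 + 0.056 := by linarith
  have hnorm : ∀ z : ℂ, z.re = 0 ∨ z.re = σ + 1 ∨ |z.im| = τ / 50 → z ≠ a := by
    rintro z h rfl
    rcases h with h | h | h
    · simp at h; linarith
    · simp at h; linarith
    · simp at h; linarith
  have hder : HasDerivAt (fun z => dslope (ft c) a z * (z + a) / riemannZeta (c + z))
      (q' * ((0 + a) / (0 - a)) + (ft c 0 / riemannZeta (c + 0)) * (-2 / a)) 0 := by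
    have h1 : HasDerivAt (fun z : ℂ => (z + a) / (z - a)) (-2 / a) 0 := by
      have := ((hasDerivAt_id (0:ℂ)).add_const (a:ℂ)).div ((hasDerivAt_id (0:ℂ)).sub_const (a:ℂ)) (by simpa using haC)
      refine this.congr_deriv ?_
      simp; field_simp; ring
    refine (hq.mul h1).congr_of_eventuallyEq ?_
    have : ∀ᶠ z : ℂ in 𝓝 0, z ≠ a := by
      exact isOpen_ne.mem_nhds haC.symm
    filter_upwards [this] with z hz
    exact hds z hz
  have hleft : ∀ z : ℂ, z.re = 0 → ‖dslope (ft c) a z * (z + a) / riemannZeta (c + z)‖ = 1 := by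
    intro z h1
    rw [hds z (hnorm z (Or.inl h1)), norm_mul, edge_left hσ h1, one_mul, norm_div]
    have : ‖z + a‖ = ‖z - a‖ := by
      refine (pow_left_inj₀ (norm_nonneg _) (norm_nonneg _) two_ne_zero).1 ?_
      rw [← normSq_eq_norm_sq, ← normSq_eq_norm_sq, normSq_apply, normSq_apply]; simp [h1]
    rw [this, div_self]
    rw [norm_ne_zero_iff, sub_ne_zero]; exact hnorm z (Or.inl h1)
  have key := strip_slope (h := fun z => dslope (ft c) a z * (z + a) / riemannZeta (c + z))
    (A := σ + 1) (Y := τ / 50) (N := 1.5 * ln τ - 1.94 + 0.056) (K := 12 * τ ^ 5 + 1)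
    (by linarith) (by linarith) (by linarith) (by positivity) hN
    ?_ ?_ ?_ ?_ ?_ hder
  · have e0 : dslope (ft c) a 0 * (0 + a) / riemannZeta (c + 0) = -(ft c 0 / riemannZeta (c + 0)) := by
      rw [hds 0 haC.symm]; field_simp; ring
    have hne : ft c 0 / riemannZeta (c + 0) ≠ 0 := by
      have := edge_left (τ := τ) hσ (z := 0) (by simp)
      intro h; rw [← hc, h] at this; simp at this
    have e1 : (q' * ((0 + (a:ℂ)) / (0 - a)) + (ft c 0 / riemannZeta (c + 0)) * (-2 / a)) /
        (dslope (ft c) a 0 * (0 + a) / riemannZeta (c + 0)) = q' / (ft c 0 / riemannZeta (c + 0)) + ((2 / a : ℝ) : ℂ) := by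
      rw [e0]
      generalize ft c 0 / riemannZeta (c + 0) = Q at *
      push_cast
      field_simp; ring
    rw [e1, add_re, ofReal_re, hq'] at key
    have h1 := lam_small (K := 12 * τ ^ 5 + 1) hτ (by
      have : 1 ≤ τ ^ 5 := one_le_pow₀ (by linarith)
      linarith)
    have h2 : (1.5 * ln τ - 1.94 + 0.056) / (σ + 1) ≤ (1.5 * ln τ - 1.94 + 0.056) / 2 := by
      gcongr; linarith
    have h3 : 2 / a = 2 * (1 / a) := by ring
    linarith
  · intro z h1 h2 h3 h4
    have hfd : ∀ z : ℂ, -(τ/50) ≤ z.im → DifferentiableAt ℂ (ft c) z := by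
      intro z hz
      refine (ft_hasDeriv ?_).differentiableAt
      intro h; have := congrArg im h; simp [hc] at this; linarith
    have hdd : DifferentiableAt ℂ (dslope (ft c) a) z := by
      by_cases hza : z = a
      · have hs : {w : ℂ | -(τ/50) < w.im} ∈ 𝓝 (a : ℂ) :=
          (isOpen_lt continuous_const continuous_im).mem_nhds (by simp; linarith)
        rw [hza]
        refine ((Complex.differentiableOn_dslope hs).2 ?_).differentiableAt hs
        intro w hw
        exact (hfd w (le_of_lt hw)).differentiableWithinAt
      · exact (differentiableAt_dslope_of_ne hza).2 (hfd z h3)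
    apply DifferentiableAt.div
    · exact hdd.mul (by fun_prop)
    · refine DifferentiableAt.fun_comp' z (differentiableAt_riemannZeta ?_) (by fun_prop)
      intro h; have := congrArg im h; simp [hc] at this; linarith
    · apply riemannZeta_ne_zero_of_one_le_re; simp [hc]; linarith
  · intro z h1 h2 h3; exact (hleft z h1).le
  · intro z h1 h2 h3
    rw [hds z (hnorm z (Or.inr (Or.inl h1))), norm_mul, Real.exp_add]
    gcongr
    · exact edge_right hσ hτ h1 (abs_le.2 ⟨h2, h3⟩)
    · have h5 : (σ + 1 - a) ^ 2 ≤ ‖z - a‖ ^ 2 := by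
        have := abs_re_le_norm (z - a)
        simp only [sub_re, ofReal_re, h1] at this
        rw [← sq_abs]; gcongr
      refine (ratio_le ha0 (by linarith) (by nlinarith) h5).trans ?_
      gcongr
      rw [h1, div_le_iff₀ (by nlinarith)]
      nlinarith
  · intro z h1 h2 h3
    rw [hds z (hnorm z (Or.inr (Or.inr h1))), norm_mul, add_mul, Real.exp_add]
    gcongr
    · exact edge_top hσ hσ2 hτ hη h2 h3 h1.le
    · have h5 : (τ / 50) ^ 2 ≤ ‖z - a‖ ^ 2 := by
        have := abs_im_le_norm (z - a)
        simp only [sub_im, ofReal_im, sub_zero, h1] at this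
        gcongr
      refine (ratio_le ha0 (by linarith) (by positivity) h5).trans ?_
      gcongr
      rw [div_le_iff₀ (by positivity)]
      have h6 : (1:ℝ) ≤ (τ / 50) ^ 2 := one_le_pow₀ (by linarith)
      have h7 : 2 * a ≤ 1 * (τ / 50) ^ 2 := by linarith
      calc 2 * a * z.re ≤ 1 * (τ / 50) ^ 2 * z.re := by gcongr
        _ = _ := by ring
  · exact hleft 0 (by simp)

lemma Z_near_one {s : ℂ} {r : ℝ} (hr : r ≤ 1/4) (hs : ‖s - 1‖ ≤ r) :
    ‖Z s - (1 + (s - 1) / 2 + (s - 1) * s / 12)‖ ≤ r * (1 + r) * (2 + r) / 12 * (19/12) := by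
  have hre := (abs_le.1 ((abs_re_le_norm _).trans hs))
  simp only [sub_re, one_re] at hre
  have hr0 : 0 ≤ r := (norm_nonneg _).trans hs
  have e := Z_eq_emH 2 (by norm_num) bern2_le s (by push_cast; linarith)
  have hR := emR_bound 2 (by norm_num) bern2_le s (by push_cast; linarith) one_pos
  have hA : emA 2 s 1 = 1 + (s - 1) / 2 + (s - 1) * s / 12 := by
    rw [emA, emT]
    simp only [sum_range_succ, Finset.sum_range_zero, ofReal_one, one_cpow, bern1, bern2]
    norm_num [poch, bern1, bern2, factorial]; ring
  rw [e, emH, hA, add_sub_cancel_left]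
  refine hR.trans ?_
  have h1 : ‖s‖ ≤ 1 + r := by
    have := norm_add_le (s - 1) 1
    rw [sub_add_cancel, norm_one] at this; linarith
  have h2 : ‖s + 1‖ ≤ 2 + r := by
    have := norm_add_le s 1
    rw [norm_one] at this; linarith
  have hp : ‖poch s 2‖ ≤ (1 + r) * (2 + r) := by
    have : poch s 2 = s * (s + 1) := by simp [poch, Finset.prod_range_succ]
    rw [this, norm_mul]; gcongr
  have hrr : (1:ℝ) ^ (-s.re - (2:ℕ)) + (1:ℝ) ^ (1 - s.re - (2:ℕ)) / (s.re + (2:ℕ) - 1) ≤ 19/12 := by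
    rw [Real.one_rpow, Real.one_rpow]
    have : 1 / (s.re + (2:ℕ) - 1) ≤ 7/12 := by
      rw [div_le_iff₀] <;> push_cast <;> linarith
    linarith
  calc _ ≤ r * ((1 + r) * (2 + r)) * (1 / 6 / (factorial 2)) * (19/12) := by
        gcongr
        rw [Real.one_rpow, Real.one_rpow]
        have : (0:ℝ) ≤ 1 / (s.re + (2:ℕ) - 1) := by
          apply div_nonneg zero_le_one; push_cast; linarith
        linarith
    _ = _ := by norm_num [factorial]; ring

lemma neg_logDeriv_real {σ : ℝ} (hσ : 1 < σ) (hσ2 : σ ≤ 1.05) :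
    -(deriv riemannZeta σ / riemannZeta σ).re ≤ 1 / (σ - 1) := by
  have hn : ‖(σ:ℂ) - 1‖ = σ - 1 := by
    rw [← ofReal_one, ← ofReal_sub, norm_real, norm_of_nonneg (by linarith)]
  have hs1 : (σ:ℂ) ≠ 1 := by exact_mod_cast hσ.ne'
  have hZ0 : Z σ ≠ 0 := Z_ne_zero_of_one_le (by simpa using hσ.le)
  have hz0 : riemannZeta σ ≠ 0 := riemannZeta_ne_zero_of_one_le_re (by simpa using hσ.le)
  set P : ℂ → ℂ := fun s => 1 + (s - 1) / 2 + (s - 1) * s / 12 with hP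
  have hPd : HasDerivAt P (((1 / 2 + (2 * σ - 1) / 12 : ℝ)) : ℂ) σ := by
    have h1 := (hasDerivAt_id (σ:ℂ)).sub_const 1
    have := ((h1.div_const 2).const_add 1).add ((h1.mul (hasDerivAt_id (σ:ℂ))).div_const 12)
    refine this.congr_deriv ?_
    simp; ring
  have hd : HasDerivAt (fun s => Z s - P s) (deriv Z σ - ((1 / 2 + (2 * σ - 1) / 12 : ℝ) : ℂ)) σ :=
    (Z_differentiable σ).hasDerivAt.sub hPd
  have hR' := norm_deriv_le_of_forall_mem_sphere_norm_le (f := fun s => Z s - P s) (c := σ) (R := 0.2)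
    (C := 0.0935) (by norm_num) ?_ ?_
  · rw [hd.deriv] at hR'
    have hR := Z_near_one (s := σ) (r := 0.05) (by norm_num) (by rw [hn]; linarith)
    set D := deriv Z σ with hD
    have a1 := (abs_le.1 ((abs_re_le_norm _).trans hR')).1
    have a2 := (abs_le.1 ((abs_im_le_norm _).trans hR'))
    have b1 := (abs_le.1 ((abs_re_le_norm _).trans hR)).1
    have b2 := (abs_le.1 ((abs_im_le_norm _).trans hR))
    simp only [sub_re, sub_im, ofReal_re, ofReal_im, sub_zero] at a1 a2
    have c1 : (1 + ((σ:ℂ) - 1) / 2 + ((σ:ℂ) - 1) * σ / 12) = ((1 + (σ - 1) / 2 + (σ - 1) * σ / 12 : ℝ) : ℂ) := by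
      push_cast; ring
    rw [c1] at b1 b2
    simp only [sub_re, sub_im, ofReal_re, ofReal_im, sub_zero] at b1 b2
    have hDre : 0.1 ≤ D.re := by norm_num at a1 ⊢; linarith
    have hDim : |D.im| ≤ 0.5 := by rw [abs_le]; norm_num at a2 ⊢; constructor <;> linarith [a2.1, a2.2]
    have hZre : 0.9 ≤ (Z σ).re := by norm_num at b1 ⊢; nlinarith
    have hZim : |(Z σ).im| ≤ 0.02 := by rw [abs_le]; norm_num at b2 ⊢; constructor <;> linarith [b2.1, b2.2]
    have hpos : 0 ≤ (D / Z σ).re := by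
      rw [div_re, ← add_div]
      apply div_nonneg _ (normSq_nonneg _)
      have : |D.im * (Z σ).im| ≤ 0.5 * 0.02 := by rw [abs_mul]; gcongr
      have := (abs_le.1 this).1
      nlinarith
    have e : D / Z σ = ((1 / (σ - 1) : ℝ) : ℂ) + deriv riemannZeta σ / riemannZeta σ := by
      rw [hD, deriv_Z hs1, Z_ne hs1]
      have : (σ:ℂ) - 1 ≠ 0 := sub_ne_zero.2 hs1
      push_cast; field_simp
    rw [e, add_re, ofReal_re] at hpos
    linarith
  · apply Differentiable.diffContOnCl
    have : Differentiable ℂ P := by rw [hP]; fun_prop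
    exact Z_differentiable.sub this
  · intro z hz
    rw [mem_sphere_iff_norm] at hz
    have : ‖z - 1‖ ≤ 0.25 := by
      have := norm_add_le (z - σ) ((σ:ℂ) - 1)
      rw [sub_add_sub_cancel, hz, hn] at this; linarith
    have := Z_near_one (s := z) (r := 0.25) (by norm_num) this
    refine this.trans ?_
    norm_num

lemma trig_nonneg {w : ℂ} (hw : ‖w‖ = 1) : 0 ≤ (5 + 8 * w + 4 * w ^ 2 + w ^ 3).re := by
  have h1 : w.re ^ 2 + w.im ^ 2 = 1 := by
    have := normSq_eq_norm_sq w
    rw [hw, normSq_apply] at this; linarith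
  have h2 : -1 ≤ w.re := by nlinarith
  have e : (5 + 8 * w + 4 * w ^ 2 + w ^ 3).re = 5 + 8 * w.re + 4 * (w.re ^ 2 - w.im ^ 2) + (w.re ^ 3 - 3 * w.re * w.im ^ 2) := by
    simp [pow_succ, mul_re, mul_im]; ring
  rw [e, show w.im ^ 2 = 1 - w.re ^ 2 by linarith]
  have : 0 ≤ (1 + w.re) * (1 + 2 * w.re) ^ 2 := mul_nonneg (by linarith) (sq_nonneg _)
  nlinarith

lemma four_sum {σ t : ℝ} (hσ : 1 < σ) :
    0 ≤ 5 * -(deriv riemannZeta σ / riemannZeta σ).re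
      + 8 * -(deriv riemannZeta (σ + t * I) / riemannZeta (σ + t * I)).re
      + 4 * -(deriv riemannZeta (σ + (2 * t : ℝ) * I) / riemannZeta (σ + (2 * t : ℝ) * I)).re
      + -(deriv riemannZeta (σ + (3 * t : ℝ) * I) / riemannZeta (σ + (3 * t : ℝ) * I)).re := by
  have hs : ∀ x : ℝ, 1 < ((σ:ℂ) + x * I).re := by intro x; simpa using hσ
  have hsum : ∀ x : ℝ, HasSum (fun n => LSeries.term (fun n => (vonMangoldt n : ℂ)) (σ + x * I) n)
      (-(deriv riemannZeta (σ + x * I) / riemannZeta (σ + x * I))) := by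
    intro x
    have h1 := (ArithmeticFunction.LSeriesSummable_vonMangoldt (hs x)).hasSum
    have h2 := ArithmeticFunction.LSeries_vonMangoldt_eq_deriv_riemannZeta_div (hs x)
    rw [LSeries] at h2
    rw [h2, neg_div] at h1
    exact h1
  have H := ((((hsum 0).mul_left 5).add ((hsum t).mul_left 8)).add ((hsum (2*t)).mul_left 4)).add (hsum (3*t))
  have H2 := Complex.hasSum_re H
  have := H2.nonneg (by
    intro n
    rcases Nat.eq_zero_or_pos n with rfl | hn
    · simp
    have hn0 : (n : ℂ) ≠ 0 := by exact_mod_cast hn.ne'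
    set w : ℂ := (n:ℂ) ^ (-(t * I)) with hw
    have hw1 : ‖w‖ = 1 := by
      rw [hw, norm_natCast_cpow_of_pos hn]; simp
    have hterm : ∀ (k : ℕ), LSeries.term (fun n => (vonMangoldt n : ℂ)) (σ + ((k * t : ℝ)) * I) n =
        ((vonMangoldt n * (n:ℝ) ^ (-σ) : ℝ) : ℂ) * w ^ k := by
      intro k
      rw [LSeries.term_of_ne_zero hn.ne', div_eq_mul_inv, ← cpow_neg, neg_add, cpow_add _ _ hn0, hw, ← cpow_nat_mul]
      rw [show ((vonMangoldt n * (n:ℝ) ^ (-σ) : ℝ) : ℂ) =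
        (vonMangoldt n : ℂ) * (n:ℂ) ^ (-(σ:ℂ)) by
          rw [ofReal_mul, ofReal_cpow (by positivity)]; push_cast; rfl]
      push_cast
      rw [← mul_assoc]; congr 2; ring
    have t0 := hterm 0
    have t1 := hterm 1
    have t2 := hterm 2
    have t3 := hterm 3
    simp only [Nat.cast_zero, zero_mul, Nat.cast_one, one_mul, Nat.cast_ofNat] at t0 t1 t2 t3
    rw [t0, t1, t2, t3]
    set q := vonMangoldt n * (n:ℝ) ^ (-σ)
    have hq : 0 ≤ q := mul_nonneg vonMangoldt_nonneg (by positivity)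
    have e : (5 * ((q:ℂ) * w ^ 0) + 8 * (q * w ^ 1) + 4 * (q * w ^ 2) + q * w ^ 3) = (q:ℂ) * (5 + 8 * w + 4 * w ^ 2 + w ^ 3) := by ring
    rw [e, re_ofReal_mul]
    exact mul_nonneg hq (trig_nonneg hw1))
  simp only [add_re, mul_re, neg_re] at this
  simp only [re_ofNat, im_ofNat, zero_mul, sub_zero, ofReal_zero, add_zero] at this
  exact this

noncomputable def SS (t : ℝ) : ℝ := 4.875 * ln t - 4.5

lemma SS_ge {t : ℝ} (ht : 3000 ≤ t) : 34.5 ≤ SS t := by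
  have := log_big ht
  unfold SS; linarith

lemma SS_le {t : ℝ} (ht : 3000 ≤ t) : SS t ≤ t / 100 + 35 := by
  have h1 : ln t = ln 3000 + ln (t / 3000) := by
    rw [← Real.log_mul (by norm_num) (by positivity)]; congr 1; ring
  have h2 : ln 3000 ≤ 9 := by
    rw [Real.log_le_iff_le_exp (by norm_num)]
    have : rexp 9 = rexp 1 ^ 9 := by rw [← Real.exp_nat_mul]; norm_num
    rw [this]
    calc (3000:ℝ) ≤ 2.7 ^ 9 := by norm_num
      _ ≤ _ := by gcongr; linarith [Real.exp_one_gt_d9]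
  have h3 := log_le_sub_one_of_pos (show 0 < t / 3000 by positivity)
  unfold SS; rw [h1]; linarith

lemma zero_free {β t : ℝ} (ht : 3000 ≤ t) (hβ : 1 - 0.35 / SS t < β) : riemannZeta (β + t * I) ≠ 0 := by
  intro hz
  have hβ1 : β < 1 := by
    by_contra h
    exact riemannZeta_ne_zero_of_one_le_re (s := β + t * I) (by simpa using h) hz
  have hS := SS_ge ht
  have hS2 := SS_le ht
  set S := SS t with hSdef
  have hS0 : 0 < S := by linarith
  set η := 1.3246 / S with hη
  have hη0 : 0 < η := by positivity
  have hη1 : η ≤ 0.039 := by rw [hη, div_le_iff₀ hS0]; linarith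
  have hη2 : 1 / η = S / 1.3246 := by rw [hη, one_div_div]
  have hb : 1 - β < 0.35 / S := by linarith
  have hb2 : 0.35 / S ≤ 0.0102 := by rw [div_le_iff₀ hS0]; linarith
  have h4 := four_sum (σ := 1 + η) (t := t) (by linarith)
  have g0 := neg_logDeriv_real (σ := 1 + η) (by linarith) (by linarith)
  have hcond : 1 + 1 / (1 + η - 1) ≤ t := by
    rw [add_sub_cancel_left, hη2, ← le_sub_iff_add_le', div_le_iff₀ (by norm_num)]; nlinarith
  have g1 := slope_zero (σ := 1 + η) (by linarith) (by linarith) ht hcond hz hβ1 (by linarith)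
  have g2 := slope_nozero (σ := 1 + η) (τ := 2 * t) (by linarith) (by linarith) (by linarith) (by linarith)
  have g3 := slope_nozero (σ := 1 + η) (τ := 3 * t) (by linarith) (by linarith) (by linarith) (by linarith)
  rw [Real.log_mul (by norm_num) (by linarith)] at g2 g3
  have l2 := log_two_lt_d9
  have l3 : ln 3 ≤ 2 * ln 2 := by
    rw [← Real.log_rpow (by norm_num)]; apply log_le_log <;> norm_num
  rw [add_sub_cancel_left, hη2] at g0
  have ha : 1 + η - β < 1.6746 / S := by
    have : 1.6746 / S = η + 0.35 / S := by rw [hη, ← add_div]; norm_num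
    linarith
  have ha0 : 0 < 1 + η - β := by linarith
  have hinv : S / 1.6746 < 1 / (1 + η - β) := by
    rw [lt_div_iff₀ ha0]
    calc _ < S / 1.6746 * (1.6746 / S) := by gcongr
      _ = 1 := by field_simp
  have hSe : S = 4.875 * ln t - 4.5 := rfl
  have g0' : 5 * -(deriv riemannZeta ((1 + η : ℝ) : ℂ) / riemannZeta ((1 + η : ℝ) : ℂ)).re ≤ 3.7749 * S := by
    refine (mul_le_mul_of_nonneg_left g0 (by norm_num : (0:ℝ) ≤ 5)).trans ?_
    rw [← mul_div_assoc, div_le_iff₀ (by norm_num)]; nlinarith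
  have hinv' : 0.59715 * S < 1 / (1 + η - β) := by
    refine lt_of_le_of_lt ?_ hinv
    rw [le_div_iff₀ (by norm_num)]; nlinarith
  clear g0 hinv
  generalize 1 / (1 + η - β) = X at *
  generalize (deriv riemannZeta ((1 + η : ℝ) : ℂ) / riemannZeta ((1 + η : ℝ) : ℂ)).re = x0 at *
  generalize (deriv riemannZeta (((1 + η : ℝ) : ℂ) + t * I) / riemannZeta (((1 + η : ℝ) : ℂ) + t * I)).re = x1 at *
  generalize (deriv riemannZeta (((1 + η : ℝ) : ℂ) + (2 * t : ℝ) * I) / riemannZeta (((1 + η : ℝ) : ℂ) + (2 * t : ℝ) * I)).re = x2 at *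
  generalize (deriv riemannZeta (((1 + η : ℝ) : ℂ) + (3 * t : ℝ) * I) / riemannZeta (((1 + η : ℝ) : ℂ) + (3 * t : ℝ) * I)).re = x3 at *
  clear ha ha0 hb hb2 hcond hη2 hη1 hη0 hS2
  linarith

/-- Generic: logarithmic derivative bound from a growth bound on a zero-free disc. -/
lemma logDeriv_BC {f : ℂ → ℂ} {c : ℂ} {ρ r A : ℝ} (hr : 0 < r) (hrρ : r < ρ) (hA : 0 < A)
    (hf : DifferentiableOn ℂ f (Metric.ball c ρ)) (h0 : ∀ z ∈ Metric.ball c ρ, f z ≠ 0)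
    (hb : ∀ z ∈ Metric.ball c ρ, ‖f z‖ ≤ ‖f c‖ * rexp A) {z : ℂ} (hz : ‖z - c‖ ≤ r) :
    ‖deriv f z / f z‖ ≤ 4 * A * (ρ + r) / (ρ - r) ^ 2 := by
  have hρ : 0 < ρ := hr.trans hrρ
  have hopen : IsOpen (Metric.ball c ρ) := Metric.isOpen_ball
  have hd : DifferentiableOn ℂ (fun z => deriv f z / f z) (Metric.ball c ρ) :=
    (hf.deriv hopen).div hf h0
  obtain ⟨F, hF0, hF⟩ := hd.isExactOn_ball.with_val_at c 0
  have hcm : c ∈ Metric.ball c ρ := Metric.mem_ball_self hρ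
  have hfd : ∀ z ∈ Metric.ball c ρ, HasDerivAt f (deriv f z) z := fun z hz =>
    ((hf z hz).differentiableAt (hopen.mem_nhds hz)).hasDerivAt
  have hg : ∀ z ∈ Metric.ball c ρ, HasDerivAt (fun z => f z * cexp (-F z)) 0 z := by
    intro z hz
    have := (hfd z hz).mul ((hF z hz).neg.cexp)
    refine this.congr_deriv ?_
    have := h0 z hz
    simp only [Pi.neg_apply]
    field_simp; ring
  have hconst : ∀ z ∈ Metric.ball c ρ, f z = f c * cexp (F z) := by
    intro z hz
    have := hopen.is_const_of_deriv_eq_zero (convex_ball c ρ).isPreconnected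
      (fun z hz => (hg z hz).differentiableAt.differentiableWithinAt)
      (fun z hz => (hg z hz).deriv) hz hcm
    simp only [hF0, neg_zero, Complex.exp_zero, mul_one] at this
    rw [← this, mul_assoc, ← Complex.exp_add, neg_add_cancel, Complex.exp_zero, mul_one]
  have hre : ∀ z ∈ Metric.ball c ρ, (F z).re ≤ A := by
    intro z hz
    have h1 := hb z hz
    rw [hconst z hz, norm_mul, norm_exp] at h1
    have := le_of_mul_le_mul_left h1 (norm_pos_iff.2 (h0 c hcm))
    exact Real.exp_le_exp.1 this
  have hmap : ∀ w ∈ Metric.ball (0:ℂ) ρ, c + w ∈ Metric.ball c ρ := by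
    intro w hw; simpa [mem_ball_iff_norm] using hw
  have hBC : ∀ w : ℂ, ‖w‖ < ρ → ‖F (c + w)‖ ≤ 2 * A * ‖w‖ / (ρ - ‖w‖) := by
    intro w hw
    refine borelCaratheodory_zero (f := fun w => F (c + w)) hA ?_ ?_ hρ (by simpa using hw) (by simpa using hF0)
    · intro w hw
      have := (hF _ (hmap w hw)).differentiableAt
      exact (DifferentiableAt.fun_comp' w this (by fun_prop)).differentiableWithinAt
    · intro w hw
      exact hre _ (hmap w hw)
  have hd0 : 0 < (ρ - r) / 2 := by linarith
  have hzm : z ∈ Metric.ball c ρ := by rw [mem_ball_iff_norm]; linarith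
  rw [← (hF z hzm).deriv]
  have hsub : Metric.closedBall z ((ρ - r) / 2) ⊆ Metric.ball c ρ := by
    intro w hw
    rw [mem_closedBall_iff_norm] at hw
    rw [mem_ball_iff_norm]
    have := norm_add_le (w - z) (z - c)
    rw [sub_add_sub_cancel] at this; linarith
  have := norm_deriv_le_of_forall_mem_sphere_norm_le (f := F) (c := z) (R := (ρ - r) / 2)
    (C := 2 * A * ((ρ + r) / 2) / (ρ - (ρ + r) / 2)) hd0 ?_ ?_
  · refine this.trans (le_of_eq ?_)
    have : ρ - r ≠ 0 := by linarith
    have : ρ - (ρ + r) / 2 = (ρ - r) / 2 := by ring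
    rw [this]; field_simp; ring
  · refine DifferentiableOn.diffContOnCl ?_
    rw [closure_ball _ hd0.ne']
    intro w hw
    exact (hF w (hsub hw)).differentiableAt.differentiableWithinAt
  · intro w hw
    have hw' : ‖w - c‖ ≤ (ρ + r) / 2 := by
      rw [mem_sphere_iff_norm] at hw
      have := norm_add_le (w - z) (z - c)
      rw [sub_add_sub_cancel] at this; linarith
    have := hBC (w - c) (by linarith)
    rw [add_sub_cancel] at this
    refine this.trans ?_
    gcongr
    linarith

lemma SS_mono {a b : ℝ} (ha : 0 < a) (h : a ≤ b) : SS a ≤ SS b := by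
  have := log_le_log ha h
  unfold SS; linarith

/-- zeta log derivative near the 1-line at large height -/
lemma logDeriv_high {v T σ : ℝ} (hv : 3001 ≤ v) (hvT : v ≤ T) (hσ : 1 - 0.28 / SS (T + 1) ≤ σ) (hσ1 : σ ≤ 1) :
    ‖deriv riemannZeta (σ + v * I) / riemannZeta (σ + v * I)‖ ≤ 1260 * SS (T + 1) * ln T := by
  have hT : 3001 ≤ T := hv.trans hvT
  have hS := SS_ge (t := T + 1) (by linarith)
  have hS2 := SS_le (t := T + 1) (by linarith)
  set S := SS (T + 1) with hSdef
  have hS0 : 0 < S := by linarith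
  set δ := 0.35 / S with hδ
  have hδ0 : 0 < δ := by positivity
  have hδ1 : δ ≤ 0.0102 := by rw [hδ, div_le_iff₀ hS0]; linarith
  have hδ8 : 0.28 / S = 0.8 * δ := by rw [hδ]; ring
  set c : ℂ := ((1 + 0.2 * δ : ℝ) : ℂ) + v * I with hc
  have hcre : c.re = 1 + 0.2 * δ := by simp [hc]
  have hcim : c.im = v := by simp [hc]
  have hlT : 8 ≤ ln T := log_big (by linarith)
  have key : ∀ z ∈ Metric.ball c (1.2 * δ), 1 - δ < z.re ∧ z.re ≤ 1.02 ∧ 3000 ≤ z.im ∧ z.im ≤ T + 1 := by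
    intro z hz
    rw [mem_ball_iff_norm] at hz
    have h1 := abs_le.1 (abs_re_le_norm (z - c))
    have h2 := abs_le.1 (abs_im_le_norm (z - c))
    rw [sub_re, hcre] at h1
    rw [sub_im, hcim] at h2
    refine ⟨by linarith, by linarith, by linarith, by linarith⟩
  have hne1 : ∀ z ∈ Metric.ball c (1.2 * δ), z ≠ 1 := by
    rintro z hz rfl
    have := (key 1 hz).2.2.1
    norm_num at this
  have hz : ‖((σ:ℂ) + v * I) - c‖ ≤ δ := by
    have : ((σ:ℂ) + v * I) - c = ((σ - (1 + 0.2 * δ) : ℝ) : ℂ) := by rw [hc]; push_cast; ring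
    rw [this, norm_real, Real.norm_eq_abs, abs_le]
    constructor <;> linarith
  have hfin := logDeriv_BC (f := riemannZeta) (c := c) (ρ := 1.2 * δ) (r := δ) (A := 2 * ln T) hδ0
    (by linarith) (by linarith) ?_ ?_ ?_ hz
  · refine hfin.trans ?_
    have : 4 * (2 * ln T) * (1.2 * δ + δ) / (1.2 * δ - δ) ^ 2 = 440 * ln T / δ := by
      field_simp; ring
    rw [this, hδ, div_div_eq_mul_div, div_le_iff₀ (by norm_num)]
    nlinarith [mul_pos hS0 (by linarith : 0 < ln T)]
  · intro z hz
    exact (differentiableAt_riemannZeta (hne1 z hz)).differentiableWithinAt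
  · intro z hz
    obtain ⟨h1, h2, h3, h4⟩ := key z hz
    have : z = (z.re : ℂ) + z.im * I := (re_add_im z).symm
    rw [this]
    apply zero_free h3
    have : SS z.im ≤ S := SS_mono (by linarith) h4
    have h0 : 0 < SS z.im := by linarith [SS_ge h3]
    have : 0.35 / S ≤ 0.35 / SS z.im := by gcongr
    linarith
  · intro z hz
    obtain ⟨h1, h2, h3, h4⟩ := key z hz
    have hn : ‖z‖ ≤ T + 2.02 := by
      refine (norm_le_abs_re_add_abs_im z).trans ?_
      rw [abs_of_nonneg (by linarith), abs_of_nonneg (by linarith)]; linarith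
    have hn1 : 1 ≤ ‖z - 1‖ := by
      refine le_trans ?_ (abs_im_le_norm (z - 1))
      rw [sub_im, one_im, sub_zero, abs_of_nonneg (by linarith)]; linarith
    have hz1 := zeta_near (s := z) (by linarith) hn1
    have hc1 : 1 < c.re := by rw [hcre]; linarith
    have hz2 := (zeta_inv_norm_le hc1).trans (zr_le hc1)
    rw [hcre, add_sub_cancel_left] at hz2
    have hz0 : riemannZeta c ≠ 0 := riemannZeta_ne_zero_of_one_le_re hc1.le
    rw [norm_inv] at hz2
    have hp : 0 < ‖riemannZeta c‖ := norm_pos_iff.2 hz0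
    have hexp : rexp (2 * ln T) = T ^ 2 := by
      rw [two_mul, Real.exp_add, Real.exp_log (by linarith)]; ring
    rw [hexp]
    have e5 : 1 / (0.2 * δ) = S * (100 / 7) := by rw [hδ]; field_simp; norm_num
    rw [e5] at hz2
    have hx : 1 ≤ ‖riemannZeta c‖ * (1 + S * (100 / 7)) := by
      calc (1:ℝ) = ‖riemannZeta c‖ * ‖riemannZeta c‖⁻¹ := by field_simp
        _ ≤ _ := by gcongr
    have hy : ‖riemannZeta z‖ ≤ 1.2 * T := by linarith
    calc ‖riemannZeta z‖ ≤ 1 * (1.2 * T) := by linarith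
      _ ≤ (‖riemannZeta c‖ * (1 + S * (100 / 7))) * (1.2 * T) := by gcongr
      _ = ‖riemannZeta c‖ * ((1 + S * (100 / 7)) * (1.2 * T)) := by ring
      _ ≤ _ := by
        gcongr
        nlinarith

lemma Z_conj (s : ℂ) : Z ((starRingEnd ℂ) s) = (starRingEnd ℂ) (Z s) := by
  by_cases h : s = 1
  · subst h; simp [Z_one]
  · have h' : (starRingEnd ℂ) s ≠ 1 := by
      intro h2; apply h
      have := congrArg (starRingEnd ℂ) h2
      simpa using this
    rw [Z_ne h, Z_ne h', riemannZeta_conj]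
    simp

lemma Z_real_im (x : ℝ) : (Z x).im = 0 := by
  have := Z_conj x
  rw [conj_ofReal] at this
  exact (conj_eq_iff_im.1 this.symm)

lemma Z_deriv_real_im (x : ℝ) : (deriv Z x).im = 0 := by
  have h1 : HasDerivAt (fun y : ℝ => Z y) (deriv Z x) x := ((Z_differentiable x).hasDerivAt).comp_ofReal
  have h2 := Complex.imCLM.hasFDerivAt.comp_hasDerivAt x h1
  have h3 : (⇑imCLM ∘ fun y : ℝ => Z y) = fun _ => (0:ℝ) := by
    funext y; exact Z_real_im y
  rw [h3] at h2
  exact h2.unique (hasDerivAt_const x (0:ℝ))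

lemma Gf_real_im (x : ℝ) : (Gf x).im = 0 := by
  rw [Gf]
  have h1 : deriv Z x = ((deriv Z x).re : ℂ) := by
    apply Complex.ext <;> simp [Z_deriv_real_im]
  have h2 : Z x = ((Z x).re : ℂ) := by
    apply Complex.ext <;> simp [Z_real_im]
  rw [h1, h2, ← ofReal_div, ← ofReal_one, ← ofReal_add, ← ofReal_neg, ← ofReal_div]
  exact ofReal_im _

lemma Gf_differentiableAt {s : ℂ} (h0 : s ≠ 0) (hz : Z s ≠ 0) : DifferentiableAt ℂ Gf s := by
  have h1 : Differentiable ℂ (deriv Z) := by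
    intro w
    exact ((Z_differentiable.differentiableOn (s := univ)).deriv isOpen_univ w (mem_univ _)).differentiableAt univ_mem
  unfold Gf
  exact (((differentiableAt_const _).add ((h1 s).div (Z_differentiable s) hz)).neg).div differentiableAt_id h0

lemma edge_int {L δ : ℝ} (hL : 0 < L) (hδ : 0 < δ) :
    ∫ x in (1 - δ)..1, (1 - x) * rexp ((x - 1) * L) ≤ 1 / L ^ 2 := by
  have hd : ∀ x ∈ uIcc (1 - δ) 1, HasDerivAt (fun x : ℝ => ((1 - x) / L + 1 / L ^ 2) * rexp ((x - 1) * L))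
      ((1 - x) * rexp ((x - 1) * L)) x := by
    intro x _
    have h1 : HasDerivAt (fun x : ℝ => (1 - x) / L + 1 / L ^ 2) (-1 / L) x := by
      simpa using (((hasDerivAt_id x).const_sub 1).div_const L).add_const (1 / L ^ 2)
    have h2 : HasDerivAt (fun x : ℝ => rexp ((x - 1) * L)) (rexp ((x - 1) * L) * L) x := by
      simpa using (((hasDerivAt_id x).sub_const 1).mul_const L).exp
    refine (h1.mul h2).congr_deriv ?_
    field_simp; ring
  rw [integral_eq_sub_of_hasDerivAt hd (by
    apply Continuous.intervalIntegrable; fun_prop)]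
  simp only [sub_self, zero_div, zero_add, zero_mul, Real.exp_zero, mul_one]
  have : 0 ≤ ((1 - (1 - δ)) / L + 1 / L ^ 2) * rexp ((1 - δ - 1) * L) := by
    apply mul_nonneg _ (Real.exp_pos _).le
    have : 1 - (1 - δ) = δ := by ring
    rw [this]; positivity
  linarith

lemma shift_bound {L T δ M : ℝ} {B : ℝ → ℝ} (hL : 0 < L) (hT : 0 < T) (hδ : 0 < δ) (hδ1 : δ < 1)
    (hZ : ∀ s : ℂ, 1 - δ ≤ s.re → s.re ≤ 1 → 0 ≤ s.im → s.im ≤ T → Z s ≠ 0)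
    (hBi : IntervalIntegrable B volume 0 T)
    (hB : ∀ y : ℝ, 0 ≤ y → y ≤ T → ((1 - y / T) + δ / T) * ‖Gf ((1 - δ : ℝ) + y * I)‖ ≤ B y)
    (hM0 : ∀ x : ℝ, 1 - δ ≤ x → x ≤ 1 → ‖Gf x‖ ≤ M)
    (hM1 : ∀ x : ℝ, 1 - δ ≤ x → x ≤ 1 → ‖Gf (x + T * I)‖ ≤ M) :
    |Jf L T| ≤ (rexp (-(L * δ)) * (∫ y in (0:ℝ)..T, B y) + 2 * M / (T * L ^ 2)) / π := by
  set F : ℂ → ℂ := fun s => (1 + I * (s - 1) / T) * cexp ((s - 1) * L) * Gf s with hF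
  have hTc : (T:ℂ) ≠ 0 := by exact_mod_cast hT.ne'
  have hM : 0 ≤ M := (norm_nonneg _).trans (hM0 1 (by linarith) le_rfl)
  have hFd : DifferentiableOn ℂ F (uIcc (((1 - δ : ℝ) : ℂ).re) (((1:ℂ) + T * I).re) ×ℂ uIcc (((1 - δ : ℝ) : ℂ).im) (((1:ℂ) + T * I).im)) := by
    intro s hs
    rw [mem_reProdIm] at hs
    simp only [ofReal_re, ofReal_im, add_re, add_im, one_re, one_im, mul_re, mul_im, I_re, I_im, mul_zero, mul_one, sub_self, add_zero, zero_add, zero_mul] at hs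
    rw [uIcc_of_le (by linarith), uIcc_of_le hT.le] at hs
    obtain ⟨⟨h1, h2⟩, h3, h4⟩ := hs
    have hs0 : s ≠ 0 := by
      rintro rfl; simp at h1; linarith
    have := Gf_differentiableAt hs0 (hZ s h1 h2 h3 h4)
    apply DifferentiableAt.differentiableWithinAt
    apply DifferentiableAt.mul _ this
    fun_prop
  have H := integral_boundary_rect_eq_zero_of_differentiableOn F ((1 - δ : ℝ) : ℂ) (1 + T * I) hFd
  simp only [ofReal_re, ofReal_im, add_re, add_im, one_re, one_im, mul_re, mul_im, I_re, I_im, mul_zero, mul_one, sub_self, add_zero, zero_add, zero_mul, smul_eq_mul, ofReal_zero, ofReal_one] at H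
  have hR : (∫ y in (0:ℝ)..T, F (1 + y * I)) = ∫ t in (0:ℝ)..T, ((1 - t / T : ℝ) : ℂ) * cexp (t * L * I) * Gf (1 + t * I) := by
    apply intervalIntegral.integral_congr
    intro t _
    simp only [hF]
    congr 2
    · push_cast
      field_simp
      ring_nf; rw [I_sq]; ring
    · congr 1; ring
  set RR := ∫ y in (0:ℝ)..T, F (1 + y * I)
  set LL := ∫ y in (0:ℝ)..T, F ((1 - δ : ℝ) + y * I) with hLL
  set BB := ∫ x in (1 - δ)..1, F x with hBB
  set TT := ∫ x in (1 - δ)..1, F (x + T * I) with hTT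
  have hre : RR.re = LL.re + TT.im - BB.im := by
    have := congrArg Complex.im H
    simp at this
    linarith
  have hb1 : ‖LL‖ ≤ rexp (-(L * δ)) * ∫ y in (0:ℝ)..T, B y := by
    rw [hLL, ← intervalIntegral.integral_const_mul]
    apply intervalIntegral.norm_integral_le_of_norm_le hT.le _ (hBi.const_mul _)
    refine Eventually.of_forall ?_
    intro y hy
    simp only [hF, norm_mul, norm_exp]
    have e1 : (((((1 - δ : ℝ) : ℂ) + y * I - 1) * L).re) = -(L * δ) := by simp; ring
    rw [e1]
    have e2 : ‖1 + I * (((1 - δ : ℝ) : ℂ) + y * I - 1) / T‖ ≤ (1 - y / T) + δ / T := by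
      have : 1 + I * (((1 - δ : ℝ) : ℂ) + y * I - 1) / T = ((1 - y / T : ℝ) : ℂ) - ((δ / T : ℝ) : ℂ) * I := by
        push_cast; field_simp; ring_nf; rw [I_sq]; ring
      rw [this]
      refine (norm_sub_le _ _).trans ?_
      rw [norm_mul, norm_I, mul_one, norm_real, norm_real, norm_of_nonneg, norm_of_nonneg (by positivity)]
      rw [sub_nonneg, div_le_one hT]; exact hy.2
    have := hB y hy.1.le hy.2
    calc _ ≤ ((1 - y / T) + δ / T) * rexp (-(L * δ)) * ‖Gf (((1 - δ : ℝ) : ℂ) + y * I)‖ := by gcongr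
      _ = rexp (-(L * δ)) * (((1 - y / T) + δ / T) * ‖Gf (((1 - δ : ℝ) : ℂ) + y * I)‖) := by ring
      _ ≤ _ := by gcongr
  have hint : IntervalIntegrable (fun x : ℝ => M / T * ((1 - x) * rexp ((x - 1) * L))) volume (1 - δ) 1 := by
    apply Continuous.intervalIntegrable; fun_prop
  have hedge : (∫ x in (1 - δ)..1, M / T * ((1 - x) * rexp ((x - 1) * L))) ≤ M / (T * L ^ 2) := by
    rw [intervalIntegral.integral_const_mul]
    calc _ ≤ M / T * (1 / L ^ 2) := by gcongr; exact edge_int hL hδ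
      _ = _ := by field_simp
  have hb2 : |TT.im| ≤ M / (T * L ^ 2) := by
    refine (abs_im_le_norm _).trans (le_trans ?_ hedge)
    apply intervalIntegral.norm_integral_le_of_norm_le (by linarith) _ hint
    refine Eventually.of_forall ?_
    intro x hx
    simp only [hF, norm_mul, norm_exp]
    have e1 : (((x:ℂ) + T * I - 1) * L).re = (x - 1) * L := by simp
    have e2 : ‖1 + I * ((x:ℂ) + T * I - 1) / T‖ = (1 - x) / T := by
      have : 1 + I * ((x:ℂ) + T * I - 1) / T = (((x - 1) / T : ℝ) : ℂ) * I := by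
        push_cast; field_simp; ring_nf; rw [I_sq]; ring
      rw [this, norm_mul, norm_I, mul_one, norm_real, Real.norm_eq_abs, abs_div, abs_of_pos hT, abs_of_nonpos (by linarith [hx.2])]
      ring
    rw [e1, e2]
    have := hM1 x hx.1.le hx.2
    have hx2 : 0 ≤ (1 - x) := by linarith [hx.2]
    calc (1 - x) / T * rexp ((x - 1) * L) * ‖Gf (x + T * I)‖ ≤ (1 - x) / T * rexp ((x - 1) * L) * M := by gcongr
      _ = _ := by ring
  have hFi : IntervalIntegrable (fun x : ℝ => F x) volume (1 - δ) 1 := by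
    apply ContinuousOn.intervalIntegrable
    intro x hx
    rw [uIcc_of_le (by linarith)] at hx
    have hs0 : (x:ℂ) ≠ 0 := by
      intro h; rw [ofReal_eq_zero] at h; rw [h] at hx; linarith [hx.1]
    have h1 := Gf_differentiableAt hs0 (hZ x (by simpa using hx.1) (by simpa using hx.2) (by simp) (by simpa using hT.le))
    have h2 : ContinuousAt F (x:ℂ) := by
      apply ContinuousAt.mul _ h1.continuousAt
      fun_prop
    exact (ContinuousAt.comp (f := fun y : ℝ => (y:ℂ)) h2 continuous_ofReal.continuousAt).continuousWithinAt
  have hb3 : |BB.im| ≤ M / (T * L ^ 2) := by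
    have : BB.im = ∫ x in (1 - δ)..1, (F x).im := by
      have := Complex.imCLM.intervalIntegral_comp_comm hFi
      exact this.symm
    rw [this, ← Real.norm_eq_abs]
    refine le_trans ?_ hedge
    apply intervalIntegral.norm_integral_le_of_norm_le (by linarith) _ hint
    refine Eventually.of_forall ?_
    intro x hx
    have e1 : Gf x = ((Gf x).re : ℂ) := by apply Complex.ext <;> simp [Gf_real_im]
    have e2 : F x = ((rexp ((x - 1) * L) * (Gf x).re : ℝ) : ℂ) + (((x - 1) / T * (rexp ((x - 1) * L) * (Gf x).re) : ℝ) : ℂ) * I := by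
      simp only [hF]
      rw [e1, ofReal_re]; push_cast; ring
    have e3 : (F x).im = (x - 1) / T * (rexp ((x - 1) * L) * (Gf x).re) := by
      rw [e2]; simp only [add_im, mul_im, ofReal_re, ofReal_im, I_re, I_im]; ring
    rw [e3, Real.norm_eq_abs, abs_mul, abs_mul, abs_div, abs_of_pos hT, abs_of_nonpos (by linarith [hx.2] : x - 1 ≤ 0), Real.abs_exp]
    have := (abs_re_le_norm _).trans (hM0 x hx.1.le hx.2)
    have hx2 : 0 ≤ -(x - 1) := by linarith [hx.2]
    calc -(x - 1) / T * (rexp ((x - 1) * L) * |(Gf x).re|) ≤ -(x - 1) / T * (rexp ((x - 1) * L) * M) := by gcongr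
      _ = _ := by ring
  have hJ : Jf L T = RR.re / π := by rw [Jf, ← hR]
  rw [hJ, abs_div, abs_of_pos pi_pos, hre]
  gcongr
  have h1 := (abs_re_le_norm LL).trans hb1
  have e : 2 * M / (T * L ^ 2) = M / (T * L ^ 2) + M / (T * L ^ 2) := by ring
  rw [e]
  calc |LL.re + TT.im - BB.im| ≤ |LL.re + TT.im| + |BB.im| := abs_sub _ _
    _ ≤ |LL.re| + |TT.im| + |BB.im| := by gcongr; exact abs_add_le _ _
    _ ≤ _ := by linarith

/-- the normalised function used in the numerical verification -/
noncomputable def gn (s : ℂ) : ℂ := (1 - (2:ℂ) ^ (-s)) * Z s / s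

lemma gn_differentiableAt {s : ℂ} (hs : s ≠ 0) : DifferentiableAt ℂ gn s := by
  unfold gn
  refine DifferentiableAt.div (DifferentiableAt.mul ?_ (Z_differentiable s)) differentiableAt_id hs
  have : DifferentiableAt ℂ (fun s : ℂ => (2:ℂ) ^ (-s)) s :=
    DifferentiableAt.const_cpow (by fun_prop) (Or.inl (by norm_num))
  fun_prop

lemma gn_conj (s : ℂ) : gn ((starRingEnd ℂ) s) = (starRingEnd ℂ) (gn s) := by
  unfold gn
  rw [Z_conj, map_div₀, map_mul, map_sub, map_one]
  congr 3
  have h := Complex.cpow_conj 2 (-s) (by rw [show (2:ℂ) = ((2:ℝ):ℂ) by norm_num, arg_ofReal_of_nonneg (by norm_num)]; exact Real.pi_pos.ne)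
  rw [map_neg] at h
  rw [h]
  rw [show (starRingEnd ℂ) (2:ℂ) = 2 from Complex.conj_ofNat 2]

lemma zeta_sub_one_norm_le {s : ℂ} (hs : 1 < s.re) : ‖riemannZeta s - 1‖ ≤ zr s.re - 1 := by
  have h1 : HasSum (fun n => LSeries.term 1 s n) (riemannZeta s) := by
    have := (LSeriesSummable_one_iff.2 hs).hasSum
    rwa [← LSeries, LSeries_one_eq_riemannZeta hs] at this
  have h2 := h1.sub (hasSum_ite_eq (1:ℕ) (1:ℂ))
  have h3 := (zr_summable hs).hasSum.sub (hasSum_ite_eq (1:ℕ) (1:ℝ))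
  rw [← h2.tsum_eq]
  refine tsum_of_norm_bounded h3 ?_
  intro n
  rcases eq_or_ne n 1 with rfl | hn
  · simp [LSeries.term]
  · simp only [if_neg hn, sub_zero]
    rcases Nat.eq_zero_or_pos n with rfl | hn
    · simp [LSeries.term_zero]; positivity
    · rw [LSeries.norm_term_eq, if_neg (by omega)]; simp

lemma two_cpow_norm (s : ℂ) : ‖(2:ℂ) ^ (-s)‖ = (2:ℝ) ^ (-s.re) := by
  have := norm_natCast_cpow_of_pos (show 0 < 2 by norm_num) (-s)
  simpa using this

lemma gn_right {s : ℂ} (hs : s.re = 3) : 0.1 ≤ (gn s).re := by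
  have hs1 : s ≠ 1 := by rintro rfl; norm_num at hs
  have hs0 : s ≠ 0 := by rintro rfl; norm_num at hs
  set d : ℂ := (1 - (2:ℂ) ^ (-s)) * riemannZeta s - 1 with hd
  have h2 := zr_two
  have h3 : zr 3 ≤ 1.325 := by
    have := zr_three_le
    have := Real.pi_lt_d4
    have := pi_pos
    rw [h2] at *
    nlinarith
  have hz := zeta_sub_one_norm_le (s := s) (by rw [hs]; norm_num)
  have hz2 := zeta_norm_le (s := s) (by rw [hs]; norm_num)
  rw [hs] at hz hz2
  have hp : ‖(2:ℂ) ^ (-s)‖ = 1/8 := by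
    rw [two_cpow_norm, hs, show (-(3:ℝ)) = ((-3:ℤ):ℝ) by norm_num, Real.rpow_intCast]; norm_num
  have hdn : ‖d‖ ≤ 0.5 := by
    have : d = (riemannZeta s - 1) - (2:ℂ) ^ (-s) * riemannZeta s := by rw [hd]; ring
    rw [this]
    refine (norm_sub_le _ _).trans ?_
    rw [norm_mul, hp]; linarith
  have e : gn s = 1 - 1 / s + (1 - 1 / s) * d := by
    rw [gn, Z_ne hs1, hd]; field_simp; ring
  have hn : 9 ≤ normSq s := by rw [normSq_apply, hs]; nlinarith [mul_self_nonneg s.im]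
  have h5 : (1 / s).re ≤ 1/3 := by
    rw [one_div, inv_re, hs, div_le_iff₀ (by linarith)]; linarith
  have h6 : ‖1 - 1 / s‖ ≤ 1 := by
    have : 1 - 1 / s = (s - 1) / s := by field_simp
    rw [this, norm_div, div_le_one (norm_pos_iff.2 hs0), norm_def, norm_def]
    apply Real.sqrt_le_sqrt
    rw [normSq_apply, normSq_apply]; simp [hs]; norm_num
  have h7 : ‖(1 - 1 / s) * d‖ ≤ 0.5 := by
    rw [norm_mul]; nlinarith [norm_nonneg d, norm_nonneg (1 - 1 / s)]
  have h8 := (abs_le.1 ((abs_re_le_norm _).trans h7)).1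
  rw [e, add_re, sub_re, one_re]
  norm_num at h8 h5 ⊢
  linarith

lemma gn_crude {s : ℂ} {H : ℝ} (hH : 100 ≤ H) (hH2 : H ≤ 4000) (h1 : 7/8 ≤ s.re) (h2 : s.re ≤ 3) (h3 : |s.im| = H) :
    ‖gn s‖ ≤ 2200000000000000 := by
  have him : H ≤ ‖s‖ := by rw [← h3]; exact abs_im_le_norm s
  have him1 : H ≤ ‖s - 1‖ := by
    have := abs_im_le_norm (s - 1)
    rwa [sub_im, one_im, sub_zero, h3] at this
  have hs1 : s ≠ 1 := by rintro rfl; simp at him1; linarith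
  have hn : ‖s‖ ≤ 4003 := by
    refine (norm_le_abs_re_add_abs_im s).trans ?_
    rw [abs_of_nonneg (by linarith), h3]; linarith
  have hz := zeta_crude (s := s) (by linarith) (by linarith)
  have hz' : ‖riemannZeta s‖ ≤ 4 * (4003 + 3) ^ 4 := hz.trans (by gcongr)
  have hp : ‖1 - (2:ℂ) ^ (-s)‖ ≤ 2 := by
    refine (norm_sub_le _ _).trans ?_
    rw [two_cpow_norm, norm_one]
    have : (2:ℝ) ^ (-s.re) ≤ 1 := Real.rpow_le_one_of_one_le_of_nonpos (by norm_num) (by linarith)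
    linarith
  have hq : ‖s - 1‖ ≤ 1.01 * ‖s‖ := by
    refine (norm_sub_le _ _).trans ?_
    rw [norm_one]; linarith
  have hs0 : 0 < ‖s‖ := by linarith
  rw [gn, Z_ne hs1, norm_div, norm_mul, norm_mul, div_le_iff₀ hs0]
  calc _ ≤ 2 * (1.01 * ‖s‖ * (4 * (4003 + 3) ^ 4)) := by gcongr
    _ = (2 * 1.01 * 4 * (4003 + 3) ^ 4) * ‖s‖ := by ring
    _ ≤ _ := by gcongr; norm_num

lemma cos_re (z : ℂ) : (Complex.cos z).re = Real.cos z.re * Real.cosh z.im := by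
  conv_lhs => rw [← re_add_im z, Complex.cos_add_mul_I]
  rw [← ofReal_cos, ← ofReal_sin, ← ofReal_cosh, ← ofReal_sinh, sub_re, ← ofReal_mul, ofReal_re, ← ofReal_mul, re_ofReal_mul]
  simp

lemma barrier {H : ℝ} (hH : 100 ≤ H) (hH2 : H ≤ 4000)
    (hnum : ∀ t : ℝ, 0 ≤ t → t ≤ H → 0.1 ≤ (gn ((7/8 : ℝ) + t * I)).re)
    {s : ℂ} (h1 : 7/8 ≤ s.re) (h2 : s.re ≤ 3) (h3 : |s.im| ≤ H - 41) : 0 < (gn s).re := by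
  set lam : ℝ := 20000000000000000 * rexp (-H) with hlam
  have hlam0 : 0 < lam := by positivity
  set c : ℂ := ((31/16 : ℝ) : ℂ) with hc
  set h : ℂ → ℂ := fun z => cexp (-(gn z + lam * Complex.cos (z - c))) with hh
  have hnum' : ∀ z : ℂ, z.re = 7/8 → |z.im| ≤ H → 0.1 ≤ (gn z).re := by
    intro z hz hz2
    rcases le_total 0 z.im with h0 | h0
    · have := hnum z.im h0 (by rwa [abs_of_nonneg h0] at hz2)
      rwa [← hz, re_add_im] at this
    · have := hnum (-z.im) (by linarith) (by rwa [abs_of_nonpos h0] at hz2)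
      have e : (((7/8:ℝ):ℂ) + ((-z.im : ℝ) : ℂ) * I) = (starRingEnd ℂ) z := by
        apply Complex.ext <;> simp [hz]
      rw [e, gn_conj, conj_re] at this
      exact this
  have hbre : ∀ z : ℂ, (lam * Complex.cos (z - c)).re = lam * (Real.cos (z.re - 31/16) * Real.cosh z.im) := by
    intro z
    rw [re_ofReal_mul, cos_re]; simp [hc]
  have hcos : ∀ x : ℝ, 7/8 ≤ x → x ≤ 3 → 0.4 ≤ Real.cos (x - 31/16) := by
    intro x hx1 hx2
    have := Real.one_sub_sq_div_two_le_cos (x := x - 31/16)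
    nlinarith
  have hnorm : ∀ z : ℂ, ‖h z‖ = rexp (-((gn z).re + lam * (Real.cos (z.re - 31/16) * Real.cosh z.im))) := by
    intro z
    rw [hh, norm_exp, neg_re, add_re, hbre]
  have hbpos : ∀ z : ℂ, 7/8 ≤ z.re → z.re ≤ 3 → 0 ≤ lam * (Real.cos (z.re - 31/16) * Real.cosh z.im) := by
    intro z h1 h2
    have := hcos z.re h1 h2
    have := Real.cosh_pos z.im
    positivity
  have hedge : ∀ z : ℂ, |z.im| = H → 7/8 ≤ z.re → z.re ≤ 3 → ‖h z‖ ≤ rexp (-0.1) := by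
    intro z hz h1 h2
    rw [hnorm]
    apply Real.exp_le_exp.2
    have hg := (abs_le.1 ((abs_re_le_norm _).trans (gn_crude hH hH2 h1 h2 hz))).1
    have hch : rexp H / 2 ≤ Real.cosh z.im := by
      rw [← Real.cosh_abs, hz, Real.cosh_eq]
      have := Real.exp_pos (-H); linarith
    have : lam * (0.4 * (rexp H / 2)) ≤ lam * (Real.cos (z.re - 31/16) * Real.cosh z.im) := by
      have := hcos z.re h1 h2
      gcongr
    have e : lam * (0.4 * (rexp H / 2)) = 4000000000000000 := by
      rw [hlam, Real.exp_neg]; field_simp; norm_num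
    rw [e] at this
    norm_num at hg this ⊢
    linarith
  have hside : ∀ z : ℂ, 7/8 ≤ z.re → z.re ≤ 3 → 0.1 ≤ (gn z).re → ‖h z‖ ≤ rexp (-0.1) := by
    intro z h1 h2 h3
    rw [hnorm]
    apply Real.exp_le_exp.2
    linarith [hbpos z h1 h2]
  have h3' := abs_le.1 h3
  have hmax := rect_max (h := h) (x0 := 7/8) (x1 := 3) (y0 := -H) (y1 := H) (C := rexp (-0.1)) (by norm_num) (by linarith)
    ?_ ?_ ?_ ?_ ?_ h1 h2 (by linarith) (by linarith)
  · rw [hnorm, Real.exp_le_exp] at hmax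
    have hch : Real.cosh s.im ≤ rexp (H - 41) := by
      rw [← Real.cosh_abs]
      refine le_trans ?_ (Real.exp_le_exp.2 h3)
      rw [Real.cosh_eq]
      have := Real.exp_le_exp.2 (show -|s.im| ≤ |s.im| by linarith [abs_nonneg s.im])
      linarith
    have hch0 := Real.cosh_pos s.im
    have : lam * (Real.cos (s.re - 31/16) * Real.cosh s.im) ≤ lam * (1 * rexp (H - 41)) := by
      gcongr
      exact Real.cos_le_one _
    have e : lam * (1 * rexp (H - 41)) = 20000000000000000 * rexp (-41) := by
      rw [hlam, one_mul, mul_assoc, ← Real.exp_add]; congr 2; ring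
    have e41 : rexp (-41) ≤ 1 / 2.7 ^ 41 := by
      rw [Real.exp_neg, ← one_div]
      apply one_div_le_one_div_of_le (by norm_num)
      have : rexp 41 = rexp 1 ^ 41 := by rw [← Real.exp_nat_mul]; norm_num
      rw [this]; gcongr; linarith [Real.exp_one_gt_d9]
    have e42 : (20000000000000000:ℝ) * rexp (-41) ≤ 20000000000000000 * (1 / 2.7 ^ 41) := by gcongr
    have e43 : (20000000000000000:ℝ) * (1 / 2.7 ^ 41) ≤ 0.05 := by norm_num
    norm_num at hmax
    norm_num at e43 e42 this e
    linarith
  · intro z hz1 _ _ _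
    have hz0 : z ≠ 0 := by rintro rfl; norm_num at hz1
    have := gn_differentiableAt hz0
    rw [hh]
    fun_prop
  · intro z hz ha hb
    exact hside z (by linarith) (by linarith) (hnum' z hz (abs_le.2 ⟨ha, hb⟩))
  · intro z hz ha hb
    exact hside z (by linarith) (by linarith) (gn_right hz)
  · intro z hz ha hb
    exact hedge z (by rw [hz, abs_neg, abs_of_pos (by linarith)]) ha hb
  · intro z hz ha hb
    exact hedge z (by rw [hz, abs_of_pos (by linarith)]) ha hb

lemma posreal_logDeriv {g : ℂ → ℂ} {c : ℂ} {R : ℝ} (hR : 0 < R) (hd : DifferentiableOn ℂ g (Metric.ball c R))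
    (hp : ∀ z ∈ Metric.ball c R, 0 < (g z).re) : ‖deriv g c / g c‖ ≤ 2 / R := by
  have hc : c ∈ Metric.ball c R := Metric.mem_ball_self hR
  have hM := hp c hc
  set M := (g c).re with hMd
  have hmap : ∀ w ∈ Metric.ball (0:ℂ) R, c + w ∈ Metric.ball c R := by
    intro w hw; simpa [mem_ball_iff_norm] using hw
  have hBC : ∀ w : ℂ, ‖w‖ < R → ‖g c - g (c + w)‖ ≤ 2 * M * ‖w‖ / (R - ‖w‖) := by
    intro w hw
    refine borelCaratheodory_zero (f := fun w => g c - g (c + w)) hM ?_ ?_ hR (by simpa using hw) (by simp)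
    · intro w hw
      have := (hd _ (hmap w hw)).differentiableAt (Metric.isOpen_ball.mem_nhds (hmap w hw))
      exact ((differentiableAt_const _).sub (DifferentiableAt.fun_comp' w this (by fun_prop))).differentiableWithinAt
    · intro w hw
      have := hp _ (hmap w hw)
      simp only [mem_ofPred_eq, sub_re]
      linarith
  have hdc := ((hd c hc).differentiableAt (Metric.isOpen_ball.mem_nhds hc)).hasDerivAt
  have hder : ‖deriv g c‖ ≤ 2 * M / R := by
    have : ∀ r : ℝ, 0 < r → r < R → ‖deriv g c‖ ≤ 2 * M / (R - r) := by
      intro r hr hrR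
      have hRr : 0 < R - r := by linarith
      refine hdc.le_of_lip' (by positivity) ?_
      filter_upwards [Metric.ball_mem_nhds c hr] with z hz
      rw [mem_ball_iff_norm] at hz
      have := hBC (z - c) (by linarith)
      rw [add_sub_cancel, norm_sub_rev] at this
      refine this.trans ?_
      rw [mul_div_right_comm]
      gcongr
    have ht : Tendsto (fun r : ℝ => 2 * M / (R - r)) (𝓝[>] 0) (𝓝 (2 * M / (R - 0))) := by
      apply Tendsto.mono_left _ nhdsWithin_le_nhds
      apply Tendsto.div tendsto_const_nhds _ (by linarith)
      exact tendsto_const_nhds.sub tendsto_id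
    rw [sub_zero] at ht
    refine ge_of_tendsto ht ?_
    filter_upwards [Ioo_mem_nhdsGT hR] with r hr using this r hr.1 hr.2
  have hn : M ≤ ‖g c‖ := (le_abs_self _).trans (abs_re_le_norm _)
  rw [norm_div, div_le_iff₀ (by linarith)]
  refine hder.trans ?_
  rw [div_mul_eq_mul_div]
  gcongr

lemma Z_ne_zero_of_gn {s : ℂ} (h : 0 < (gn s).re) : Z s ≠ 0 := by
  intro h0
  rw [gn, h0] at h; simp at h

lemma Gf_low {H d : ℝ} (hH : 100 ≤ H) (hH2 : H ≤ 4000)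
    (hnum : ∀ t : ℝ, 0 ≤ t → t ≤ H → 0.1 ≤ (gn ((7/8 : ℝ) + t * I)).re) (hd : 0 < d) (hd1 : d ≤ 1)
    {s : ℂ} (h1 : 7/8 + d ≤ s.re) (h1' : 9/10 ≤ s.re) (h2 : s.re ≤ 1) (h3 : |s.im| ≤ H - 42) :
    ‖Gf s‖ ≤ (2 / d + 3) / ‖s‖ := by
  have hs0 : s ≠ 0 := by rintro rfl; norm_num at h1'
  have hreg : ∀ z ∈ Metric.ball s d, 7/8 ≤ z.re ∧ z.re ≤ 3 ∧ |z.im| ≤ H - 41 := by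
    intro z hz
    rw [mem_ball_iff_norm] at hz
    have a := abs_le.1 (abs_re_le_norm (z - s))
    have b := abs_le.1 (abs_im_le_norm (z - s))
    rw [sub_re] at a
    rw [sub_im] at b
    have c := abs_le.1 h3
    exact ⟨by linarith, by linarith, abs_le.2 ⟨by linarith, by linarith⟩⟩
  have hg := posreal_logDeriv (g := gn) (c := s) hd (by
      intro z hz
      have hz0 : z ≠ 0 := by rintro rfl; have := (hreg 0 hz).1; norm_num at this
      exact (gn_differentiableAt hz0).differentiableWithinAt)
    (fun z hz => barrier hH hH2 hnum (hreg z hz).1 (hreg z hz).2.1 (hreg z hz).2.2)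
  have hpos := barrier hH hH2 hnum (s := s) (by linarith) (by linarith) (by linarith)
  have hZ := Z_ne_zero_of_gn hpos
  set q : ℂ := (2:ℂ) ^ (-s) with hq
  have hqn : ‖q‖ ≤ 0.54 := by
    rw [hq, two_cpow_norm]
    calc (2:ℝ) ^ (-s.re) ≤ (2:ℝ) ^ (-(9/10) : ℝ) := by
          apply Real.rpow_le_rpow_of_exponent_le <;> linarith
      _ ≤ 0.54 := by
          rw [← pow_le_pow_iff_left₀ (by positivity) (by norm_num) (show 10 ≠ 0 by norm_num), ← rpow_natCast, ← Real.rpow_mul (by norm_num)]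
          rw [show (-(9/10):ℝ) * ((10:ℕ):ℝ) = ((-9:ℤ):ℝ) by norm_num, Real.rpow_intCast]; norm_num
  have hM0 : 1 - q ≠ 0 := by
    intro h
    have : q = 1 := by rw [sub_eq_zero] at h; exact h.symm
    rw [this] at hqn; norm_num at hqn
  have hqd : HasDerivAt (fun s : ℂ => 1 - (2:ℂ) ^ (-s)) (q * Complex.log 2) s := by
    have := ((hasDerivAt_id s).neg.const_cpow (c := 2) (Or.inl (by norm_num))).const_sub 1
    refine this.congr_deriv ?_
    simp [hq]
  have hgd : HasDerivAt gn (((q * Complex.log 2 * Z s + (1 - q) * deriv Z s) * s - (1 - q) * Z s) / s ^ 2) s := by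
    have := (hqd.mul (Z_differentiable s).hasDerivAt).div (hasDerivAt_id s) hs0
    refine this.congr_deriv ?_
    simp [hq]
  have e : deriv Z s / Z s = deriv gn s / gn s + 1 / s - q * Complex.log 2 / (1 - q) := by
    rw [hgd.deriv, gn, ← hq]; field_simp; ring
  have hsn : 9/10 ≤ ‖s‖ := h1'.trans ((le_abs_self _).trans (abs_re_le_norm _))
  have hlog : ‖Complex.log 2‖ ≤ 0.6932 := by
    rw [show (2:ℂ) = ((2:ℝ):ℂ) by norm_num, ← ofReal_log (by norm_num), norm_real, norm_of_nonneg (Real.log_nonneg (by norm_num))]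
    linarith [log_two_lt_d9]
  have h4 : ‖q * Complex.log 2 / (1 - q)‖ ≤ 0.85 := by
    have : 0.46 ≤ ‖1 - q‖ := by
      have := norm_sub_norm_le 1 q
      rw [norm_one] at this; linarith
    rw [norm_div, norm_mul, div_le_iff₀ (by linarith)]
    have : ‖q‖ * ‖Complex.log 2‖ ≤ 0.54 * 0.6932 := by gcongr
    linarith
  have h5 : ‖1 / s‖ ≤ 1.12 := by
    rw [norm_div, norm_one, div_le_iff₀ (by linarith)]; linarith
  rw [Gf, norm_div, norm_neg]
  gcongr
  rw [e]
  have a1 := norm_add_le (1:ℂ) (deriv gn s / gn s + 1 / s - q * Complex.log 2 / (1 - q))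
  have a2 := norm_sub_le (deriv gn s / gn s + 1 / s) (q * Complex.log 2 / (1 - q))
  have a3 := norm_add_le (deriv gn s / gn s) (1 / s)
  rw [norm_one] at a1
  linarith

/-- the numerical verification hypothesis -/
def NumH : Prop := ∀ t : ℝ, 0 ≤ t → t ≤ 3264 → 0.1 ≤ (gn ((7/8 : ℝ) + t * I)).re

lemma norm_ge_sum {σ y : ℝ} (hσ : 9/10 ≤ σ) (hy : 0 ≤ y) : 1 / ‖(σ:ℂ) + y * I‖ ≤ 1.4143 / (0.9 + y) := by
  have h : (0.9 + y) / 1.4143 ≤ ‖(σ:ℂ) + y * I‖ := by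
    rw [norm_def, normSq_apply]
    apply Real.le_sqrt_of_sq_le
    simp
    rw [div_pow, div_le_iff₀ (by norm_num)]
    nlinarith [sq_nonneg (σ - y)]
  have h0 : 0 < (0.9 + y) / 1.4143 := by positivity
  calc 1 / ‖(σ:ℂ) + y * I‖ ≤ 1 / ((0.9 + y) / 1.4143) := one_div_le_one_div_of_le h0 h
    _ = _ := by rw [one_div_div]

lemma log3200 : ln 3200 ≤ 8.071 ∧ 8.0708 ≤ ln 3200 := by
  have h : ln 3200 = 11 * ln 2 + ln (25/16) := by
    rw [← Real.log_rpow (by norm_num), ← Real.log_mul (by positivity) (by norm_num)]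
    norm_num
  have h5 : ln (25/16) = 2 * ln (5/4) := by
    rw [← Real.log_rpow (by norm_num)]; norm_num
  have l1 := log_two_lt_d9
  have l2 := Real.log_two_gt_d9
  have a1 : ln (5/4) ≤ 0.22315 := by
    rw [Real.log_le_iff_le_exp (by norm_num)]
    have := Real.sum_le_exp_of_nonneg (x := 0.22315) (by norm_num) 8
    refine le_trans ?_ this
    norm_num [sum_range_succ, factorial]
  have a2 : 0.2231 ≤ ln (5/4) := by
    rw [Real.le_log_iff_exp_le (by norm_num)]
    have := Real.exp_bound' (x := 0.2231) (by norm_num) (by norm_num) (n := 6) (by norm_num)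
    refine this.trans ?_
    norm_num [sum_range_succ, factorial]
  rw [h, h5]
  constructor <;> linarith

lemma low_int : ∫ y in (0:ℝ)..3200, 1 / (0.9 + y) ≤ 8.19 := by
  have hd : ∀ x ∈ uIcc (0:ℝ) 3200, HasDerivAt (fun y : ℝ => ln (0.9 + y)) (1 / (0.9 + x)) x := by
    intro x hx
    rw [uIcc_of_le (by norm_num)] at hx
    have := ((hasDerivAt_id x).const_add 0.9).log (by simp; linarith [hx.1])
    simpa using this
  rw [integral_eq_sub_of_hasDerivAt hd]
  · have h1 : ln (0.9 + 3200) ≤ 8.072 := by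
      have : (0.9 + 3200 : ℝ) = 3200 * (1 + 9/32000) := by norm_num
      rw [this, Real.log_mul (by norm_num) (by norm_num)]
      have := log_le_sub_one_of_pos (show (0:ℝ) < 1 + 9/32000 by norm_num)
      linarith [log3200.1]
    have h2 : -0.112 ≤ ln (0.9 + 0) := by
      have := Real.one_sub_inv_le_log_of_pos (show (0:ℝ) < 0.9 + 0 by norm_num)
      norm_num at this ⊢
      linarith
    linarith
  · apply ContinuousOn.intervalIntegrable
    intro x hx
    rw [uIcc_of_le (by norm_num)] at hx
    apply ContinuousAt.continuousWithinAt
    have : 0.9 + x ≠ 0 := by linarith [hx.1]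
    fun_prop (disch := assumption)

lemma low_integrable (a b c : ℝ) (ha : 0 ≤ a) (hb : 0 ≤ b) : IntervalIntegrable (fun y : ℝ => c * (1 / (0.9 + y))) volume a b := by
  apply ContinuousOn.intervalIntegrable
  intro x hx
  have hx0 : 0 ≤ x := by
    rcases hx with ⟨h, _⟩
    exact le_trans (le_min ha hb) h
  apply ContinuousAt.continuousWithinAt
  have : 0.9 + x ≠ 0 := by linarith
  fun_prop (disch := assumption)

lemma J_fixed (hn : NumH) {L : ℝ} (hL : 100 ≤ L) : |Jf L 3200| ≤ 310 * rexp (-(L / 10)) + 0.00001 := by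
  have hG : ∀ x y : ℝ, 0.9 ≤ x → x ≤ 1 → 0 ≤ y → y ≤ 3200 → ‖Gf (x + y * I)‖ ≤ 83 * (1.4143 / (0.9 + y)) := by
    intro x y h1 h2 h3 h4
    have := Gf_low (H := 3264) (d := 0.025) (by norm_num) (by norm_num) hn (by norm_num) (by norm_num)
      (s := x + y * I) (by simp; linarith) (by simp; linarith) (by simpa using h2) (by simp; rw [abs_of_nonneg h3]; linarith)
    refine this.trans ?_
    rw [← mul_one_div]
    have h5 := norm_ge_sum (σ := x) (y := y) (by linarith) h3
    calc _ = 83 * (1 / ‖(x:ℂ) + y * I‖) := by norm_num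
      _ ≤ _ := by gcongr
  have hZ : ∀ s : ℂ, 1 - 0.1 ≤ s.re → s.re ≤ 1 → 0 ≤ s.im → s.im ≤ 3200 → Z s ≠ 0 := by
    intro s h1 h2 h3 h4
    exact Z_ne_zero_of_gn (barrier (H := 3264) (by norm_num) (by norm_num) hn (by linarith) (by linarith) (by rw [abs_of_nonneg h3]; linarith))
  have hs := shift_bound (L := L) (T := 3200) (δ := 0.1) (M := 131) (B := fun y => (117.4 * 1.0001) * (1 / (0.9 + y))) (by linarith)
    (by norm_num) (by norm_num) (by norm_num) hZ (low_integrable _ _ _ le_rfl (by norm_num)) ?_ ?_ ?_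
  · refine hs.trans ?_
    rw [intervalIntegral.integral_const_mul]
    have hint := low_int
    rw [div_le_iff₀ pi_pos]
    have hp := Real.pi_gt_d4
    have e1 : rexp (-(L * 0.1)) = rexp (-(L / 10)) := by congr 1; ring
    rw [e1]
    have h2 : 2 * 131 / (3200 * L ^ 2) ≤ 0.00001 := by
      rw [div_le_iff₀ (by positivity)]; nlinarith
    have hE := Real.exp_pos (-(L / 10))
    calc rexp (-(L / 10)) * (117.4 * 1.0001 * ∫ y in (0:ℝ)..3200, 1 / (0.9 + y)) + 2 * 131 / (3200 * L ^ 2)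
        ≤ rexp (-(L / 10)) * (117.4 * 1.0001 * 8.19) + 0.00001 := by gcongr
      _ ≤ (310 * rexp (-(L / 10)) + 0.00001) * 3.14 := by norm_num; nlinarith
      _ ≤ _ := by gcongr; linarith
  · intro y h1 h2
    have := hG (1 - 0.1) y (by norm_num) (by norm_num) h1 h2
    have h3 : 0 ≤ 1 / (0.9 + y) := by positivity
    have h4 : (1 - y / 3200 + 0.1 / 3200) ≤ 1.0001 := by
      have : 0 ≤ y / 3200 := by positivity
      norm_num; linarith
    have h5 : 0 ≤ (1 - y / 3200 + 0.1 / 3200) := by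
      have : y / 3200 ≤ 1 := by rw [div_le_one (by norm_num)]; exact h2
      norm_num; linarith
    calc _ ≤ 1.0001 * (83 * (1.4143 / (0.9 + y))) := by gcongr
      _ = 1.0001 * (83 * 1.4143) * (1 / (0.9 + y)) := by ring
      _ ≤ _ := mul_le_mul_of_nonneg_right (by norm_num) h3
  · intro x h1 h2
    have := hG x 0 (by linarith) h2 le_rfl (by norm_num)
    simp at this
    refine this.trans ?_
    norm_num
  · intro x h1 h2
    have := hG x 3200 (by linarith) h2 (by norm_num) le_rfl
    refine le_trans (by exact_mod_cast this) ?_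
    norm_num

lemma Gf_high {v T σ : ℝ} (hv : 3200 ≤ v) (hvT : v ≤ T) (hσ : 1 - 0.28 / SS (T + 1) ≤ σ) (hσ1 : σ ≤ 1) :
    Z (σ + v * I) ≠ 0 ∧ ‖Gf (σ + v * I)‖ ≤ (1260 * SS (T + 1) * ln T + 1) / 3200 := by
  have hS := SS_ge (t := T + 1) (by linarith)
  have hSv := SS_ge (t := v) (by linarith)
  have hm := SS_mono (a := v) (b := T + 1) (by linarith) (by linarith)
  have hz : riemannZeta (σ + v * I) ≠ 0 := by
    apply zero_free (by linarith)
    refine lt_of_lt_of_le ?_ hσ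
    have : 0.28 / SS (T + 1) < 0.35 / SS v := by
      rw [div_lt_div_iff₀ (by linarith) (by linarith)]; nlinarith
    linarith
  have hs1 : (σ + v * I : ℂ) ≠ 1 := by
    intro h
    have := congrArg Complex.im h
    simp at this; linarith
  have hs0 : (σ + v * I : ℂ) ≠ 0 := by
    intro h
    have := congrArg Complex.im h
    simp at this; linarith
  have n1 : 3200 ≤ ‖(σ + v * I : ℂ)‖ := by
    refine le_trans ?_ (abs_im_le_norm _)
    simp; rw [abs_of_nonneg (by linarith)]; exact hv
  have n2 : 3200 ≤ ‖(σ + v * I : ℂ) - 1‖ := by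
    refine le_trans ?_ (abs_im_le_norm _)
    simp; rw [abs_of_nonneg (by linarith)]; exact hv
  refine ⟨?_, ?_⟩
  · rw [Z_ne hs1]
    exact mul_ne_zero (sub_ne_zero.2 hs1) hz
  · rw [Gf_eq hs1 hs0 hz]
    have h := logDeriv_high (v := v) (T := T) (σ := σ) (by linarith) hvT hσ hσ1
    refine (norm_sub_le _ _).trans ?_
    rw [neg_div, norm_div, norm_neg, norm_div 1, norm_one, add_div]
    have h0 : 0 ≤ 1260 * SS (T + 1) * ln T := (norm_nonneg _).trans h
    gcongr

lemma J_raw (hn : NumH) {L T δ C : ℝ} (hL : 0 < L) (hT : 3200 ≤ T) (hδ : δ = 0.28 / SS (T + 1))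
    (hC : C = (1260 * SS (T + 1) * ln T + 1) / 3200) :
    |Jf L T| ≤ (rexp (-(L * δ)) * (237.7 + C * ((T - 3200) ^ 2 / (2 * T) + δ)) + 2 * (33 + C) / (T * L ^ 2)) / π := by
  have hS := SS_ge (t := T + 1) (by linarith)
  have hlT := log_big (τ := T) (by linarith)
  have hC0 : 0 ≤ C := by rw [hC]; positivity
  have hδ0 : 0 < δ := by rw [hδ]; positivity
  have hδ1 : δ ≤ 0.009 := by
    rw [hδ, div_le_iff₀ (by linarith)]; linarith
  have hT0 : 0 < T := by linarith
  have hG : ∀ x y : ℝ, 1 - δ ≤ x → x ≤ 1 → 0 ≤ y → y ≤ 3200 → ‖Gf (x + y * I)‖ ≤ 20.4 * (1.4143 / (0.9 + y)) := by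
    intro x y h1 h2 h3 h4
    have := Gf_low (H := 3264) (d := 0.115) (by norm_num) (by norm_num) hn (by norm_num) (by norm_num)
      (s := x + y * I) (by simp; linarith) (by simp; linarith) (by simpa using h2) (by simp; rw [abs_of_nonneg h3]; linarith)
    refine this.trans ?_
    rw [← mul_one_div]
    have h5 := norm_ge_sum (σ := x) (y := y) (by linarith) h3
    gcongr
    norm_num
  have hH : ∀ x y : ℝ, 1 - δ ≤ x → x ≤ 1 → 3200 ≤ y → y ≤ T → Z (x + y * I) ≠ 0 ∧ ‖Gf (x + y * I)‖ ≤ C := by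
    intro x y h1 h2 h3 h4
    rw [hC]
    rw [hδ] at h1
    exact Gf_high h3 h4 h1 h2
  have hZ : ∀ s : ℂ, 1 - δ ≤ s.re → s.re ≤ 1 → 0 ≤ s.im → s.im ≤ T → Z s ≠ 0 := by
    intro s h1 h2 h3 h4
    rcases le_total s.im 3200 with h5 | h5
    · exact Z_ne_zero_of_gn (barrier (H := 3264) (by norm_num) (by norm_num) hn (by linarith) (by linarith) (by rw [abs_of_nonneg h3]; linarith))
    · have := (hH s.re s.im h1 h2 h5 h4).1
      rwa [Complex.re_add_im] at this
  set f : ℝ → ℝ := fun y => 29.01 * (1 / (0.9 + y)) with hf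
  set g : ℝ → ℝ := fun y => C * ((1 - y / T) + δ / T) with hg
  set B : ℝ → ℝ := fun y => if y ≤ 3200 then f y else g y with hB
  have hBf : EqOn f B (uIoc 0 3200) := by
    intro y hy
    rw [uIoc_of_le (by norm_num)] at hy
    simp only [hB, if_pos hy.2]
  have hBg : EqOn g B (uIoc 3200 T) := by
    intro y hy
    rw [uIoc_of_le hT] at hy
    simp only [hB, if_neg (not_le.2 hy.1)]
  have hgc : Continuous g := by simp only [hg]; fun_prop
  have i1 : IntervalIntegrable B volume 0 3200 := (low_integrable 0 3200 29.01 le_rfl (by norm_num)).congr hBf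
  have i2 : IntervalIntegrable B volume 3200 T := (hgc.intervalIntegrable _ _).congr hBg
  have hint : ∫ y in (0:ℝ)..T, B y ≤ 237.7 + C * ((T - 3200) ^ 2 / (2 * T) + δ) := by
    rw [← intervalIntegral.integral_add_adjacent_intervals i1 i2]
    have e1 : ∫ y in (0:ℝ)..3200, B y = ∫ y in (0:ℝ)..3200, f y :=
      intervalIntegral.integral_congr_ae (ae_of_all _ fun y hy => (hBf hy).symm)
    have e2 : ∫ y in (3200:ℝ)..T, B y = ∫ y in (3200:ℝ)..T, g y :=
      intervalIntegral.integral_congr_ae (ae_of_all _ fun y hy => (hBg hy).symm)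
    rw [e1, e2]
    have e3 : ∫ y in (0:ℝ)..3200, f y ≤ 237.7 := by
      simp only [hf]
      rw [intervalIntegral.integral_const_mul]
      have := low_int
      nlinarith
    have e4 : ∫ y in (3200:ℝ)..T, g y = C * ((T - 3200) ^ 2 / (2 * T) + δ * ((T - 3200) / T)) := by
      have hd : ∀ x ∈ uIcc (3200:ℝ) T, HasDerivAt (fun y : ℝ => C * (y - y ^ 2 / (2 * T) + δ / T * y)) (g x) x := by
        intro x hx
        have h1 := ((((hasDerivAt_id x).sub (((hasDerivAt_id x).pow 2).div_const (2 * T))).add ((hasDerivAt_id x).const_mul (δ / T))).const_mul C)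
        refine h1.congr_deriv ?_
        simp only [hg, id]
        field_simp
        ring
      rw [integral_eq_sub_of_hasDerivAt hd (hgc.intervalIntegrable _ _)]
      field_simp
      ring
    rw [e4]
    have e5 : (T - 3200) / T ≤ 1 := by rw [div_le_one hT0]; linarith
    have : δ * ((T - 3200) / T) ≤ δ * 1 := by gcongr
    have : C * ((T - 3200) ^ 2 / (2 * T) + δ * ((T - 3200) / T)) ≤ C * ((T - 3200) ^ 2 / (2 * T) + δ) := by
      gcongr; linarith
    linarith
  have hs := shift_bound (L := L) (T := T) (δ := δ) (M := 33 + C) (B := B) hL hT0 hδ0 (by linarith) hZ (i1.trans i2) ?_ ?_ ?_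
  · refine hs.trans ?_
    gcongr
  · intro y h1 h2
    have h6 : y / T ≤ 1 := by rw [div_le_one hT0]; exact h2
    have h7 : 0 ≤ δ / T := by positivity
    have h5 : 0 ≤ (1 - y / T + δ / T) := by linarith
    by_cases h3 : y ≤ 3200
    · have := hG (1 - δ) y le_rfl (by linarith) h1 h3
      simp only [hB, if_pos h3, hf]
      have h3 : 0 ≤ 1 / (0.9 + y) := by positivity
      have h4 : (1 - y / T + δ / T) ≤ 1.0001 := by
        have : 0 ≤ y / T := by positivity
        have : δ / T ≤ 0.0001 := by rw [div_le_iff₀ hT0]; linarith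
        norm_num at this ⊢; linarith
      calc _ ≤ 1.0001 * (20.4 * (1.4143 / (0.9 + y))) := by gcongr
        _ = 1.0001 * (20.4 * 1.4143) * (1 / (0.9 + y)) := by ring
        _ ≤ _ := mul_le_mul_of_nonneg_right (by norm_num) h3
    · simp only [hB, if_neg h3, hg]
      have := (hH (1 - δ) y le_rfl (by linarith) (by linarith) h2).2
      rw [mul_comm]
      gcongr
  · intro x h1 h2
    have := hG x 0 h1 h2 le_rfl (by norm_num)
    simp at this
    refine this.trans ?_
    norm_num; linarith
  · intro x h1 h2
    have := (hH x T h1 h2 hT le_rfl).2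
    linarith

set_option maxHeartbeats 1000000 in
lemma J_var (hn : NumH) {L y T : ℝ} (hy : 0 ≤ y) (hTy : T = 3200 * rexp y) (hL : |L - T / 1.6| ≤ 0.001) :
    L * |Jf L T| ≤ 0.07 := by
  set w := rexp y with hw
  have hw0 : 0 < w := Real.exp_pos _
  have hw1 : 1 ≤ w := Real.one_le_exp hy
  have hT : 3200 ≤ T := by rw [hTy]; linarith
  have hT0 : 0 < T := by linarith
  rw [abs_le] at hL
  have h16 : T / 1.6 = 2000 * w := by rw [hTy]; ring
  rw [h16] at hL
  have hL1 : 2000 * w - 0.001 ≤ L := by linarith [hL.1]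
  have hL2 : L ≤ 2001 * w := by
    have := hL.2
    norm_num at this
    linarith
  have hL0 : 0 < L := by linarith
  set P := rexp (0.264 * y) with hP
  have hP1 : 1 ≤ P := Real.one_le_exp (by positivity)
  have hPw : P ≤ w := by apply Real.exp_le_exp.2; linarith
  have hS := SS_ge (t := T + 1) (by linarith)
  have hlogT : ln T = ln 3200 + y := by
    rw [hTy, Real.log_mul (by norm_num) hw0.ne', hw, Real.log_exp]
  have hlogT1 : ln (T + 1) ≤ ln T + 1 / 3200 := by
    have : T + 1 = T * (1 + 1 / T) := by field_simp
    rw [this, Real.log_mul hT0.ne' (by positivity)]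
    have := log_le_sub_one_of_pos (show (0:ℝ) < 1 + 1 / T by positivity)
    have h2 : 1 / T ≤ 1 / 3200 := one_div_le_one_div_of_le (by norm_num) hT
    linarith
  have hl := log3200
  have hS1 : SS (T + 1) ≤ 34.85 * (1 + 0.14 * y) := by
    unfold SS; linarith
  have hl1 : ln T ≤ 8.071 * (1 + 0.124 * y) := by linarith
  have hlT0 : 0 ≤ ln T := by linarith
  have hPP : (1 + 0.14 * y) * (1 + 0.124 * y) ≤ P := by
    have a1 : 1 + 0.14 * y ≤ rexp (0.14 * y) := by linarith [add_one_le_exp (0.14 * y)]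
    have a2 : 1 + 0.124 * y ≤ rexp (0.124 * y) := by linarith [add_one_le_exp (0.124 * y)]
    calc _ ≤ rexp (0.14 * y) * rexp (0.124 * y) := by gcongr
      _ = P := by rw [← Real.exp_add, hP]; congr 1; ring
  set C := (1260 * SS (T + 1) * ln T + 1) / 3200 with hC
  have hCP : C ≤ 110.8 * P := by
    rw [hC, div_le_iff₀ (by norm_num)]
    have : SS (T + 1) * ln T ≤ (34.85 * (1 + 0.14 * y)) * (8.071 * (1 + 0.124 * y)) := by gcongr
    linarith only [this, hPP, hP1]
  have hC0 : 0 ≤ C := by rw [hC]; positivity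
  set δ := 0.28 / SS (T + 1) with hδ
  have hδ0 : 0 < δ := by rw [hδ]; positivity
  have hδ1 : δ ≤ 0.009 := by
    rw [hδ, div_le_iff₀ (by linarith)]; linarith
  have hLδ : 16.06 + 13.8 * y ≤ L * δ := by
    have hwy : (1 + 0.14 * y) * (1 + 0.86 * y) ≤ w := by
      have := Real.quadratic_le_exp_of_nonneg hy
      linarith only [this, sq_nonneg y]
    rw [hδ, mul_div_assoc', le_div_iff₀ (by linarith)]
    have : (16.06 + 13.8 * y) * SS (T + 1) ≤ (16.06 + 13.8 * y) * (34.85 * (1 + 0.14 * y)) := by gcongr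
    linarith only [this, hwy, hL1, hy, sq_nonneg y]
  have hE : rexp (-(L * δ)) ≤ 0.000000107 * rexp (-(13.8 * y)) := by
    have e1 : rexp (-16.06) ≤ 0.000000107 := by
      have h1 : rexp (-16.06) = (rexp (-1)) ^ 16 * rexp (-0.06) := by
        rw [← Real.exp_nat_mul, ← Real.exp_add]; norm_num
      have h2 : rexp (-1) ≤ 0.36788 := Real.exp_neg_one_lt_d9.le.trans (by norm_num)
      have h3 : rexp (-0.06) ≤ 0.9435 := by
        rw [Real.exp_neg, inv_le_comm₀ (Real.exp_pos _) (by norm_num)]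
        have := add_one_le_exp (0.06:ℝ)
        refine le_trans ?_ this
        norm_num
      rw [h1]
      calc _ ≤ (0.36788:ℝ) ^ 16 * 0.9435 := by gcongr
        _ ≤ _ := by norm_num
    calc _ ≤ rexp (-16.06 + -(13.8 * y)) := by apply Real.exp_le_exp.2; linarith
      _ = rexp (-16.06) * rexp (-(13.8 * y)) := Real.exp_add _ _
      _ ≤ _ := by gcongr
  have hJ := J_raw hn (L := L) (T := T) (δ := δ) (C := C) hL0 hT hδ hC
  set E := rexp (-(13.8 * y)) with hEd
  have hE0 : 0 < E := Real.exp_pos _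
  have hwE : w * E ≤ 1 := by
    rw [hw, hEd, ← Real.exp_add]; apply Real.exp_le_one_iff.2; linarith
  have hwPE : w * E * P ≤ 1 := by
    rw [hw, hEd, hP, ← Real.exp_add, ← Real.exp_add]; apply Real.exp_le_one_iff.2; linarith
  -- main term
  have hmain : E * P * (w - 1) ^ 2 ≤ 0.0041 := by
    have h1 : w - 1 ≤ y * w := by
      have := add_one_le_exp (-y)
      have h2 : w * rexp (-y) = 1 := by rw [hw, ← Real.exp_add]; simp
      linarith only [mul_le_mul_of_nonneg_left this hw0.le, h2]
    have h2 : E * P * w ^ 2 = rexp (-(5.768 * y)) ^ 2 := by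
      rw [hw, hEd, hP, ← Real.exp_nat_mul, ← Real.exp_nat_mul, ← Real.exp_add, ← Real.exp_add]; congr 1; push_cast; ring
    have h3 : y * rexp (-(5.768 * y)) ≤ 0.0639 := by
      have a1 := add_one_le_exp (5.768 * y - 1)
      have a2 : rexp (5.768 * y - 1) * rexp (-(5.768 * y)) = rexp (-1) := by
        rw [← Real.exp_add]; congr 1; ring
      have a3 : rexp (-1) ≤ 0.36788 := Real.exp_neg_one_lt_d9.le.trans (by norm_num)
      have a4 : 5.768 * y * rexp (-(5.768 * y)) ≤ rexp (5.768 * y - 1) * rexp (-(5.768 * y)) := by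
        gcongr; linarith
      linarith only [a4, a2, a3]
    have h4 : (w - 1) ^ 2 ≤ (y * w) ^ 2 := by
      apply pow_le_pow_left₀ (by linarith) h1
    calc E * P * (w - 1) ^ 2 ≤ E * P * (y * w) ^ 2 := by gcongr
      _ = (y * rexp (-(5.768 * y))) ^ 2 := by rw [mul_pow, mul_pow, ← h2]; ring
      _ ≤ 0.0639 ^ 2 := by gcongr
      _ ≤ _ := by norm_num
  have hpi : 3.14 ≤ π := by have := Real.pi_gt_d2; linarith
  have hpi0 := pi_pos
  have hq : (T - 3200) ^ 2 / (2 * T) = 1600 * (w - 1) ^ 2 / w := by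
    rw [hTy]; field_simp; ring
  have hA : L * (rexp (-(L * δ)) * (237.7 + C * ((T - 3200) ^ 2 / (2 * T) + δ))) ≤ 0.2075 := by
    rw [hq]
    calc L * (rexp (-(L * δ)) * (237.7 + C * (1600 * (w - 1) ^ 2 / w + δ)))
        ≤ (2001 * w) * ((0.000000107 * E) * (237.7 + (110.8 * P) * (1600 * (w - 1) ^ 2 / w + 0.009))) := by
          have : 0 ≤ 1600 * (w - 1) ^ 2 / w := by positivity
          gcongr
      _ = (2001 * 0.000000107 * 237.7) * (w * E) + (2001 * 0.000000107 * 110.8 * 1600) * (E * P * (w - 1) ^ 2) + (2001 * 0.000000107 * 110.8 * 0.009) * (w * E * P) := by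
          field_simp
          ring
      _ ≤ (2001 * 0.000000107 * 237.7) * 1 + (2001 * 0.000000107 * 110.8 * 1600) * 0.0041 + (2001 * 0.000000107 * 110.8 * 0.009) * 1 := by
          gcongr
      _ ≤ _ := by norm_num
  have hBd : L * (2 * (33 + C) / (T * L ^ 2)) ≤ 0.0001 := by
    have : L * (2 * (33 + C) / (T * L ^ 2)) = 2 * (33 + C) / (T * L) := by field_simp
    rw [this, div_le_iff₀ (by positivity)]
    have h1 : C ≤ 110.8 * w := by linarith only [hCP, hPw]
    have h2 : 3200 * w * 1999 ≤ T * L := by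
      have : (1999:ℝ) ≤ L := by linarith
      rw [hTy]; gcongr
    linarith only [h1, h2, hw1]
  calc L * |Jf L T| ≤ L * ((rexp (-(L * δ)) * (237.7 + C * ((T - 3200) ^ 2 / (2 * T) + δ)) + 2 * (33 + C) / (T * L ^ 2)) / π) := by gcongr
    _ = (L * (rexp (-(L * δ)) * (237.7 + C * ((T - 3200) ^ 2 / (2 * T) + δ))) + L * (2 * (33 + C) / (T * L ^ 2))) / π := by ring
    _ ≤ 0.07 := by
      rw [div_le_iff₀ hpi0]
      linarith

lemma taub_both {T L E ε ε2 b b2 Q : ℝ} (hT : 3200 ≤ T) (hL : 100 ≤ L)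
    (hb : 0.001 ≤ b) (hb2 : 0 < b2) (hε : 0 ≤ ε) (hε2 : 0 ≤ ε2)
    (h1 : ∀ u, L - 0.001 - b ≤ u → |W u - 1| ≤ ε)
    (h2 : ∀ u, L - 0.001 - b2 ≤ u → |W u - 1| ≤ ε2)
    (hE : ∀ L', |L' - L| ≤ 0.001 → |Jf L' T| ≤ E)
    (hQ : E + ε * 0.227 + 2 * ε2 / (π * T * b) + 10 / (π * T * b2) ≤ Q) :
    |W L - 1| ≤ 1.0011 * (Q / 0.773 + π / T) := by
  have hpi := pi_pos
  set a := π / T with ha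
  have ha0 : 0 < a := by rw [ha]; positivity
  have ha1 : a ≤ 0.001 := by
    rw [ha, div_le_iff₀ (by linarith)]
    have := Real.pi_lt_d2
    linarith
  have hE0 : 0 ≤ E := (abs_nonneg _).trans (hE L (by simp; norm_num))
  have hQ0 : 0 ≤ Q := by
    refine le_trans ?_ hQ
    have : 0 < b := by linarith
    positivity
  have u1 := taub_upper (T := T) (L := L) (E := E) (ε := ε) (ε2 := ε2) (b := b) (b2 := b2) (by linarith) (by linarith) (ha1.trans hb)
    hb2 hε hε2 (fun u hu => h1 u (by linarith)) (fun u hu => h2 u (by linarith)) (hE _ (by rw [add_sub_cancel_left, abs_of_pos ha0]; exact ha1))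
  have u2 := taub_lower (T := T) (L := L) (E := E) (ε := ε) (ε2 := ε2) (b := b) (b2 := b2) (by linarith) (by linarith) (ha1.trans hb)
    hb2 hε hε2 (fun u hu => h1 u (by linarith)) (fun u hu => h2 u (by linarith)) (hE _ (by rw [sub_sub_cancel_left, abs_neg, abs_of_pos ha0]; exact ha1))
  rw [← ha] at u1 u2
  have hQ' : (E + ε * 0.227 + 2 * ε2 / (π * T * b) + 10 / (π * T * b2)) / 0.773 ≤ Q / 0.773 := by gcongr
  set q := Q / 0.773 with hq
  have hq0 : 0 ≤ q := by rw [hq]; positivity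
  have hW := W_nonneg L
  have v1 : W L * (1 - a) ≤ 1 + q := by linarith
  have v2 : 1 - q ≤ W L * (rexp a * (1 + a ^ 2)) := by rw [← mul_assoc]; linarith
  rw [abs_le]
  constructor
  · have e1 : rexp a * (1 + a ^ 2) * (1 - a) ≤ 1 + a ^ 2 := by
      have h := add_one_le_exp (-a)
      have h3 : rexp a * rexp (-a) = 1 := by rw [← Real.exp_add]; simp
      have h4 : rexp a * (1 - a) ≤ 1 := by
        rw [← h3]; gcongr; linarith
      calc _ = (rexp a * (1 - a)) * (1 + a ^ 2) := by ring
        _ ≤ 1 * (1 + a ^ 2) := by gcongr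
        _ = _ := one_mul _
    have e2 : (1 - q) * (1 - a) ≤ W L * (1 + a ^ 2) := by
      calc (1 - q) * (1 - a) ≤ W L * (rexp a * (1 + a ^ 2)) * (1 - a) := by
            apply mul_le_mul_of_nonneg_right v2; linarith
        _ = W L * (rexp a * (1 + a ^ 2) * (1 - a)) := by ring
        _ ≤ _ := by gcongr
    by_contra hcon
    push Not at hcon
    have h5 : W L < 1 - 1.0011 * (q + a) := by linarith
    have h6 : W L * (1 + a ^ 2) ≤ W L + a ^ 2 := by nlinarith [sq_nonneg a]
    nlinarith
  · nlinarith

lemma exp_neg_ten (k : ℕ) : rexp (-(k:ℝ)) ≤ 0.36788 ^ k := by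
  have a3 : rexp (-1) ≤ 0.36788 := Real.exp_neg_one_lt_d9.le.trans (by norm_num)
  calc rexp (-(k:ℝ)) = rexp (-1) ^ k := by rw [← Real.exp_nat_mul]; ring_nf
    _ ≤ _ := by gcongr

lemma step1 (hn : NumH) (hel : ∀ u, 20 ≤ u → |W u - 1| ≤ 0.029) {U V ε : ℝ} (hU : 100 ≤ U) (hV : U + 1.01 ≤ V) (hε : 0 ≤ ε)
    (h : ∀ u, U ≤ u → |W u - 1| ≤ ε) :
    ∀ u, V ≤ u → |W u - 1| ≤ 0.294 * ε + 402 * rexp (-(V / 10)) + 0.00102 := by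
  intro L hL
  have hpi := Real.pi_gt_d4
  have hpi2 := Real.pi_lt_d4
  have hpi0 := pi_pos
  set e := rexp (-(V / 10)) with he
  have he0 : 0 < e := Real.exp_pos _
  have := taub_both (T := 3200) (L := L) (E := 310.04 * e + 0.00001) (ε := ε) (ε2 := 0.029) (b := 1) (b2 := 80)
    (Q := 310.04 * e + 0.227 * ε + 0.0000283)
    le_rfl (by linarith) (by norm_num) (by norm_num) hε (by norm_num) (fun u hu => h u (by linarith))
    (fun u hu => hel u (by linarith)) ?_ ?_
  · refine this.trans ?_
    have : π / 3200 ≤ 0.00098175 := by rw [div_le_iff₀ (by norm_num)]; linarith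
    have e1 : 1.0011 * ((310.04 * e + 0.227 * ε + 0.0000283) / 0.773 + π / 3200) ≤
      1.0011 * ((310.04 * e + 0.227 * ε + 0.0000283) / 0.773 + 0.00098175) := by gcongr
    refine e1.trans ?_
    have : (310.04 * e + 0.227 * ε + 0.0000283) / 0.773 ≤ 401.09 * e + 0.29367 * ε + 0.00003662 := by
      rw [div_le_iff₀ (by norm_num)]; linarith
    linarith
  · intro L' hL'
    rw [abs_le] at hL'
    have h1 := J_fixed hn (L := L') (by linarith)
    refine h1.trans ?_
    have h2 : rexp (-(L' / 10)) ≤ 1.00011 * e := by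
      have a1 : rexp (-(L' / 10)) ≤ rexp (0.0001 + -(V / 10)) := by
        apply Real.exp_le_exp.2; linarith
      refine a1.trans ?_
      rw [Real.exp_add]
      gcongr
      have := Real.exp_bound' (x := 0.0001) (by norm_num) (by norm_num) (n := 2) (by norm_num)
      refine this.trans ?_
      norm_num [sum_range_succ, factorial]
    linarith
  · have h1 : 2 * 0.029 / (π * 3200 * 1) ≤ 0.0000058 := by
      rw [div_le_iff₀ (by positivity)]; linarith
    have h2 : 10 / (π * 3200 * 80) ≤ 0.00001245 := by
      rw [div_le_iff₀ (by positivity)]; linarith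
    linarith

lemma regimeI (hn : NumH) (hel : ∀ u, 20 ≤ u → |W u - 1| ≤ 0.029) :
    (∀ u, 205 ≤ u → |W u - 1| ≤ 0.00148) ∧ ∀ u, 100 ≤ u → u ≤ 2004 → |W u - 1| ≤ 3 / u - 6 / u ^ 2 := by
  have s0 : ∀ u, 100 ≤ u → |W u - 1| ≤ 0.029 := fun u hu => hel u (by linarith)
  have e10 : rexp (-10) ≤ 0.0000455 := by
    have := exp_neg_ten 10
    norm_num at this ⊢; linarith
  have e05 : rexp (-0.5) ≤ 0.6154 := by
    rw [Real.exp_neg, inv_le_comm₀ (Real.exp_pos _) (by norm_num)]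
    refine le_trans ?_ (Real.quadratic_le_exp_of_nonneg (x := 0.5) (by norm_num))
    norm_num
  have x1 : rexp (-(101.01 / 10)) ≤ 0.0000455 := le_trans (Real.exp_le_exp.2 (by norm_num)) e10
  have x2 : rexp (-(105 / 10)) ≤ 0.0000281 := by
    have : rexp (-(105 / 10)) = rexp (-10) * rexp (-0.5) := by rw [← Real.exp_add]; norm_num
    rw [this]
    calc _ ≤ (0.0000455:ℝ) * 0.6154 := by gcongr
      _ ≤ _ := by norm_num
  have x3 : rexp (-(140 / 10)) ≤ 0.000000833 := by
    have := exp_neg_ten 14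
    norm_num at this ⊢; linarith
  have x4 : rexp (-(200 / 10)) ≤ 0.0000000021 := by
    have := exp_neg_ten 20
    norm_num at this ⊢; linarith
  have s1 := step1 hn hel (V := 101.01) le_rfl (by norm_num) (by norm_num) s0
  have s2 := step1 hn hel (V := 105) le_rfl (by norm_num) (by norm_num) s0
  have s3 : ∀ u, 140 ≤ u → |W u - 1| ≤ 0.0099 := fun u hu =>
    (step1 hn hel (V := 140) le_rfl (by norm_num) (by norm_num) s0 u hu).trans (by linarith)
  have s4 : ∀ u, 200 ≤ u → |W u - 1| ≤ 0.00394 := fun u hu =>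
    (step1 hn hel (V := 200) (by norm_num) (by norm_num) (by norm_num) s3 u hu).trans (by linarith)
  have nxt : ∀ V : ℝ, 200 ≤ V → rexp (-(V / 10)) ≤ 0.0000000021 := fun V hV =>
    le_trans (Real.exp_le_exp.2 (by linarith)) x4
  have s5 : ∀ u, 201.1 ≤ u → |W u - 1| ≤ 0.00218 := fun u hu =>
    (step1 hn hel (V := 201.1) (by norm_num) (by norm_num) (by norm_num) s4 u hu).trans (by linarith [nxt 201.1 (by norm_num)])
  have s6 : ∀ u, 202.2 ≤ u → |W u - 1| ≤ 0.001663 := fun u hu =>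
    (step1 hn hel (V := 202.2) (by norm_num) (by norm_num) (by norm_num) s5 u hu).trans (by linarith [nxt 202.2 (by norm_num)])
  have s7 : ∀ u, 203.3 ≤ u → |W u - 1| ≤ 0.00151 := fun u hu =>
    (step1 hn hel (V := 203.3) (by norm_num) (by norm_num) (by norm_num) s6 u hu).trans (by linarith [nxt 203.3 (by norm_num)])
  have s8 : ∀ u, 205 ≤ u → |W u - 1| ≤ 0.00148 := fun u hu =>
    (step1 hn hel (V := 205) (by norm_num) (by norm_num) (by norm_num) s7 u hu).trans (by linarith [nxt 205 (by norm_num)])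
  refine ⟨s8, ?_⟩
  intro u h1 h2
  have key : ∀ c A B : ℝ, 0 ≤ c → A ≤ u → u ≤ B → c * A ^ 2 ≤ 3 * A - 6 → c * B ^ 2 ≤ 3 * B - 6 → c ≤ 3 / u - 6 / u ^ 2 := by
    intro c A B hc hA hB k1 k2
    have hu : 0 < u := by linarith
    have : c * u ^ 2 ≤ 3 * u - 6 := by
      rcases eq_or_lt_of_le (hA.trans hB) with h | h
      · have : u = A := by linarith
        rw [this]; exact k1
      · have h3 : c * ((u - A) * (B - u)) ≥ 0 := mul_nonneg hc (mul_nonneg (by linarith) (by linarith))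
        have h4 : (c * A ^ 2) * (B - u) ≤ (3 * A - 6) * (B - u) := mul_le_mul_of_nonneg_right k1 (by linarith)
        have h5 : (c * B ^ 2) * (u - A) ≤ (3 * B - 6) * (u - A) := mul_le_mul_of_nonneg_right k2 (by linarith)
        have h6 : (c * u ^ 2) * (B - A) ≤ (3 * u - 6) * (B - A) := by
          have : (c * u ^ 2) * (B - A) = (c * A ^ 2) * (B - u) + (c * B ^ 2) * (u - A) - c * ((u - A) * (B - u)) * (B - A) := by ring
          have h7 : 0 ≤ c * ((u - A) * (B - u)) * (B - A) := mul_nonneg h3 (by linarith)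
          linarith
        exact le_of_mul_le_mul_right h6 (by linarith)
    have e : 3 / u - 6 / u ^ 2 = (3 * u - 6) / u ^ 2 := by field_simp
    rw [e, le_div_iff₀ (by positivity)]
    exact this
  rcases le_total u 101.01 with h | h
  · exact (s0 u h1).trans (key _ 100 101.01 (by norm_num) h1 h (by norm_num) (by norm_num))
  rcases le_total u 105 with h' | h'
  · exact (s1 u h).trans ((by linarith : _ ≤ (0.0279:ℝ)).trans (key _ 101.01 105 (by norm_num) h h' (by norm_num) (by norm_num)))
  rcases le_total u 140 with h | h
  · exact (s2 u h').trans ((by linarith : _ ≤ (0.0209:ℝ)).trans (key _ 105 140 (by norm_num) h' h (by norm_num) (by norm_num)))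
  rcases le_total u 250 with h' | h'
  · exact (s3 u h).trans (key _ 140 250 (by norm_num) h h' (by norm_num) (by norm_num))
  rcases le_total u 750 with h | h
  · exact (s4 u (by linarith)).trans (key _ 250 750 (by norm_num) h' h (by norm_num) (by norm_num))
  rcases le_total u 1360 with h' | h'
  · exact (s5 u (by linarith)).trans (key _ 750 1360 (by norm_num) h h' (by norm_num) (by norm_num))
  rcases le_total u 1800 with h | h
  · exact (s6 u (by linarith)).trans (key _ 1360 1800 (by norm_num) h' h (by norm_num) (by norm_num))
  rcases le_total u 1980 with h' | h'
  · exact (s7 u (by linarith)).trans (key _ 1800 1980 (by norm_num) h h' (by norm_num) (by norm_num))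
  · exact (s8 u (by linarith)).trans (key _ 1980 2004 (by norm_num) h' h2 (by norm_num) (by norm_num))

lemma step2 (hn : NumH) (hel : ∀ u, 205 ≤ u → |W u - 1| ≤ 0.00148) {r : ℝ} (hr : 0 ≤ r)
    (h : ∀ u, 1990 ≤ u → |W u - 1| ≤ 2.97 / u + r) :
    ∀ u, 1990 ≤ u → |W u - 1| ≤ 2.97 / u + 0.3 * r := by
  intro L hL
  have hpi := Real.pi_gt_d4
  have hpi2 := Real.pi_lt_d4
  have hpi0 := pi_pos
  have hL0 : 0 < L := by linarith
  rcases le_total L 2000 with h2000 | h2000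
  · refine (hel L (by linarith)).trans ?_
    have : 0.00148 ≤ 2.97 / L := by rw [le_div_iff₀ hL0]; linarith
    linarith
  have := taub_both (T := 1.6 * L) (L := L) (E := 0.0701 / L) (ε := 2.9716 / L + r) (ε2 := 0.00148) (b := 1) (b2 := 1500)
    (Q := 0.7468 / L + 0.227 * r)
    (by linarith) (by linarith) (by norm_num) (by norm_num) (by positivity) (by norm_num) ?_
    (fun u hu => hel u (by linarith)) ?_ ?_
  · refine this.trans ?_
    have e0 : π / (1.6 * L) ≤ 1.9636 / L := by
      rw [div_le_div_iff₀ (by positivity) hL0]; nlinarith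
    have e1 : 1.0011 * ((0.7468 / L + 0.227 * r) / 0.773 + π / (1.6 * L)) ≤
      1.0011 * ((0.7468 / L + 0.227 * r) / 0.773 + 1.9636 / L) := by gcongr
    refine e1.trans ?_
    have e2 : 2.97 / L = 2.97 * (1 / L) := by ring
    have e3 : 1.0011 * ((0.7468 / L + 0.227 * r) / 0.773 + 1.9636 / L) = 1.0011 * ((0.7468 / 0.773) + 1.9636) * (1 / L) + 1.0011 * 0.227 / 0.773 * r := by ring
    rw [e2, e3]
    have : 0 < 1 / L := by positivity
    gcongr <;> norm_num
  · intro u hu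
    refine (h u (by linarith)).trans ?_
    have : 2.97 / u ≤ 2.9716 / L := by
      rw [div_le_div_iff₀ (by linarith) hL0]; linarith
    linarith
  · intro L' hL'
    have h1 : 0 < L' := by rw [abs_le] at hL'; linarith
    have hy : 0 ≤ ln (L / 2000) := Real.log_nonneg (by rw [le_div_iff₀ (by norm_num)]; linarith)
    have h2 := J_var hn (L := L') (y := ln (L / 2000)) (T := 1.6 * L) hy
      (by rw [Real.exp_log (by positivity)]; ring) (by rw [mul_div_cancel_left₀ _ (by norm_num)]; exact hL')
    have h3 : |Jf L' (1.6 * L)| ≤ 0.07 / L' := by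
      rw [le_div_iff₀ h1]; linarith
    refine h3.trans ?_
    rw [div_le_div_iff₀ h1 hL0]
    rw [abs_le] at hL'
    linarith
  · have h1 : 2 * 0.00148 / (π * (1.6 * L) * 1) ≤ 0.0006 / L := by
      rw [div_le_div_iff₀ (by positivity) hL0]; nlinarith
    have h2 : 10 / (π * (1.6 * L) * 1500) ≤ 0.00135 / L := by
      rw [div_le_div_iff₀ (by positivity) hL0]; nlinarith
    have e : 0.0701 / L + (2.9716 / L + r) * 0.227 + 0.0006 / L + 0.00135 / L = (0.0701 + 2.9716 * 0.227 + 0.0006 + 0.00135) / L + 0.227 * r := by ring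
    have e4 : (0.0701 + 2.9716 * 0.227 + 0.0006 + 0.00135) / L ≤ 0.7468 / L := by gcongr; norm_num
    linarith

lemma regimeII (hn : NumH) (hel : ∀ u, 205 ≤ u → |W u - 1| ≤ 0.00148) :
    ∀ u, 1990 ≤ u → |W u - 1| ≤ 2.97 / u := by
  have hk : ∀ k : ℕ, ∀ u, 1990 ≤ u → |W u - 1| ≤ 2.97 / u + 5 * 0.3 ^ k := by
    intro k
    induction k with
    | zero =>
      intro u hu
      have := W_sub_abs_le u
      have h2 : 0 ≤ 2.97 / u := by positivity
      norm_num; norm_num at h2; linarith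
    | succ k ih =>
      intro u hu
      have := step2 hn hel (r := 5 * 0.3 ^ k) (by positivity) ih u hu
      refine this.trans (le_of_eq ?_)
      ring
  intro u hu
  have ht : Tendsto (fun k : ℕ => 2.97 / u + 5 * (0.3:ℝ) ^ k) atTop (𝓝 (2.97 / u + 5 * 0)) :=
    ((tendsto_pow_atTop_nhds_zero_of_lt_one (by norm_num) (by norm_num)).const_mul 5).const_add _
  have := ge_of_tendsto' ht (fun k => hk k u hu)
  simpa using this

theorem W_final (hn : NumH) (hel : ∀ u, 20 ≤ u → |W u - 1| ≤ 0.029) {u : ℝ} (hu : 100 ≤ u) :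
    |W u - 1| ≤ 3 / u - 6 / u ^ 2 := by
  obtain ⟨h1, h2⟩ := regimeI hn hel
  rcases le_total u 2004 with h | h
  · exact h2 u hu h
  · refine (regimeII hn h1 u (by linarith)).trans ?_
    have e : 3 / u - 6 / u ^ 2 = (3 - 6 / u) / u := by field_simp
    have : 6 / u ≤ 0.003 := by rw [div_le_iff₀ (by linarith)]; linarith
    rw [e]
    gcongr
    linarith

/-- log factorial as a sum -/
noncomputable def TL (m : ℕ) : ℝ := ∑ n ∈ Finset.Ioc 0 m, ln n

noncomputable def psN (m : ℕ) : ℝ := ∑ n ∈ Finset.Ioc 0 m, vonMangoldt n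

lemma psN_eq (m : ℕ) : psi (m : ℝ) = psN m := by
  simp [psi, psN]

lemma TL_eq (m : ℕ) :
    TL m = ∑ n ∈ Finset.Ioc 0 m, vonMangoldt n * ((m / n : ℕ) : ℝ) := by
  have := ArithmeticFunction.sum_Ioc_mul_zeta_eq_sum (R := ℝ) vonMangoldt m
  rw [← this]
  unfold TL
  refine sum_congr rfl fun n _ => ?_
  have h2 := ArithmeticFunction.vonMangoldt_mul_zeta
  have h3 := congrArg (fun f : ArithmeticFunction ℝ => f n) h2
  simp only [ArithmeticFunction.log_apply] at h3
  rw [← h3]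

lemma TL_div (M d : ℕ) :
    TL (M / d) = ∑ n ∈ Finset.Ioc 0 M, vonMangoldt n * ((M / n / d : ℕ) : ℝ) := by
  rw [TL_eq]
  have hsub : Finset.Ioc 0 (M / d) ⊆ Finset.Ioc 0 M :=
    Finset.Ioc_subset_Ioc le_rfl (Nat.div_le_self _ _)
  rw [← Finset.sum_subset hsub]
  · refine sum_congr rfl fun n _ => ?_
    rw [Nat.div_div_eq_div_mul, Nat.div_div_eq_div_mul, mul_comm d n]
  · intro n hn hn'
    simp only [Finset.mem_Ioc] at hn hn'
    have hlt : M / d < n := by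
      by_contra h
      exact hn' ⟨hn.1, by omega⟩
    have : M / n / d = 0 := by
      rw [Nat.div_div_eq_div_mul, mul_comm, ← Nat.div_div_eq_div_mul]
      exact Nat.div_eq_of_lt hlt
    rw [this]; simp

lemma ps_div (M j : ℕ) (hj : 0 < j) :
    psN (M / j) = ∑ n ∈ Finset.Ioc 0 M,
      vonMangoldt n * (if j ≤ M / n then 1 else 0) := by
  unfold psN
  have hsub : Finset.Ioc 0 (M / j) ⊆ Finset.Ioc 0 M :=
    Finset.Ioc_subset_Ioc le_rfl (Nat.div_le_self _ _)
  rw [← Finset.sum_subset hsub]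
  · refine sum_congr rfl fun n hn => ?_
    simp only [Finset.mem_Ioc] at hn
    have : j ≤ M / n := by
      rw [Nat.le_div_iff_mul_le hn.1, mul_comm]
      exact (Nat.le_div_iff_mul_le hj).1 hn.2
    simp [this]
  · intro n hn hn'
    simp only [Finset.mem_Ioc] at hn hn'
    have : ¬ j ≤ M / n := by
      intro h
      apply hn'
      refine ⟨hn.1, ?_⟩
      rw [Nat.le_div_iff_mul_le hj, mul_comm]
      exact (Nat.le_div_iff_mul_le hn.1).1 h
    simp [this]

/-- weight function -/
noncomputable def Fw (D : Finset ℕ) (ν : ℕ → ℝ) (k : ℕ) : ℝ := ∑ d ∈ D, ν d * ((k / d : ℕ) : ℝ)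

noncomputable def Aw (D : Finset ℕ) (ν : ℕ → ℝ) (M : ℕ) : ℝ := ∑ d ∈ D, ν d * TL (M / d)

lemma Aw_eq (D : Finset ℕ) (ν : ℕ → ℝ) (M : ℕ) :
    Aw D ν M = ∑ n ∈ Finset.Ioc 0 M, vonMangoldt n * Fw D ν (M / n) := by
  unfold Aw Fw
  simp_rw [TL_div, mul_sum]
  rw [Finset.sum_comm]
  refine sum_congr rfl fun n _ => sum_congr rfl fun d _ => by ring

lemma step_sum (J : Finset ℕ) (hJ : ∀ j ∈ J, 0 < j) (c : ℕ → ℝ) (M : ℕ) :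
    ∑ j ∈ J, c j * psN (M / j) = ∑ n ∈ Finset.Ioc 0 M, vonMangoldt n *
      ∑ j ∈ J, c j * (if j ≤ M / n then 1 else 0) := by
  simp_rw [mul_sum]
  rw [Finset.sum_comm]
  refine sum_congr rfl fun j hj => ?_
  rw [ps_div M j (hJ j hj), mul_sum]
  refine sum_congr rfl fun n _ => by ring

lemma ps_upper (D J : Finset ℕ) (ν c : ℕ → ℝ) (hJ : ∀ j ∈ J, 0 < j)
    (h : ∀ k, 1 ≤ k → 1 ≤ Fw D ν k + ∑ j ∈ J, c j * (if j ≤ k then 1 else 0)) (M : ℕ) :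
    psN M ≤ Aw D ν M + ∑ j ∈ J, c j * psN (M / j) := by
  rw [Aw_eq, step_sum J hJ, ← sum_add_distrib, psN]
  refine sum_le_sum fun n hn => ?_
  simp only [Finset.mem_Ioc] at hn
  rw [← mul_add]
  have h1 := h (M / n) (Nat.div_pos hn.2 hn.1)
  exact le_mul_of_one_le_right vonMangoldt_nonneg h1

lemma ps_lower (D J : Finset ℕ) (ν c : ℕ → ℝ) (hJ : ∀ j ∈ J, 0 < j)
    (h : ∀ k, 1 ≤ k → Fw D ν k ≤ 1 + ∑ j ∈ J, c j * (if j ≤ k then 1 else 0)) (M : ℕ) :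
    Aw D ν M ≤ psN M + ∑ j ∈ J, c j * psN (M / j) := by
  rw [Aw_eq, step_sum J hJ, psN, ← sum_add_distrib]
  refine sum_le_sum fun n hn => ?_
  simp only [Finset.mem_Ioc] at hn
  have h1 := h (M / n) (Nat.div_pos hn.2 hn.1)
  calc _ ≤ vonMangoldt n * (1 + ∑ j ∈ J, c j * (if j ≤ M / n then 1 else 0)) :=
        mul_le_mul_of_nonneg_left h1 vonMangoldt_nonneg
    _ = _ := by ring

lemma ylog_mono {a b : ℝ} (ha : 0 < a) (hab : a ≤ b) :
    (b - a) * ln a ≤ (b * ln b - b) - (a * ln a - a) ∧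
    (b * ln b - b) - (a * ln a - a) ≤ (b - a) * ln b := by
  have hb : 0 < b := ha.trans_le hab
  have h1 := log_le_sub_one_of_pos (div_pos hb ha)
  have h2 := log_le_sub_one_of_pos (div_pos ha hb)
  rw [Real.log_div hb.ne' ha.ne'] at h1
  rw [Real.log_div ha.ne' hb.ne'] at h2
  have h1' : a * (ln b - ln a) ≤ b - a := by
    have := mul_le_mul_of_nonneg_left h1 ha.le
    have e : a * (b / a - 1) = b - a := by field_simp
    linarith
  have h2' : b * (ln a - ln b) ≤ a - b := by
    have := mul_le_mul_of_nonneg_left h2 hb.le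
    have e : b * (a / b - 1) = a - b := by field_simp
    linarith
  constructor <;> nlinarith

lemma TL_nat (n : ℕ) (hn : 1 ≤ n) :
    n * ln n - n + 1 ≤ TL n ∧ TL n ≤ n * ln n - n + 1 + ln n := by
  induction n, hn using Nat.le_induction with
  | base => simp [TL]
  | succ n hn ih =>
    have e : TL (n + 1) = TL n + ln ((n + 1 : ℕ) : ℝ) := by
      unfold TL; rw [Finset.sum_Ioc_succ_top (by omega)]
    have hn' : (0 : ℝ) < n := by exact_mod_cast hn
    have := ylog_mono hn' (b := ((n + 1 : ℕ) : ℝ)) (by push_cast; linarith)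
    rw [e]
    have e2 : ((n + 1 : ℕ) : ℝ) - n = 1 := by push_cast; ring
    rw [e2] at this
    constructor
    · linarith [this.2, ih.1]
    · linarith [this.1, ih.2]

lemma TL_floor (y : ℝ) (hy : 1 ≤ y) :
    |TL ⌊y⌋₊ - (y * ln y - y + 1)| ≤ ln y := by
  have hn : 1 ≤ ⌊y⌋₊ := Nat.one_le_floor_iff _ |>.2 hy
  obtain ⟨h1, h2⟩ := TL_nat _ hn
  have hn' : (1 : ℝ) ≤ (⌊y⌋₊ : ℝ) := by exact_mod_cast hn
  have hle : (⌊y⌋₊ : ℝ) ≤ y := Nat.floor_le (by linarith)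
  have hlt := Nat.lt_floor_add_one y
  obtain ⟨h3, h4⟩ := ylog_mono (by linarith) hle
  have h5 : ln (⌊y⌋₊ : ℝ) ≤ ln y := log_le_log (by linarith) hle
  have h6 : 0 ≤ ln (⌊y⌋₊ : ℝ) := Real.log_nonneg hn'
  have h7 : (y - ⌊y⌋₊) * ln y ≤ 1 * ln y :=
    mul_le_mul_of_nonneg_right (by linarith) (by linarith)
  have h8 : 0 ≤ (y - ⌊y⌋₊) * ln (⌊y⌋₊ : ℝ) := mul_nonneg (by linarith) h6
  rw [abs_le]
  constructor <;> linarith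

lemma Aw_bound (D : Finset ℕ) (ν : ℕ → ℝ) (N : ℕ) (hD : ∀ d ∈ D, 0 < d ∧ d ≤ N)
    (h0 : ∑ d ∈ D, ν d / d = 0) (M : ℕ) (hM : N ≤ M) (h1 : 1 ≤ M) :
    |Aw D ν M - (-∑ d ∈ D, ν d * ln d / d) * M| ≤ (∑ d ∈ D, |ν d|) * (1 + ln M) := by
  have hM' : (1 : ℝ) ≤ M := by exact_mod_cast h1
  have e : Aw D ν M - (-∑ d ∈ D, ν d * ln d / d) * M =
      ∑ d ∈ D, ν d * ((TL (M / d) - ((M / d : ℝ) * ln (M / d : ℝ) - (M / d : ℝ) + 1)) + 1) := by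
    have e1 : ∀ d ∈ D, ν d * ((TL (M / d) - ((M / d : ℝ) * ln (M / d : ℝ) - (M / d : ℝ) + 1)) + 1)
        = ν d * TL (M / d) - (M * (ln M - 1)) * (ν d / d) + M * (ν d * ln d / d) := by
      intro d hd
      have hd' : (d : ℝ) ≠ 0 := by have := (hD d hd).1; positivity
      rw [Real.log_div (by positivity) hd']
      field_simp
      ring
    rw [sum_congr rfl e1, sum_add_distrib, Finset.sum_sub_distrib, ← mul_sum,
      ← mul_sum, h0, Aw]
    ring
  rw [e, Finset.sum_mul]
  refine (Finset.abs_sum_le_sum_abs _ _).trans (sum_le_sum fun d hd => ?_)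
  rw [abs_mul]
  refine mul_le_mul_of_nonneg_left ?_ (abs_nonneg _)
  obtain ⟨hd0, hdN⟩ := hD d hd
  have hd' : (1 : ℝ) ≤ d := by exact_mod_cast hd0
  have hdM : (d : ℝ) ≤ M := by exact_mod_cast hdN.trans hM
  have hy : (1 : ℝ) ≤ M / d := by rw [le_div_iff₀ (by linarith)]; linarith
  have := TL_floor (M / d : ℝ) hy
  rw [Nat.floor_div_eq_div] at this
  have h5 : ln (M / d : ℝ) ≤ ln M :=
    log_le_log (by linarith) (div_le_self (by linarith) hd')
  refine (abs_add_le _ _).trans ?_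
  rw [abs_one]
  linarith

/-- evaluation barrier for kernel computations -/
def frc {α : Type} (n : ℕ) (k : ℕ → α) : α := Nat.rec (k 0) (fun m _ => k (Nat.succ m)) n

lemma frc_eq {α : Type} (n : ℕ) (k : ℕ → α) : frc n k = k n := by cases n <;> rfl

/-- running check lcm(1..n) ≤ 3^n -/
def lchk (f : ℕ) : ℕ → ℕ → ℕ → Bool :=
  Nat.rec (fun _ _ _ => true) (fun _ ih n L P =>
    frc (Nat.lcm L (Nat.succ n)) fun L' => frc (Nat.mul 3 P) fun P' => frc (Nat.succ n) fun n' =>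
      Bool.rec false (ih n' L' P') (ble L' P')) f

lemma lcmUpto_succ (n : ℕ) : Nat.lcmUpto (n + 1) = Nat.lcm (Nat.lcmUpto n) (n + 1) := by
  unfold Nat.lcmUpto
  have : Finset.Icc 1 (n + 1) = insert (n + 1) (Finset.Icc 1 n) := by
    ext x; simp only [Finset.mem_Icc, Finset.mem_insert]; omega
  rw [this, Finset.lcm_insert, Nat.lcm_comm]
  rfl

lemma lchk_spec (f : ℕ) : ∀ n, lchk f n (Nat.lcmUpto n) (3 ^ n) = true →
    ∀ k, k < f → Nat.lcmUpto (n + 1 + k) ≤ 3 ^ (n + 1 + k) := by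
  induction f with
  | zero => intro n _ k hk; omega
  | succ f ih =>
    intro n h k hk
    have e : lchk (f + 1) n (Nat.lcmUpto n) (3 ^ n) =
      (frc (Nat.lcm (Nat.lcmUpto n) (Nat.succ n)) fun L' => frc (Nat.mul 3 (3 ^ n)) fun P' =>
        frc (Nat.succ n) fun n' =>
          Bool.rec false (lchk f n' L' P') (ble L' P') : Bool) := rfl
    rw [e, frc_eq, frc_eq, frc_eq] at h
    have e1 : Nat.lcm (Nat.lcmUpto n) (Nat.succ n) = Nat.lcmUpto (n + 1) := (lcmUpto_succ n).symm
    have e2 : Nat.mul 3 (3 ^ n) = 3 ^ (n + 1) := by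
      show 3 * 3 ^ n = 3 ^ (n + 1)
      ring
    rw [e1, e2] at h
    cases hb : ble (Nat.lcmUpto (n + 1)) (3 ^ (n + 1)) with
    | false => rw [hb] at h; exact absurd h (by simp)
    | true =>
      rw [hb] at h
      cases k with
      | zero => exact Nat.le_of_ble_eq_true hb
      | succ k =>
        have := ih (n + 1) h k (by omega)
        rwa [show n + 1 + (k + 1) = n + 1 + 1 + k by ring]

set_option maxRecDepth 100000 in
lemma lchk_true : lchk 4200 0 1 1 = true := by decide +kernel

lemma log3_bd : 1.0985 ≤ ln 3 ∧ ln 3 ≤ 1.0987 := by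
  have h2 := Real.log_two_gt_d9
  have h2' := log_two_lt_d9
  have e : ln (531441 / 524288) = 12 * ln 3 - 19 * ln 2 := by
    rw [show (531441 : ℝ) = 3 ^ 12 by norm_num, show (524288 : ℝ) = 2 ^ 19 by norm_num,
      Real.log_div (by norm_num) (by norm_num), Real.log_pow, Real.log_pow]; norm_num
  have hu := log_le_sub_one_of_pos (x := 531441 / 524288) (by norm_num)
  have hl := Real.one_sub_inv_le_log_of_pos (x := 531441 / 524288) (by norm_num)
  rw [e] at hu hl
  norm_num at hu hl
  constructor <;> linarith

lemma log5_bd : 1.6093 ≤ ln 5 ∧ ln 5 ≤ 1.6096 := by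
  have h2 := Real.log_two_gt_d9
  have h2' := log_two_lt_d9
  have e : ln (125 / 128) = 3 * ln 5 - 7 * ln 2 := by
    rw [show (125 : ℝ) = 5 ^ 3 by norm_num, show (128 : ℝ) = 2 ^ 7 by norm_num,
      Real.log_div (by norm_num) (by norm_num), Real.log_pow, Real.log_pow]; norm_num
  have hu := log_le_sub_one_of_pos (x := 125 / 128) (by norm_num)
  have hl := Real.one_sub_inv_le_log_of_pos (x := 125 / 128) (by norm_num)
  rw [e] at hu hl
  norm_num at hu hl
  constructor <;> linarith

lemma psN_small (n : ℕ) (hn : n ≤ 4200) : psN n ≤ 1.12 * n := by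
  rcases Nat.eq_zero_or_pos n with rfl | hpos
  · simp [psN]
  have h0 : Nat.lcmUpto 0 = 1 := by simp [Nat.lcmUpto]
  have h := lchk_spec 4200 0 (by rw [h0]; exact lchk_true) (n - 1) (by omega)
  rw [show 0 + 1 + (n - 1) = n by omega] at h
  rw [← psN_eq, Chebyshev.psi_eq_log_lcmUpto]
  have h1 : ln (Nat.lcmUpto n : ℝ) ≤ ln ((3 : ℝ) ^ n) := by
    apply log_le_log
    · exact_mod_cast Nat.lcmUpto_pos n
    · exact_mod_cast h
  rw [Real.log_pow] at h1
  have := log3_bd.2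
  have hn0 : (0 : ℝ) ≤ n := by positivity
  nlinarith

noncomputable def nuC (d : ℕ) : ℝ := if d = 1 then 1 else if d = 30 then 1 else -1

def DC : Finset ℕ := {1, 2, 3, 5, 30}

lemma FwC (k : ℕ) : Fw DC nuC k = ((k : ℤ) - (k / 2 : ℕ) - (k / 3 : ℕ) - (k / 5 : ℕ) + (k / 30 : ℕ) : ℤ) := by
  unfold Fw DC nuC
  simp only [Int.cast_add, Int.cast_sub, Int.cast_natCast]
  simp
  ring

lemma FwC_val (k : ℕ) : ((k : ℤ) - (k / 2 : ℕ) - (k / 3 : ℕ) - (k / 5 : ℕ) + (k / 30 : ℕ) : ℤ) ≤ 1 ∧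
    0 ≤ ((k : ℤ) - (k / 2 : ℕ) - (k / 3 : ℕ) - (k / 5 : ℕ) + (k / 30 : ℕ) : ℤ) ∧
    (1 ≤ k → k < 6 → ((k : ℤ) - (k / 2 : ℕ) - (k / 3 : ℕ) - (k / 5 : ℕ) + (k / 30 : ℕ) : ℤ) = 1) := by
  have hr : k % 30 < 30 := Nat.mod_lt _ (by norm_num)
  have hk : k = 30 * (k / 30) + k % 30 := (Nat.div_add_mod k 30).symm
  generalize k % 30 = r at hr hk
  generalize k / 30 = a at hk
  subst hk
  interval_cases r <;> omega

lemma mC_bd : 0.9212 ≤ -∑ d ∈ DC, nuC d * ln d / d ∧ -∑ d ∈ DC, nuC d * ln d / d ≤ 0.9214 := by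
  have h2 := Real.log_two_gt_d9
  have h2' := log_two_lt_d9
  have h3 := log3_bd
  have h5 := log5_bd
  have e : ln 30 = ln 2 + ln 3 + ln 5 := by
    rw [← Real.log_mul (by norm_num) (by norm_num), ← Real.log_mul (by norm_num) (by norm_num)]
    norm_num
  have e2 : -∑ d ∈ DC, nuC d * ln d / d =
      ln 2 / 2 + ln 3 / 3 + ln 5 / 5 - ln 30 / 30 := by
    unfold DC nuC
    simp
    ring
  rw [e2, e]
  constructor <;> linarith [h3.1, h3.2, h5.1, h5.2]

lemma AwC (M : ℕ) (hM : 30 ≤ M) :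
    0.9212 * M - 5 * (1 + ln M) ≤ Aw DC nuC M ∧ Aw DC nuC M ≤ 0.9214 * M + 5 * (1 + ln M) := by
  have h := Aw_bound DC nuC 30 (by unfold DC; decide) (by unfold DC nuC; norm_num) M hM (by omega)
  have hS : ∑ d ∈ DC, |nuC d| = 5 := by unfold DC nuC; norm_num
  rw [hS, abs_le] at h
  have hm := mC_bd
  have hM0 : (0 : ℝ) ≤ M := by positivity
  generalize (-∑ d ∈ DC, nuC d * ln d / d) = m at *
  constructor <;> nlinarith [h.1, h.2, hm.1, hm.2]

lemma psN_lower (M : ℕ) (hM : 30 ≤ M) : 0.9212 * M - 5 * (1 + ln M) ≤ psN M := by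
  have h := ps_lower DC ∅ nuC (fun _ => 0) (by simp) (fun k _ => by
    rw [FwC]; simp only [Finset.sum_empty, add_zero]
    exact_mod_cast (FwC_val k).1) M
  simp only [Finset.sum_empty, add_zero] at h
  exact (AwC M hM).1.trans h

lemma log_4200 (M : ℝ) (hM : 4200 ≤ M) : 5 * (1 + ln M) ≤ 0.0119 * M := by
  have h2' := log_two_lt_d9
  have h1 := log_le_sub_one_of_pos (x := M / 4096) (by linarith)
  rw [Real.log_div (by linarith) (by norm_num), show (4096 : ℝ) = 2 ^ 12 by norm_num, Real.log_pow] at h1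
  norm_num at h1
  linarith

lemma psN_crude (n : ℕ) : psN n ≤ 1.12 * n := by
  induction n using Nat.strong_induction_on with
  | _ n ih =>
    rcases le_or_gt n 4200 with h | h
    · exact psN_small n h
    have h1 := ps_upper DC {6} nuC (fun _ => 1) (by simp) (fun k hk => by
      rw [FwC]
      have := FwC_val k
      simp only [Finset.sum_singleton, one_mul]
      split_ifs with h6
      · have := this.2.1
        have h' : (0 : ℝ) ≤ (((k : ℤ) - (k / 2 : ℕ) - (k / 3 : ℕ) - (k / 5 : ℕ) + (k / 30 : ℕ) : ℤ) : ℝ) := by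
          exact_mod_cast this
        linarith
      · rw [this.2.2 hk (by omega)]; norm_num) n
    simp only [Finset.sum_singleton, one_mul] at h1
    have h2 := ih (n / 6) (by omega)
    have h3 := (AwC n (by omega)).2
    have hn : (4200 : ℝ) ≤ n := by exact_mod_cast h.le
    have h4 := log_4200 n hn
    have h5 : ((n / 6 : ℕ) : ℝ) ≤ n / 6 := Nat.cast_div_le
    norm_num at h1 h2 h3 h4 h5 ⊢
    linarith

lemma psi_crude (y : ℝ) (hy : 0 ≤ y) : psi y ≤ 1.12 * y := by
  rw [Chebyshev.psi_eq_psi_coe_floor, psN_eq]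
  have := psN_crude ⌊y⌋₊
  have := Nat.floor_le hy
  linarith

lemma psi_lower (y : ℝ) (hy : 30 ≤ y) : 0.9212 * (y - 1) - 5 * (1 + ln y) ≤ psi y := by
  rw [Chebyshev.psi_eq_psi_coe_floor, psN_eq]
  have h30 : 30 ≤ ⌊y⌋₊ := Nat.le_floor (by exact_mod_cast hy)
  have h1 := psN_lower ⌊y⌋₊ h30
  have h2 := Nat.lt_floor_add_one y
  have h3 := Nat.floor_le (show 0 ≤ y by linarith)
  have h30' : (30 : ℝ) ≤ (⌊y⌋₊ : ℝ) := by exact_mod_cast h30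
  have h4 : ln ⌊y⌋₊ ≤ ln y := log_le_log (by linarith) h3
  linarith

/-- packed digits in base `2^w` -/
def pack (w Y : ℕ) (f : ℕ → ℕ) : ℕ := ∑ k ∈ Finset.range Y, f k * (2 ^ w) ^ k

lemma pack_lt (w Y : ℕ) (f : ℕ → ℕ) (hf : ∀ k, k < Y → f k < 2 ^ w) : pack w Y f < (2 ^ w) ^ Y := by
  induction Y with
  | zero => simp [pack]
  | succ Y ih =>
    have h1 := ih fun k hk => hf k (by omega)
    unfold pack at *
    rw [sum_range_succ, pow_succ]
    have h2 := hf Y (by omega)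
    have h3 : f Y * (2 ^ w) ^ Y + (2 ^ w) ^ Y ≤ (2 ^ w) ^ Y * 2 ^ w := by
      rw [← Nat.succ_mul, mul_comm ((2 ^ w) ^ Y)]
      exact Nat.mul_le_mul_right _ h2
    omega

lemma pack_split (w k n : ℕ) (f : ℕ → ℕ) :
    pack w (k + n) f = pack w k f + (2 ^ w) ^ k * pack w n (fun i => f (k + i)) := by
  unfold pack
  rw [Finset.sum_range_add, mul_sum]
  congr 1
  refine sum_congr rfl fun i _ => ?_
  rw [pow_add]; ring

lemma pack_digit (w Y : ℕ) (f : ℕ → ℕ) (hf : ∀ k, k < Y → f k < 2 ^ w) (k : ℕ) (hk : k < Y) :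
    pack w Y f / (2 ^ w) ^ k % 2 ^ w = f k := by
  have hB : 0 < 2 ^ w := by positivity
  obtain ⟨n, rfl⟩ : ∃ n, Y = k + (1 + n) := ⟨Y - k - 1, by omega⟩
  rw [pack_split, Nat.add_mul_div_left _ _ (by positivity),
    Nat.div_eq_of_lt (pack_lt w k f fun i hi => hf i (by omega)), zero_add, pack_split]
  have : pack w 1 (fun i => f (k + i)) = f k := by simp [pack]
  rw [this, pow_one, Nat.add_mul_mod_self_left, Nat.mod_eq_of_lt (hf k hk)]

lemma pack_testBit (w Y : ℕ) (f : ℕ → ℕ) (hf : ∀ k, k < Y → f k < 2 ^ w) (k : ℕ) (hk : k < Y)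
    (h : ℕ) (hh : h < w) : (pack w Y f).testBit (w * k + h) = (f k).testBit h := by
  rw [← pack_digit w Y f hf k hk, ← pow_mul, Nat.testBit_mod_two_pow, Nat.testBit_div_two_pow]
  simp [hh, add_comm]

lemma pack_add (w Y : ℕ) (f g : ℕ → ℕ) : pack w Y (fun k => f k + g k) = pack w Y f + pack w Y g := by
  simp [pack, add_mul, sum_add_distrib]

lemma pack_mul (w Y c : ℕ) (f : ℕ → ℕ) : pack w Y (fun k => c * f k) = c * pack w Y f := by
  simp [pack, mul_assoc, mul_sum]

lemma pack_congr (w Y : ℕ) (f g : ℕ → ℕ) (h : ∀ k, k < Y → f k = g k) : pack w Y f = pack w Y g := by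
  unfold pack
  exact sum_congr rfl fun k hk => by rw [h k (Finset.mem_range.1 hk)]

lemma pack_sum (w Y : ℕ) (s : Finset ℕ) (f : ℕ → ℕ → ℕ) :
    pack w Y (fun k => ∑ d ∈ s, f d k) = ∑ d ∈ s, pack w Y (f d) := by
  unfold pack
  simp_rw [Finset.sum_mul]
  rw [Finset.sum_comm]

lemma pack_le (w Y h : ℕ) (hw : h + 2 ≤ w) (a b : ℕ → ℕ) (ha : ∀ k, k < Y → a k ≤ 2 ^ h)
    (hb : ∀ k, k < Y → b k < 2 ^ h)
    (hc : Nat.land (pack w Y b + 2 ^ h * pack w Y (fun _ => 1) - pack w Y a)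
      (2 ^ h * pack w Y (fun _ => 1)) = 2 ^ h * pack w Y (fun _ => 1)) :
    ∀ k, k < Y → a k ≤ b k := by
  intro k hk
  have hw2 : 2 ^ (h + 1) ≤ 2 ^ w / 2 := by
    obtain ⟨r, rfl⟩ := Nat.exists_eq_add_of_le hw
    have : 2 ^ (h + 2 + r) = 2 ^ (h + 1) * 2 ^ r * 2 := by rw [pow_add, pow_add, pow_add]; ring
    rw [this, Nat.mul_div_cancel _ (by norm_num)]
    exact Nat.le_mul_of_pos_right _ (by positivity)
  have hp : 2 ^ (h + 1) = 2 * 2 ^ h := by rw [pow_succ]; ring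
  have hpos : 0 < 2 ^ h := by positivity
  have e1 : 2 ^ h * pack w Y (fun _ => 1) = pack w Y (fun _ => 2 ^ h) := by
    rw [← pack_mul]; simp
  have e2 : pack w Y b + 2 ^ h * pack w Y (fun _ => 1) - pack w Y a =
      pack w Y (fun k => b k + 2 ^ h - a k) := by
    rw [e1, ← pack_add]
    apply Nat.sub_eq_of_eq_add
    rw [← pack_add]
    refine pack_congr _ _ _ _ fun i hi => ?_
    have := ha i hi
    omega
  rw [e2, e1] at hc
  have hc2 := congrArg (fun n => Nat.testBit n (w * k + h)) hc
  change ((pack w Y fun k => b k + 2 ^ h - a k) &&& (pack w Y fun _ => 2 ^ h)).testBit _ = _ at hc2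
  rw [Nat.testBit_land, pack_testBit w Y _ (fun i hi => by have := hb i hi; omega) k hk h (by omega),
    pack_testBit w Y _ (fun i hi => by have := hb i hi; omega) k hk h (by omega), Nat.testBit_two_pow_self,
    Bool.and_true] at hc2
  have := Nat.ge_two_pow_of_testBit hc2
  omega

lemma pack_step (w Y a : ℕ) (ha : a ≤ Y) :
    (2 ^ w - 1) * pack w Y (fun k => if a ≤ k then 1 else 0) + (2 ^ w) ^ a = (2 ^ w) ^ Y := by
  obtain ⟨n, rfl⟩ := Nat.exists_eq_add_of_le ha
  rw [pack_split]
  have e1 : pack w a (fun k => if a ≤ k then 1 else 0) = 0 := by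
    rw [pack]
    refine Finset.sum_eq_zero fun k hk => ?_
    have := Finset.mem_range.1 hk
    simp [show ¬ a ≤ k by omega]
  have e2 : (2 ^ w - 1) * pack w n (fun i => if a ≤ a + i then 1 else 0) + 1 = (2 ^ w) ^ n := by
    simp only [Nat.le_add_right, if_true]
    unfold pack
    simp only [one_mul]
    have h1 : 1 ≤ 2 ^ w := Nat.one_le_two_pow
    have := Nat.geomSum_eq (m := 2 ^ w)
    induction n with
    | zero => simp
    | succ n ih =>
      rw [sum_range_succ, mul_add, add_right_comm, ih (by omega), pow_succ]
      obtain ⟨b, hb⟩ := Nat.exists_eq_add_of_le h1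
      rw [hb, Nat.add_sub_cancel_left]; ring
  rw [e1, zero_add, pow_add, ← e2]
  ring

/-- closed form numerator pieces -/
def geoW (w d c : ℕ) : ℕ :=
  Nat.div (Nat.mul (Nat.pow 2 (Nat.mul w d)) (Nat.sub (Nat.pow 2 (Nat.mul w (Nat.mul d c))) 1))
    (Nat.sub (Nat.pow 2 (Nat.mul w d)) 1)

lemma geoW_eq (w d c : ℕ) (hw : 0 < w) (hd : 0 < d) :
    geoW w d c = ∑ j ∈ Finset.range c, (2 ^ w) ^ (d * (j + 1)) := by
  have h1 : 2 ≤ (2 ^ w) ^ d := by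
    rw [← pow_mul]
    calc 2 = 2 ^ 1 := rfl
      _ ≤ _ := Nat.pow_le_pow_right (by norm_num) (Nat.mul_pos hw hd)
  have e : geoW w d c = ((2 ^ w) ^ d * (((2 ^ w) ^ d) ^ c - 1)) / ((2 ^ w) ^ d - 1) := by
    show (2 ^ (w * d) * (2 ^ (w * (d * c)) - 1)) / (2 ^ (w * d) - 1) = _
    rw [← pow_mul, ← pow_mul, mul_assoc]
  have hs : ((2 ^ w) ^ d - 1) * ∑ j ∈ Finset.range c, ((2 ^ w) ^ d) ^ j = ((2 ^ w) ^ d) ^ c - 1 := by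
    have := Nat.geomSum_eq h1 c
    rw [this]
    exact Nat.mul_div_cancel' (Nat.sub_one_dvd_pow_sub_one _ _)
  rw [e, ← hs, ← mul_assoc, mul_comm ((2 ^ w) ^ d), mul_assoc, Nat.mul_div_cancel_left _ (by omega),
    mul_sum]
  refine sum_congr rfl fun j _ => ?_
  rw [show d * (j + 1) = d + d * j by ring, pow_add, pow_mul (2 ^ w) d j]

lemma floor_steps (k d c : ℕ) (hd : 0 < d) (hk : k / d ≤ c) :
    k / d = ∑ j ∈ Finset.range c, if d * (j + 1) ≤ k then 1 else 0 := by
  rw [Finset.sum_boole]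
  have : Finset.filter (fun j => d * (j + 1) ≤ k) (Finset.range c) = Finset.range (k / d) := by
    ext j
    simp only [Finset.mem_filter, Finset.mem_range]
    rw [mul_comm, ← Nat.le_div_iff_mul_le hd]
    omega
  rw [this]; simp

lemma pack_floor (w Y d : ℕ) (hw : 0 < w) (hd : 0 < d) (hY : 0 < Y) :
    (2 ^ w - 1) * pack w Y (fun k => k / d) + geoW w d ((Y - 1) / d) =
      ((Y - 1) / d) * (2 ^ w) ^ Y := by
  set c := (Y - 1) / d with hc
  have e : pack w Y (fun k => k / d) =
      ∑ j ∈ Finset.range c, pack w Y (fun k => if d * (j + 1) ≤ k then 1 else 0) := by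
    rw [← pack_sum]
    refine pack_congr _ _ _ _ fun k hk => floor_steps k d c hd ?_
    exact Nat.div_le_div_right (by omega)
  rw [e, geoW_eq w d c hw hd, mul_sum, ← sum_add_distrib]
  have : ∀ j ∈ Finset.range c, (2 ^ w - 1) * pack w Y (fun k => if d * (j + 1) ≤ k then 1 else 0) +
      (2 ^ w) ^ (d * (j + 1)) = (2 ^ w) ^ Y := by
    intro j hj
    refine pack_step w Y _ ?_
    have := Finset.mem_range.1 hj
    calc d * (j + 1) ≤ d * c := Nat.mul_le_mul_left _ this
      _ ≤ Y - 1 := Nat.mul_div_le _ _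
      _ ≤ Y := by omega
  rw [sum_congr rfl this]
  simp

/-- accumulating sum -/
def sumK (f : ℕ → ℕ) (n : ℕ) : ℕ → ℕ → ℕ :=
  Nat.rec (fun _ acc => acc) (fun _ ih d acc =>
    frc (Nat.add acc (f d)) fun acc' => frc (Nat.succ d) fun d' => ih d' acc') n

lemma sumK_eq (f : ℕ → ℕ) (n : ℕ) : ∀ d acc, sumK f n d acc = acc + ∑ i ∈ Finset.range n, f (d + i) := by
  induction n with
  | zero => intro d acc; simp [sumK]
  | succ n ih =>
    intro d acc
    have e : sumK f (n + 1) d acc = frc (Nat.add acc (f d)) fun acc' => frc (Nat.succ d) fun d' =>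
      sumK f n d' acc' := rfl
    rw [e, frc_eq, frc_eq, ih, Finset.sum_range_succ']
    have : ∀ i, Nat.succ d + i = d + (i + 1) := fun i => by omega
    simp only [this]
    show acc + f d + _ = _
    simp only [Nat.add_zero]
    omega

def mP : ℕ := 10180681255521465615875490749415043930836202984039442327793916948900635987484468544523391567558288929255889521824588121606876758702377003090230909669000258
def mN : ℕ := 1914173124207557983666644069071927675113393195776521185027775200347368593815012225323069854961074668545335076226810687177439347548861882788096827267360940

/-- masked value -/
def mv (m d v : ℕ) : ℕ := Bool.rec 0 v (Nat.testBit m d)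

lemma mv_eq (m d v : ℕ) : mv m d v = mv m d 1 * v := by
  unfold mv; cases Nat.testBit m d <;> simp

lemma mv_le (m d : ℕ) : mv m d 1 ≤ 1 := by
  unfold mv; cases Nat.testBit m d <;> simp

def stK (w Y a : ℕ) : ℕ :=
  Nat.div (Nat.sub (Nat.pow 2 (Nat.mul w Y)) (Nat.pow 2 (Nat.mul w a))) (Nat.sub (Nat.pow 2 w) 1)

def flK (w Y d : ℕ) : ℕ :=
  Nat.div (Nat.sub (Nat.mul (Nat.div (Nat.sub Y 1) d) (Nat.pow 2 (Nat.mul w Y)))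
    (geoW w d (Nat.div (Nat.sub Y 1) d))) (Nat.sub (Nat.pow 2 w) 1)

def mkK (w Y m : ℕ) : ℕ :=
  Nat.div (Nat.sub (Nat.mul (sumK (fun d => mv m d (Nat.div (Nat.sub Y 1) d)) 511 1 0)
      (Nat.pow 2 (Nat.mul w Y)))
    (sumK (fun d => mv m d (geoW w d (Nat.div (Nat.sub Y 1) d))) 511 1 0)) (Nat.sub (Nat.pow 2 w) 1)

lemma div_aux (p g t c : ℕ) (hc : 0 < c) (h : c * p + g = t) : (t - g) / c = p := by
  rw [← h, Nat.add_sub_cancel, Nat.mul_div_cancel_left _ hc]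

lemma two_pow_sub_pos (w : ℕ) (hw : 0 < w) : 0 < 2 ^ w - 1 := by
  have : 2 ^ 1 ≤ 2 ^ w := Nat.pow_le_pow_right (by norm_num) hw
  omega

lemma stK_eq (w Y a : ℕ) (hw : 0 < w) (ha : a ≤ Y) :
    stK w Y a = pack w Y (fun k => if a ≤ k then 1 else 0) := by
  have h := pack_step w Y a ha
  rw [← pow_mul, ← pow_mul] at h
  exact div_aux _ _ _ _ (two_pow_sub_pos w hw) h

lemma flK_eq (w Y d : ℕ) (hw : 0 < w) (hd : 0 < d) (hY : 0 < Y) :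
    flK w Y d = pack w Y (fun k => k / d) := by
  have h := pack_floor w Y d hw hd hY
  rw [← pow_mul] at h
  exact div_aux _ _ _ _ (two_pow_sub_pos w hw) h

/-- digit sums for a mask -/
def dg (m k : ℕ) : ℕ := ∑ i ∈ Finset.range 511, mv m (1 + i) 1 * (k / (1 + i))

lemma mkK_eq (w Y m : ℕ) (hw : 0 < w) (hY : 0 < Y) : mkK w Y m = pack w Y (dg m) := by
  have h : (2 ^ w - 1) * pack w Y (dg m) +
      sumK (fun d => mv m d (geoW w d (Nat.div (Nat.sub Y 1) d))) 511 1 0 =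
      sumK (fun d => mv m d (Nat.div (Nat.sub Y 1) d)) 511 1 0 * 2 ^ (w * Y) := by
    rw [sumK_eq, sumK_eq, zero_add, zero_add]
    unfold dg
    rw [pack_sum w Y (Finset.range 511) (fun i k => mv m (1 + i) 1 * (k / (1 + i))), mul_sum,
      ← sum_add_distrib, Finset.sum_mul]
    refine sum_congr rfl fun i _ => ?_
    rw [mv_eq m (1 + i) (geoW _ _ _), mv_eq m (1 + i) (Nat.div _ _), pack_mul, pow_mul]
    have := pack_floor w Y (1 + i) hw (by omega) hY
    change _ + mv m (1 + i) 1 * geoW w (1 + i) ((Y - 1) / (1 + i)) =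
      mv m (1 + i) 1 * ((Y - 1) / (1 + i)) * _
    rw [mul_assoc, ← this]
    ring
  exact div_aux _ _ _ _ (two_pow_sub_pos w hw) h

lemma dg_le (m k : ℕ) : dg m k ≤ 511 * k := by
  unfold dg
  calc _ ≤ ∑ i ∈ Finset.range 511, k := by
        refine sum_le_sum fun i _ => ?_
        calc _ ≤ 1 * (k / (1 + i)) := Nat.mul_le_mul_right _ (mv_le _ _)
          _ ≤ k := by rw [one_mul]; exact Nat.div_le_self _ _
    _ = _ := by simp

/-- the upper check, packed -/
def chkU (w Y pp nn : ℕ) : Bool :=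
  frc (Nat.mul (Nat.pow 2 44) (stK w Y 0)) fun H =>
  Nat.beq (Nat.land (Nat.sub (Nat.add (Nat.add (Nat.mul 65536 pp) (Nat.add (Nat.mul 153138 (flK w Y 512))
    (Nat.add (Nat.mul 573440 (stK w Y 512)) (Nat.add (Nat.mul 245760 (stK w Y 1024))
      (Nat.mul 65536 (stK w Y 32768)))))) H)
    (Nat.add (Nat.mul 65536 nn) (Nat.mul 65536 (stK w Y 1)))) H) H

def chkL (w Y pp nn : ℕ) : Bool :=
  frc (Nat.mul (Nat.pow 2 44) (stK w Y 0)) fun H =>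
  Nat.beq (Nat.land (Nat.sub (Nat.add (Nat.add (Nat.mul 65536 nn) (Nat.add (Nat.mul 65536 (stK w Y 0))
    (Nat.add (Nat.mul 688128 (stK w Y 512)) (Nat.mul 245760 (stK w Y 4096))))) H)
    (Nat.add (Nat.mul 65536 pp) (Nat.mul 153139 (flK w Y 512)))) H) H

lemma chkU_spec (w Y : ℕ) (hw : 46 ≤ w) (hY : 0 < Y) (hY2 : Y ≤ 131072) (hY3 : 32768 ≤ Y) (h : chkU w Y (mkK w Y mP) (mkK w Y mN) = true) :
    ∀ k, k < Y → 65536 * dg mN k + 65536 * (if 1 ≤ k then 1 else 0) ≤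
      65536 * dg mP k + (153138 * (k / 512) + (573440 * (if 512 ≤ k then 1 else 0) +
        (245760 * (if 1024 ≤ k then 1 else 0) + 65536 * (if 32768 ≤ k then 1 else 0)))) := by
  unfold chkU at h
  rw [frc_eq] at h
  have h := Nat.eq_of_beq_eq_true h
  rw [mkK_eq w Y _ (by omega) hY, mkK_eq w Y _ (by omega) hY, stK_eq w Y 0 (by omega) (by omega),
    stK_eq w Y 1 (by omega) (by omega), stK_eq w Y 512 (by omega) (by omega),
    stK_eq w Y 1024 (by omega) (by omega), stK_eq w Y 32768 (by omega) (by omega),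
    flK_eq w Y _ (by omega) (by omega) hY] at h
  simp only [Nat.add_eq, Nat.mul_eq, Nat.sub_eq, Nat.pow_eq, ← pack_mul, ← pack_add] at h
  refine pack_le w Y 44 hw _ _ ?_ ?_ ?_
  · intro k hk
    have := dg_le mN k
    split_ifs <;> norm_num <;> omega
  · intro k hk
    have := dg_le mP k
    split_ifs <;> norm_num <;> omega
  · rw [← pack_mul, ← pack_add]
    simpa using h

lemma chkL_spec (w Y : ℕ) (hw : 46 ≤ w) (hY : 0 < Y) (hY2 : Y ≤ 131072) (hY3 : 32768 ≤ Y) (h : chkL w Y (mkK w Y mP) (mkK w Y mN) = true) :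
    ∀ k, k < Y → 65536 * dg mP k + 153139 * (k / 512) ≤
      65536 * dg mN k + (65536 * (if 0 ≤ k then 1 else 0) + (688128 * (if 512 ≤ k then 1 else 0) +
        (245760 * (if 4096 ≤ k then 1 else 0)))) := by
  unfold chkL at h
  rw [frc_eq] at h
  have h := Nat.eq_of_beq_eq_true h
  rw [mkK_eq w Y _ (by omega) hY, mkK_eq w Y _ (by omega) hY, stK_eq w Y 0 (by omega) (by omega),
    stK_eq w Y 512 (by omega) (by omega), stK_eq w Y 4096 (by omega) (by omega),
    flK_eq w Y _ (by omega) (by omega) hY] at h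
  simp only [Nat.add_eq, Nat.mul_eq, Nat.sub_eq, Nat.pow_eq, ← pack_mul, ← pack_add] at h
  refine pack_le w Y 44 hw _ _ ?_ ?_ ?_
  · intro k hk
    have := dg_le mP k
    norm_num
    omega
  · intro k hk
    have := dg_le mN k
    split_ifs <;> norm_num <;> omega
  · rw [← pack_mul, ← pack_add]
    simpa using h

def chkB (w Y : ℕ) : Bool := frc (mkK w Y mP) fun pp => frc (mkK w Y mN) fun nn =>
  Bool.rec false (chkU w Y pp nn) (chkL w Y pp nn)

lemma chkB_spec (w Y : ℕ) (h : chkB w Y = true) :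
    chkU w Y (mkK w Y mP) (mkK w Y mN) = true ∧ chkL w Y (mkK w Y mP) (mkK w Y mN) = true := by
  unfold chkB at h
  rw [frc_eq, frc_eq] at h
  revert h
  cases chkL w Y (mkK w Y mP) (mkK w Y mN) <;> simp

set_option maxRecDepth 100000 in
lemma chkB_true : chkB 48 131072 = true := by decide +kernel

/-- fixed-point approximation from below of `2^S * log ((a+1)/(a-1))` -/
def dlogK (S N a : ℕ) : ℕ :=
  sumK (fun i => Nat.div (Nat.pow 2 (Nat.succ S))
    (Nat.mul (Nat.pow a (Nat.succ (Nat.mul 2 i))) (Nat.succ (Nat.mul 2 i)))) N 0 0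

lemma dlogK_bd (S N a : ℕ) (ha : 2 ≤ a) :
    (dlogK S N a : ℝ) ≤ 2 ^ S * ln (((a : ℝ) + 1) / (a - 1)) ∧
    2 ^ S * ln (((a : ℝ) + 1) / (a - 1)) ≤ dlogK S N a + N +
      2 ^ (S + 1) * ((1 / (a : ℝ)) ^ (2 * N + 1) / (1 - (1 / (a : ℝ)) ^ 2)) := by
  have ha' : (2 : ℝ) ≤ a := by exact_mod_cast ha
  have hz1 : (1 / (a : ℝ)) < 1 := by rw [div_lt_one (by linarith)]; linarith
  have hz0 : 0 ≤ 1 / (a : ℝ) := by positivity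
  have hl := Real.sum_range_le_log_div hz0 hz1 N
  have hu := Real.log_div_le_sum_range_add hz0 hz1 N
  have e : (1 + 1 / (a : ℝ)) / (1 - 1 / (a : ℝ)) = ((a : ℝ) + 1) / (a - 1) := by
    have : (a : ℝ) - 1 ≠ 0 := by linarith
    field_simp
  rw [e] at hl hu
  have hS : (0 : ℝ) < 2 ^ (S + 1) := by positivity
  have e2 : (2 : ℝ) ^ S * ln (((a : ℝ) + 1) / (a - 1)) =
      2 ^ (S + 1) * (1 / 2 * ln (((a : ℝ) + 1) / (a - 1))) := by rw [pow_succ]; ring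
  have e3 : (dlogK S N a : ℝ) = ∑ i ∈ Finset.range N, ((2 ^ (S + 1) / (a ^ (2 * i + 1) * (2 * i + 1)) : ℕ) : ℝ) := by
    unfold dlogK
    rw [sumK_eq]
    push_cast [zero_add]
    rfl
  have e4 : ∀ i : ℕ, (2 : ℝ) ^ (S + 1) * ((1 / (a : ℝ)) ^ (2 * i + 1) / (2 * i + 1)) =
      ((2 ^ (S + 1) : ℕ) : ℝ) / ((a ^ (2 * i + 1) * (2 * i + 1) : ℕ) : ℝ) := by
    intro i; push_cast; rw [one_div, inv_pow]; field_simp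
  have hlo : (dlogK S N a : ℝ) ≤ 2 ^ (S + 1) * ∑ i ∈ Finset.range N, (1 / (a : ℝ)) ^ (2 * i + 1) / (2 * i + 1) := by
    rw [e3, mul_sum]
    refine sum_le_sum fun i _ => ?_
    rw [e4]
    exact Nat.cast_div_le
  have hhi : 2 ^ (S + 1) * ∑ i ∈ Finset.range N, (1 / (a : ℝ)) ^ (2 * i + 1) / (2 * i + 1) ≤ dlogK S N a + N := by
    have : (N : ℝ) = ∑ i ∈ Finset.range N, (1 : ℝ) := by simp
    rw [e3, mul_sum, this, ← sum_add_distrib]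
    refine sum_le_sum fun i _ => ?_
    rw [e4, ← Nat.floor_div_eq_div (K := ℝ)]
    exact (Nat.lt_floor_add_one _).le
  rw [e2]
  constructor
  · exact hlo.trans (mul_le_mul_of_nonneg_left hl hS.le)
  · have := mul_le_mul_of_nonneg_left hu hS.le
    rw [mul_add] at this
    linarith

/-- accumulating loop with an inner running sum -/
def loopL (f : ℕ → ℕ → ℕ) (st : ℕ → ℕ) (n : ℕ) : ℕ → ℕ → ℕ → ℕ :=
  Nat.rec (fun _ _ acc => acc) (fun _ ih j L acc =>
    frc (Nat.add acc (f j L)) fun acc' => frc (Nat.add L (st j)) fun L' =>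
      frc (Nat.succ j) fun j' => ih j' L' acc') n

lemma loopL_eq (f : ℕ → ℕ → ℕ) (st : ℕ → ℕ) (n : ℕ) : ∀ j acc,
    loopL f st n j (∑ l ∈ Finset.range j, st l) acc =
      acc + ∑ i ∈ Finset.range n, f (j + i) (∑ l ∈ Finset.range (j + i), st l) := by
  induction n with
  | zero => intro d acc; simp [loopL]
  | succ n ih =>
    intro j acc
    have e : loopL f st (n + 1) j (∑ l ∈ Finset.range j, st l) acc =
      frc (Nat.add acc (f j (∑ l ∈ Finset.range j, st l))) fun acc' =>
      frc (Nat.add (∑ l ∈ Finset.range j, st l) (st j)) fun L' =>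
      frc (Nat.succ j) fun j' => loopL f st n j' L' acc' := rfl
    rw [e, frc_eq, frc_eq, frc_eq]
    have e2 : Nat.add (∑ l ∈ Finset.range j, st l) (st j) = ∑ l ∈ Finset.range (Nat.succ j), st l := by
      rw [Nat.succ_eq_add_one, sum_range_succ]; rfl
    rw [e2, ih, Finset.sum_range_succ']
    have : ∀ i, Nat.succ j + i = j + (i + 1) := fun i => by omega
    simp only [this]
    show acc + f j _ + _ = _
    simp only [Nat.add_zero]
    omega

/-- approximate logs -/
def stE (j : ℕ) : ℕ := dlogK 40 13 (Nat.add (Nat.mul 2 j) 3)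

def LE (j : ℕ) : ℕ := ∑ l ∈ Finset.range j, stE l

lemma LE_bd (j : ℕ) : (LE j : ℝ) ≤ 2 ^ 40 * ln (j + 1) ∧
    2 ^ 40 * ln (j + 1) ≤ LE j + 14 * j := by
  induction j with
  | zero => simp [LE]
  | succ j ih =>
    have e : LE (j + 1) = LE j + stE j := by unfold LE; rw [sum_range_succ]
    have h := dlogK_bd 40 13 (2 * j + 3) (by omega)
    have e2 : ((2 * j + 3 : ℕ) : ℝ) + 1 = 2 * ((j : ℝ) + 2) := by push_cast; ring
    have e3 : ((2 * j + 3 : ℕ) : ℝ) - 1 = 2 * ((j : ℝ) + 1) := by push_cast; ring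
    rw [e2, e3, mul_div_mul_left _ _ (by norm_num), Real.log_div (by positivity) (by positivity)] at h
    have hz : 1 / ((2 * j + 3 : ℕ) : ℝ) ≤ 1 / 3 := by
      apply one_div_le_one_div_of_le (by norm_num)
      push_cast; linarith [(Nat.cast_nonneg j : (0 : ℝ) ≤ j)]
    have hz0 : 0 ≤ 1 / ((2 * j + 3 : ℕ) : ℝ) := by positivity
    have ht : (2 : ℝ) ^ (40 + 1) * ((1 / ((2 * j + 3 : ℕ) : ℝ)) ^ (2 * 13 + 1) / (1 - (1 / ((2 * j + 3 : ℕ) : ℝ)) ^ 2)) ≤ 1 := by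
      calc _ ≤ (2 : ℝ) ^ (40 + 1) * ((1 / 3) ^ (2 * 13 + 1) / (1 - (1 / 3) ^ 2)) := by
            gcongr
        _ ≤ 1 := by norm_num
    have hs : (stE j : ℝ) = dlogK 40 13 (2 * j + 3) := rfl
    rw [e]
    push_cast
    have e5 : (j : ℝ) + 1 + 1 = j + 2 := by ring
    rw [e5, hs]
    push_cast at h ht
    obtain ⟨h1, h2⟩ := h
    obtain ⟨h3, h4⟩ := ih
    constructor
    · linarith only [h1, h3]
    · linarith only [h2, h4, ht]

def sR (m : ℕ) : ℕ := sumK (fun d => mv m d (Nat.div (Nat.pow 2 60) d)) 511 1 0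
def sX (m : ℕ) : ℕ := loopL (fun j L => mv m (Nat.add 1 j) (Nat.div (Nat.mul L (Nat.pow 2 20)) (Nat.add 1 j))) stE 511 0 0 0

set_option maxRecDepth 100000 in
lemma sR_P : sR mP = 2787249895758500665 := by decide +kernel
set_option maxRecDepth 100000 in
lemma sR_N : sR mN = 2792511691038601824 := by decide +kernel
set_option maxRecDepth 100000 in
lemma sX_P : sX mP = 6374766263121037561 := by decide +kernel
set_option maxRecDepth 100000 in
lemma sX_N : sX mN = 7559762689687439194 := by decide +kernel

lemma sR_bd (m : ℕ) : (sR m : ℝ) ≤ 2 ^ 60 * ∑ i ∈ Finset.range 511, (mv m (1 + i) 1 : ℝ) / ((1 + i : ℕ) : ℝ) ∧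
    2 ^ 60 * ∑ i ∈ Finset.range 511, (mv m (1 + i) 1 : ℝ) / ((1 + i : ℕ) : ℝ) ≤ sR m + 511 := by
  have e : (sR m : ℝ) = ∑ i ∈ Finset.range 511, (mv m (1 + i) 1 : ℝ) * ((2 ^ 60 / (1 + i) : ℕ) : ℝ) := by
    unfold sR; rw [sumK_eq, zero_add, Nat.cast_sum]
    refine sum_congr rfl fun i _ => ?_
    rw [mv_eq]; push_cast; rfl
  have e1 : (511 : ℝ) = ∑ i ∈ Finset.range 511, (1 : ℝ) := by simp
  have key : ∀ i : ℕ, ((2 ^ 60 / (1 + i) : ℕ) : ℝ) ≤ 2 ^ 60 / ((1 + i : ℕ) : ℝ) ∧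
      2 ^ 60 / ((1 + i : ℕ) : ℝ) ≤ ((2 ^ 60 / (1 + i) : ℕ) : ℝ) + 1 := by
    intro i
    have h := Nat.floor_div_eq_div (K := ℝ) (2 ^ 60) (1 + i)
    rw [← h]
    have e : ((2 ^ 60 : ℕ) : ℝ) = 2 ^ 60 := by norm_num
    rw [e]
    exact ⟨Nat.floor_le (by positivity), (Nat.lt_floor_add_one _).le⟩
  have hm : ∀ i, (0 : ℝ) ≤ mv m (1 + i) 1 ∧ (mv m (1 + i) 1 : ℝ) ≤ 1 :=
    fun i => ⟨Nat.cast_nonneg _, by exact_mod_cast mv_le _ _⟩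
  have e3 : ∀ i : ℕ, (2 : ℝ) ^ 60 * ((mv m (1 + i) 1 : ℝ) / ((1 + i : ℕ) : ℝ)) =
    (mv m (1 + i) 1 : ℝ) * (2 ^ 60 / ((1 + i : ℕ) : ℝ)) := fun i => by ring
  constructor
  · rw [e, mul_sum]
    refine sum_le_sum fun i _ => ?_
    rw [e3]
    exact mul_le_mul_of_nonneg_left (key i).1 (hm i).1
  · rw [e, e1, mul_sum, ← sum_add_distrib]
    refine sum_le_sum fun i _ => ?_
    rw [e3]
    have := mul_le_mul_of_nonneg_left (key i).2 (hm i).1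
    linarith [(hm i).2]

lemma sX_bd (m : ℕ) :
    (sX m : ℝ) ≤ 2 ^ 60 * ∑ i ∈ Finset.range 511, (mv m (1 + i) 1 : ℝ) * ln ((1 + i : ℕ) : ℝ) / ((1 + i : ℕ) : ℝ) ∧
    2 ^ 60 * ∑ i ∈ Finset.range 511, (mv m (1 + i) 1 : ℝ) * ln ((1 + i : ℕ) : ℝ) / ((1 + i : ℕ) : ℝ) ≤
      sX m + 511 * (1 + 14 * 2 ^ 20) := by
  have e : (sX m : ℝ) = ∑ i ∈ Finset.range 511, (mv m (1 + i) 1 : ℝ) * ((LE i * 2 ^ 20 / (1 + i) : ℕ) : ℝ) := by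
    unfold sX
    have := loopL_eq (fun j L => mv m (Nat.add 1 j) (Nat.div (Nat.mul L (Nat.pow 2 20)) (Nat.add 1 j))) stE 511 0 0
    rw [Finset.sum_range_zero] at this
    rw [this, zero_add, Nat.cast_sum]
    refine sum_congr rfl fun i _ => ?_
    rw [mv_eq, zero_add]; push_cast; rfl
  have e1 : (511 : ℝ) * (1 + 14 * 2 ^ 20) = ∑ i ∈ Finset.range 511, (1 + 14 * 2 ^ 20 : ℝ) := by
    rw [Finset.sum_const, Finset.card_range, nsmul_eq_mul]; norm_num
  have key : ∀ i : ℕ, ((LE i * 2 ^ 20 / (1 + i) : ℕ) : ℝ) ≤ 2 ^ 60 * ln ((1 + i : ℕ) : ℝ) / ((1 + i : ℕ) : ℝ) ∧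
      2 ^ 60 * ln ((1 + i : ℕ) : ℝ) / ((1 + i : ℕ) : ℝ) ≤ ((LE i * 2 ^ 20 / (1 + i) : ℕ) : ℝ) + (1 + 14 * 2 ^ 20) := by
    intro i
    have h := Nat.floor_div_eq_div (K := ℝ) (LE i * 2 ^ 20) (1 + i)
    rw [← h]
    have e : ((LE i * 2 ^ 20 : ℕ) : ℝ) = LE i * 2 ^ 20 := by push_cast; ring
    rw [e]
    obtain ⟨h1, h2⟩ := LE_bd i
    have e2 : ((1 + i : ℕ) : ℝ) = i + 1 := by push_cast; ring
    rw [e2]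
    have hi : (0 : ℝ) < (i : ℝ) + 1 := Nat.cast_add_one_pos i
    have hL0 : (0 : ℝ) ≤ LE i := Nat.cast_nonneg _
    generalize (LE i : ℝ) = x at *
    have hf : ((⌊x * 2 ^ 20 / ((i : ℝ) + 1)⌋₊ : ℕ) : ℝ) ≤ x * 2 ^ 20 / ((i : ℝ) + 1) :=
      Nat.floor_le (div_nonneg (mul_nonneg hL0 (by norm_num)) hi.le)
    have hf2 := (Nat.lt_floor_add_one (x * 2 ^ 20 / ((i : ℝ) + 1))).le
    constructor
    · refine hf.trans (div_le_div_of_nonneg_right ?_ hi.le)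
      linarith
    · have : 2 ^ 60 * ln ((i : ℝ) + 1) / ((i : ℝ) + 1) ≤ x * 2 ^ 20 / ((i : ℝ) + 1) + 14 * 2 ^ 20 := by
        rw [div_add' _ _ _ hi.ne']
        refine div_le_div_of_nonneg_right ?_ hi.le
        linarith
      linarith
  have hm : ∀ i, (0 : ℝ) ≤ mv m (1 + i) 1 ∧ (mv m (1 + i) 1 : ℝ) ≤ 1 :=
    fun i => ⟨Nat.cast_nonneg _, by exact_mod_cast mv_le _ _⟩
  have e3 : ∀ i : ℕ, (2 : ℝ) ^ 60 * ((mv m (1 + i) 1 : ℝ) * ln ((1 + i : ℕ) : ℝ) / ((1 + i : ℕ) : ℝ)) =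
    (mv m (1 + i) 1 : ℝ) * (2 ^ 60 * ln ((1 + i : ℕ) : ℝ) / ((1 + i : ℕ) : ℝ)) := fun i => by ring
  constructor
  · rw [e, mul_sum]
    refine sum_le_sum fun i _ => ?_
    rw [e3]
    exact mul_le_mul_of_nonneg_left (key i).1 (hm i).1
  · rw [e, e1, mul_sum, ← sum_add_distrib]
    refine sum_le_sum fun i _ => ?_
    rw [e3]
    have := mul_le_mul_of_nonneg_left (key i).2 (hm i).1
    have h2 := mul_le_mul_of_nonneg_right (hm i).2 (show (0 : ℝ) ≤ 1 + 14 * 2 ^ 20 by norm_num)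
    linarith

lemma sum_Ioc0 (n : ℕ) (g : ℕ → ℝ) : ∑ d ∈ Finset.Ioc 0 n, g d = ∑ i ∈ Finset.range n, g (1 + i) := by
  induction n with
  | zero => simp
  | succ n ih => rw [Finset.sum_Ioc_succ_top (by omega), ih, sum_range_succ, add_comm 1 n]

noncomputable def sumF (m : ℕ) (g : ℕ → ℝ) : ℝ := ∑ i ∈ Finset.range 511, (mv m (1 + i) 1 : ℝ) * g (1 + i)

noncomputable def qF : ℝ := -512 * (sumF mP (fun d => 1 / (d : ℝ)) - sumF mN (fun d => 1 / (d : ℝ)))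

noncomputable def nuF (d : ℕ) : ℝ := if d = 512 then qF else (mv mP d 1 : ℝ) - mv mN d 1

lemma sum_nuF (g : ℕ → ℝ) : ∑ d ∈ Finset.Ioc 0 512, nuF d * g d = sumF mP g - sumF mN g + qF * g 512 := by
  rw [sum_Ioc0, sum_range_succ, sumF, sumF, ← Finset.sum_sub_distrib]
  have h1 : ∑ i ∈ Finset.range 511, nuF (1 + i) * g (1 + i) =
      ∑ i ∈ Finset.range 511, ((mv mP (1 + i) 1 : ℝ) * g (1 + i) - (mv mN (1 + i) 1 : ℝ) * g (1 + i)) := by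
    refine sum_congr rfl fun i hi => ?_
    have := Finset.mem_range.1 hi
    rw [nuF, if_neg (by omega)]
    exact sub_mul _ _ _
  rw [h1, nuF, if_pos (by norm_num)]

lemma nuF_zero : ∑ d ∈ Finset.Ioc 0 512, nuF d / d = 0 := by
  have := sum_nuF (fun d => 1 / (d : ℝ))
  simp only [mul_one_div] at this
  rw [this]
  simp only [qF]
  push_cast
  ring

lemma sumR_bd : (-0.00456388 : ℝ) ≤ sumF mP (fun d => 1 / (d : ℝ)) - sumF mN (fun d => 1 / (d : ℝ)) ∧
    153138 ≤ 65536 * qF ∧ 65536 * qF ≤ 153139 ∧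
    sumF mP (fun d => 1 / (d : ℝ)) - sumF mN (fun d => 1 / (d : ℝ)) ≤ -0.00456387 := by
  have h1 := sR_bd mP
  have h2 := sR_bd mN
  rw [sR_P] at h1
  rw [sR_N] at h2
  have e : ∀ m, sumF m (fun d => 1 / (d : ℝ)) =
      ∑ i ∈ Finset.range 511, (mv m (1 + i) 1 : ℝ) / ((1 + i : ℕ) : ℝ) := by
    intro m; unfold sumF; exact sum_congr rfl fun i _ => by ring
  rw [← e] at h1 h2
  unfold qF
  generalize sumF mP (fun d => 1 / (d : ℝ)) = x at *
  generalize sumF mN (fun d => 1 / (d : ℝ)) = y at *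
  obtain ⟨h1, h1'⟩ := h1
  obtain ⟨h2, h2'⟩ := h2
  norm_num at h1 h1' h2 h2' ⊢
  refine ⟨?_, ?_, ?_, ?_⟩ <;> linarith

lemma nuF_main : 0.9993 ≤ -∑ d ∈ Finset.Ioc 0 512, nuF d * ln d / d ∧
    -∑ d ∈ Finset.Ioc 0 512, nuF d * ln d / d ≤ 0.9994 := by
  have e0 : ∑ d ∈ Finset.Ioc 0 512, nuF d * ln d / d =
      sumF mP (fun d => ln d / d) - sumF mN (fun d => ln d / d) + qF * (ln 512 / 512) := by
    rw [← Nat.cast_ofNat (n := 512) (R := ℝ), ← sum_nuF (fun d => ln d / d)]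
    exact sum_congr rfl fun d _ => by ring
  have h1 := sX_bd mP
  have h2 := sX_bd mN
  rw [sX_P] at h1
  rw [sX_N] at h2
  have e : ∀ m, sumF m (fun d => ln d / d) =
      ∑ i ∈ Finset.range 511, (mv m (1 + i) 1 : ℝ) * ln ((1 + i : ℕ) : ℝ) / ((1 + i : ℕ) : ℝ) := by
    intro m; unfold sumF; exact sum_congr rfl fun i _ => by ring
  rw [← e] at h1 h2
  have h3 := sumR_bd
  rw [e0]
  generalize sumF mP (fun d => ln d / d) = x at *
  generalize sumF mN (fun d => ln d / d) = y at *
  obtain ⟨h1, h1'⟩ := h1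
  obtain ⟨h2, h2'⟩ := h2
  obtain ⟨-, h4, h5, -⟩ := h3
  have h6 := Real.log_two_gt_d9
  have h7 := log_two_lt_d9
  have e9 : ln 512 = 9 * ln 2 := by
    rw [show (512 : ℝ) = 2 ^ 9 by norm_num, Real.log_pow]; norm_num
  rw [e9]
  have h8 : qF * (9 * ln 2 / 512) ≤ 153139 / 65536 * (9 * 0.6931471808 / 512) := by
    apply mul_le_mul (by linarith) (by linarith) (by linarith) (by norm_num)
  have h9 : 153138 / 65536 * (9 * 0.6931471803 / 512) ≤ qF * (9 * ln 2 / 512) := by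
    apply mul_le_mul (by linarith) (by linarith) (by norm_num) (by linarith)
  norm_num at h1 h1' h2 h2' h8 h9 ⊢
  constructor <;> linarith only [h1, h1', h2, h2', h8, h9]

def cntM (m : ℕ) : ℕ := sumK (fun d => mv m d 1) 511 1 0
set_option maxRecDepth 100000 in
lemma cntM_le : ble (Nat.add (cntM mP) (cntM mN)) 314 = true := by decide +kernel

lemma nuF_abs : ∑ d ∈ Finset.Ioc 0 512, |nuF d| ≤ 316.5 := by
  rw [sum_Ioc0, sum_range_succ]
  have h1 : ∑ i ∈ Finset.range 511, |nuF (1 + i)| ≤ 314 := by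
    have h := Nat.le_of_ble_eq_true cntM_le
    have e : ((Nat.add (cntM mP) (cntM mN) : ℕ) : ℝ) =
        ∑ i ∈ Finset.range 511, ((mv mP (1 + i) 1 : ℝ) + mv mN (1 + i) 1) := by
      unfold cntM
      rw [sumK_eq, sumK_eq, sum_add_distrib]
      simp only [Nat.add_eq, zero_add]
      push_cast
      rfl
    have h' : ((Nat.add (cntM mP) (cntM mN) : ℕ) : ℝ) ≤ 314 := by exact_mod_cast h
    rw [e] at h'
    refine le_trans (sum_le_sum fun i hi => ?_) h'
    have := Finset.mem_range.1 hi
    rw [nuF, if_neg (by omega)]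
    refine (abs_sub _ _).trans ?_
    rw [Nat.abs_cast, Nat.abs_cast]
  have h2 : |nuF (1 + 511)| ≤ 2.5 := by
    have := sumR_bd
    rw [nuF, if_pos (by norm_num), abs_le]
    constructor <;> linarith [this.2.1, this.2.2.1]
  linarith

lemma Fw_nuF (k : ℕ) : Fw (Finset.Ioc 0 512) nuF k = (dg mP k : ℝ) - dg mN k + qF * ((k / 512 : ℕ) : ℝ) := by
  unfold Fw
  rw [sum_nuF (fun d => ((k / d : ℕ) : ℝ))]
  have e : ∀ m, sumF m (fun d => ((k / d : ℕ) : ℝ)) = dg m k := by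
    intro m; unfold sumF dg; rw [Nat.cast_sum]
    exact sum_congr rfl fun i _ => (Nat.cast_mul _ _).symm
  rw [e, e]

lemma Fw_abs (k : ℕ) : |Fw (Finset.Ioc 0 512) nuF k| ≤ 316.5 := by
  refine le_trans ?_ nuF_abs
  have e : Fw (Finset.Ioc 0 512) nuF k = ∑ d ∈ Finset.Ioc 0 512, nuF d * (((k / d : ℕ) : ℝ) - k / d) := by
    have h0 : (k : ℝ) * ∑ d ∈ Finset.Ioc 0 512, nuF d / d = 0 := by rw [nuF_zero, mul_zero]
    rw [mul_sum] at h0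
    unfold Fw
    rw [← sub_zero (∑ d ∈ Finset.Ioc 0 512, nuF d * ((k / d : ℕ) : ℝ)), ← h0, ← Finset.sum_sub_distrib]
    exact sum_congr rfl fun d _ => by ring
  rw [e]
  refine (Finset.abs_sum_le_sum_abs _ _).trans (sum_le_sum fun d _ => ?_)
  rw [abs_mul]
  refine mul_le_of_le_one_right (abs_nonneg _) ?_
  rw [← Nat.floor_div_eq_div (K := ℝ), abs_le]
  have h1 := Nat.floor_le (show (0 : ℝ) ≤ (k : ℝ) / d by positivity)
  have h2 := Nat.lt_floor_add_one ((k : ℝ) / d)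
  constructor <;> linarith

noncomputable def cU (j : ℕ) : ℝ :=
  if j = 512 then 8.75 else if j = 1024 then 3.75 else if j = 32768 then 1 else 304

noncomputable def cL (j : ℕ) : ℝ := if j = 512 then 10.5 else if j = 4096 then 3.75 else 304

lemma fine_upper (k : ℕ) (hk : 1 ≤ k) : 1 ≤ Fw (Finset.Ioc 0 512) nuF k +
    ∑ j ∈ ({512, 1024, 32768, 131072} : Finset ℕ), cU j * (if j ≤ k then 1 else 0) := by
  have e : ∑ j ∈ ({512, 1024, 32768, 131072} : Finset ℕ), cU j * (if j ≤ k then 1 else 0) =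
      8.75 * (if 512 ≤ k then 1 else 0) + (3.75 * (if 1024 ≤ k then 1 else 0) +
        (1 * (if 32768 ≤ k then 1 else 0) + 304 * (if 131072 ≤ k then 1 else 0))) := by
    rw [sum_insert (by simp), sum_insert (by simp), sum_insert (by simp),
      Finset.sum_singleton]
    simp only [cU]
    norm_num
  rw [e]
  rcases lt_or_ge k 131072 with h | h
  · have hc := chkU_spec 48 131072 (by norm_num) (by norm_num) le_rfl (by norm_num) (chkB_spec _ _ chkB_true).1 k h
    rw [Fw_nuF, if_neg (by omega : ¬ 131072 ≤ k)]
    rw [if_pos hk] at hc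
    have hc' : (65536 * (dg mN k : ℝ) + 65536) ≤ 65536 * dg mP k + (153138 * ((k / 512 : ℕ) : ℝ) +
        (573440 * (if 512 ≤ k then 1 else 0) + (245760 * (if 1024 ≤ k then 1 else 0) +
          65536 * (if 32768 ≤ k then 1 else 0)))) := by exact_mod_cast hc
    have hq := mul_le_mul_of_nonneg_right sumR_bd.2.1 (Nat.cast_nonneg (α := ℝ) (k / 512))
    generalize (if 512 ≤ k then (1 : ℝ) else 0) = i1 at *
    generalize (if 1024 ≤ k then (1 : ℝ) else 0) = i2 at *
    generalize (if 32768 ≤ k then (1 : ℝ) else 0) = i3 at *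
    generalize (dg mP k : ℝ) = dp at *
    generalize (dg mN k : ℝ) = dn at *
    generalize qF = qf at *
    generalize ((k / 512 : ℕ) : ℝ) = kk at *
    clear hc
    norm_num
    linarith only [hc', hq]
  · have := abs_le.1 (Fw_abs k)
    rw [if_pos (by omega), if_pos (by omega), if_pos (by omega), if_pos (by omega)]
    norm_num at this ⊢
    linarith [this.1]

lemma fine_lower (k : ℕ) (_hk : 1 ≤ k) : Fw (Finset.Ioc 0 512) nuF k ≤ 1 +
    ∑ j ∈ ({512, 4096, 131072} : Finset ℕ), cL j * (if j ≤ k then 1 else 0) := by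
  have e : ∑ j ∈ ({512, 4096, 131072} : Finset ℕ), cL j * (if j ≤ k then 1 else 0) =
      10.5 * (if 512 ≤ k then 1 else 0) + (3.75 * (if 4096 ≤ k then 1 else 0) +
        304 * (if 131072 ≤ k then 1 else 0)) := by
    rw [sum_insert (by simp), sum_insert (by simp), Finset.sum_singleton]
    simp only [cL]
    norm_num
  rw [e]
  rcases lt_or_ge k 131072 with h | h
  · have hc := chkL_spec 48 131072 (by norm_num) (by norm_num) le_rfl (by norm_num) (chkB_spec _ _ chkB_true).2 k h
    rw [Fw_nuF, if_neg (by omega : ¬ 131072 ≤ k)]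
    rw [if_pos (Nat.zero_le k)] at hc
    have hc' : 65536 * (dg mP k : ℝ) + 153139 * ((k / 512 : ℕ) : ℝ) ≤ 65536 * dg mN k + (65536 +
        (688128 * (if 512 ≤ k then 1 else 0) + 245760 * (if 4096 ≤ k then 1 else 0))) := by exact_mod_cast hc
    have hq := mul_le_mul_of_nonneg_right sumR_bd.2.2.1 (Nat.cast_nonneg (α := ℝ) (k / 512))
    generalize (if 512 ≤ k then (1 : ℝ) else 0) = i1 at *
    generalize (if 4096 ≤ k then (1 : ℝ) else 0) = i2 at *
    generalize (dg mP k : ℝ) = dp at *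
    generalize (dg mN k : ℝ) = dn at *
    generalize qF = qf at *
    generalize ((k / 512 : ℕ) : ℝ) = kk at *
    clear hc
    norm_num
    linarith only [hc', hq]
  · have := abs_le.1 (Fw_abs k)
    rw [if_pos (by omega), if_pos (by omega), if_pos (by omega)]
    norm_num at this ⊢
    linarith [this.2]

lemma psN_div_le (M j : ℕ) : psN (M / j) ≤ 1.12 * (M / j) := by
  refine (psN_crude _).trans ?_
  exact mul_le_mul_of_nonneg_left Nat.cast_div_le (by norm_num)

lemma psN_fine (M : ℕ) (hM : 512 ≤ M) :
    psN M ≤ 1.0254 * M + 316.5 * (1 + ln M) ∧ 0.9726 * M - 316.5 * (1 + ln M) ≤ psN M := by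
  have hA := Aw_bound (Finset.Ioc 0 512) nuF 512 (by simp) nuF_zero M hM (by omega)
  have hM1 : (1 : ℝ) ≤ M := by exact_mod_cast (by omega : 1 ≤ M)
  have hl : 0 ≤ 1 + ln M := by linarith [Real.log_nonneg hM1]
  have hA' := hA.trans (mul_le_mul_of_nonneg_right nuF_abs hl)
  rw [abs_le] at hA'
  have hm := nuF_main
  generalize (-∑ d ∈ Finset.Ioc 0 512, nuF d * ln d / d) = m at *
  have hm1 := mul_le_mul_of_nonneg_right hm.1 (by linarith : (0 : ℝ) ≤ M)
  have hm2 := mul_le_mul_of_nonneg_right hm.2 (by linarith : (0 : ℝ) ≤ M)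
  have hu := ps_upper (Finset.Ioc 0 512) {512, 1024, 32768, 131072} nuF cU (by simp) fine_upper M
  have hlw := ps_lower (Finset.Ioc 0 512) {512, 4096, 131072} nuF cL (by simp) fine_lower M
  rw [sum_insert (by simp), sum_insert (by simp), sum_insert (by simp),
      Finset.sum_singleton] at hu
  rw [sum_insert (by simp), sum_insert (by simp), Finset.sum_singleton] at hlw
  have h1 := psN_div_le M 512
  have h2 := psN_div_le M 1024
  have h3 := psN_div_le M 32768
  have h4 := psN_div_le M 131072
  have h5 := psN_div_le M 4096
  simp only [cU, cL] at hu hlw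
  norm_num at hu hlw h1 h2 h3 h4 h5 hm1 hm2 hA' ⊢
  obtain ⟨hA1, hA2⟩ := hA'
  generalize ln (M : ℝ) = l at *
  constructor
  · linarith only [hu, h1, h2, h3, h4, hm2, hA2]
  · linarith only [hlw, h1, h4, h5, hm1, hA1]

lemma hel : ∀ u : ℝ, 20 ≤ u → |W u - 1| ≤ 0.029 := by
  intro u hu
  have hexp : 480000000 + 10000000 * (u - 20) ≤ rexp u := by
    have h1 : rexp u = rexp 20 * rexp (u - 20) := by rw [← Real.exp_add]; ring_nf
    have h2 : (480000000 : ℝ) ≤ rexp 20 := by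
      have : rexp 20 = rexp 1 ^ 20 := by rw [← Real.exp_nat_mul]; norm_num
      rw [this]
      calc (480000000 : ℝ) ≤ 2.718 ^ 20 := by norm_num
        _ ≤ _ := pow_le_pow_left₀ (by norm_num) (by linarith [Real.exp_one_gt_d9]) _
    have h3 := add_one_le_exp (u - 20)
    rw [h1]
    have h4 : (480000000 : ℝ) * (u - 20 + 1) ≤ rexp 20 * rexp (u - 20) :=
      mul_le_mul h2 h3 (by linarith) (by positivity)
    norm_num at h4 ⊢
    linarith
  set x := rexp u with hx
  have hx0 : 0 < x := Real.exp_pos u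
  have hM512 : 512 ≤ ⌊x⌋₊ := Nat.le_floor (by norm_num at hexp ⊢; linarith)
  obtain ⟨h1, h2⟩ := psN_fine ⌊x⌋₊ hM512
  have hM1 : (512 : ℝ) ≤ (⌊x⌋₊ : ℝ) := by exact_mod_cast hM512
  have hfl := Nat.floor_le hx0.le
  have hlt := Nat.lt_floor_add_one x
  have hlog : ln (⌊x⌋₊ : ℝ) ≤ u := by
    have := log_le_log (by linarith) hfl
    rwa [hx, Real.log_exp] at this
  have hW : W u = psN ⌊x⌋₊ / x := by
    rw [W, Real.exp_neg, ← div_eq_mul_inv, ← hx, Chebyshev.psi_eq_psi_coe_floor, psN_eq]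
  rw [hW, abs_le]
  norm_num at hexp h1 h2 ⊢
  constructor
  · rw [← sub_nonneg]
    have : 0.971 * x ≤ psN ⌊x⌋₊ := by norm_num; linarith only [h2, hlt, hlog, hexp, hu]
    have h3 : 0.971 ≤ psN ⌊x⌋₊ / x := by rw [le_div_iff₀ hx0]; exact this
    norm_num at h3 ⊢
    linarith
  · have : psN ⌊x⌋₊ ≤ 1.029 * x := by norm_num; linarith only [h1, hfl, hlog, hexp, hu]
    have h3 : psN ⌊x⌋₊ / x ≤ 1.029 := by rw [div_le_iff₀ hx0]; exact this
    norm_num at h3 ⊢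
    linarith

/-! Fixed-point complex arithmetic, scale `2^64`, each component biased by `2^66`. -/

def sqRe (A B : ℕ) : ℕ :=
  shiftRight (Nat.sub (Nat.add (Nat.mul B (Nat.sub 147573952589676412928 B))
    1361129467683753853853498429727072845824) (Nat.mul A (Nat.sub 147573952589676412928 A))) 64

def sqIm (A B : ℕ) : ℕ :=
  shiftRight (Nat.sub (Nat.add (Nat.mul A B) 6125082604576892342340742933771827806208)
    (shiftLeft (Nat.add A B) 66)) 63

def sqc {α : Type} (k : ℕ) : ℕ → ℕ → (ℕ → ℕ → α) → α :=
  Nat.rec (fun A B f => f A B)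
    (fun _ ih A B f => frc (sqRe A B) fun A' => frc (sqIm A B) fun B' => ih A' B' f) k

def exRe (zr zi : ℕ) : ℕ :=
  Nat.sub (Nat.add (Nat.add 73786976294838206464 18446744073709551616) (shiftRight (Nat.mul zr zr) 65))
    (Nat.add zr (shiftRight (Nat.mul zi zi) 65))

def exIm (zr zi : ℕ) : ℕ :=
  Nat.sub (Nat.add 73786976294838206464 (shiftRight (Nat.mul zr zi) 64)) zi

def expK {α : Type} (k a b L : ℕ) (f : ℕ → ℕ → α) : α :=
  frc (shiftRight (Nat.mul L a) (Nat.add 4 k)) fun zr =>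
  frc (shiftRight (Nat.mul L b) (Nat.add 4 k)) fun zi =>
  frc (exRe zr zi) fun A => frc (exIm zr zi) fun B => sqc k A B f

def dblS {α : Type} (ih : ℕ → ℕ → ℕ → ℕ → ℕ → ℕ → ℕ → (ℕ → ℕ → ℕ → ℕ → α) → α)
    (sh U V A B C D : ℕ) (f : ℕ → ℕ → ℕ → ℕ → α) (u v E1 E2 E3 E4 F1 F2 F3 F4 : ℕ) : α :=
  frc (sqRe U V) fun U' => frc (sqIm U V) fun V' =>
  ih (Nat.add sh sh) U' V'
    (Nat.add (shiftLeft A 15) (shiftLeft (Nat.add (Nat.mul u E1) (Nat.mul v F1)) sh))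
    (Nat.add (shiftLeft B 15) (shiftLeft (Nat.add (Nat.mul u E2) (Nat.mul v F2)) sh))
    (Nat.add (shiftLeft C 15) (shiftLeft (Nat.add (Nat.mul u E3) (Nat.mul v F3)) sh))
    (Nat.add (shiftLeft D 15) (shiftLeft (Nat.add (Nat.mul u E4) (Nat.mul v F4)) sh)) f

def dbl {α : Type} (r : ℕ) : ℕ → ℕ → ℕ → ℕ → ℕ → ℕ → ℕ → (ℕ → ℕ → ℕ → ℕ → α) → α :=
  Nat.rec (fun _ _ _ A B C D f => f A B C D)
   (fun _ ih sh U V A B C D f =>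
      Bool.rec
       (Bool.rec
         (dblS ih sh U V A B C D f (shiftRight (Nat.sub 73786976294838206464 U) 49)
            (shiftRight (Nat.sub 73786976294838206464 V) 49) B A D C C D B A)
         (dblS ih sh U V A B C D f (shiftRight (Nat.sub 73786976294838206464 U) 49)
            (shiftRight (Nat.sub V 73786976294838206464) 49) B A D C D C A B)
          (ble 73786976294838206464 V))
       (Bool.rec
         (dblS ih sh U V A B C D f (shiftRight (Nat.sub U 73786976294838206464) 49)
            (shiftRight (Nat.sub 73786976294838206464 V) 49) A B C D C D B A)
         (dblS ih sh U V A B C D f (shiftRight (Nat.sub U 73786976294838206464) 49)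
            (shiftRight (Nat.sub V 73786976294838206464) 49) A B C D D C A B)
          (ble 73786976294838206464 V))
       (ble 73786976294838206464 U)) r

/-- loop over odd `n = 2j+1`, `L ≈ 2^64 log n` -/
def outer {α : Type} (b K : ℕ) : ℕ → ℕ → ℕ → ℕ → ℕ → ℕ → (ℕ → ℕ → ℕ → ℕ → α) → α :=
  Nat.rec (fun _ _ A B C D f => f A B C D)
   (fun _ ih j L A B C D f =>
     expK 33 14 b L fun qa qb => expK 14 0 1 L fun wa wb =>
     dbl 10 176 wa wb (shiftRight (Nat.sub qa 73786976294838206464) 43)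
       (shiftRight (Nat.sub 73786976294838206464 qa) 43)
       (shiftRight (Nat.sub qb 73786976294838206464) 43)
       (shiftRight (Nat.sub 73786976294838206464 qb) 43) fun A' B' C' D' =>
     frc (Nat.add A A') fun A'' => frc (Nat.add B B') fun B'' =>
     frc (Nat.add C C') fun C'' => frc (Nat.add D D') fun D'' =>
     frc (Nat.add L (dlogK 64 22 (Nat.succ (Nat.succ (Nat.mul 2 j))))) fun L' =>
     frc (Nat.succ j) fun j' => ih j' L' A'' B'' C'' D'' f) K

def finB (thr A B : ℕ) : Bool :=
  frc (Nat.div (Nat.sub (Nat.pow 2 180224) 1) (Nat.sub (Nat.pow 2 176) 1)) fun G =>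
  Nat.beq (Nat.land (Nat.sub (Nat.add A (Nat.mul (Nat.sub (Nat.pow 2 175) thr) G)) B) (shiftLeft G 175))
    (shiftLeft G 175)

/-- `0.285 * 2^171` -/
def thrK : ℕ := Nat.div (Nat.mul 285 (Nat.pow 2 171)) 1000

def chunkB (c : ℕ) : Bool :=
  outer (Nat.succ (Nat.mul 1023 c)) (Nat.mul 16 (Nat.succ c)) 0 0 0 0 0 0 fun A B _ _ => finB thrK A B

noncomputable def cv (A B : ℕ) : ℂ := ⟨(A : ℝ) - 2 ^ 66, (B : ℝ) - 2 ^ 66⟩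

lemma sqRe_eq (A B : ℕ) (hA : |(A : ℤ) - 2 ^ 66| ≤ 2 ^ 65) (hB : |(B : ℤ) - 2 ^ 66| ≤ 2 ^ 65) :
    (sqRe A B : ℤ) - 2 ^ 66 = (((A : ℤ) - 2 ^ 66) ^ 2 - ((B : ℤ) - 2 ^ 66) ^ 2) / 2 ^ 64 := by
  have e : sqRe A B = (B * (2 ^ 67 - B) + 2 ^ 130 - A * (2 ^ 67 - A)) / 2 ^ 64 := by
    unfold sqRe
    rw [← Nat.shiftRight_eq_div_pow]
    rfl
  have hA1 := (abs_le.1 hA).2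
  have hB1 := (abs_le.1 hB).2
  obtain ⟨A', hA'⟩ := Nat.exists_eq_add_of_le (show A ≤ 2 ^ 67 by omega)
  obtain ⟨B', hB'⟩ := Nat.exists_eq_add_of_le (show B ≤ 2 ^ 67 by omega)
  rw [show 2 ^ 67 - B = B' by omega, show 2 ^ 67 - A = A' by omega] at e
  have eA : (A' : ℤ) = 2 ^ 67 - A := by omega
  have eB : (B' : ℤ) = 2 ^ 67 - B := by omega
  have h1 : A * A' ≤ B * B' + 2 ^ 130 := by
    zify
    rw [eA, eB]
    have : ((B : ℤ) - 2 ^ 66) ^ 2 ≤ (2 ^ 65) ^ 2 := sq_le_sq' (by linarith [(abs_le.1 hB).1]) (abs_le.1 hB).2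
    linarith only [this, sq_nonneg ((A : ℤ) - 2 ^ 66)]
  have e2 : (sqRe A B : ℤ) = ((B * B' + 2 ^ 130 - A * A' : ℕ) : ℤ) / 2 ^ 64 := by
    rw [e]; push_cast; rfl
  rw [e2, Nat.cast_sub h1]
  simp only [Nat.cast_add, Nat.cast_mul, Nat.cast_pow, Nat.cast_ofNat]
  have e3 : (B : ℤ) * B' + 2 ^ 130 - A * A' =
      (((A : ℤ) - 2 ^ 66) ^ 2 - ((B : ℤ) - 2 ^ 66) ^ 2) + 2 ^ 66 * 2 ^ 64 := by rw [eA, eB]; ring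
  rw [e3, Int.add_mul_ediv_right _ _ (by norm_num)]
  ring

lemma sqIm_eq (A B : ℕ) (hAB : ((A : ℤ) - 2 ^ 66) ^ 2 + ((B : ℤ) - 2 ^ 66) ^ 2 ≤ 2 ^ 130) :
    (sqIm A B : ℤ) - 2 ^ 66 = (2 * ((A : ℤ) - 2 ^ 66) * ((B : ℤ) - 2 ^ 66)) / 2 ^ 64 := by
  have e : sqIm A B = (A * B + (2 ^ 129 + 2 ^ 132) - (A + B) * 2 ^ 66) / 2 ^ 63 := by
    unfold sqIm
    rw [← Nat.shiftRight_eq_div_pow, ← Nat.shiftLeft_eq]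
    rfl
  have h0 : -(2 ^ 130) ≤ 2 * ((A : ℤ) - 2 ^ 66) * ((B : ℤ) - 2 ^ 66) := by
    have h3 := sq_nonneg (((A : ℤ) - 2 ^ 66) + ((B : ℤ) - 2 ^ 66))
    linarith only [hAB, h3]
  have h1 : (A + B) * 2 ^ 66 ≤ A * B + (2 ^ 129 + 2 ^ 132) := by
    zify
    linarith only [h0]
  have e2 : (sqIm A B : ℤ) = ((A * B + (2 ^ 129 + 2 ^ 132) - (A + B) * 2 ^ 66 : ℕ) : ℤ) / 2 ^ 63 := by
    rw [e]; push_cast; rfl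
  rw [e2, Nat.cast_sub h1]
  simp only [Nat.cast_add, Nat.cast_mul, Nat.cast_pow, Nat.cast_ofNat]
  have e3 : (A : ℤ) * B + (2 ^ 129 + 2 ^ 132) - (A + B) * 2 ^ 66 =
      ((A : ℤ) - 2 ^ 66) * ((B : ℤ) - 2 ^ 66) + 2 ^ 66 * 2 ^ 63 := by ring
  rw [e3, Int.add_mul_ediv_right _ _ (by norm_num), mul_assoc, show (2 : ℤ) ^ 64 = 2 * 2 ^ 63 by norm_num,
    Int.mul_ediv_mul_of_pos _ _ (by norm_num)]
  ring

lemma ediv_err (x : ℤ) : |((x / 2 ^ 64 : ℤ) : ℝ) - (x : ℝ) / 2 ^ 64| ≤ 1 := by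
  have h1 := Int.mul_ediv_self_le (x := x) (k := 2 ^ 64) (by norm_num)
  have h2 := Int.lt_mul_ediv_self_add (x := x) (k := 2 ^ 64) (by norm_num)
  have h1' : (2 : ℝ) ^ 64 * ((x / 2 ^ 64 : ℤ) : ℝ) ≤ x := by exact_mod_cast h1
  have h2' : (x : ℝ) < (2 : ℝ) ^ 64 * ((x / 2 ^ 64 : ℤ) : ℝ) + 2 ^ 64 := by exact_mod_cast h2
  generalize ((x / 2 ^ 64 : ℤ) : ℝ) = q at *
  have e : (x : ℝ) / 2 ^ 64 * 2 ^ 64 = x := by field_simp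
  generalize (x : ℝ) / 2 ^ 64 = w at *
  rw [abs_le]
  constructor <;> linarith

lemma norm_le_two {z : ℂ} (h1 : |z.re| ≤ 1) (h2 : |z.im| ≤ 1) : ‖z‖ ≤ 2 :=
  (Complex.norm_le_abs_re_add_abs_im z).trans (by linarith)

lemma sq_err {A B : ℕ} {y : ℂ} {d : ℝ} (hy : ‖y‖ ≤ 1) (hd : d ≤ 2 ^ 44) (h : ‖cv A B - 2 ^ 64 * y‖ ≤ d) :
    ‖cv (sqRe A B) (sqIm A B) - 2 ^ 64 * y ^ 2‖ ≤ (2 + 1 / 2 ^ 20) * d + 2 := by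
  have hd0 : 0 ≤ d := (norm_nonneg _).trans h
  set x := cv A B with hx
  have n2 : ‖(2 : ℂ) ^ 64‖ = 2 ^ 64 := by simp
  have hny : ‖(2 : ℂ) ^ 64 * y‖ ≤ 2 ^ 64 := by
    rw [norm_mul, n2]; nlinarith [norm_nonneg y]
  have hxn : ‖x‖ ≤ 2 ^ 65 := by
    have : x = (x - 2 ^ 64 * y) + 2 ^ 64 * y := by ring
    rw [this]
    refine (norm_add_le _ _).trans ?_
    linarith
  have hA : |(A : ℤ) - 2 ^ 66| ≤ 2 ^ 65 := by
    have := (abs_re_le_norm x).trans hxn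
    simp only [hx, cv] at this
    exact_mod_cast this
  have hB : |(B : ℤ) - 2 ^ 66| ≤ 2 ^ 65 := by
    have := (abs_im_le_norm x).trans hxn
    simp only [hx, cv] at this
    exact_mod_cast this
  have hAB : ((A : ℤ) - 2 ^ 66) ^ 2 + ((B : ℤ) - 2 ^ 66) ^ 2 ≤ 2 ^ 130 := by
    have h1 : ‖x‖ ^ 2 ≤ (2 ^ 65) ^ 2 := pow_le_pow_left₀ (norm_nonneg _) hxn 2
    rw [Complex.sq_norm, normSq_apply] at h1
    have h2 : ((A : ℝ) - 2 ^ 66) ^ 2 + ((B : ℝ) - 2 ^ 66) ^ 2 ≤ 2 ^ 130 := by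
      simp only [hx, cv] at h1
      linarith only [h1]
    exact_mod_cast h2
  have h1 : ‖cv (sqRe A B) (sqIm A B) - x ^ 2 / 2 ^ 64‖ ≤ 2 := by
    have e64 : x ^ 2 / 2 ^ 64 = ⟨(((A : ℝ) - 2 ^ 66) ^ 2 - ((B : ℝ) - 2 ^ 66) ^ 2) / 2 ^ 64,
        (2 * ((A : ℝ) - 2 ^ 66) * ((B : ℝ) - 2 ^ 66)) / 2 ^ 64⟩ := by
      have e1 : (2 : ℂ) ^ 64 = (((2 : ℝ) ^ 64 : ℝ) : ℂ) := by push_cast; rfl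
      rw [e1]
      apply Complex.ext
      · rw [div_ofReal_re]; simp [hx, cv, pow_two]
      · rw [div_ofReal_im]; simp [hx, cv, pow_two]; ring
    rw [e64]
    apply norm_le_two
    · have h1 := ediv_err (((A : ℤ) - 2 ^ 66) ^ 2 - ((B : ℤ) - 2 ^ 66) ^ 2)
      rw [← sqRe_eq A B hA hB] at h1
      simp only [cv, sub_re]
      simp only [Int.cast_sub, Int.cast_mul, Int.cast_pow, Int.cast_natCast, Int.cast_ofNat] at h1
      exact h1
    · have h1 := ediv_err (2 * ((A : ℤ) - 2 ^ 66) * ((B : ℤ) - 2 ^ 66))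
      rw [← sqIm_eq A B hAB] at h1
      simp only [cv, sub_im]
      simp only [Int.cast_sub, Int.cast_mul, Int.cast_pow, Int.cast_natCast, Int.cast_ofNat] at h1
      exact h1
  have h2 : ‖x ^ 2 / 2 ^ 64 - 2 ^ 64 * y ^ 2‖ ≤ (2 + 1 / 2 ^ 20) * d := by
    have e : x ^ 2 / 2 ^ 64 - 2 ^ 64 * y ^ 2 = (x - 2 ^ 64 * y) * ((x - 2 ^ 64 * y) + 2 * (2 ^ 64 * y)) / 2 ^ 64 := by
      field_simp; ring
    rw [e, norm_div, norm_mul, n2]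
    have h3 : ‖(x - 2 ^ 64 * y) + 2 * (2 ^ 64 * y)‖ ≤ d + 2 * 2 ^ 64 := by
      refine (norm_add_le _ _).trans (add_le_add h ?_)
      rw [norm_mul]
      have : ‖(2 : ℂ)‖ = 2 := by simp
      rw [this]; linarith
    rw [div_le_iff₀ (by positivity)]
    calc _ ≤ d * (d + 2 * 2 ^ 64) := mul_le_mul h h3 (norm_nonneg _) hd0
      _ ≤ d * (2 ^ 44 + 2 * 2 ^ 64) := mul_le_mul_of_nonneg_left (by linarith) hd0
      _ = _ := by ring
  have : cv (sqRe A B) (sqIm A B) - 2 ^ 64 * y ^ 2 =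
    (cv (sqRe A B) (sqIm A B) - x ^ 2 / 2 ^ 64) + (x ^ 2 / 2 ^ 64 - 2 ^ 64 * y ^ 2) := by ring
  rw [this]
  refine (norm_add_le _ _).trans ?_
  linarith

lemma sqc_spec {α : Type} (k : ℕ) : ∀ (A B : ℕ) (f : ℕ → ℕ → α) (y : ℂ) (d : ℝ), ‖y‖ ≤ 1 →
    (2 + 1 / 2 ^ 20) ^ k * (d + 2) ≤ 2 ^ 44 → ‖cv A B - 2 ^ 64 * y‖ ≤ d →
    ∃ A' B', sqc k A B f = f A' B' ∧ ‖cv A' B' - 2 ^ 64 * y ^ (2 ^ k)‖ ≤ (2 + 1 / 2 ^ 20) ^ k * (d + 2) := by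
  induction k with
  | zero =>
    intro A B f y d hy _ h
    exact ⟨A, B, rfl, by simpa using h.trans (by linarith)⟩
  | succ k ih =>
    intro A B f y d hy hd h
    have hd0 : 0 ≤ d := (norm_nonneg _).trans h
    have e : sqc (k + 1) A B f = frc (sqRe A B) fun A' => frc (sqIm A B) fun B' => sqc k A' B' f := rfl
    rw [e, frc_eq, frc_eq]
    have hk1 : (1 : ℝ) ≤ (2 + 1 / 2 ^ 20) ^ (k + 1) := one_le_pow₀ (by norm_num)
    have hd' : d ≤ 2 ^ 44 := by
      refine le_trans ?_ hd
      nlinarith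
    have h1 := sq_err hy hd' h
    have h2 : (2 + 1 / 2 ^ 20) ^ k * (((2 + 1 / 2 ^ 20) * d + 2) + 2) ≤ (2 + 1 / 2 ^ 20) ^ (k + 1) * (d + 2) := by
      rw [pow_succ (2 + 1 / 2 ^ 20 : ℝ) k, mul_assoc]
      refine mul_le_mul_of_nonneg_left ?_ (by positivity)
      norm_num
      linarith
    obtain ⟨A', B', e1, h3⟩ := ih (sqRe A B) (sqIm A B) f (y ^ 2) ((2 + 1 / 2 ^ 20) * d + 2)
      (by rw [norm_pow]; exact pow_le_one₀ (norm_nonneg _) hy) (h2.trans hd) h1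
    refine ⟨A', B', e1, ?_⟩
    rw [show y ^ 2 ^ (k + 1) = (y ^ 2) ^ 2 ^ k by rw [← pow_mul, ← pow_succ']]
    exact h3.trans h2

lemma shr_err (x k : ℕ) : |((shiftRight x k : ℕ) : ℝ) - (x : ℝ) / 2 ^ k| ≤ 1 := by
  have e : shiftRight x k = x / 2 ^ k := Nat.shiftRight_eq_div_pow x k
  rw [e]
  have h1 : ((x / 2 ^ k : ℕ) : ℝ) ≤ (x : ℝ) / 2 ^ k := by
    have := Nat.cast_div_le (α := ℝ) (m := x) (n := 2 ^ k); push_cast at this; exact this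
  have h2 : (x : ℝ) / 2 ^ k < ((x / 2 ^ k : ℕ) : ℝ) + 1 := by
    rw [div_lt_iff₀ (by positivity)]
    have := Nat.lt_div_mul_add (a := x) (b := 2 ^ k) (by positivity)
    have h3 : x < (x / 2 ^ k + 1) * 2 ^ k := by rw [add_mul, one_mul]; exact this
    exact_mod_cast h3
  rw [abs_le]; constructor <;> linarith

lemma ex_err (zr zi : ℕ) (hr : (zr : ℝ) ≤ 2 ^ 63) (hi : (zi : ℝ) ≤ 2 ^ 63) :
    ‖cv (exRe zr zi) (exIm zr zi) - (2 ^ 64 - (zr + zi * I) + (zr + zi * I) ^ 2 / 2 ^ 65)‖ ≤ 3 := by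
  have hr' : zr ≤ 2 ^ 63 := by exact_mod_cast hr
  have hi' : zi ≤ 2 ^ 63 := by exact_mod_cast hi
  have s1 := shr_err (zr * zr) 65
  have s2 := shr_err (zi * zi) 65
  have s3 := shr_err (zr * zi) 64
  have hs2 : shiftRight (zi * zi) 65 ≤ 2 ^ 63 := by
    rw [show shiftRight (zi * zi) 65 = zi * zi / 2 ^ 65 from Nat.shiftRight_eq_div_pow _ _]
    calc zi * zi / 2 ^ 65 ≤ (2 ^ 63 * 2 ^ 63) / 2 ^ 65 := Nat.div_le_div_right (Nat.mul_le_mul hi' hi')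
      _ ≤ _ := by norm_num
  have e1 : ((exRe zr zi : ℕ) : ℝ) = 2 ^ 66 + 2 ^ 64 + (shiftRight (zr * zr) 65 : ℕ) - (zr + (shiftRight (zi * zi) 65 : ℕ)) := by
    unfold exRe
    simp only [Nat.add_eq, Nat.sub_eq, Nat.mul_eq]
    rw [Nat.cast_sub (by omega)]
    push_cast; norm_num
  have e2 : ((exIm zr zi : ℕ) : ℝ) = 2 ^ 66 + (shiftRight (zr * zi) 64 : ℕ) - zi := by
    unfold exIm
    simp only [Nat.add_eq, Nat.sub_eq, Nat.mul_eq]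
    rw [Nat.cast_sub (by omega)]
    push_cast; norm_num
  have e65 : (2 ^ 64 - ((zr : ℂ) + zi * I) + (zr + zi * I) ^ 2 / 2 ^ 65) =
      ⟨2 ^ 64 - zr + ((zr : ℝ) ^ 2 - zi ^ 2) / 2 ^ 65, - zi + (2 * zr * zi) / 2 ^ 65⟩ := by
    have h1 : (2 : ℂ) ^ 65 = (((2 : ℝ) ^ 65 : ℝ) : ℂ) := by push_cast; rfl
    have h2 : (2 : ℂ) ^ 64 = (((2 : ℝ) ^ 64 : ℝ) : ℂ) := by push_cast; rfl
    rw [h1, h2]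
    apply Complex.ext
    · rw [Complex.add_re, div_ofReal_re, sub_re, Complex.ofReal_re]; simp [pow_two]
    · rw [Complex.add_im, div_ofReal_im, sub_im, Complex.ofReal_im]; simp [pow_two]; ring
  rw [e65]
  refine (Complex.norm_le_abs_re_add_abs_im _).trans ?_
  simp only [cv, sub_re, sub_im]
  rw [e1, e2]
  push_cast at s1 s2 s3
  generalize ((shiftRight (zr * zr) 65 : ℕ) : ℝ) = p1 at *
  generalize ((shiftRight (zi * zi) 65 : ℕ) : ℝ) = p2 at *
  generalize ((shiftRight (zr * zi) 64 : ℕ) : ℝ) = p3 at *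
  rw [abs_le] at s1 s2 s3
  have a1 : |2 ^ 66 + 2 ^ 64 + p1 - (zr + p2) - 2 ^ 66 - (2 ^ 64 - zr + ((zr : ℝ) ^ 2 - zi ^ 2) / 2 ^ 65)| ≤ 2 := by
    rw [abs_le]; constructor <;> linarith
  have a2 : |2 ^ 66 + p3 - zi - 2 ^ 66 - (- zi + (2 * (zr : ℝ) * zi) / 2 ^ 65)| ≤ 1 := by
    rw [abs_le]; constructor <;> linarith
  linarith

lemma exp_cubic {ζ : ℂ} (h : ‖ζ‖ ≤ 1) : ‖(1 - ζ + ζ ^ 2 / 2) - Complex.exp (-ζ)‖ ≤ 0.2223 * ‖ζ‖ ^ 3 := by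
  have := Complex.exp_bound (x := -ζ) (by simpa using h) (n := 3) (by norm_num)
  rw [← norm_neg, neg_sub]
  have e : ∑ m ∈ Finset.range 3, (-ζ) ^ m / (m.factorial : ℂ) = 1 - ζ + ζ ^ 2 / 2 := by
    simp [sum_range_succ, factorial]; ring
  rw [e] at this
  refine this.trans ?_
  rw [norm_neg, mul_comm]
  refine mul_le_mul_of_nonneg_right ?_ (by positivity)
  norm_num [factorial]

lemma expK_spec {α : Type} (k a b L : ℕ) (f : ℕ → ℕ → α) (l e μ ℓ d : ℝ) (hl0 : 0 ≤ l) (hl : l ≤ ℓ)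
    (hL : |(L : ℝ) - 2 ^ 64 * l| ≤ e) (hμ : ‖((a : ℂ) + b * I) / 16‖ ≤ μ) (hρ : μ * ℓ / 2 ^ k ≤ 1 / 4)
    (he : e * μ / 2 ^ k ≤ 2 ^ 60)
    (hd : 2 ^ 64 * 0.2223 * (μ * ℓ / 2 ^ k) ^ 3 + 2 * (2 + e * μ / 2 ^ k) + 3 ≤ d)
    (hdk : (2 + 1 / 2 ^ 20) ^ k * (d + 2) ≤ 2 ^ 44) :
    ∃ A B, expK k a b L f = f A B ∧
      ‖cv A B - 2 ^ 64 * Complex.exp (-(l * (((a : ℂ) + b * I) / 16)))‖ ≤ (2 + 1 / 2 ^ 20) ^ k * (d + 2) := by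
  have he0 : 0 ≤ e := (abs_nonneg _).trans hL
  have hμ0 : 0 ≤ μ := (norm_nonneg _).trans hμ
  have hk0 : (0 : ℝ) < 2 ^ k := by positivity
  have nk : ‖(2 : ℂ) ^ k‖ = 2 ^ k := by simp
  have n64 : ‖(2 : ℂ) ^ 64‖ = 2 ^ 64 := by simp
  set w : ℂ := ((a : ℂ) + b * I) / 16 with hw
  set ζ : ℂ := l * w / 2 ^ k with hζ
  have hζn : ‖ζ‖ ≤ μ * ℓ / 2 ^ k := by
    rw [hζ, norm_div, nk, norm_mul, Complex.norm_real, norm_of_nonneg hl0, mul_comm μ]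
    gcongr
    exact hl0.trans hl
  set zr := shiftRight (Nat.mul L a) (Nat.add 4 k) with hzr
  set zi := shiftRight (Nat.mul L b) (Nat.add 4 k) with hzi
  have e0 : expK k a b L f = sqc k (exRe zr zi) (exIm zr zi) f := by
    unfold expK
    simp only [frc_eq]
    rfl
  have hr := shr_err (Nat.mul L a) (Nat.add 4 k)
  have hi := shr_err (Nat.mul L b) (Nat.add 4 k)
  rw [← hzr] at hr
  rw [← hzi] at hi
  have p4 : (2 : ℝ) ^ (Nat.add 4 k) = 16 * 2 ^ k := by
    rw [Nat.add_eq, pow_add]; norm_num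
  rw [p4] at hr hi
  have hm1 : ((Nat.mul L a : ℕ) : ℝ) = L * a := by rw [Nat.mul_eq]; push_cast; ring
  have hm2 : ((Nat.mul L b : ℕ) : ℝ) = L * b := by rw [Nat.mul_eq]; push_cast; ring
  rw [hm1] at hr
  rw [hm2] at hi
  set z : ℂ := (zr : ℂ) + zi * I with hz
  have h1 : ‖z - L * w / 2 ^ k‖ ≤ 2 := by
    have e1 : z - L * w / 2 ^ k = ⟨(zr : ℝ) - L * a / (16 * 2 ^ k), (zi : ℝ) - L * b / (16 * 2 ^ k)⟩ := by
      have e2 : (L : ℂ) * w / 2 ^ k = ((L * a / (16 * 2 ^ k) : ℝ) : ℂ) + ((L * b / (16 * 2 ^ k) : ℝ) : ℂ) * I := by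
        rw [hw]; push_cast
        have : (2 : ℂ) ^ k ≠ 0 := pow_ne_zero k two_ne_zero
        field_simp
      rw [e2, hz]
      generalize (L * a / (16 * 2 ^ k) : ℝ) = x1
      generalize (L * b / (16 * 2 ^ k) : ℝ) = x2
      apply Complex.ext <;> simp
    rw [e1]
    exact norm_le_two hr hi
  have h2 : ‖(L : ℂ) * w / 2 ^ k - 2 ^ 64 * ζ‖ ≤ e * μ / 2 ^ k := by
    have e1 : (L : ℂ) * w / 2 ^ k - 2 ^ 64 * ζ = (((L : ℝ) - 2 ^ 64 * l : ℝ) : ℂ) * w / 2 ^ k := by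
      rw [hζ]; push_cast; ring
    rw [e1, norm_div, nk, norm_mul, Complex.norm_real, Real.norm_eq_abs]
    gcongr
  have h3 : ‖z - 2 ^ 64 * ζ‖ ≤ 2 + e * μ / 2 ^ k := by
    have : z - 2 ^ 64 * ζ = (z - L * w / 2 ^ k) + (L * w / 2 ^ k - 2 ^ 64 * ζ) := by ring
    rw [this]
    exact (norm_add_le _ _).trans (add_le_add h1 h2)
  have h4 : ‖(2 : ℂ) ^ 64 * ζ‖ ≤ 2 ^ 62 := by
    rw [norm_mul, n64]
    have := hζn.trans hρ
    linarith
  have h5 : ‖z‖ ≤ 2 ^ 63 := by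
    have h50 := norm_add_le (z - 2 ^ 64 * ζ) (2 ^ 64 * ζ)
    rw [sub_add_cancel] at h50
    generalize e * μ / 2 ^ k = q1 at *
    linarith only [h50, h3, h4, he]
  have hzre : (zr : ℝ) ≤ 2 ^ 63 := by
    have := (re_le_norm z).trans h5
    simpa [hz] using this
  have hzim : (zi : ℝ) ≤ 2 ^ 63 := by
    have := (Complex.im_le_norm z).trans h5
    simpa [hz] using this
  have h6 := ex_err zr zi hzre hzim
  rw [← hz] at h6
  have h7 : ‖(2 ^ 64 - z + z ^ 2 / 2 ^ 65) - 2 ^ 64 * (1 - ζ + ζ ^ 2 / 2)‖ ≤ 2 * (2 + e * μ / 2 ^ k) := by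
    have e1 : (2 ^ 64 - z + z ^ 2 / 2 ^ 65) - 2 ^ 64 * (1 - ζ + ζ ^ 2 / 2) =
        (z - 2 ^ 64 * ζ) * ((z + 2 ^ 64 * ζ) / 2 ^ 65 - 1) := by ring
    rw [e1, norm_mul, mul_comm 2]
    refine mul_le_mul h3 ?_ (norm_nonneg _) ((norm_nonneg _).trans h3)
    refine (norm_sub_le _ _).trans ?_
    rw [norm_div]
    have n65 : ‖(2 : ℂ) ^ 65‖ = 2 ^ 65 := by simp
    rw [n65, norm_one]
    have h8 : ‖z + 2 ^ 64 * ζ‖ ≤ 2 ^ 65 := (norm_add_le _ _).trans (by linarith)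
    have : ‖z + 2 ^ 64 * ζ‖ / 2 ^ 65 ≤ 1 := by rw [div_le_one (by positivity)]; exact h8
    linarith
  have h8 : ‖2 ^ 64 * (1 - ζ + ζ ^ 2 / 2) - 2 ^ 64 * Complex.exp (-ζ)‖ ≤ 2 ^ 64 * 0.2223 * (μ * ℓ / 2 ^ k) ^ 3 := by
    rw [← mul_sub, norm_mul, n64, mul_assoc]
    refine mul_le_mul_of_nonneg_left ?_ (by positivity)
    refine (exp_cubic (hζn.trans (by linarith))).trans ?_
    gcongr
  have h9 : ‖cv (exRe zr zi) (exIm zr zi) - 2 ^ 64 * Complex.exp (-ζ)‖ ≤ d := by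
    have : cv (exRe zr zi) (exIm zr zi) - 2 ^ 64 * Complex.exp (-ζ) =
      (cv (exRe zr zi) (exIm zr zi) - (2 ^ 64 - z + z ^ 2 / 2 ^ 65)) +
      (((2 ^ 64 - z + z ^ 2 / 2 ^ 65) - 2 ^ 64 * (1 - ζ + ζ ^ 2 / 2)) +
       (2 ^ 64 * (1 - ζ + ζ ^ 2 / 2) - 2 ^ 64 * Complex.exp (-ζ))) := by ring
    rw [this]
    refine (norm_add_le _ _).trans ?_
    have := norm_add_le ((2 ^ 64 - z + z ^ 2 / 2 ^ 65) - 2 ^ 64 * (1 - ζ + ζ ^ 2 / 2))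
       (2 ^ 64 * (1 - ζ + ζ ^ 2 / 2) - 2 ^ 64 * Complex.exp (-ζ))
    linarith
  have hy : ‖Complex.exp (-ζ)‖ ≤ 1 := by
    rw [norm_exp, Real.exp_le_one_iff]
    have e1 : ζ = ((l / 2 ^ k / 16 * a : ℝ) : ℂ) + ((l / 2 ^ k / 16 * b : ℝ) : ℂ) * I := by
      rw [hζ, hw]; push_cast; ring
    rw [e1]
    simp only [neg_add_rev, Complex.add_re, Complex.neg_re, Complex.ofReal_re, re_ofReal_mul, Complex.I_re,
      mul_zero, neg_zero, zero_add, Left.neg_nonpos_iff]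
    positivity
  obtain ⟨A, B, e1, hAB⟩ := sqc_spec k (exRe zr zi) (exIm zr zi) f _ d hy hdk h9
  refine ⟨A, B, e0.trans e1, ?_⟩
  have e2 : Complex.exp (-ζ) ^ 2 ^ k = Complex.exp (-(l * w)) := by
    rw [← Complex.exp_nat_mul]
    congr 1
    rw [hζ]
    push_cast
    have : (2 : ℂ) ^ k ≠ 0 := pow_ne_zero k two_ne_zero
    field_simp
  rw [e2] at hAB
  exact hAB

/-- the logarithm table -/
def LO (j : ℕ) : ℕ := ∑ l ∈ Finset.range j, dlogK 64 22 (2 * l + 2)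

lemma LO_bd (j : ℕ) : (LO j : ℝ) ≤ 2 ^ 64 * ln (2 * j + 1) ∧
    2 ^ 64 * ln (2 * j + 1) ≤ LO j + (if j = 0 then 0 else 2 ^ 21) + 23 * j := by
  induction j with
  | zero => simp [LO]
  | succ j ih =>
    have e : LO (j + 1) = LO j + dlogK 64 22 (2 * j + 2) := by unfold LO; rw [sum_range_succ]
    have h := dlogK_bd 64 22 (2 * j + 2) (by omega)
    have hj : (0 : ℝ) ≤ j := Nat.cast_nonneg j
    have e2 : ((2 * j + 2 : ℕ) : ℝ) + 1 = 2 * ((j + 1 : ℕ) : ℝ) + 1 := by push_cast; ring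
    have e3 : ((2 * j + 2 : ℕ) : ℝ) - 1 = 2 * (j : ℝ) + 1 := by push_cast; ring
    rw [e2, e3, Real.log_div (by positivity) (by positivity)] at h
    have hz2 : 1 / ((2 * j + 2 : ℕ) : ℝ) ≤ 1 / 2 := by
      apply one_div_le_one_div_of_le (by norm_num)
      push_cast; linarith
    have key : (2 : ℝ) ^ (64 + 1) * ((1 / ((2 * j + 2 : ℕ) : ℝ)) ^ (2 * 22 + 1) / (1 - (1 / ((2 * j + 2 : ℕ) : ℝ)) ^ 2)) ≤
        (if j = 0 then 2 ^ 21 else 0) + 1 := by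
      have hz0 : 0 ≤ 1 / ((2 * j + 2 : ℕ) : ℝ) := by positivity
      have hden : 3 / 4 ≤ 1 - (1 / ((2 * j + 2 : ℕ) : ℝ)) ^ 2 := by nlinarith
      rcases Nat.eq_zero_or_pos j with h0 | h0
      · subst h0; norm_num
      · rw [if_neg (by omega)]
        have hz4 : 1 / ((2 * j + 2 : ℕ) : ℝ) ≤ 1 / 4 := by
          apply one_div_le_one_div_of_le (by norm_num)
          have : (1 : ℝ) ≤ j := by exact_mod_cast h0
          push_cast; linarith
        generalize 1 / ((2 * j + 2 : ℕ) : ℝ) = x at *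
        have h1 : x ^ (2 * 22 + 1) ≤ (1 / 4) ^ (2 * 22 + 1) := pow_le_pow_left₀ hz0 hz4 _
        have h2 : x ^ (2 * 22 + 1) / (1 - x ^ 2) ≤ (1 / 4) ^ (2 * 22 + 1) / (3 / 4) :=
          div_le_div₀ (by positivity) h1 (by norm_num) hden
        calc _ ≤ (2 : ℝ) ^ (64 + 1) * ((1 / 4) ^ (2 * 22 + 1) / (3 / 4)) := mul_le_mul_of_nonneg_left h2 (by positivity)
          _ ≤ _ := by norm_num
    rw [e]
    generalize (2 : ℝ) ^ (64 + 1) * ((1 / ((2 * j + 2 : ℕ) : ℝ)) ^ (2 * 22 + 1) / (1 - (1 / ((2 * j + 2 : ℕ) : ℝ)) ^ 2)) = T at *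
    generalize dlogK 64 22 (2 * j + 2) = q at *
    generalize LO j = p at *
    rw [if_neg (by omega)]
    push_cast at h ⊢
    obtain ⟨ih1, ih2⟩ := ih
    obtain ⟨h1, h2⟩ := h
    constructor
    · linarith only [ih1, h1]
    · rcases Nat.eq_zero_or_pos j with h0 | h0
      · rw [if_pos h0] at *
        linarith only [ih2, h2, key]
      · rw [if_neg (by omega)] at key ih2
        linarith only [ih2, h2, key]

lemma LO_err (j : ℕ) (hj : j ≤ 1000) : |(LO j : ℝ) - 2 ^ 64 * ln (2 * j + 1)| ≤ 2 ^ 22 := by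
  obtain ⟨h1, h2⟩ := LO_bd j
  have hj' : (j : ℝ) ≤ 1000 := by exact_mod_cast hj
  have : (if j = 0 then (0 : ℝ) else 2 ^ 21) ≤ 2 ^ 21 := by split_ifs <;> norm_num
  rw [abs_le]
  constructor <;> linarith

def gval (A B C D : ℕ) : GaussianInt := ⟨(A : ℤ) - B, (C : ℤ) - D⟩

/-- signed truncation -/
def gtr (s U V : ℕ) : GaussianInt :=
  gval (shiftRight (Nat.sub U 73786976294838206464) s) (shiftRight (Nat.sub 73786976294838206464 U) s)
    (shiftRight (Nat.sub V 73786976294838206464) s) (shiftRight (Nat.sub 73786976294838206464 V) s)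

lemma zero_shr (s : ℕ) : shiftRight 0 s = 0 := Nat.zero_shiftRight s

lemma tr_err (s U : ℕ) : |((shiftRight (Nat.sub U 73786976294838206464) s : ℕ) : ℝ) -
    (shiftRight (Nat.sub 73786976294838206464 U) s : ℕ) - ((U : ℝ) - 2 ^ 66) / 2 ^ s| ≤ 1 := by
  rcases le_total U 73786976294838206464 with h | h
  · have e : Nat.sub U 73786976294838206464 = 0 := Nat.sub_eq_zero_of_le h
    rw [e, zero_shr]
    have h1 := shr_err (Nat.sub 73786976294838206464 U) s
    have e2 : ((Nat.sub 73786976294838206464 U : ℕ) : ℝ) = 2 ^ 66 - U := by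
      rw [Nat.sub_eq, Nat.cast_sub h]; norm_num
    rw [e2] at h1
    rw [← abs_neg] at h1
    convert h1 using 2
    push_cast; ring
  · have e : Nat.sub 73786976294838206464 U = 0 := Nat.sub_eq_zero_of_le h
    rw [e, zero_shr]
    have h1 := shr_err (Nat.sub U 73786976294838206464) s
    have e2 : ((Nat.sub U 73786976294838206464 : ℕ) : ℝ) = U - 2 ^ 66 := by
      rw [Nat.sub_eq, Nat.cast_sub h]; norm_num
    rw [e2] at h1
    convert h1 using 2
    push_cast; ring

lemma gtr_err (s U V : ℕ) : ‖((gtr s U V : GaussianInt) : ℂ) - cv U V / 2 ^ s‖ ≤ 2 := by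
  have e1 : (2 : ℂ) ^ s = (((2 : ℝ) ^ s : ℝ) : ℂ) := by push_cast; rfl
  rw [e1]
  apply norm_le_two
  · rw [sub_re, div_ofReal_re, ← GaussianInt.intCast_re]
    have := tr_err s U
    simp only [gtr, gval, cv]
    push_cast at this ⊢
    exact this
  · rw [sub_im, div_ofReal_im, ← GaussianInt.intCast_im]
    have := tr_err s V
    simp only [gtr, gval, cv]
    push_cast at this ⊢
    exact this

lemma dbl_succ {α : Type} (r sh U V A B C D : ℕ) (f : ℕ → ℕ → ℕ → ℕ → α) :
    ∃ A' B' C' D', dbl (r + 1) sh U V A B C D f = dbl r (sh + sh) (sqRe U V) (sqIm U V) A' B' C' D' f ∧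
      gval A' B' C' D' = (2 ^ 15 + 2 ^ sh * gtr 49 U V) * gval A B C D := by
  have hS : ∀ u v E1 E2 E3 E4 F1 F2 F3 F4 : ℕ,
      dblS (dbl r) sh U V A B C D f u v E1 E2 E3 E4 F1 F2 F3 F4 = dbl r (sh + sh) (sqRe U V) (sqIm U V)
        (A * 2 ^ 15 + (u * E1 + v * F1) * 2 ^ sh) (B * 2 ^ 15 + (u * E2 + v * F2) * 2 ^ sh)
        (C * 2 ^ 15 + (u * E3 + v * F3) * 2 ^ sh) (D * 2 ^ 15 + (u * E4 + v * F4) * 2 ^ sh) f := by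
    intro u v E1 E2 E3 E4 F1 F2 F3 F4
    unfold dblS
    rw [frc_eq, frc_eq]
    simp only [← Nat.shiftLeft_eq]
    rfl
  have h2 : ∀ n : ℕ, ((2 : GaussianInt) ^ n) = ⟨(2 : ℤ) ^ n, 0⟩ := by
    intro n
    induction n with
    | zero => rfl
    | succ n ih => rw [pow_succ, ih]; ext <;> simp [pow_succ]
  set u1 := shiftRight (Nat.sub U 73786976294838206464) 49 with hu1
  set u2 := shiftRight (Nat.sub 73786976294838206464 U) 49 with hu2
  set v1 := shiftRight (Nat.sub V 73786976294838206464) 49 with hv1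
  set v2 := shiftRight (Nat.sub 73786976294838206464 V) 49 with hv2
  have e : dbl (r + 1) sh U V A B C D f =
      Bool.rec
       (Bool.rec (dblS (dbl r) sh U V A B C D f u2 v2 B A D C C D B A)
         (dblS (dbl r) sh U V A B C D f u2 v1 B A D C D C A B) (ble 73786976294838206464 V))
       (Bool.rec (dblS (dbl r) sh U V A B C D f u1 v2 A B C D C D B A)
         (dblS (dbl r) sh U V A B C D f u1 v1 A B C D D C A B) (ble 73786976294838206464 V))
       (ble 73786976294838206464 U) := rfl
  have eg : gtr 49 U V = gval u1 u2 v1 v2 := rfl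
  rw [e, eg, h2, h2]
  have hUf : ble 73786976294838206464 U = false → u1 = 0 := by
    intro h
    have h' : ¬ 73786976294838206464 ≤ U := by
      intro h3; rw [Nat.ble_eq_true_of_le h3] at h; exact Bool.noConfusion h
    rw [hu1, show Nat.sub U 73786976294838206464 = 0 from Nat.sub_eq_zero_of_le (by omega), zero_shr]
  have hUt : ble 73786976294838206464 U = true → u2 = 0 := by
    intro h
    rw [hu2, show Nat.sub 73786976294838206464 U = 0 from Nat.sub_eq_zero_of_le (Nat.le_of_ble_eq_true h), zero_shr]
  have hVf : ble 73786976294838206464 V = false → v1 = 0 := by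
    intro h
    have h' : ¬ 73786976294838206464 ≤ V := by
      intro h3; rw [Nat.ble_eq_true_of_le h3] at h; exact Bool.noConfusion h
    rw [hv1, show Nat.sub V 73786976294838206464 = 0 from Nat.sub_eq_zero_of_le (by omega), zero_shr]
  have hVt : ble 73786976294838206464 V = true → v2 = 0 := by
    intro h
    rw [hv2, show Nat.sub 73786976294838206464 V = 0 from Nat.sub_eq_zero_of_le (Nat.le_of_ble_eq_true h), zero_shr]
  clear_value u1 u2 v1 v2
  generalize ble 73786976294838206464 U = bU at *
  generalize ble 73786976294838206464 V = bV at *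
  cases bU <;> cases bV
  · refine ⟨_, _, _, _, hS _ _ _ _ _ _ _ _ _ _, ?_⟩
    rw [hUf rfl, hVf rfl]
    refine Zsqrtd.ext ?_ ?_ <;> simp only [gval, Zsqrtd.re_mul, Zsqrtd.im_mul, Zsqrtd.re_add, Zsqrtd.im_add, Nat.cast_add, Nat.cast_mul, Nat.cast_pow, Nat.cast_zero, Nat.cast_ofNat] <;> ring
  · refine ⟨_, _, _, _, hS _ _ _ _ _ _ _ _ _ _, ?_⟩
    rw [hUf rfl, hVt rfl]
    refine Zsqrtd.ext ?_ ?_ <;> simp only [gval, Zsqrtd.re_mul, Zsqrtd.im_mul, Zsqrtd.re_add, Zsqrtd.im_add, Nat.cast_add, Nat.cast_mul, Nat.cast_pow, Nat.cast_zero, Nat.cast_ofNat] <;> ring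
  · refine ⟨_, _, _, _, hS _ _ _ _ _ _ _ _ _ _, ?_⟩
    rw [hUt rfl, hVf rfl]
    refine Zsqrtd.ext ?_ ?_ <;> simp only [gval, Zsqrtd.re_mul, Zsqrtd.im_mul, Zsqrtd.re_add, Zsqrtd.im_add, Nat.cast_add, Nat.cast_mul, Nat.cast_pow, Nat.cast_zero, Nat.cast_ofNat] <;> ring
  · refine ⟨_, _, _, _, hS _ _ _ _ _ _ _ _ _ _, ?_⟩
    rw [hUt rfl, hVt rfl]
    refine Zsqrtd.ext ?_ ?_ <;> simp only [gval, Zsqrtd.re_mul, Zsqrtd.im_mul, Zsqrtd.re_add, Zsqrtd.im_add, Nat.cast_add, Nat.cast_mul, Nat.cast_pow, Nat.cast_zero, Nat.cast_ofNat] <;> ring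

lemma toC_two_pow (n : ℕ) : (((2 : GaussianInt) ^ n : GaussianInt) : ℂ) = 2 ^ n := by
  rw [map_pow, map_ofNat]

lemma dbl_spec {α : Type} (r : ℕ) : ∀ (m sh U V A B C D : ℕ) (f : ℕ → ℕ → ℕ → ℕ → α)
    (p : ℕ → GaussianInt) (y ω : ℂ) (η d S : ℝ), 0 ≤ η → 0 ≤ S → ‖ω‖ ≤ 1 → sh = 176 * 2 ^ m →
    ‖cv U V - 2 ^ 64 * ω ^ (2 ^ m)‖ ≤ d → (2 + 1 / 2 ^ 20) ^ r * (d + 2) ≤ 2 ^ 44 →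
    gval A B C D = ∑ j ∈ Finset.range (2 ^ m), p j * 2 ^ (176 * j) →
    (∀ j < 2 ^ m, ‖(p j : ℂ) - S * (y * ω ^ j)‖ ≤ S * η) →
    ∃ (A' B' C' D' : ℕ) (p' : ℕ → GaussianInt), dbl r sh U V A B C D f = f A' B' C' D' ∧
      gval A' B' C' D' = ∑ j ∈ Finset.range (2 ^ (m + r)), p' j * 2 ^ (176 * j) ∧
      ∀ j < 2 ^ (m + r), ‖(p' j : ℂ) - ((2 ^ 15) ^ r * S : ℝ) * (y * ω ^ j)‖ ≤
        ((2 ^ 15) ^ r * S) * ((η + ‖y‖) * (1 + 1 / 16000) ^ r - ‖y‖) := by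
  induction r with
  | zero =>
    intro m sh U V A B C D f p y ω η d S _ _ _ _ _ _ hg hp
    refine ⟨A, B, C, D, p, rfl, hg, ?_⟩
    intro j hj
    have := hp j hj
    simpa using this
  | succ r ih =>
    intro m sh U V A B C D f p y ω η d S hη hS hω hsh hUV hd hg hp
    have hd0 : 0 ≤ d := (norm_nonneg _).trans hUV
    have c1 : (1 : ℝ) ≤ (2 + 1 / 2 ^ 20) ^ r := one_le_pow₀ (by norm_num)
    have hd' : d ≤ 2 ^ 44 := by
      refine le_trans ?_ hd
      have : (1 : ℝ) ≤ (2 + 1 / 2 ^ 20) ^ (r + 1) := one_le_pow₀ (by norm_num)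
      nlinarith
    obtain ⟨A1, B1, C1, D1, e1, g1⟩ := dbl_succ r sh U V A B C D f
    have hω2 : ‖ω ^ (2 ^ m)‖ ≤ 1 := by rw [norm_pow]; exact pow_le_one₀ (norm_nonneg _) hω
    have hsq := sq_err hω2 hd' hUV
    set p1 : ℕ → GaussianInt := fun j => if j < 2 ^ m then 2 ^ 15 * p j else gtr 49 U V * p (j - 2 ^ m) with hp1
    have hW : ‖((gtr 49 U V : GaussianInt) : ℂ) - 2 ^ 15 * ω ^ (2 ^ m)‖ ≤ 2 ^ 15 * (1 / 16000) := by
      have h1 := gtr_err 49 U V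
      have h2 : ‖cv U V / 2 ^ 49 - 2 ^ 15 * ω ^ (2 ^ m)‖ ≤ d / 2 ^ 49 := by
        have : cv U V / 2 ^ 49 - 2 ^ 15 * ω ^ (2 ^ m) = (cv U V - 2 ^ 64 * ω ^ (2 ^ m)) / 2 ^ 49 := by
          field_simp
        rw [this, norm_div, norm_pow, Complex.norm_two]
        exact div_le_div_of_nonneg_right hUV (by positivity)
      have h3 := norm_sub_le_norm_sub_add_norm_sub ((gtr 49 U V : GaussianInt) : ℂ) (cv U V / 2 ^ 49) (2 ^ 15 * ω ^ (2 ^ m))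
      have h4 : d / 2 ^ 49 ≤ 1 / 32 := by rw [div_le_iff₀ (by norm_num)]; linarith
      have h5 : (2 : ℝ) + 1 / 32 ≤ 2 ^ 15 * (1 / 16000) := by norm_num
      linarith
    have H := ih (m + 1) (sh + sh) (sqRe U V) (sqIm U V) A1 B1 C1 D1 f p1 y ω (η + (η + ‖y‖) / 16000)
      ((2 + 1 / 2 ^ 20) * d + 2) (2 ^ 15 * S) (by positivity) (by positivity) hω
      (by rw [hsh, pow_succ]; ring) (by rw [pow_succ 2 m, pow_mul]; exact hsq)
      (by
        refine le_trans ?_ hd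
        rw [pow_succ _ r, mul_assoc]
        refine mul_le_mul_of_nonneg_left ?_ (by positivity)
        linarith)
      (by
        rw [g1, hg, pow_succ 2 m, mul_two, Finset.sum_range_add, add_mul]
        congr 1
        · rw [mul_sum]
          refine sum_congr rfl fun j hj => ?_
          simp only [hp1, if_pos (Finset.mem_range.1 hj)]
          ring
        · rw [mul_sum]
          refine sum_congr rfl fun j hj => ?_
          have : ¬ (2 ^ m + j < 2 ^ m) := by omega
          simp only [hp1, if_neg this, Nat.add_sub_cancel_left]
          rw [hsh, mul_add 176, pow_add]
          ring)
      (by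
        intro j hj
        by_cases hjm : j < 2 ^ m
        · simp only [hp1, if_pos hjm]
          rw [GaussianInt.toComplex_mul, toC_two_pow]
          have e : (2 : ℂ) ^ 15 * (p j : ℂ) - ((2 ^ 15 * S : ℝ) : ℂ) * (y * ω ^ j) = 2 ^ 15 * ((p j : ℂ) - S * (y * ω ^ j)) := by
            push_cast; ring
          rw [e, norm_mul, norm_pow, Complex.norm_two, mul_assoc]
          refine mul_le_mul_of_nonneg_left ((hp j hjm).trans (mul_le_mul_of_nonneg_left ?_ hS)) (by positivity)
          have : 0 ≤ (η + ‖y‖) / 16000 := by positivity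
          linarith
        · simp only [hp1, if_neg hjm]
          have hj2 : j - 2 ^ m < 2 ^ m := by rw [pow_succ] at hj; omega
          have hj3 : j = (j - 2 ^ m) + 2 ^ m := by omega
          generalize j - 2 ^ m = i at *
          subst hj3
          rw [GaussianInt.toComplex_mul]
          have hpi := hp i hj2
          have hni : ‖(p i : ℂ)‖ ≤ S * (η + ‖y‖) := by
            have h1 : ‖(S : ℂ) * (y * ω ^ i)‖ ≤ S * ‖y‖ := by
              rw [norm_mul, norm_mul, norm_pow, Complex.norm_real, norm_of_nonneg hS]
              refine mul_le_mul_of_nonneg_left ?_ hS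
              exact mul_le_of_le_one_right (norm_nonneg _) (pow_le_one₀ (norm_nonneg _) hω)
            have h2 := norm_sub_norm_le (p i : ℂ) (S * (y * ω ^ i))
            linarith
          have e : ((gtr 49 U V : GaussianInt) : ℂ) * (p i : ℂ) - ((2 ^ 15 * S : ℝ) : ℂ) * (y * ω ^ (i + 2 ^ m)) =
              (((gtr 49 U V : GaussianInt) : ℂ) - 2 ^ 15 * ω ^ (2 ^ m)) * (p i : ℂ) +
                2 ^ 15 * ω ^ (2 ^ m) * ((p i : ℂ) - S * (y * ω ^ i)) := by
            push_cast; rw [pow_add]; ring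
          rw [e]
          refine (norm_add_le _ _).trans ?_
          rw [norm_mul, norm_mul, norm_mul, norm_pow 2 15, Complex.norm_two]
          have t1 := mul_le_mul hW hni (norm_nonneg _) (by positivity)
          have t2 : (2 : ℝ) ^ 15 * ‖ω ^ 2 ^ m‖ * ‖(p i : ℂ) - S * (y * ω ^ i)‖ ≤ 2 ^ 15 * (S * η) :=
            mul_le_mul (mul_le_of_le_one_right (by positivity) hω2) hpi (norm_nonneg _) (by positivity)
          refine (add_le_add t1 t2).trans (le_of_eq ?_)
          ring)
    obtain ⟨A', B', C', D', p', q1, q2, q3⟩ := H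
    refine ⟨A', B', C', D', p', e1.trans q1, ?_, ?_⟩
    · rw [q2, show m + 1 + r = m + (r + 1) by ring]
    · intro j hj
      have := q3 j (by rwa [show m + 1 + r = m + (r + 1) by ring])
      have e2 : (2 ^ 15 : ℝ) ^ r * (2 ^ 15 * S) = (2 ^ 15) ^ (r + 1) * S := by rw [pow_succ]; ring
      rw [e2] at this
      refine this.trans (le_of_eq ?_)
      rw [pow_succ (1 + 1 / 16000 : ℝ)]
      ring

noncomputable def yq (b l : ℕ) : ℂ := Complex.exp (-((ln (2 * l + 1) : ℝ) * (((14 : ℕ) + (b : ℂ) * I) / 16)))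
noncomputable def ωq (l : ℕ) : ℂ := Complex.exp (-((ln (2 * l + 1) : ℝ) * (((0 : ℕ) + ((1 : ℕ) : ℂ) * I) / 16)))

lemma log_odd_bd (l : ℕ) (hl : l ≤ 831) : 0 ≤ ln (2 * l + 1) ∧ ln (2 * l + 1) ≤ 7.5 := by
  have hl' : (l : ℝ) ≤ 831 := by exact_mod_cast hl
  have h0 : (0 : ℝ) ≤ l := Nat.cast_nonneg l
  refine ⟨Real.log_nonneg (by linarith), ?_⟩
  rw [Real.log_le_iff_le_exp (by linarith)]
  have h1 : rexp 7.5 = rexp 1 ^ 7 * rexp 0.5 := by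
    rw [← Real.exp_nat_mul, ← Real.exp_add]; norm_num
  have h2 : (2.718 : ℝ) ≤ rexp 1 := by have := Real.exp_one_gt_d9; linarith
  have h3 : (1.6 : ℝ) ≤ rexp 0.5 := by
    have := Real.quadratic_le_exp_of_nonneg (x := (0.5 : ℝ)) (by norm_num); linarith
  have h4 : (2.718 : ℝ) ^ 7 ≤ rexp 1 ^ 7 := pow_le_pow_left₀ (by norm_num) h2 7
  have h5 : (1664 : ℝ) ≤ 2.718 ^ 7 * 1.6 := by norm_num
  have h6 := mul_le_mul h4 h3 (by norm_num) (by positivity)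
  linarith

lemma norm_ωq (l : ℕ) : ‖ωq l‖ ≤ 1 := by
  unfold ωq
  rw [norm_exp]
  have : (-(((ln (2 * l + 1) : ℝ) : ℂ) * (((0 : ℕ) + ((1 : ℕ) : ℂ) * I) / 16))).re = 0 := by
    rw [Complex.neg_re, re_ofReal_mul]
    simp
  rw [this, Real.exp_zero]

noncomputable def Fs (b j i : ℕ) : ℂ := ∑ l ∈ Finset.range j, yq b l * ωq l ^ i
noncomputable def Es (b j : ℕ) : ℝ :=
  ∑ l ∈ Finset.range j, ((11 / 10 ^ 7 + ‖yq b l‖) * (1 + 1 / 16000) ^ 10 - ‖yq b l‖)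

lemma outer_succ {α : Type} (b K j A B C D : ℕ) (f : ℕ → ℕ → ℕ → ℕ → α) (hb : b ≤ 52200) (hj : j ≤ 831) :
    ∃ (A' B' C' D' : ℕ) (p' : ℕ → GaussianInt),
      outer b (K + 1) j (LO j) A B C D f = outer b K (j + 1) (LO (j + 1)) (A + A') (B + B') (C + C') (D + D') f ∧
      gval A' B' C' D' = ∑ i ∈ Finset.range 1024, p' i * 2 ^ (176 * i) ∧
      ∀ i < 1024, ‖(p' i : ℂ) - (2 ^ 171 : ℝ) * (yq b j * ωq j ^ i)‖ ≤
        2 ^ 171 * ((11 / 10 ^ 7 + ‖yq b j‖) * (1 + 1 / 16000) ^ 10 - ‖yq b j‖) := by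
  obtain ⟨hl0, hl⟩ := log_odd_bd j hj
  have hb' : (b : ℝ) ≤ 52200 := by exact_mod_cast hb
  have hL := LO_err j (by omega)
  have e0 : outer b (K + 1) j (LO j) A B C D f = expK 33 14 b (LO j) fun qa qb => expK 14 0 1 (LO j) fun wa wb =>
     dbl 10 176 wa wb (shiftRight (Nat.sub qa 73786976294838206464) 43)
       (shiftRight (Nat.sub 73786976294838206464 qa) 43)
       (shiftRight (Nat.sub qb 73786976294838206464) 43)
       (shiftRight (Nat.sub 73786976294838206464 qb) 43) fun A' B' C' D' =>
     frc (Nat.add A A') fun A'' => frc (Nat.add B B') fun B'' =>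
     frc (Nat.add C C') fun C'' => frc (Nat.add D D') fun D'' =>
     frc (Nat.add (LO j) (dlogK 64 22 (Nat.succ (Nat.succ (Nat.mul 2 j))))) fun L' =>
     frc (Nat.succ j) fun j' => outer b K j' L' A'' B'' C'' D'' f := rfl
  obtain ⟨qa, qb, eq, hq⟩ := expK_spec 33 14 b (LO j) (fun qa qb => expK 14 0 1 (LO j) fun wa wb =>
     dbl 10 176 wa wb (shiftRight (Nat.sub qa 73786976294838206464) 43)
       (shiftRight (Nat.sub 73786976294838206464 qa) 43)
       (shiftRight (Nat.sub qb 73786976294838206464) 43)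
       (shiftRight (Nat.sub 73786976294838206464 qb) 43) fun A' B' C' D' =>
     frc (Nat.add A A') fun A'' => frc (Nat.add B B') fun B'' =>
     frc (Nat.add C C') fun C'' => frc (Nat.add D D') fun D'' =>
     frc (Nat.add (LO j) (dlogK 64 22 (Nat.succ (Nat.succ (Nat.mul 2 j))))) fun L' =>
     frc (Nat.succ j) fun j' => outer b K j' L' A'' B'' C'' D'' f) (ln (2 * j + 1)) (2 ^ 22) 3301 7.5 120
     hl0 hl hL (by
      rw [norm_div]
      have h1 : ‖((14 : ℕ) : ℂ) + (b : ℂ) * I‖ ≤ 14 + b := by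
        refine (norm_add_le _ _).trans ?_
        rw [norm_mul, Complex.norm_I, norm_natCast, norm_natCast]
        norm_num
      have h2 : ‖(16 : ℂ)‖ = 16 := by norm_num
      rw [h2, div_le_iff₀ (by norm_num)]
      linarith) (by norm_num) (by norm_num) (by norm_num) (by norm_num)
  rw [e0, eq]
  obtain ⟨wa, wb, ew, hw⟩ := expK_spec 14 0 1 (LO j) (fun wa wb =>
     dbl 10 176 wa wb (shiftRight (Nat.sub qa 73786976294838206464) 43)
       (shiftRight (Nat.sub 73786976294838206464 qa) 43)
       (shiftRight (Nat.sub qb 73786976294838206464) 43)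
       (shiftRight (Nat.sub 73786976294838206464 qb) 43) fun A' B' C' D' =>
     frc (Nat.add A A') fun A'' => frc (Nat.add B B') fun B'' =>
     frc (Nat.add C C') fun C'' => frc (Nat.add D D') fun D'' =>
     frc (Nat.add (LO j) (dlogK 64 22 (Nat.succ (Nat.succ (Nat.mul 2 j))))) fun L' =>
     frc (Nat.succ j) fun j' => outer b K j' L' A'' B'' C'' D'' f) (ln (2 * j + 1)) (2 ^ 22) (1 / 16) 7.5 100000
     hl0 hl hL (by simp) (by norm_num) (by norm_num) (by norm_num) (by norm_num)
  rw [ew]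
  have hq' : ‖cv qa qb - 2 ^ 64 * yq b j‖ ≤ 2 ^ 40 := hq.trans (by norm_num)
  have hw' : ‖cv wa wb - 2 ^ 64 * ωq j ^ (2 ^ 0)‖ ≤ 2 ^ 31 := by
    rw [pow_zero, pow_one]
    exact hw.trans (by norm_num)
  have hg := gtr_err 43 qa qb
  have hp0 : ‖((gtr 43 qa qb : GaussianInt) : ℂ) - (2 ^ 21 : ℝ) * yq b j‖ ≤ 2 ^ 21 * (11 / 10 ^ 7) := by
    have h2 : ‖cv qa qb / 2 ^ 43 - (2 ^ 21 : ℝ) * yq b j‖ ≤ 2 ^ 40 / 2 ^ 43 := by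
      have : cv qa qb / 2 ^ 43 - (2 ^ 21 : ℝ) * yq b j = (cv qa qb - 2 ^ 64 * yq b j) / 2 ^ 43 := by
        push_cast
        field_simp
      rw [this, norm_div, norm_pow, Complex.norm_two]
      exact div_le_div_of_nonneg_right hq' (by positivity)
    have h3 := norm_sub_le_norm_sub_add_norm_sub ((gtr 43 qa qb : GaussianInt) : ℂ) (cv qa qb / 2 ^ 43) ((2 ^ 21 : ℝ) * yq b j)
    have h5 : (2 : ℝ) + 2 ^ 40 / 2 ^ 43 ≤ 2 ^ 21 * (11 / 10 ^ 7) := by norm_num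
    linarith
  obtain ⟨A', B', C', D', p', q1, q2, q3⟩ := dbl_spec 10 0 176 wa wb
    (shiftRight (Nat.sub qa 73786976294838206464) 43)
    (shiftRight (Nat.sub 73786976294838206464 qa) 43)
    (shiftRight (Nat.sub qb 73786976294838206464) 43)
    (shiftRight (Nat.sub 73786976294838206464 qb) 43) (fun A' B' C' D' =>
     frc (Nat.add A A') fun A'' => frc (Nat.add B B') fun B'' =>
     frc (Nat.add C C') fun C'' => frc (Nat.add D D') fun D'' =>
     frc (Nat.add (LO j) (dlogK 64 22 (Nat.succ (Nat.succ (Nat.mul 2 j))))) fun L' =>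
     frc (Nat.succ j) fun j' => outer b K j' L' A'' B'' C'' D'' f)
     (fun _ => gtr 43 qa qb) (yq b j) (ωq j) (11 / 10 ^ 7) (2 ^ 31) (2 ^ 21) (by norm_num) (by norm_num)
     (norm_ωq j) (by norm_num) hw' (by norm_num)
     (by rw [pow_zero, Finset.sum_range_one, Nat.mul_zero, pow_zero, mul_one]; rfl)
     (by
      intro i hi
      have : i = 0 := by omega
      subst this
      rw [pow_zero, mul_one]
      exact hp0)
  refine ⟨A', B', C', D', p', ?_, ?_, ?_⟩
  · rw [q1]
    simp only [frc_eq]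
    have e : LO (j + 1) = LO j + dlogK 64 22 (2 * j + 2) := by unfold LO; rw [sum_range_succ]
    rw [e]
    rfl
  · rw [q2]
    norm_num only
  · intro i hi
    have := q3 i (by simpa using hi)
    have e3 : ((2 : ℝ) ^ 15) ^ 10 * 2 ^ 21 = 2 ^ 171 := by norm_num only
    rw [e3] at this
    exact this

lemma gval_add (A B C D A' B' C' D' : ℕ) :
    gval (A + A') (B + B') (C + C') (D + D') = gval A B C D + gval A' B' C' D' := by
  refine Zsqrtd.ext ?_ ?_ <;> simp only [gval, Zsqrtd.re_add, Zsqrtd.im_add, Nat.cast_add] <;> ring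

lemma outer_spec {α : Type} (b K : ℕ) (hb : b ≤ 52200) : ∀ (j A B C D : ℕ) (f : ℕ → ℕ → ℕ → ℕ → α)
    (p : ℕ → GaussianInt), j + K ≤ 832 →
    gval A B C D = ∑ i ∈ Finset.range 1024, p i * 2 ^ (176 * i) →
    (∀ i < 1024, ‖(p i : ℂ) - (2 ^ 171 : ℝ) * Fs b j i‖ ≤ 2 ^ 171 * Es b j) →
    ∃ (A' B' C' D' : ℕ) (p' : ℕ → GaussianInt), outer b K j (LO j) A B C D f = f A' B' C' D' ∧
      gval A' B' C' D' = ∑ i ∈ Finset.range 1024, p' i * 2 ^ (176 * i) ∧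
      ∀ i < 1024, ‖(p' i : ℂ) - (2 ^ 171 : ℝ) * Fs b (j + K) i‖ ≤ 2 ^ 171 * Es b (j + K) := by
  induction K with
  | zero => intro j A B C D f p _ hg hp; exact ⟨A, B, C, D, p, rfl, hg, hp⟩
  | succ K ih =>
    intro j A B C D f p hj hg hp
    obtain ⟨A1, B1, C1, D1, p1, e1, g1, h1⟩ := outer_succ b K j A B C D f hb (by omega)
    obtain ⟨A', B', C', D', p', q1, q2, q3⟩ := ih (j + 1) (A + A1) (B + B1) (C + C1) (D + D1) f
      (fun i => p i + p1 i) (by omega)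
      (by
        rw [gval_add, hg, g1, ← sum_add_distrib]
        exact sum_congr rfl fun i _ => (add_mul _ _ _).symm)
      (by
        intro i hi
        have ef : Fs b (j + 1) i = Fs b j i + yq b j * ωq j ^ i := by unfold Fs; rw [sum_range_succ]
        have ee : Es b (j + 1) = Es b j + ((11 / 10 ^ 7 + ‖yq b j‖) * (1 + 1 / 16000) ^ 10 - ‖yq b j‖) := by
          unfold Es; rw [sum_range_succ]
        rw [ef, ee, GaussianInt.toComplex_add, mul_add, mul_add, add_sub_add_comm]
        exact (norm_add_le _ _).trans (add_le_add (hp i hi) (h1 i hi)))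
    refine ⟨A', B', C', D', p', e1.trans q1, q2, ?_⟩
    rw [show j + (K + 1) = j + 1 + K by ring]
    exact q3

lemma land_spec (w Y h T A B : ℕ) (hhw : h < w) (hT : T ≤ 2 ^ h) (p : ℕ → ℤ)
    (hp : (A : ℤ) - B = ∑ i ∈ Finset.range Y, p i * (2 ^ w) ^ i)
    (hlo : ∀ i < Y, 0 ≤ p i + (2 ^ h - T)) (hhi : ∀ i < Y, p i + (2 ^ h - T) < 2 ^ w)
    (hc : Nat.land (A + (2 ^ h - T) * pack w Y (fun _ => 1) - B) (2 ^ h * pack w Y (fun _ => 1)) =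
      2 ^ h * pack w Y (fun _ => 1)) : ∀ i < Y, (T : ℤ) ≤ p i := by
  intro k hk
  set d : ℕ → ℕ := fun i => (p i + (2 ^ h - T)).toNat with hd
  have hdi : ∀ i < Y, (d i : ℤ) = p i + (2 ^ h - T) := fun i hi => Int.toNat_of_nonneg (hlo i hi)
  have hdw : ∀ i, i < Y → d i < 2 ^ w := by
    intro i hi
    have h1 := hhi i hi
    rw [← hdi i hi] at h1
    exact_mod_cast h1
  have e1 : A + (2 ^ h - T) * pack w Y (fun _ => 1) - B = pack w Y d := by
    have : ((A + (2 ^ h - T) * pack w Y (fun _ => 1) : ℕ) : ℤ) = (pack w Y d : ℕ) + B := by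
      unfold pack
      rw [Nat.cast_add, Nat.cast_mul, Nat.cast_sub hT, Nat.cast_sum, Nat.cast_sum]
      have : (A : ℤ) = B + ∑ i ∈ Finset.range Y, p i * (2 ^ w) ^ i := by rw [← hp]; ring
      rw [this, mul_sum, add_assoc, ← sum_add_distrib, add_comm]
      congr 1
      refine sum_congr rfl fun i hi => ?_
      rw [Nat.cast_mul (d i), hdi i (Finset.mem_range.1 hi)]
      simp only [one_mul, Nat.cast_pow, Nat.cast_ofNat]
      ring
    have h3 : A + (2 ^ h - T) * pack w Y (fun _ => 1) = pack w Y d + B := by exact_mod_cast this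
    rw [h3, Nat.add_sub_cancel]
  rw [e1] at hc
  have e2 : 2 ^ h * pack w Y (fun _ => 1) = pack w Y (fun _ => 2 ^ h) := by
    rw [← pack_mul]; simp
  have hlt : (2 : ℕ) ^ h < 2 ^ w := Nat.pow_lt_pow_right (by norm_num) hhw
  have t1 : (2 ^ h * pack w Y (fun _ => 1)).testBit (w * k + h) = true := by
    rw [e2, pack_testBit w Y _ (fun _ _ => hlt) k hk h hhw]
    exact Nat.testBit_two_pow_self
  rw [← hc] at t1
  change ((pack w Y d) &&& (2 ^ h * pack w Y (fun _ => 1))).testBit (w * k + h) = true at t1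
  rw [Nat.testBit_and, Bool.and_eq_true, pack_testBit w Y d hdw k hk h hhw] at t1
  have h3 := Nat.ge_two_pow_of_testBit t1.1
  have h4 : ((2 ^ h : ℕ) : ℤ) ≤ d k := by exact_mod_cast h3
  rw [hdi k hk] at h4
  push_cast at h4
  linarith

lemma geo_pack (w Y : ℕ) (hw : 0 < w) : ((2 ^ w) ^ Y - 1) / (2 ^ w - 1) = pack w Y (fun _ => 1) := by
  have h := pack_step w Y 0 (by omega)
  simp only [Nat.zero_le, if_true, pow_zero] at h
  have h1 : 1 < 2 ^ w := Nat.one_lt_two_pow (by omega)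
  rw [← h, Nat.add_sub_cancel, Nat.mul_div_cancel_left _ (by omega)]

set_option maxRecDepth 100000 in
lemma finB_spec (A B T : ℕ) (hT : T ≤ 2 ^ 174) (p : ℕ → ℤ)
    (hp : (A : ℤ) - B = ∑ i ∈ Finset.range 1024, p i * 2 ^ (176 * i))
    (hb : ∀ i < 1024, |p i| ≤ 2 ^ 174) (hf : finB T A B = true) : ∀ i < 1024, (T : ℤ) ≤ p i := by
  have hG : Nat.div (Nat.sub (Nat.pow 2 180224) 1) (Nat.sub (Nat.pow 2 176) 1) = pack 176 1024 (fun _ => 1) := by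
    have h0 : ∀ e w : ℕ, Nat.div (Nat.sub (Nat.pow 2 e) 1) (Nat.sub (Nat.pow 2 w) 1) = (2 ^ e - 1) / (2 ^ w - 1) :=
      fun _ _ => rfl
    rw [← geo_pack 176 1024 (by norm_num), ← pow_mul, h0]
  unfold finB at hf
  rw [frc_eq, hG] at hf
  have hf2 := Nat.eq_of_beq_eq_true hf
  have e : shiftLeft (pack 176 1024 (fun _ => 1)) 175 = 2 ^ 175 * pack 176 1024 (fun _ => 1) := by
    rw [mul_comm]; exact Nat.shiftLeft_eq _ _
  rw [e] at hf2
  have hT' : (T : ℤ) ≤ 2 ^ 174 := by exact_mod_cast hT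
  refine land_spec 176 1024 175 T A B (by norm_num) (hT.trans (by norm_num)) p ?_ ?_ ?_ hf2
  · rw [hp]
    exact sum_congr rfl fun i _ => by rw [pow_mul]
  · intro i hi
    have := (abs_le.1 (hb i hi)).1
    generalize p i = x at *
    generalize (T : ℤ) = y at *
    norm_num at *
    linarith
  · intro i hi
    have := (abs_le.1 (hb i hi)).2
    have h0 : (0 : ℤ) ≤ T := Nat.cast_nonneg T
    generalize p i = x at *
    generalize (T : ℤ) = y at *
    norm_num at *
    linarith

lemma re_gsum (p : ℕ → GaussianInt) (w : ℕ) (s : Finset ℕ) :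
    (∑ i ∈ s, p i * 2 ^ (w * i)).re = ∑ i ∈ s, (p i).re * 2 ^ (w * i) := by
  induction s using Finset.induction_on with
  | empty => simp
  | insert a s ha ih =>
    rw [sum_insert ha, sum_insert ha, Zsqrtd.re_add, ih]
    congr 1
    have h2 : ∀ n : ℕ, ((2 : GaussianInt) ^ n) = ⟨(2 : ℤ) ^ n, 0⟩ := by
      intro n
      induction n with
      | zero => rfl
      | succ n ih => rw [pow_succ, ih]; ext <;> simp [pow_succ]
    rw [h2, Zsqrtd.re_mul]
    ring

lemma Es_zero (b : ℕ) : Es b 0 = 0 := by simp [Es]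
lemma Fs_zero (b i : ℕ) : Fs b 0 i = 0 := by simp [Fs]

set_option maxRecDepth 100000 in
lemma thrK_bd : thrK ≤ 2 ^ 174 ∧ (0.2849 : ℝ) * 2 ^ 171 ≤ thrK := by
  have e : thrK = 285 * 2 ^ 171 / 1000 := rfl
  rw [e]
  norm_num

lemma chunk_spec (c : ℕ) (hc : c ≤ 51) (h : chunkB c = true)
    (hE : Es (1023 * c + 1) (16 * (c + 1)) ≤ 0.1) (hF : ∀ i < 1024, ‖Fs (1023 * c + 1) (16 * (c + 1)) i‖ ≤ 7.5) :
    ∀ i < 1024, 0.2849 - Es (1023 * c + 1) (16 * (c + 1)) ≤ (Fs (1023 * c + 1) (16 * (c + 1)) i).re := by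
  obtain ⟨A, B, C, D, p, q1, q2, q3⟩ := outer_spec (1023 * c + 1) (16 * (c + 1)) (by omega) 0 0 0 0 0
    (fun A B _ _ => finB thrK A B) (fun _ => 0) (by omega)
    (by simp [gval]; rfl)
    (by intro i _; rw [Fs_zero, Es_zero]; simp)
  have h' : finB thrK A B = true := by
    rw [← q1]; exact h
  rw [Nat.zero_add] at q3
  obtain ⟨t1, t2⟩ := thrK_bd
  generalize thrK = T at *
  have hre : ∀ i < 1024, |((p i).re : ℝ) - 2 ^ 171 * (Fs (1023 * c + 1) (16 * (c + 1)) i).re| ≤ 2 ^ 171 * Es (1023 * c + 1) (16 * (c + 1)) := by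
    intro i hi
    refine le_trans ?_ (q3 i hi)
    refine le_trans (le_of_eq ?_) (abs_re_le_norm _)
    rw [sub_re, re_ofReal_mul, GaussianInt.intCast_re]
  have hfin := finB_spec A B T t1 (fun i => (p i).re) (by
      exact (congrArg Zsqrtd.re q2).trans (re_gsum p 176 _)) (by
      intro i hi
      have h1 := hre i hi
      have h2 := hF i hi
      have h3 := (abs_re_le_norm (Fs (1023 * c + 1) (16 * (c + 1)) i)).trans h2
      generalize (Fs (1023 * c + 1) (16 * (c + 1)) i).re = x at *
      generalize Es (1023 * c + 1) (16 * (c + 1)) = e at *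
      have : |((p i).re : ℝ)| ≤ 2 ^ 174 := by
        rw [abs_le] at *
        constructor <;> norm_num at * <;> linarith
      exact_mod_cast this) h'
  intro i hi
  have h1 := hre i hi
  have h2 : (T : ℝ) ≤ (p i).re := by exact_mod_cast hfin i hi
  generalize (Fs (1023 * c + 1) (16 * (c + 1)) i).re = x at *
  generalize Es (1023 * c + 1) (16 * (c + 1)) = e at *
  generalize ((p i).re : ℝ) = y at *
  have h3 := (abs_le.1 h1).2
  have h4 : (0.2849 : ℝ) * 2 ^ 171 ≤ 2 ^ 171 * (x + e) := by linarith
  have h5 : (0 : ℝ) < 2 ^ 171 := by positivity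
  have h6 : (0.2849 : ℝ) ≤ x + e := by
    by_contra hcon
    push Not at hcon
    have := mul_lt_mul_of_pos_left hcon h5
    linarith
  linarith

lemma bb5 : bernoulli 5 = 0 := bernoulli_eq_zero_of_odd (by decide) (by norm_num)
lemma bb7 : bernoulli 7 = 0 := bernoulli_eq_zero_of_odd (by decide) (by norm_num)
lemma bb3 : bernoulli 3 = 0 := bernoulli_eq_zero_of_odd (by decide) (by norm_num)
lemma bb4 : bernoulli 4 = -1 / 30 := by
  rw [bernoulli_eq_bernoulli'_of_ne_one (by norm_num), bernoulli'_four]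
lemma bb6' : bernoulli' 6 = 1 / 42 := by
  have h5 : bernoulli' 5 = 0 := bernoulli'_eq_zero_of_odd (by decide) (by norm_num)
  rw [bernoulli'_def]
  norm_num [sum_range_succ, Nat.choose, h5]
lemma bb6 : bernoulli 6 = 1 / 42 := by
  rw [bernoulli_eq_bernoulli'_of_ne_one (by norm_num), bb6']
lemma bb8' : bernoulli' 8 = -1 / 30 := by
  have h5 : bernoulli' 5 = 0 := bernoulli'_eq_zero_of_odd (by decide) (by norm_num)
  have h7 : bernoulli' 7 = 0 := bernoulli'_eq_zero_of_odd (by decide) (by norm_num)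
  rw [bernoulli'_def]
  norm_num [sum_range_succ, Nat.choose, h5, h7, bb6']
lemma bb8 : bernoulli 8 = -1 / 30 := by
  rw [bernoulli_eq_bernoulli'_of_ne_one (by norm_num), bb8']

lemma bern8 (y : ℝ) : bernoulliFun 8 y = (y * (1 - y)) ^ 4 + 4 / 3 * (y * (1 - y)) ^ 3 + 2 / 3 * (y * (1 - y)) ^ 2 - 1 / 30 := by
  simp [bernoulliFun, Polynomial.bernoulli, sum_range_succ, Polynomial.eval_add, bb3, bb4, bb5, bb6, bb7, bb8,
    Nat.choose]
  norm_num
  ring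

lemma bern5_one : bernoulliFun 5 1 = 0 := by
  rw [bernoulliFun_eval_one]
  simp [bernoulliFun_eval_zero, bb5]
lemma bern6_one : bernoulliFun 6 1 = 1 / 42 := by
  rw [bernoulliFun_eval_one]
  simp [bernoulliFun_eval_zero, bb6]
lemma bern7_one : bernoulliFun 7 1 = 0 := by
  rw [bernoulliFun_eval_one]
  simp [bernoulliFun_eval_zero, bb7]

lemma bern8_le : ∀ y ∈ Icc (0:ℝ) 1, |bernoulliFun 8 y| ≤ 1/30 := by
  rintro y ⟨h0, h1⟩
  rw [bern8]
  have u0 : 0 ≤ y * (1 - y) := mul_nonneg h0 (by linarith)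
  have u1 : y * (1 - y) ≤ 1 / 4 := by nlinarith [sq_nonneg (y - 1 / 2)]
  generalize y * (1 - y) = u at *
  have h2 : u ^ 2 ≤ (1 / 4) ^ 2 := pow_le_pow_left₀ u0 u1 2
  have h3 : u ^ 3 ≤ (1 / 4) ^ 3 := pow_le_pow_left₀ u0 u1 3
  have h4 : u ^ 4 ≤ (1 / 4) ^ 4 := pow_le_pow_left₀ u0 u1 4
  have : 0 ≤ u ^ 2 := by positivity
  have : 0 ≤ u ^ 3 := by positivity
  have : 0 ≤ u ^ 4 := by positivity
  rw [abs_le]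
  constructor <;> norm_num at * <;> linarith

/-- sums of powers of odd numbers -/
lemma sum_odd_rpow (p : ℝ) (hp0 : 0 < p) (hp1 : p ≤ 1) (K : ℕ) :
    ∑ l ∈ Finset.range (K + 1), (2 * (l : ℝ) + 1) ^ (p - 1) ≤ ((2 * (K : ℝ) + 1) ^ p - 1) / (2 * p) + 1 := by
  induction K with
  | zero => simp
  | succ K ih =>
    rw [sum_range_succ]
    have hK : (0 : ℝ) ≤ K := Nat.cast_nonneg K
    have hb : (0 : ℝ) < 2 * K + 3 := by linarith
    have e1 : (2 * ((K + 1 : ℕ) : ℝ) + 1) = 2 * K + 3 := by push_cast; ring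
    rw [e1]
    have hB := rpow_one_add_le_one_add_mul_self (s := -2 / (2 * K + 3)) (p := p)
      (by rw [le_div_iff₀ hb]; linarith) hp0.le hp1
    have e2 : 1 + -2 / (2 * (K : ℝ) + 3) = (2 * K + 1) / (2 * K + 3) := by field_simp; ring
    rw [e2, Real.div_rpow (by linarith) hb.le, div_le_iff₀ (by positivity)] at hB
    have e3 : (2 * (K : ℝ) + 3) ^ (p - 1) = (2 * (K : ℝ) + 3) ^ p / (2 * K + 3) := by
      rw [Real.rpow_sub hb, Real.rpow_one]
    rw [e3]
    have e4 : (1 + p * (-2 / (2 * (K : ℝ) + 3))) * (2 * K + 3) ^ p = (2 * K + 3) ^ p - 2 * p * ((2 * K + 3) ^ p / (2 * K + 3)) := by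
      field_simp
      ring
    rw [e4] at hB
    generalize (2 * (K : ℝ) + 3) ^ p / (2 * K + 3) = q at *
    generalize (2 * (K : ℝ) + 3) ^ p = B at *
    generalize (2 * (K : ℝ) + 1) ^ p = A at *
    have : q ≤ (B - A) / (2 * p) := by rw [le_div_iff₀ (by positivity)]; linarith
    have e5 : (B - 1) / (2 * p) = (A - 1) / (2 * p) + (B - A) / (2 * p) := by ring
    rw [e5]
    linarith

lemma log_le_rpow8 (x : ℝ) (hx : 1 ≤ x) : ln x ≤ 2.944 * x ^ (1 / 8 : ℝ) := by
  have hx0 : 0 < x := by linarith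
  have hy : 0 < x ^ (1 / 8 : ℝ) := by positivity
  have h1 : ln (x ^ (1 / 8 : ℝ)) = 1 / 8 * ln x := Real.log_rpow hx0 _
  have h2 := log_le_sub_one_of_pos (x := x ^ (1 / 8 : ℝ) / rexp 1) (by positivity)
  rw [Real.log_div hy.ne' (by positivity), Real.log_exp, h1] at h2
  have h3 : x ^ (1 / 8 : ℝ) / rexp 1 ≤ x ^ (1 / 8 : ℝ) * 0.368 := by
    rw [div_le_iff₀ (by positivity)]
    have := Real.exp_one_gt_d9
    nlinarith
  linarith

lemma sum_log2 (K : ℕ) : ∑ l ∈ Finset.range (K + 1), (2 * (l : ℝ) + 1) ^ (-7 / 8 : ℝ) * ln (2 * l + 1) ^ 2 ≤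
    8.668 * (4 / 3 * (2 * (K : ℝ) + 1) ^ (3 / 8 : ℝ)) := by
  have h := sum_odd_rpow (3 / 8) (by norm_num) (by norm_num) K
  have h' : ∑ l ∈ Finset.range (K + 1), (2 * (l : ℝ) + 1) ^ (3 / 8 - 1 : ℝ) ≤ 4 / 3 * (2 * (K : ℝ) + 1) ^ (3 / 8 : ℝ) := by
    refine h.trans ?_
    generalize (2 * (K : ℝ) + 1) ^ (3 / 8 : ℝ) = y
    have e : (y - 1) / (2 * (3 / 8)) = 4 / 3 * y - 4 / 3 := by ring
    rw [e]
    linarith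
  refine le_trans ?_ (mul_le_mul_of_nonneg_left h' (by norm_num))
  rw [mul_sum]
  refine sum_le_sum fun l _ => ?_
  have hl : (0 : ℝ) ≤ l := Nat.cast_nonneg l
  have hx : (1 : ℝ) ≤ 2 * l + 1 := by linarith
  generalize 2 * (l : ℝ) + 1 = x at *
  have hx0 : 0 < x := by linarith
  have h1 := log_le_rpow8 x hx
  have h2 := pow_le_pow_left₀ (Real.log_nonneg hx) h1 2
  have e1 : (x ^ (1 / 8 : ℝ)) ^ 2 = x ^ (2 / 8 : ℝ) := by
    rw [← rpow_natCast, ← Real.rpow_mul hx0.le]; norm_num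
  have e2 : x ^ (3 / 8 - 1 : ℝ) = x ^ (-7 / 8 : ℝ) * x ^ (2 / 8 : ℝ) := by
    rw [← Real.rpow_add hx0]; norm_num
  rw [mul_pow, e1] at h2
  rw [e2]
  have h3 : 0 < x ^ (-7 / 8 : ℝ) := by positivity
  have h4 : 0 < x ^ (2 / 8 : ℝ) := by positivity
  have h5 : ln x ^ 2 ≤ 8.668 * x ^ (2 / 8 : ℝ) := by nlinarith
  calc _ ≤ x ^ (-7 / 8 : ℝ) * (8.668 * x ^ (2 / 8 : ℝ)) := mul_le_mul_of_nonneg_left h5 h3.le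
    _ = _ := by ring

noncomputable def Dk (K : ℕ) (s : ℂ) : ℂ := ∑ l ∈ Finset.range K, ((2 * (l : ℝ) + 1 : ℝ) : ℂ) ^ (-s)

lemma two_mul_cpow (x : ℝ) (hx : 0 ≤ x) (s : ℂ) : (2 : ℂ) ^ (-s) * (x : ℂ) ^ (-s) = ((2 * x : ℝ) : ℂ) ^ (-s) := by
  rw [Complex.ofReal_mul, mul_cpow_ofReal_nonneg (by norm_num) hx]
  norm_num

lemma gn_split (K : ℕ) (s : ℂ) (hs : s ≠ 0) (hre : s.re = 7 / 8) :
    gn s = ((s - 1) * Dk K s + (K + 1 / 2 : ℝ) * ((2 * (K + 1 / 2) : ℝ) : ℂ) ^ (-s)) / s +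
      (2 : ℂ) ^ (-s) * ((s - 1) * emT 8 s 1 (K + 1 / 2)) / s + (2 : ℂ) ^ (-s) * emR 8 s (K + 1 / 2) / s := by
  have hK : (0 : ℝ) < K + 1 / 2 := by positivity
  have h1 := Z_odd_eq_emH 8 (by norm_num) bern8_le s (by rw [hre]; norm_num)
  have h2 := emH_add 8 (by norm_num) bern8_le s (by rw [hre]; norm_num) (x := 1 / 2) (by norm_num) K
  have hD : (2 : ℂ) ^ (-s) * ∑ k ∈ Finset.range K, ((k + 1 / 2 : ℝ) : ℂ) ^ (-s) = Dk K s := by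
    rw [Dk, mul_sum]
    refine sum_congr rfl fun l _ => ?_
    rw [two_mul_cpow _ (by positivity)]
    congr 2
    ring
  have hx : ((K + 1 / 2 : ℝ) : ℂ) ^ (1 - s) = ((K + 1 / 2 : ℝ) : ℂ) * ((K + 1 / 2 : ℝ) : ℂ) ^ (-s) := by
    rw [sub_eq_add_neg, Complex.cpow_add _ _ (by exact_mod_cast hK.ne'), Complex.cpow_one]
  have hM : (2 : ℂ) ^ (-s) * ((K + 1 / 2 : ℝ) : ℂ) ^ (1 - s) = (K + 1 / 2 : ℝ) * ((2 * (K + 1 / 2) : ℝ) : ℂ) ^ (-s) := by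
    rw [hx, ← two_mul_cpow _ hK.le]; ring
  rw [gn, h1, h2, emH, emA]
  rw [← hD, ← hM]
  ring

lemma poch_bd (K : ℕ) (hK : 4 ≤ K) (t : ℝ) (ht0 : 0 ≤ t) (ht : t ≤ 4 * K) (k : ℕ) (hk : k ≤ 8) :
    ‖poch ((7 / 8 : ℝ) + t * I) k‖ ≤ (4 * (K + 1 / 2 : ℝ)) ^ k := by
  have hK' : (4 : ℝ) ≤ K := by exact_mod_cast hK
  rw [poch, norm_prod]
  calc _ ≤ ∏ i ∈ Finset.range k, (4 * (K + 1 / 2 : ℝ)) := by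
        refine Finset.prod_le_prod (fun _ _ => norm_nonneg _) fun i hi => ?_
        have hi7 : i ≤ 7 := by have := Finset.mem_range.1 hi; omega
        have hi' : (i : ℝ) ≤ 7 := by exact_mod_cast hi7
        have hi0 : (0 : ℝ) ≤ i := Nat.cast_nonneg i
        have e : ((7 / 8 : ℝ) : ℂ) + t * I + i = ⟨7 / 8 + i, t⟩ := by
          apply Complex.ext <;> simp
        rw [e, norm_def, Complex.normSq_mk]
        apply Real.sqrt_le_iff.2
        refine ⟨by positivity, ?_⟩
        nlinarith
    _ = _ := by simp

lemma gn_approx (K : ℕ) (hK : 4 ≤ K) (t : ℝ) (ht0 : 0 ≤ t) (ht : t ≤ 4 * K) :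
    ‖gn ((7 / 8 : ℝ) + t * I) - (((7 / 8 : ℝ) + t * I - 1) * Dk K ((7 / 8 : ℝ) + t * I) +
      (K + 1 / 2 : ℝ) * ((2 * (K + 1 / 2) : ℝ) : ℂ) ^ (-((7 / 8 : ℝ) + t * I : ℂ))) / ((7 / 8 : ℝ) + t * I)‖ ≤
    (2 * (K + 1 / 2) : ℝ) ^ (-7 / 8 : ℝ) * (0.97 + 0.0543 * (1 + (K + 1 / 2) / 7.875)) := by
  have hp := fun k hk => poch_bd K hK t ht0 ht k hk
  have hre : ((7 / 8 : ℝ) + t * I : ℂ).re = 7 / 8 := by simp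
  have him : ((7 / 8 : ℝ) + t * I : ℂ).im = t := by simp
  set s : ℂ := (7 / 8 : ℝ) + t * I with hsdef
  have hs : s ≠ 0 := by intro h; rw [h] at hre; norm_num at hre
  have hxp : (0 : ℝ) < K + 1 / 2 := by positivity
  set x : ℝ := K + 1 / 2 with hx
  have hsn : 0 < ‖s‖ := norm_pos_iff.2 hs
  have hs1 : ‖s - 1‖ ≤ ‖s‖ := by
    rw [norm_def, norm_def]
    apply Real.sqrt_le_sqrt
    rw [normSq_apply, normSq_apply, sub_re, sub_im, hre]
    norm_num
  have hn2 : ‖(2 : ℂ) ^ (-s)‖ = 2 ^ (-7 / 8 : ℝ) := by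
    rw [two_cpow_norm]
    congr 1
    rw [hre]; norm_num
  have hxk : ∀ k : ℕ, x ^ (-7 / 8 - k : ℝ) = x ^ (-7 / 8 : ℝ) / x ^ k := by
    intro k
    rw [Real.rpow_sub hxp, rpow_natCast]
  rw [gn_split K s hs hre, ← hx]
  have e : ∀ a b c : ℂ, a + b + c - a = b + c := by intros; ring
  rw [e]
  have h2x : (2 * x) ^ (-7 / 8 : ℝ) = 2 ^ (-7 / 8 : ℝ) * x ^ (-7 / 8 : ℝ) := Real.mul_rpow (by norm_num) hxp.le
  have hT : ‖emT 8 s 1 x‖ ≤ x ^ (-7 / 8 : ℝ) * 0.97 := by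
    have hk : ∀ k ≤ 7, ‖poch s k * ((bernoulliFun (k+1) 1 / (k+1).factorial : ℝ) : ℂ) * (x : ℂ) ^ (-s - k)‖ ≤
        x ^ (-7 / 8 : ℝ) * (4 ^ k * |bernoulliFun (k+1) 1 / (k+1).factorial|) := by
      intro k hk
      rw [norm_mul, norm_mul, Complex.norm_real, Real.norm_eq_abs, norm_cpow_eq_rpow_re_of_pos hxp]
      have : (-s - k : ℂ).re = -7 / 8 - k := by
        rw [sub_re, Complex.neg_re, hre, Complex.natCast_re]; ring
      rw [this, hxk]
      have h1 := hp k (by omega)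
      have h2 : ‖poch s k‖ / x ^ k ≤ 4 ^ k := by
        rw [div_le_iff₀ (by positivity), ← mul_pow]; exact h1
      calc _ = x ^ (-7 / 8 : ℝ) * ((‖poch s k‖ / x ^ k) * |bernoulliFun (k+1) 1 / (k+1).factorial|) := by ring
        _ ≤ _ := by gcongr
    rw [emT]
    refine (norm_sum_le_of_le _ (f := fun k => poch s k * ((bernoulliFun (k+1) 1 / (k+1).factorial : ℝ) : ℂ) * (x : ℂ) ^ (-s - k)) (fun k hk' => hk k (by have := Finset.mem_range.1 hk'; omega))).trans ?_
    rw [← mul_sum]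
    refine mul_le_mul_of_nonneg_left ?_ (by positivity)
    have b1 : bernoulliFun 1 1 = 1 / 2 := by rw [bern1]; norm_num
    have b2 : bernoulliFun 2 1 = 1 / 6 := by rw [bern2]; norm_num
    have b3 : bernoulliFun 3 1 = 0 := by rw [bern3]; norm_num
    have b4 : bernoulliFun 4 1 = -1/30 := by rw [bern4]; norm_num
    have b8 : bernoulliFun 8 1 = -1/30 := by rw [bern8]; norm_num
    simp only [sum_range_succ, Finset.sum_range_zero, zero_add, Nat.reduceAdd, b1, b2, b3, b4, bern5_one, bern6_one, bern7_one, b8,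
      factorial]
    norm_num [abs_div]
  have hR := emR_bound 8 (by norm_num) bern8_le s (by rw [hre]; norm_num) hxp
  have hR2 : ‖emR 8 s x‖ ≤ ‖s‖ * (x ^ (-7 / 8 : ℝ) * (0.0543 * (1 + x / 7.875))) := by
    refine hR.trans ?_
    rw [hre]
    have e1 : (-(7 / 8) - ((8 : ℕ) : ℝ)) = -7 / 8 - (8 : ℕ) := by ring
    have e2 : x ^ (1 - 7 / 8 - ((8 : ℕ) : ℝ)) = x * x ^ (-7 / 8 - ((8 : ℕ) : ℝ)) := by
      rw [show (1 - 7 / 8 - ((8 : ℕ) : ℝ)) = 1 + (-7 / 8 - ((8 : ℕ) : ℝ)) by ring, Real.rpow_add hxp, Real.rpow_one]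
    rw [e1, e2, hxk]
    have h8 : ‖poch s 8‖ / x ^ 8 ≤ 4 ^ 8 := by
      rw [div_le_iff₀ (by positivity), ← mul_pow]; exact hp 8 le_rfl
    have hc : (7 / 8 + ((8 : ℕ) : ℝ) - 1) = 7.875 := by norm_num
    rw [hc]
    calc _ = ‖s - 1‖ * (x ^ (-7 / 8 : ℝ) * ((‖poch s 8‖ / x ^ 8) * (1 / 30 / (factorial 8 : ℝ)) * (1 + x / 7.875))) := by
          ring
      _ ≤ ‖s‖ * (x ^ (-7 / 8 : ℝ) * (4 ^ 8 * (1 / 30 / (factorial 8 : ℝ)) * (1 + x / 7.875))) := by gcongr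
      _ ≤ _ := by
        have hf : (4 : ℝ) ^ 8 * (1 / 30 / (factorial 8 : ℝ)) ≤ 0.0543 := by norm_num [factorial]
        gcongr
  refine (norm_add_le _ _).trans ?_
  rw [norm_div, norm_div, norm_mul, norm_mul, norm_mul, hn2, h2x]
  have hP : 0 < (2 : ℝ) ^ (-7 / 8 : ℝ) := by positivity
  have t1 : 2 ^ (-7 / 8 : ℝ) * (‖s - 1‖ * ‖emT 8 s 1 x‖) / ‖s‖ ≤ 2 ^ (-7 / 8 : ℝ) * (x ^ (-7 / 8 : ℝ) * 0.97) := by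
    rw [div_le_iff₀ hsn]
    have := mul_le_mul hs1 hT (norm_nonneg _) hsn.le
    calc _ ≤ 2 ^ (-7 / 8 : ℝ) * (‖s‖ * (x ^ (-7 / 8 : ℝ) * 0.97)) := mul_le_mul_of_nonneg_left this hP.le
      _ = _ := by ring
  have t2 : 2 ^ (-7 / 8 : ℝ) * ‖emR 8 s x‖ / ‖s‖ ≤ 2 ^ (-7 / 8 : ℝ) * (x ^ (-7 / 8 : ℝ) * (0.0543 * (1 + x / 7.875))) := by
    rw [div_le_iff₀ hsn]
    calc _ ≤ 2 ^ (-7 / 8 : ℝ) * (‖s‖ * (x ^ (-7 / 8 : ℝ) * (0.0543 * (1 + x / 7.875)))) := mul_le_mul_of_nonneg_left hR2 hP.le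
      _ = _ := by ring
  calc _ ≤ 2 ^ (-7 / 8 : ℝ) * (x ^ (-7 / 8 : ℝ) * 0.97) + 2 ^ (-7 / 8 : ℝ) * (x ^ (-7 / 8 : ℝ) * (0.0543 * (1 + x / 7.875))) :=
        add_le_add t1 t2
    _ = _ := by ring

lemma interp (f f' f'' : ℝ → ℝ) (h1 : ∀ t, HasDerivAt f (f' t) t) (h2 : ∀ t, HasDerivAt f' (f'' t) t) (B : ℝ)
    (hB0 : 0 ≤ B) (hB : ∀ t, f'' t ≤ B) {a m : ℝ} (ha : m ≤ f a) (hb : m ≤ f (a + 1 / 16)) (t : ℝ) (hat : a ≤ t)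
    (htb : t ≤ a + 1 / 16) : m - B / 2048 ≤ f t := by
  have g1 : ∀ t, HasDerivAt (fun t => f t - B / 2 * t ^ 2) (f' t - B * t) t := fun t =>
    ((h1 t).sub (((hasDerivAt_id t).pow 2).const_mul (B / 2))).congr_deriv (by simp; ring)
  have g2 : ∀ t, HasDerivAt (fun t => f' t - B * t) (f'' t - B) t := fun t =>
    ((h2 t).sub ((hasDerivAt_id t).const_mul B)).congr_deriv (by simp)
  have hd : deriv (fun t => f t - B / 2 * t ^ 2) = fun t => f' t - B * t := funext fun t => (g1 t).deriv
  have hc : ConcaveOn ℝ univ (fun t => f t - B / 2 * t ^ 2) := by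
    refine concaveOn_univ_of_deriv2_nonpos (fun t => (g1 t).differentiableAt) ?_ ?_
    · rw [hd]; exact fun t => (g2 t).differentiableAt
    · intro t
      simp only [Function.iterate_succ, Function.iterate_zero, Function.comp_apply, id]
      rw [hd, (g2 t).deriv]; linarith [hB t]
  have := hc.2 (mem_univ a) (mem_univ (a + 1 / 16)) (show (0 : ℝ) ≤ 1 - 16 * (t - a) by linarith)
    (show (0 : ℝ) ≤ 16 * (t - a) by linarith) (by ring)
  simp only [smul_eq_mul] at this
  have e : (1 - 16 * (t - a)) * a + 16 * (t - a) * (a + 1 / 16) = t := by ring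
  rw [e] at this
  have q1 := mul_le_mul_of_nonneg_left ha (show 0 ≤ 1 - 16 * (t - a) by linarith)
  have q2 := mul_le_mul_of_nonneg_left hb (show 0 ≤ 16 * (t - a) by linarith)
  have q3 : 0 ≤ B * (t - a - 1 / 32) ^ 2 := by positivity
  linarith only [this, q1, q2, q3]

noncomputable def en (l t : ℝ) : ℂ := Complex.exp (-(l * ((7 / 8 : ℝ) + t * I)))

lemma en_deriv (l t : ℝ) : HasDerivAt (en l) (-(l * I) * en l t) t := by
  have h : HasDerivAt (fun t : ℝ => -((l : ℂ) * ((7 / 8 : ℝ) + t * I))) (-(l * I)) t := by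
    have := (((Complex.ofRealCLM.hasDerivAt (x := t)).mul_const I).const_add ((7 / 8 : ℝ) : ℂ)).const_mul (l : ℂ)
    exact this.neg.congr_deriv (by simp)
  exact h.cexp.congr_deriv (by rw [en]; ring)

lemma norm_en (x t : ℝ) (hx : 0 < x) : ‖en (ln x) t‖ = x ^ (-7 / 8 : ℝ) := by
  rw [en, norm_exp, Real.rpow_def_of_pos hx]
  congr 1
  rw [Complex.neg_re, re_ofReal_mul]
  simp; ring

lemma cpow_en (x t : ℝ) (hx : 0 < x) : (x : ℂ) ^ (-((7 / 8 : ℝ) + t * I : ℂ)) = en (ln x) t := by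
  rw [Complex.cpow_def_of_ne_zero (by exact_mod_cast hx.ne'), ← Complex.ofReal_log hx.le, en, mul_neg]

noncomputable def DD (K m : ℕ) (t : ℝ) : ℂ :=
  ∑ l ∈ Finset.range K, (-(ln (2 * l + 1) * I)) ^ m * en (ln (2 * l + 1)) t

lemma DD_deriv (K m : ℕ) (t : ℝ) : HasDerivAt (DD K m) (DD K (m + 1) t) t := by
  unfold DD
  refine (HasDerivAt.fun_sum fun (l : ℕ) _ => (en_deriv (ln (2 * l + 1)) t).const_mul ((-(ln (2 * l + 1) * I : ℂ)) ^ m)).congr_deriv ?_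
  refine sum_congr rfl fun l _ => ?_
  ring

lemma Dk_eq (K : ℕ) (t : ℝ) : Dk K ((7 / 8 : ℝ) + t * I) = DD K 0 t := by
  rw [Dk, DD]
  refine sum_congr rfl fun l _ => ?_
  rw [cpow_en _ _ (by positivity)]; simp

lemma DD_norm (K m : ℕ) (t : ℝ) :
    ‖DD K m t‖ ≤ ∑ l ∈ Finset.range K, (2 * (l : ℝ) + 1) ^ (-7 / 8 : ℝ) * ln (2 * l + 1) ^ m := by
  refine norm_sum_le_of_le _ fun l _ => ?_
  have h0 : 0 ≤ ln (2 * (l : ℝ) + 1) := Real.log_nonneg (by have : (0 : ℝ) ≤ l := Nat.cast_nonneg l; linarith)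
  rw [norm_mul, norm_en _ _ (by positivity), norm_pow, norm_neg, norm_mul, Complex.norm_real, Complex.norm_I, mul_one,
    norm_of_nonneg h0, mul_comm]

lemma re_deriv {F : ℝ → ℂ} {F' : ℂ} {t : ℝ} (h : HasDerivAt F F' t) : HasDerivAt (fun t => (F t).re) F'.re t :=
  Complex.reCLM.hasFDerivAt.comp_hasDerivAt t h

lemma S0_bd (K : ℕ) (hK : 1 ≤ K) : ∑ l ∈ Finset.range K, (2 * (l : ℝ) + 1) ^ (-7 / 8 : ℝ) ≤ 4 * (2 * (K : ℝ) - 1) ^ (1 / 8 : ℝ) - 3 := by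
  obtain ⟨k, rfl⟩ : ∃ k, K = k + 1 := ⟨K - 1, by omega⟩
  have := sum_odd_rpow (1 / 8) (by norm_num) (by norm_num) k
  have e : (1 / 8 - 1 : ℝ) = -7 / 8 := by norm_num
  rw [e] at this
  have e2 : 2 * ((k + 1 : ℕ) : ℝ) - 1 = 2 * k + 1 := by push_cast; ring
  rw [e2]
  generalize (2 * (k : ℝ) + 1) ^ (1 / 8 : ℝ) = z at *
  generalize ∑ l ∈ Finset.range (k + 1), (2 * (l : ℝ) + 1) ^ (-7 / 8 : ℝ) = w at *
  have e3 : (z - 1) / (2 * (1 / 8)) = 4 * z - 4 := by ring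
  linarith

lemma S0_bd' (K : ℕ) (hK : 1 ≤ K) : ∑ l ∈ Finset.range K, (2 * (l : ℝ) + 1) ^ (-7 / 8 : ℝ) ≤ 4 * (2 * (K : ℝ) + 1) ^ (1 / 8 : ℝ) - 3 := by
  have h1 : (1 : ℝ) ≤ K := by exact_mod_cast hK
  have : (2 * (K : ℝ) - 1) ^ (1 / 8 : ℝ) ≤ (2 * (K : ℝ) + 1) ^ (1 / 8 : ℝ) :=
    Real.rpow_le_rpow (by linarith) (by linarith) (by norm_num)
  linarith [S0_bd K hK]

lemma S2_bd (K : ℕ) (hK : 1 ≤ K) : ∑ l ∈ Finset.range K, (2 * (l : ℝ) + 1) ^ (-7 / 8 : ℝ) * ln (2 * l + 1) ^ 2 ≤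
    11.56 * (2 * (K : ℝ) + 1) ^ (3 / 8 : ℝ) := by
  obtain ⟨k, rfl⟩ : ∃ k, K = k + 1 := ⟨K - 1, by omega⟩
  refine (sum_log2 k).trans ?_
  have : (2 * (k : ℝ) + 1) ^ (3 / 8 : ℝ) ≤ (2 * ((k + 1 : ℕ) : ℝ) + 1) ^ (3 / 8 : ℝ) :=
    Real.rpow_le_rpow (by positivity) (by push_cast; linarith) (by norm_num)
  have h0 : 0 ≤ (2 * (k : ℝ) + 1) ^ (3 / 8 : ℝ) := by positivity
  linarith

lemma Fs_eq (b j i : ℕ) : Fs b j i = DD j 0 ((b + i : ℕ) / 16) := by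
  rw [Fs, DD]
  refine sum_congr rfl fun l _ => ?_
  rw [yq, ωq, en, ← Complex.exp_nat_mul, ← Complex.exp_add, pow_zero, one_mul]
  congr 1
  push_cast
  ring

lemma norm_yq (b l : ℕ) : ‖yq b l‖ = (2 * (l : ℝ) + 1) ^ (-7 / 8 : ℝ) := by
  rw [← norm_en _ ((b : ℝ) / 16) (by positivity), yq, en]
  congr 3
  push_cast; ring

lemma Es_bd (b K : ℕ) : Es b K ≤ 1.11 / 10 ^ 6 * K + 0.000627 * ∑ l ∈ Finset.range K, (2 * (l : ℝ) + 1) ^ (-7 / 8 : ℝ) := by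
  have h : (1 + 1 / 16000 : ℝ) ^ 10 ≤ 1.000627 := by norm_num
  have e : 1.11 / 10 ^ 6 * (K : ℝ) = ∑ l ∈ Finset.range K, (1.11 / 10 ^ 6 : ℝ) := by simp; ring
  rw [Es, e, mul_sum, ← sum_add_distrib]
  refine sum_le_sum fun l _ => ?_
  rw [norm_yq]
  have h0 : (0 : ℝ) ≤ (2 * (l : ℝ) + 1) ^ (-7 / 8 : ℝ) := by positivity
  generalize (2 * (l : ℝ) + 1) ^ (-7 / 8 : ℝ) = z at *
  have := mul_le_mul_of_nonneg_left h (show 0 ≤ 11 / 10 ^ 7 + z by positivity)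
  linarith only [this, h0]

lemma numF (c : ℕ) (hc1 : 1 ≤ c) (hc : c ≤ 51) (y t K E S0 S2 : ℝ) (hy0 : 0 < y) (hK : K = 16 * (c + 1)) (hy : y ^ 8 = 2 * K + 1)
    (ht : (1023 * c + 1) / 16 ≤ t) (hS : S0 ≤ 4 * y - 3) (hS2 : S2 ≤ 11.56 * y ^ 3) (hE : E ≤ 1.11 / 10 ^ 6 * K + 0.000627 * S0) :
    S0 ≤ 7.5 ∧ E ≤ 0.1 ∧ 0.1 ≤ 0.2849 - E - S2 / 2048 - (S0 + y / 2) / t - (y ^ 7)⁻¹ * (0.97 + 0.0543 * (1 + (K + 1 / 2) / 7.875)) := by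
  have hc' : (c : ℝ) ≤ 51 := by exact_mod_cast hc
  have hc1' : (1 : ℝ) ≤ c := by exact_mod_cast hc1
  have hyu : ∀ a : ℝ, 0 ≤ a → 2 * K + 1 ≤ a ^ 8 → y ≤ a := fun a ha h => by
    rw [← hy] at h; exact le_of_pow_le_pow_left₀ (by norm_num) ha h
  have hyl : ∀ a : ℝ, a ^ 8 ≤ 2 * K + 1 → a ≤ y := fun a h => by
    rw [← hy] at h; exact le_of_pow_le_pow_left₀ (by norm_num) hy0.le h
  have herr : (y ^ 7)⁻¹ * (0.97 + 0.0543 * (1 + (K + 1 / 2) / 7.875)) = 1.0243 * (y ^ 7)⁻¹ + 0.0543 / 15.75 * y := by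
    have : K + 1 / 2 = y ^ 8 / 2 := by rw [hy]; ring
    rw [this]; field_simp; ring
  rw [herr]
  have hy2 : y ≤ 2.5277 := hyu _ (by norm_num) (by rw [hK]; norm_num; linarith)
  have hyl1 : 1.685 ≤ y := hyl _ (by rw [hK]; norm_num; linarith)
  have hE' : E ≤ 0.1 := by linarith
  refine ⟨by linarith, hE', ?_⟩
  have main : ∀ yl yu t0 : ℝ, 0 < t0 → 1 ≤ yl → yl ≤ y → y ≤ yu → t0 ≤ t →
      0.1 ≤ 0.2849 - (1.11 / 10 ^ 6 * K + 0.000627 * (4 * yu - 3)) - 11.56 * yu ^ 3 / 2048 - (4.5 * yu - 3) / t0 - (1.0243 * (yl ^ 7)⁻¹ + 0.0543 / 15.75 * yu) →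
      0.1 ≤ 0.2849 - E - S2 / 2048 - (S0 + y / 2) / t - (1.0243 * (y ^ 7)⁻¹ + 0.0543 / 15.75 * y) := by
    intro yl yu t0 ht0 h1 h2 h3 h4 h5
    have a1 : (S0 + y / 2) / t ≤ (4.5 * yu - 3) / t0 := by
      apply div_le_div₀ <;> linarith
    have a2 : (y ^ 7)⁻¹ ≤ (yl ^ 7)⁻¹ := by
      have : 0 < yl := by linarith
      gcongr
    have a3 : y ^ 3 ≤ yu ^ 3 := by gcongr
    linarith
  rcases le_or_gt c 7 with h7 | h7
  · have hc7 : (c : ℝ) ≤ 7 := by exact_mod_cast h7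
    refine main 1.685 2.0012 63.9 (by norm_num) (by norm_num) hyl1 (hyu _ (by norm_num) (by rw [hK]; norm_num; linarith)) (by linarith) ?_
    have : K ≤ 128 := by linarith
    norm_num; linarith
  · have hc8 : (8 : ℝ) ≤ c := by exact_mod_cast h7
    refine main 2.03 2.5277 511 (by norm_num) (by norm_num) (hyl _ (by rw [hK]; norm_num; linarith)) hy2 (by linarith) ?_
    have : K ≤ 832 := by linarith
    norm_num; linarith

lemma chunk_num (c : ℕ) (hc1 : 1 ≤ c) (hc : c ≤ 51) (h : chunkB c = true) (m : ℕ) (hm : 1023 * c + 1 ≤ m) (hm2 : m < 1023 * c + 1024)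
    (t : ℝ) (htm : (m : ℝ) / 16 ≤ t) (htm2 : t ≤ m / 16 + 1 / 16) : 0.1 ≤ (gn ((7 / 8 : ℝ) + t * I)).re := by
  have hmr : (1023 * c + 1 : ℝ) ≤ m := by exact_mod_cast hm
  have hmr2 : (m : ℝ) + 1 ≤ 1023 * c + 1024 := by exact_mod_cast hm2
  have ht : (1023 * c + 1 : ℝ) / 16 ≤ t := by linarith
  set K := 16 * (c + 1) with hK
  have hKr : (K : ℝ) = 16 * (c + 1) := by rw [hK]; push_cast; ring
  have hc0 : (0 : ℝ) ≤ c := Nat.cast_nonneg c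
  have hM0 : (0 : ℝ) < 2 * K + 1 := by positivity
  set y : ℝ := (2 * (K : ℝ) + 1) ^ (1 / 8 : ℝ) with hy
  have hy0 : 0 < y := by positivity
  have hyp : ∀ n : ℕ, (2 * (K : ℝ) + 1) ^ ((n : ℝ) / 8) = y ^ n := fun n => by
    rw [hy, ← rpow_natCast, ← Real.rpow_mul hM0.le]; congr 1; ring
  have hy8 : y ^ 8 = 2 * K + 1 := by rw [← hyp]; norm_num
  have hy3 := hyp 3
  have hy7 : (2 * (K : ℝ) + 1) ^ (-7 / 8 : ℝ) = (y ^ 7)⁻¹ := by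
    rw [← hyp, ← Real.rpow_neg hM0.le]; congr 1; norm_num
  have hS0 := S0_bd' K (by omega)
  have hS2 := S2_bd K (by omega)
  have hy3' : (2 * (K : ℝ) + 1) ^ (3 / 8 : ℝ) = y ^ 3 := by rw [← hy3]; norm_num
  rw [hy3'] at hS2
  have hE := Es_bd (1023 * c + 1) K
  obtain ⟨f1, f2, f3⟩ := numF c hc1 hc y t K _ _ _ hy0 hKr hy8 ht hS0 hS2 hE
  have hD0 : ∀ t, ‖DD K 0 t‖ ≤ ∑ l ∈ Finset.range K, (2 * (l : ℝ) + 1) ^ (-7 / 8 : ℝ) := fun t => by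
    simpa using DD_norm K 0 t
  have hsp := chunk_spec c hc h f2 (fun i _ => by rw [Fs_eq]; exact (hD0 _).trans f1)
  have hgrid : ∀ m : ℕ, 1023 * c + 1 ≤ m → m ≤ 1023 * c + 1024 → 0.2849 - Es (1023 * c + 1) K ≤ (DD K 0 (m / 16)).re := by
    intro m h1 h2
    have := hsp (m - (1023 * c + 1)) (by omega)
    rw [Fs_eq] at this
    rwa [show 1023 * c + 1 + (m - (1023 * c + 1)) = m by omega] at this
  have g1 := hgrid m hm (by omega)
  have g2 := hgrid (m + 1) (by omega) (by omega)
  rw [show ((m + 1 : ℕ) : ℝ) / 16 = m / 16 + 1 / 16 by push_cast; ring] at g2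
  have hin := interp (fun t => (DD K 0 t).re) (fun t => (DD K 1 t).re) (fun t => (DD K 2 t).re)
    (fun t => re_deriv (DD_deriv K 0 t)) (fun t => re_deriv (DD_deriv K 1 t)) _
    ((norm_nonneg _).trans (DD_norm K 2 0)) (fun t => (re_le_norm _).trans (DD_norm K 2 t)) g1 g2 t htm htm2
  have hga := gn_approx K (by omega) t (by linarith) (by rw [hKr]; linarith)
  have h2K : 2 * ((K : ℝ) + 1 / 2) = 2 * K + 1 := by ring
  rw [h2K, hy7] at hga
  have htp : 0 < t := by linarith
  have hs : ((7 / 8 : ℝ) + t * I : ℂ) ≠ 0 := by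
    intro h0; have := congrArg Complex.re h0; norm_num at this
  have hst : t ≤ ‖((7 / 8 : ℝ) + t * I : ℂ)‖ := by
    have := abs_im_le_norm ((7 / 8 : ℝ) + t * I : ℂ)
    have e : ((7 / 8 : ℝ) + t * I : ℂ).im = t := by simp
    rw [e] at this; exact (le_abs_self t).trans this
  rw [cpow_en _ _ hM0, Dk_eq] at hga
  set s : ℂ := (7 / 8 : ℝ) + t * I
  set U : ℂ := ((K + 1 / 2 : ℝ) : ℂ) * en (ln (2 * K + 1)) t with hU
  have hUn : ‖U‖ = y / 2 := by
    rw [hU, norm_mul, norm_en _ _ hM0, hy7, Complex.norm_real, norm_of_nonneg (by positivity),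
      show (K : ℝ) + 1 / 2 = y ^ 8 / 2 by rw [hy8]; ring]
    field_simp
  have hsplit : ((s - 1) * DD K 0 t + U) / s = DD K 0 t + (U - DD K 0 t) / s := by field_simp; ring
  rw [hsplit] at hga
  have hq : ‖(U - DD K 0 t) / s‖ ≤ (∑ l ∈ Finset.range K, (2 * (l : ℝ) + 1) ^ (-7 / 8 : ℝ) + y / 2) / t := by
    rw [norm_div]
    refine div_le_div₀ (by positivity) ?_ htp hst
    refine (norm_sub_le _ _).trans ?_
    rw [hUn]; linarith [hD0 t]
  have k1 := (abs_le.1 ((abs_re_le_norm _).trans hga)).1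
  have k2 := (abs_le.1 ((abs_re_le_norm _).trans hq)).1
  rw [sub_re, Complex.add_re] at k1
  linarith only [k1, k2, hin, f3]

/-! Low range `0 ≤ t ≤ 64`: pointwise evaluation. -/

def pnt (b K : ℕ) : ℕ → ℕ → ℕ → ℕ → (ℕ → ℕ → ℕ → Bool) → Bool :=
  Nat.rec (fun _ L A B f => f L A B)
   (fun _ ih j L A B f => expK 24 14 b L fun qa qb =>
     frc (Nat.add A qa) fun A' => frc (Nat.add B qb) fun B' =>
     frc (Nat.add L (dlogK 64 22 (Nat.succ (Nat.succ (Nat.mul 2 j))))) fun L' =>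
     frc (Nat.succ j) fun j' => ih j' L' A' B' f) K

def ptE (b A B E F : ℕ) : Bool :=
  ble (Nat.pow 2 62 * (196 + b * b) + 28 * A + 16 * b * B + b * b * Nat.pow 2 70 + 264 * (14 + b) * Nat.pow 2 66)
    (b * b * A + 28 * Nat.pow 2 70 + 16 * b * Nat.pow 2 70 + 264 * (14 * E + b * F))

def ptB (b : ℕ) : Bool := pnt b 16 0 0 0 0 fun L A B => expK 24 14 b L fun E F => ptE b A B E F

def pts (n : ℕ) : ℕ → Bool :=
  Nat.rec (fun _ => true) (fun _ ih b => Bool.rec false (frc (Nat.succ b) fun b' => ih b') (ptB b)) n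

lemma pts_spec (n : ℕ) : ∀ b, pts n b = true → ∀ i < n, ptB (b + i) = true := by
  induction n with
  | zero => intro b _ i hi; omega
  | succ n ih =>
    intro b h i hi
    have e : pts (n + 1) b = Bool.rec false (frc (Nat.succ b) fun b' => pts n b') (ptB b) := rfl
    rw [e] at h
    cases hp : ptB b with
    | false => rw [hp] at h; cases h
    | true =>
      rw [hp] at h
      have h' : frc (Nat.succ b) (fun b' => pts n b') = true := h
      rw [frc_eq] at h'
      cases i with
      | zero => exact hp
      | succ i =>
        have := ih (b + 1) h' i (by omega)
        rwa [show b + 1 + i = b + (i + 1) by ring] at this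

lemma log_le_36 (x : ℝ) (h1 : 1 ≤ x) (h : x ≤ 33) : 0 ≤ ln x ∧ ln x ≤ 3.6 := by
  refine ⟨Real.log_nonneg h1, ?_⟩
  rw [Real.log_le_iff_le_exp (by linarith)]
  have e : rexp 3.6 = rexp 1 ^ 3 * rexp 0.6 := by
    rw [← Real.exp_nat_mul, ← Real.exp_add]; norm_num
  have q := Real.quadratic_le_exp_of_nonneg (x := 0.6) (by norm_num)
  have e1 := Real.exp_one_gt_d9
  have : (2.7 : ℝ) ^ 3 * 1.78 ≤ rexp 1 ^ 3 * rexp 0.6 := by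
    gcongr
    · linarith
    · norm_num at q ⊢; linarith
  rw [e]; norm_num at this ⊢; linarith

lemma expK_low {α : Type} (b j : ℕ) (hb : b ≤ 1024) (hj : j ≤ 16) (f : ℕ → ℕ → α) :
    ∃ A B, expK 24 14 b (LO j) f = f A B ∧ ‖cv A B - 2 ^ 64 * en (ln (2 * j + 1)) (b / 16)‖ ≤ 2 ^ 38 := by
  have hj' : (j : ℝ) ≤ 16 := by exact_mod_cast hj
  have hj0 : (0 : ℝ) ≤ j := Nat.cast_nonneg j
  have hb' : (b : ℝ) ≤ 1024 := by exact_mod_cast hb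
  obtain ⟨l0, l1⟩ := log_le_36 (2 * j + 1) (by linarith) (by linarith)
  obtain ⟨A, B, h1, h2⟩ := expK_spec 24 14 b (LO j) f (ln (2 * j + 1)) (2 ^ 22) 65 3.6 12000 l0 l1 (LO_err j (by omega)) (by
      rw [norm_div]
      have h1 : ‖((14 : ℕ) : ℂ) + (b : ℂ) * I‖ ≤ 14 + b := by
        refine (norm_add_le _ _).trans ?_
        rw [norm_mul, Complex.norm_I, norm_natCast, norm_natCast]
        norm_num
      have h2 : ‖(16 : ℂ)‖ = 16 := by norm_num
      rw [h2, div_le_iff₀ (by norm_num)]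
      linarith) (by norm_num) (by norm_num) (by norm_num) (by norm_num)
  refine ⟨A, B, h1, ?_⟩
  have e : en (ln (2 * j + 1)) (b / 16) = Complex.exp (-((ln (2 * j + 1) : ℝ) * (((14 : ℕ) + (b : ℂ) * I) / 16))) := by
    rw [en]; congr 2; push_cast; ring
  rw [e]
  exact h2.trans (by norm_num)

noncomputable def pval (A B n : ℕ) : ℂ := ⟨(A : ℝ) - n * 2 ^ 66, (B : ℝ) - n * 2 ^ 66⟩

lemma pnt_spec (b K : ℕ) (hb : b ≤ 1024) : ∀ (j A B : ℕ) (f : ℕ → ℕ → ℕ → Bool), j + K ≤ 17 →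
    ‖pval A B j - 2 ^ 64 * DD j 0 (b / 16)‖ ≤ j * 2 ^ 38 →
    ∃ A' B', pnt b K j (LO j) A B f = f (LO (j + K)) A' B' ∧
      ‖pval A' B' (j + K) - 2 ^ 64 * DD (j + K) 0 (b / 16)‖ ≤ (j + K : ℕ) * 2 ^ 38 := by
  induction K with
  | zero => intro j A B f _ h; exact ⟨A, B, rfl, h⟩
  | succ K ih =>
    intro j A B f hj h
    obtain ⟨qa, qb, h1, h2⟩ := expK_low b j hb (by omega) (fun qa qb =>
     frc (Nat.add A qa) fun A' => frc (Nat.add B qb) fun B' =>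
     frc (Nat.add (LO j) (dlogK 64 22 (Nat.succ (Nat.succ (Nat.mul 2 j))))) fun L' =>
     frc (Nat.succ j) fun j' => pnt b K j' L' A' B' f)
    have e : pnt b (K + 1) j (LO j) A B f = expK 24 14 b (LO j) (fun qa qb =>
     frc (Nat.add A qa) fun A' => frc (Nat.add B qb) fun B' =>
     frc (Nat.add (LO j) (dlogK 64 22 (Nat.succ (Nat.succ (Nat.mul 2 j))))) fun L' =>
     frc (Nat.succ j) fun j' => pnt b K j' L' A' B' f) := rfl
    have eL : Nat.add (LO j) (dlogK 64 22 (Nat.succ (Nat.succ (Nat.mul 2 j)))) = LO (j + 1) := by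
      unfold LO; rw [sum_range_succ]; rfl
    rw [e, h1, frc_eq, frc_eq, frc_eq, frc_eq, eL]
    have ej : j + (K + 1) = j + 1 + K := by ring
    rw [ej]
    refine ih (j + 1) (A + qa) (B + qb) f (by omega) ?_
    have e1 : pval (A + qa) (B + qb) (j + 1) = pval A B j + cv qa qb := by
      apply Complex.ext <;> simp only [pval, cv, Complex.add_re, Complex.add_im, Nat.cast_add, Nat.cast_one] <;> ring
    have e2 : DD (j + 1) 0 (b / 16) = DD j 0 (b / 16) + en (ln (2 * j + 1)) (b / 16) := by
      unfold DD; rw [sum_range_succ]; simp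
    rw [e1, e2]
    calc _ = ‖(pval A B j - 2 ^ 64 * DD j 0 (b / 16)) + (cv qa qb - 2 ^ 64 * en (ln (2 * j + 1)) (b / 16))‖ := by
          congr 1; ring
      _ ≤ j * 2 ^ 38 + 2 ^ 38 := norm_add_le_of_le h h2
      _ = _ := by rw [Nat.cast_add, Nat.cast_one]; ring

/-- `U - D` and its derivatives -/
noncomputable def Fm (m : ℕ) (t : ℝ) : ℂ := 16.5 * ((-(ln 33 * I)) ^ m * en (ln 33) t) - DD 16 m t

lemma Fm_deriv (m : ℕ) (t : ℝ) : HasDerivAt (Fm m) (Fm (m + 1) t) t :=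
  ((((en_deriv (ln 33) t).const_mul ((-(ln 33 * I : ℂ)) ^ m)).const_mul (16.5 : ℂ)).sub (DD_deriv 16 m t)).congr_deriv
    (by rw [Fm]; ring)

noncomputable def Sm (t : ℝ) : ℂ := (7 / 8 : ℝ) + t * I

lemma Sm_ne (t : ℝ) : Sm t ≠ 0 := by
  intro h0; have := congrArg Complex.re h0; norm_num [Sm] at this

lemma Sm_norm (t : ℝ) : 7 / 8 ≤ ‖Sm t‖ := by
  have := abs_re_le_norm (Sm t)
  norm_num [Sm] at this ⊢; exact this

lemma Sm_deriv (t : ℝ) : HasDerivAt Sm I t := by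
  have := ((Complex.ofRealCLM.hasDerivAt (x := t)).mul_const I).const_add ((7 / 8 : ℝ) : ℂ)
  exact this.congr_deriv (by simp)

noncomputable def g0 (t : ℝ) : ℂ := DD 16 0 t + Fm 0 t / Sm t

lemma y33 : (33 : ℝ) ^ (-7 / 8 : ℝ) ≤ 0.04693 := by
  have h : (33 : ℝ) ^ (1 / 8 : ℝ) ≤ 1.5485 := by
    apply le_of_pow_le_pow_left₀ (n := 8) (by norm_num) (by norm_num)
    rw [← rpow_natCast, ← Real.rpow_mul (by norm_num)]
    norm_num
  have e : (33 : ℝ) ^ (-7 / 8 : ℝ) = 33 ^ (1 / 8 : ℝ) / 33 := by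
    rw [show (-7 / 8 : ℝ) = 1 / 8 - 1 by norm_num, Real.rpow_sub_one (by norm_num)]
  rw [e]; linarith

lemma DD16 (m : ℕ) (t : ℝ) : ‖DD 16 m t‖ ≤ 3.148 * 3.6 ^ m := by
  have h0 : ∑ l ∈ Finset.range 16, (2 * (l : ℝ) + 1) ^ (-7 / 8 : ℝ) ≤ 3.148 := by
    have h : (31 : ℝ) ^ (1 / 8 : ℝ) ≤ 1.537 := by
      apply le_of_pow_le_pow_left₀ (n := 8) (by norm_num) (by norm_num)
      rw [← rpow_natCast, ← Real.rpow_mul (by norm_num)]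
      norm_num
    have h1 := S0_bd 16 (by norm_num)
    have e : (2 * ((16 : ℕ) : ℝ) - 1) = 31 := by norm_num
    rw [e] at h1; linarith
  refine (DD_norm 16 m t).trans (le_trans ?_ (mul_le_mul_of_nonneg_right h0 (by positivity)))
  rw [Finset.sum_mul]
  refine sum_le_sum fun l hl => ?_
  have hl' : (l : ℝ) ≤ 16 := by exact_mod_cast (Finset.mem_range.1 hl).le
  have hl0 : (0 : ℝ) ≤ l := Nat.cast_nonneg l
  obtain ⟨l0, l1⟩ := log_le_36 (2 * l + 1) (by linarith) (by linarith)
  gcongr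

lemma Fm_norm (m : ℕ) (t : ℝ) : ‖Fm m t‖ ≤ 3.923 * 3.6 ^ m := by
  obtain ⟨l0, l1⟩ := log_le_36 33 (by norm_num) le_rfl
  rw [Fm]
  refine (norm_sub_le _ _).trans ?_
  rw [norm_mul, norm_mul, norm_en _ _ (by norm_num), norm_pow, norm_neg, norm_mul, Complex.norm_real, Complex.norm_I, mul_one,
    norm_of_nonneg l0]
  have h1 : ‖(16.5 : ℂ)‖ = 16.5 := by norm_num
  have h2 : ln 33 ^ m * 33 ^ (-7 / 8 : ℝ) ≤ 3.6 ^ m * 0.04693 := by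
    have := y33
    gcongr
  have h3 : (0 : ℝ) ≤ 3.6 ^ m := by positivity
  rw [h1]
  linarith [DD16 m t]

lemma g0_low (b : ℕ) (hb : b ≤ 1024) (h : ptB b = true) : 0.2499 ≤ (g0 (b / 16)).re := by
  obtain ⟨A, B, h1, h2⟩ := pnt_spec b 16 hb 0 0 0 (fun L A B => expK 24 14 b L fun E F => ptE b A B E F) (by norm_num)
    (by
      have e1 : pval 0 0 0 = 0 := by apply Complex.ext <;> simp [pval]
      rw [e1]; simp [DD])
  obtain ⟨E, F, h3, h4⟩ := expK_low b 16 hb le_rfl (fun E F => ptE b A B E F)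
  have h' : ptB b = pnt b 16 0 (LO 0) 0 0 fun L A B => expK 24 14 b L fun E F => ptE b A B E F := rfl
  rw [h', h1] at h
  have h5 : ptE b A B E F = true := by rw [← h3]; exact h
  rw [zero_add] at h2
  have h6 := Nat.le_of_ble_eq_true h5
  have h7 : ((2 ^ 62 * (196 + b * b) + 28 * A + 16 * b * B + b * b * 2 ^ 70 + 264 * (14 + b) * 2 ^ 66 : ℕ) : ℝ) ≤
    ((b * b * A + 28 * 2 ^ 70 + 16 * b * 2 ^ 70 + 264 * (14 * E + b * F) : ℕ) : ℝ) := Nat.cast_le.2 h6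
  clear h6 h5 h h' h1 h3
  simp only [Nat.cast_add, Nat.cast_mul, Nat.cast_pow, Nat.cast_ofNat] at h7
  have e33 : (2 * ((16 : ℕ) : ℝ) + 1) = 33 := by norm_num
  rw [e33] at h4
  have hs := Sm_ne ((b : ℝ) / 16)
  have hn := Sm_norm ((b : ℝ) / 16)
  have hsr : (Sm ((b : ℝ) / 16)).re = 7 / 8 := by simp [Sm]
  have hsi : (Sm ((b : ℝ) / 16)).im = b / 16 := by simp [Sm]
  have hF : Fm 0 ((b : ℝ) / 16) = 16.5 * en (ln 33) (b / 16) - DD 16 0 (b / 16) := by rw [Fm]; simp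
  rw [g0, hF]
  set s := Sm ((b : ℝ) / 16)
  set D := DD 16 0 ((b : ℝ) / 16)
  set e := en (ln 33) ((b : ℝ) / 16)
  set z1 := pval A B 16 with hz1
  set z2 := cv E F with hz2
  have r1 : z1.re = A - 16 * 2 ^ 66 := by simp [hz1, pval]
  have r2 : z1.im = B - 16 * 2 ^ 66 := by simp [hz1, pval]
  have r3 : z2.re = E - 2 ^ 66 := by simp [hz2, cv]
  have r4 : z2.im = F - 2 ^ 66 := by simp [hz2, cv]
  have hq : (0 : ℝ) < 49 / 64 + (b / 16) ^ 2 := by positivity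
  have key : (2 : ℝ) ^ 62 ≤ (((s - 1) * z1 + 16.5 * z2) / s).re := by
    have hns : normSq s = 49 / 64 + ((b : ℝ) / 16) ^ 2 := by rw [normSq_apply, hsr, hsi]; ring
    have c1 : ((16.5 : ℂ)).re = 16.5 := by norm_num
    have c2 : ((16.5 : ℂ)).im = 0 := by norm_num
    rw [Complex.div_re, ← add_div, hns, le_div_iff₀ hq]
    simp only [Complex.add_re, Complex.add_im, Complex.mul_re, Complex.mul_im, sub_re, sub_im, Complex.one_re,
      Complex.one_im, hsr, hsi, r1, r2, r3, r4, c1, c2]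
    linarith only [h7]
  have n64 : ‖(2 : ℂ) ^ 64‖ = 2 ^ 64 := by simp
  have hs1 : ‖(s - 1) / s‖ ≤ 1 := by
    rw [norm_div, div_le_one (by linarith), norm_def, norm_def]
    apply Real.sqrt_le_sqrt
    rw [normSq_apply, normSq_apply, sub_re, sub_im, hsr, hsi]
    norm_num
  have hs2 : ‖(16.5 : ℂ) / s‖ ≤ 19 := by
    rw [norm_div, div_le_iff₀ (by linarith)]
    have h1 : ‖(16.5 : ℂ)‖ = 16.5 := by norm_num
    rw [h1]; linarith
  have err : ‖((s - 1) * z1 + 16.5 * z2) / s - 2 ^ 64 * (D + (16.5 * e - D) / s)‖ ≤ 35 * 2 ^ 38 := by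
    have : ((s - 1) * z1 + 16.5 * z2) / s - 2 ^ 64 * (D + (16.5 * e - D) / s) =
        (s - 1) / s * (z1 - 2 ^ 64 * D) + 16.5 / s * (z2 - 2 ^ 64 * e) := by field_simp; ring
    rw [this]
    refine (norm_add_le _ _).trans ?_
    rw [norm_mul, norm_mul]
    have a1 := mul_le_mul hs1 h2 (norm_nonneg _) (by norm_num)
    have a2 := mul_le_mul hs2 h4 (norm_nonneg _) (by norm_num)
    refine (add_le_add a1 a2).trans ?_
    norm_num
  have k1 := (abs_le.1 ((abs_re_le_norm _).trans err)).2
  have e64 : (2 ^ 64 * (D + (16.5 * e - D) / s)).re = 2 ^ 64 * (D + (16.5 * e - D) / s).re := by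
    have : (2 : ℂ) ^ 64 = ((2 ^ 64 : ℝ) : ℂ) := by simp
    rw [this, re_ofReal_mul]
  rw [sub_re, e64] at k1
  norm_num at k1 key ⊢
  linarith

lemma low_num (h : ∀ b ≤ 1024, ptB b = true) (t : ℝ) (ht0 : 0 ≤ t) (ht : t < 64) : 0.1 ≤ (gn ((7 / 8 : ℝ) + t * I)).re := by
  have d1 : ∀ t, HasDerivAt g0 (DD 16 1 t + (Fm 1 t / Sm t - I * Fm 0 t / Sm t ^ 2)) t := fun t => by
    have hs := Sm_ne t
    exact ((DD_deriv 16 0 t).add ((Fm_deriv 0 t).div (Sm_deriv t) hs)).congr_deriv (by field_simp)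
  have d2 : ∀ t, HasDerivAt (fun t => DD 16 1 t + (Fm 1 t / Sm t - I * Fm 0 t / Sm t ^ 2))
      (DD 16 2 t + (Fm 2 t / Sm t - 2 * I * Fm 1 t / Sm t ^ 2 - 2 * Fm 0 t / Sm t ^ 3)) t := fun t => by
    have hs := Sm_ne t
    refine ((DD_deriv 16 1 t).add (((Fm_deriv 1 t).div (Sm_deriv t) hs).sub
      (((Fm_deriv 0 t).const_mul I).div ((Sm_deriv t).pow 2) (pow_ne_zero 2 hs)))).congr_deriv ?_
    simp only [Pi.pow_apply]
    field_simp
    ring_nf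
    rw [I_sq]; ring
  have hB : ∀ t, (DD 16 2 t + (Fm 2 t / Sm t - 2 * I * Fm 1 t / Sm t ^ 2 - 2 * Fm 0 t / Sm t ^ 3)).re ≤ 148 := fun t => by
    have hs := Sm_norm t
    have hsp : 0 < ‖Sm t‖ := by linarith
    have hF := fun m => Fm_norm m t
    have q1 : ‖Fm 2 t / Sm t‖ ≤ 58.2 := by
      rw [norm_div, div_le_iff₀ hsp]
      have := hF 2
      norm_num at this ⊢; linarith
    have q2 : ‖2 * I * Fm 1 t / Sm t ^ 2‖ ≤ 36.9 := by
      have h2 : (7 / 8 : ℝ) ^ 2 ≤ ‖Sm t‖ ^ 2 := by gcongr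
      rw [norm_div, norm_pow, div_le_iff₀ (by positivity), norm_mul, norm_mul, Complex.norm_I]
      have := hF 1
      norm_num at this h2 ⊢; linarith
    have q3 : ‖2 * Fm 0 t / Sm t ^ 3‖ ≤ 11.8 := by
      have h2 : (7 / 8 : ℝ) ^ 3 ≤ ‖Sm t‖ ^ 3 := by gcongr
      rw [norm_div, norm_pow, div_le_iff₀ (by positivity), norm_mul]
      have := hF 0
      norm_num at this h2 ⊢; linarith
    have q4 := DD16 2 t
    refine (re_le_norm _).trans ((norm_add_le _ _).trans ?_)
    have q5 := norm_sub_le (Fm 2 t / Sm t - 2 * I * Fm 1 t / Sm t ^ 2) (2 * Fm 0 t / Sm t ^ 3)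
    have q6 := norm_sub_le (Fm 2 t / Sm t) (2 * I * Fm 1 t / Sm t ^ 2)
    norm_num at q4
    linarith only [q1, q2, q3, q4, q5, q6]
  set b := ⌊16 * t⌋₊ with hb
  have hb1 : (b : ℝ) ≤ 16 * t := Nat.floor_le (by linarith)
  have hb2 : 16 * t < b + 1 := Nat.lt_floor_add_one _
  have hb3 : b < 1024 := by
    have : (b : ℝ) < 1024 := by linarith
    exact_mod_cast this
  have g1 := g0_low b (by omega) (h b (by omega))
  have g2 := g0_low (b + 1) (by omega) (h (b + 1) (by omega))
  rw [show ((b + 1 : ℕ) : ℝ) / 16 = b / 16 + 1 / 16 by push_cast; ring] at g2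
  have hin := interp _ _ _ (fun t => re_deriv (d1 t)) (fun t => re_deriv (d2 t)) 148 (by norm_num) hB g1 g2 t
    (by linarith) (by linarith)
  have hga := gn_approx 16 (by norm_num) t ht0 (by norm_num; linarith)
  have h33 : 2 * (((16 : ℕ) : ℝ) + 1 / 2) = 33 := by norm_num
  rw [h33, cpow_en _ _ (by norm_num), Dk_eq] at hga
  have e : (((7 / 8 : ℝ) + t * I - 1) * DD 16 0 t + (((16 : ℕ) + 1 / 2 : ℝ) : ℂ) * en (ln 33) t) / ((7 / 8 : ℝ) + t * I) = g0 t := by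
    have hs := Sm_ne t
    have h1 : (((16 : ℕ) + 1 / 2 : ℝ) : ℂ) = 16.5 := by norm_num
    rw [h1, g0, Fm, pow_zero, one_mul]
    change ((Sm t - 1) * DD 16 0 t + 16.5 * en (ln 33) t) / Sm t = _
    field_simp
    ring
  rw [e] at hga
  have k1 := (abs_le.1 ((abs_re_le_norm _).trans hga)).1
  rw [sub_re] at k1
  have hy := y33
  generalize (33 : ℝ) ^ (-7 / 8 : ℝ) = y at *
  norm_num at k1 hin hy ⊢
  linarith only [k1, hin, hy]

set_option maxRecDepth 100000 in
set_option maxHeartbeats 0 in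
lemma pts_all (k : ℕ) (hk : k < 5) : pts 205 (205 * k) = true := by
  interval_cases k <;> decide +kernel

set_option maxRecDepth 100000 in
set_option maxHeartbeats 0 in
lemma chunk_all (c : ℕ) (hc1 : 1 ≤ c) (hc : c ≤ 51) : chunkB c = true := by
  interval_cases c <;> decide +kernel

theorem numH : NumH := by
  intro t ht0 ht
  rcases lt_or_ge t 64 with h | h
  · refine low_num (fun b hb => ?_) t ht0 h
    have := pts_spec _ _ (pts_all (b / 205) (by omega)) (b % 205) (Nat.mod_lt _ (by norm_num))
    rwa [Nat.div_add_mod] at this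
  · have h1 : (⌊16 * t⌋₊ : ℝ) ≤ 16 * t := Nat.floor_le (by linarith)
    have h2 : 16 * t < ⌊16 * t⌋₊ + 1 := Nat.lt_floor_add_one _
    have h3 : 1024 ≤ ⌊16 * t⌋₊ := Nat.le_floor (by norm_num; linarith)
    have h4 : ⌊16 * t⌋₊ ≤ 52224 := Nat.floor_le_of_le (by norm_num; linarith)
    generalize ⌊16 * t⌋₊ = m at *
    exact chunk_num ((m - 1) / 1023) (by omega) (by omega) (chunk_all _ (by omega) (by omega)) m
      (by omega) (by omega) t (by linarith) (by linarith)

lemma prime_iff (n : ℕ) (hn : n < 529) :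
    n.Prime ↔ (n ∈ [2, 3, 5, 7, 11, 13, 17, 19] ∨ 1 < n ∧ n.gcd 9699690 = 1) := by
  constructor
  · intro h
    rcases Nat.lt_or_ge n 23 with h1 | h1
    · interval_cases n <;> first | decide | (exfalso; revert h; norm_num)
    · refine Or.inr ⟨h.one_lt, (Nat.Prime.coprime_iff_not_dvd h).2 fun hd => ?_⟩
      rw [show 9699690 = 2 * 3 * 5 * 7 * 11 * 13 * 17 * 19 by norm_num] at hd
      simp only [h.dvd_mul] at hd
      have : ∀ k, 0 < k → k < 23 → n ∣ k → False := fun k h0 hk hd => by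
        have := Nat.le_of_dvd h0 hd; omega
      rcases hd with ((((((hd | hd) | hd) | hd) | hd) | hd) | hd) | hd <;>
        exact this _ (by norm_num) (by norm_num) hd
  · rintro (h | ⟨h1, h⟩)
    · simp only [List.mem_cons, List.not_mem_nil, or_false] at h
      rcases h with h | h | h | h | h | h | h | h <;> subst h <;> norm_num
    · by_contra hp
      have h2 := Nat.minFac_sq_le_self (by omega) hp
      have h3 := Nat.minFac_prime (n := n) (by omega)
      have h4 : n.minFac < 23 := by nlinarith
      have h5 := n.minFac_dvd
      generalize n.minFac = p at *
      have h6 : p ∣ 9699690 := by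
        interval_cases p <;> first | decide | (exfalso; revert h3; norm_num)
      have := Nat.dvd_gcd h5 h6
      rw [h] at this
      exact h3.one_lt.ne' (Nat.dvd_one.1 this)

/-- the primes up to `n` -/
def pfilt (n : ℕ) : Finset ℕ :=
  (Finset.range (n + 1)).filter fun n => n ∈ [2, 3, 5, 7, 11, 13, 17, 19] ∨ 1 < n ∧ n.gcd 9699690 = 1

lemma filt_eq (n : ℕ) (hn : n < 528) : (Finset.range (n + 1)).filter Nat.Prime = pfilt n :=
  Finset.filter_congr fun p hp => prime_iff p (by have := Finset.mem_range.1 hp; omega)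

lemma pc_eq (n : ℕ) (hn : n < 528) : Nat.primeCounting n = (pfilt n).card := by
  rw [← filt_eq n hn, Nat.primeCounting, Nat.primeCounting', Nat.count_eq_card_filter_range]

set_option maxRecDepth 100000 in
lemma prim512 : primorial 512 ≤ 2 ^ 773 := by
  rw [primorial, filt_eq 512 (by norm_num)]
  decide +kernel

set_option maxRecDepth 100000 in
lemma pcs : (pfilt 55).card = 16 ∧ (pfilt 64).card = 18 ∧ (pfilt 96).card = 24 ∧ (pfilt 128).card = 31 ∧
    (pfilt 192).card = 43 ∧ (pfilt 256).card = 54 ∧ (pfilt 384).card = 76 ∧ (pfilt 512).card = 97 := by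
  decide +kernel

lemma log_two_mul (k : ℕ) : (0.6931 : ℝ) * k ≤ ln (2 ^ k) ∧ ln (2 ^ k) ≤ 0.6932 * k := by
  have h1 := Real.log_two_gt_d9
  have h2 := log_two_lt_d9
  have h3 : (0 : ℝ) ≤ k := k.cast_nonneg
  rw [Real.log_pow]
  constructor <;> nlinarith

lemma log_gt_four {n : ℕ} (hn : 55 ≤ n) : 4 < ln n := by
  rw [Real.lt_log_iff_exp_lt (by positivity)]
  have h1 := Real.exp_one_lt_d9
  have h2 : rexp 4 = rexp 1 ^ 4 := by rw [← Real.exp_nat_mul]; norm_num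
  have h3 : rexp 1 ^ 4 ≤ 2.7182818286 ^ 4 := by gcongr
  have h4 : (55 : ℝ) ≤ n := by exact_mod_cast hn
  norm_num at h3
  linarith

lemma block (a b pa pb j k : ℕ) (hb : b < 528) (ha : (pfilt a).card = pa)
    (hb1 : (pfilt b).card = pb) (hj : 2 ^ j ≤ a) (hk : b ≤ 2 ^ k) (h1 : (b : ℝ) < pa * (0.6931 * j + 2))
    (h2 : (pb : ℝ) * (0.6932 * k - 4) < a) (n : ℕ) (hn : 55 ≤ n) (han : a ≤ n) (hnb : n ≤ b) :
    (n : ℝ) / (ln n + 2) < (Nat.primeCounting n : ℝ) ∧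
      (Nat.primeCounting n : ℝ) < (n : ℝ) / (ln n - 4) := by
  have h4 := log_gt_four hn
  have hn0 : (0 : ℝ) < n := by positivity
  have q1 : (pa : ℝ) ≤ Nat.primeCounting n := by
    rw [← ha, ← pc_eq a (by omega)]; exact_mod_cast Nat.monotone_primeCounting han
  have q2 : (Nat.primeCounting n : ℝ) ≤ pb := by
    rw [← hb1, ← pc_eq b (by omega)]; exact_mod_cast Nat.monotone_primeCounting hnb
  have l1 : 0.6931 * j ≤ ln n := (log_two_mul j).1.trans
    (log_le_log (by positivity) (by exact_mod_cast hj.trans han))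
  have l2 : ln n ≤ 0.6932 * k := le_trans
    (log_le_log (by positivity) (by exact_mod_cast hnb.trans hk)) (log_two_mul k).2
  have r1 : (a : ℝ) ≤ n := by exact_mod_cast han
  have r2 : (n : ℝ) ≤ b := by exact_mod_cast hnb
  constructor
  · rw [div_lt_iff₀ (by linarith)]
    have : (pa : ℝ) * (0.6931 * j + 2) ≤ Nat.primeCounting n * (ln n + 2) := by
      gcongr
    linarith
  · rw [lt_div_iff₀ (by linarith)]
    have : (Nat.primeCounting n : ℝ) * (ln n - 4) ≤ pb * (0.6932 * k - 4) := by
      apply mul_le_mul q2 (by linarith) (by linarith) (Nat.cast_nonneg _)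
    linarith

lemma small_n (n : ℕ) (hn : 55 ≤ n) (hn2 : n ≤ 512) :
    (n : ℝ) / (ln n + 2) < (Nat.primeCounting n : ℝ) ∧
      (Nat.primeCounting n : ℝ) < (n : ℝ) / (ln n - 4) := by
  obtain ⟨p1, p2, p3, p4, p5, p6, p7, p8⟩ := pcs
  rcases le_total n 64 with h | h
  · exact block 55 64 _ _ 5 6 (by norm_num) p1 p2 (by norm_num) (by norm_num) (by norm_num) (by norm_num) n hn hn h
  rcases le_total n 96 with h' | h'
  · exact block 64 96 _ _ 6 7 (by norm_num) p2 p3 (by norm_num) (by norm_num) (by norm_num) (by norm_num) n hn h h'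
  rcases le_total n 128 with h | h
  · exact block 96 128 _ _ 6 7 (by norm_num) p3 p4 (by norm_num) (by norm_num) (by norm_num) (by norm_num) n hn h' h
  rcases le_total n 192 with h' | h'
  · exact block 128 192 _ _ 7 8 (by norm_num) p4 p5 (by norm_num) (by norm_num) (by norm_num) (by norm_num) n hn h h'
  rcases le_total n 256 with h | h
  · exact block 192 256 _ _ 7 8 (by norm_num) p5 p6 (by norm_num) (by norm_num) (by norm_num) (by norm_num) n hn h' h
  rcases le_total n 384 with h' | h'
  · exact block 256 384 _ _ 8 9 (by norm_num) p6 p7 (by norm_num) (by norm_num) (by norm_num) (by norm_num) n hn h h'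
  exact block 384 512 _ _ 8 9 (by norm_num) p7 p8 (by norm_num) (by norm_num) (by norm_num) (by norm_num) n hn h' hn2

lemma psi_W {x : ℝ} (hx : 0 < x) : psi x = W (ln x) * x := by
  rw [W, Real.exp_log hx, Real.exp_neg, Real.exp_log hx, inv_mul_cancel_right₀ hx.ne']

lemma theta_up (x : ℝ) (hx : 512 ≤ x) : theta x ≤ x * (1 + 3 / ln x) := by
  refine (Chebyshev.theta_le_psi x).trans ?_
  have hx0 : 0 < x := by linarith
  have hL0 : 0 < ln x := Real.log_pos (by linarith)
  rcases le_total (ln x) 20 with h | h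
  · have h1 : 3 / 20 ≤ 3 / ln x := by gcongr
    have := psi_crude x hx0.le
    nlinarith
  · rw [psi_W hx0, mul_comm]
    gcongr
    rcases le_total (ln x) 100 with h' | h'
    · have h1 : 3 / 100 ≤ 3 / ln x := by gcongr
      linarith [(abs_le.1 (hel _ h)).2]
    · have := (abs_le.1 (W_final numH hel h')).2
      have : 0 ≤ 6 / ln x ^ 2 := by positivity
      linarith

lemma psi_theta (x : ℝ) (hx : 1 ≤ x) : psi x - 3.36 * √x ≤ theta x := by
  have h := Chebyshev.psi_sub_theta_le_psi_add_psi_add_psi x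
  have h0 : ∀ a : ℝ, a ≤ (2 : ℝ)⁻¹ → psi (x ^ a) ≤ 1.12 * √x := fun a ha => by
    refine (psi_crude _ (by positivity)).trans ?_
    rw [Real.sqrt_eq_rpow]
    gcongr
    linarith
  linarith [h0 _ le_rfl, h0 (3 : ℝ)⁻¹ (by norm_num), h0 (5 : ℝ)⁻¹ (by norm_num)]

lemma low_v {v w : ℝ} (hw : w ≤ v) (hv : v ≤ 1 / 6) : 3 * w - 5 * w ^ 2 ≤ 3 * v - 5 * v ^ 2 := by
  nlinarith

lemma exp_ge (k : ℕ) : (2.718 : ℝ) ^ k ≤ rexp k := by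
  have := Real.exp_one_gt_d9
  rw [show rexp k = rexp 1 ^ k by rw [← Real.exp_nat_mul]; simp]
  gcongr
  linarith

lemma theta_low (x : ℝ) (hx : 512 ≤ x) :
    x * (1 - 3 / ln x + 5 / ln x ^ 2) ≤ theta x := by
  have hx0 : 0 < x := by linarith
  have hL6 : 6 ≤ ln x := by
    have h1 := (log_two_mul 9).1
    have h2 := log_le_log (x := (2 : ℝ) ^ 9) (by norm_num) (show (2 : ℝ) ^ 9 ≤ x by linarith)
    norm_num at h1 h2; linarith
  have hpt := psi_theta x (by linarith)
  set s := √x with hs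
  have hsx : s * s = x := Real.mul_self_sqrt hx0.le
  have hs0 : 0 < s := Real.sqrt_pos.2 hx0
  have hexp : rexp (ln x) = x := Real.exp_log hx0
  have hpl := psi_lower x (by linarith)
  have hW : 20 ≤ ln x → psi x = W (ln x) * x := fun _ => psi_W hx0
  have hbig : ∀ k : ℕ, (k : ℝ) ≤ ln x → (2.718 : ℝ) ^ k ≤ x := fun k hk =>
    (exp_ge k).trans (hexp ▸ Real.exp_le_exp.2 hk)
  set L := ln x with hL
  have hv6 : 1 / L ≤ 1 / 6 := by gcongr
  have hv0 : 0 < 1 / L := by positivity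
  rw [show 1 - 3 / L + 5 / L ^ 2 = 1 - (3 * (1 / L) - 5 * (1 / L) ^ 2) by ring]
  have key : ∀ (M σ : ℝ), 0 < M → L ≤ M → 0 < σ → σ * σ ≤ x →
      0.0788 * (σ * σ) + (6 + 5 * M) + 3.36 * σ ≤ (3 * (1 / M) - 5 * (1 / M) ^ 2) * (σ * σ) →
      x * (1 - (3 * (1 / L) - 5 * (1 / L) ^ 2)) ≤ theta x := by
    intro M σ hM hLM hσ hσx hh
    have h1 := low_v (one_div_le_one_div_of_le (by linarith) hLM) hv6
    set q := 3 * (1 / M) - 5 * (1 / M) ^ 2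
    have hσs : σ ≤ s := Real.le_sqrt_of_sq_le (by rwa [pow_two])
    have h2 : (6 + 5 * M) + 3.36 * s ≤ (q - 0.0788) * x := by
      have hq : (6 + 5 * M) + 3.36 * σ ≤ (q - 0.0788) * (σ * σ) := by linarith
      have hc : 3.36 ≤ (q - 0.0788) * σ := by
        by_contra! hc
        linarith [mul_lt_mul_of_pos_right hc hσ]
      have hc2 : 0 ≤ q - 0.0788 := by
        by_contra! hc2
        linarith [mul_nonpos_of_nonpos_of_nonneg hc2.le hσ.le]
      rw [← hsx]
      linarith [mul_nonneg hc2 (mul_nonneg hs0.le (sub_nonneg.2 hσs)), mul_nonneg (sub_nonneg.2 hc) (sub_nonneg.2 hσs)]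
    linarith [mul_le_mul_of_nonneg_left h1 hx0.le]
  rcases le_total L 7 with h | h
  · exact key 7 22.62 (by norm_num) h (by norm_num) (by norm_num; linarith) (by norm_num)
  rcases le_total L 9 with h' | h'
  · exact key 9 33 (by norm_num) h' (by norm_num) (by have := hbig 7 (by simpa using h); norm_num at this ⊢; linarith) (by norm_num)
  rcases le_total L 13 with h | h
  · exact key 13 89 (by norm_num) h (by norm_num) (by have := hbig 9 (by simpa using h'); norm_num at this ⊢; linarith) (by norm_num)
  rcases le_total L 20 with h' | h'
  · exact key 20 600 (by norm_num) h' (by norm_num) (by have := hbig 13 (by simpa using h); norm_num at this ⊢; linarith) (by norm_num)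
  have hps := hW h'
  have hx20 := hbig 20 (by simpa using h')
  have hs20 : 20000 ≤ s := Real.le_sqrt_of_sq_le (by norm_num at hx20 ⊢; linarith)
  rcases le_total L 100 with h2 | h2
  · have h3 : 0.0295 ≤ 3 * (1 / L) - 5 * (1 / L) ^ 2 :=
      le_trans (by norm_num) (low_v (one_div_le_one_div_of_le (by linarith) h2) hv6)
    have h4 := (abs_le.1 (hel L h')).1
    rw [hps] at hpt
    have h5 : 3.36 * s ≤ 0.0002 * x := by linarith [mul_le_mul_of_nonneg_left hs20 hs0.le]
    linarith [mul_le_mul_of_nonneg_left h3 hx0.le, mul_le_mul_of_nonneg_left h4 hx0.le]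
  · have h3 := (abs_le.1 (W_final numH hel h2)).1
    rw [hps] at hpt
    have h5 : 3.36 * s ≤ (1 / L) ^ 2 * x := by
      have h6 : L ^ 2 * 3.36 ≤ s := by
        have e1 : s = rexp (L / 2) := by
          rw [hs, ← hexp, Real.sqrt_eq_rpow, ← Real.exp_mul]; ring_nf
        have e2 := Real.pow_div_factorial_le_exp (x := L / 2) (by linarith) 4
        rw [e1]
        refine le_trans ?_ e2
        norm_num [factorial]
        nlinarith [mul_nonneg (sq_nonneg L) (show 0 ≤ L ^ 2 - 10000 by nlinarith)]
      rw [one_div, inv_pow, inv_mul_eq_div, le_div_iff₀ (by positivity)]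
      linarith [mul_le_mul_of_nonneg_left h6 hs0.le]
    have h6 : 1 - (3 * (1 / L) - 5 * (1 / L) ^ 2) + (1 / L) ^ 2 ≤ W L := by
      have : 3 / L - 6 / L ^ 2 = 3 * (1 / L) - 6 * (1 / L) ^ 2 := by ring
      linarith
    linarith [mul_le_mul_of_nonneg_left h6 hx0.le]

lemma hasDeriv_F (a : ℝ) {t : ℝ} (ht : 512 ≤ t) : HasDerivAt (fun t => t / ln t ^ 2 + a * t / ln t ^ 3)
    (1 / ln t ^ 2 + (a - 2) / ln t ^ 3 - 3 * a / ln t ^ 4) t := by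
  have h0 : 0 < ln t := Real.log_pos (by linarith)
  have ht0 : t ≠ 0 := by linarith
  have hl := Real.hasDerivAt_log ht0
  refine (((hasDerivAt_id t).div (hl.pow 2) (pow_ne_zero _ h0.ne')).add
    (((hasDerivAt_id t).const_mul a).div (hl.pow 3) (pow_ne_zero _ h0.ne'))).congr_deriv ?_
  simp only [id, Pi.pow_apply]
  field_simp
  ring

lemma log512 : 6.2379 ≤ ln 512 ∧ ln 512 ≤ 6.2388 := by
  have := log_two_mul 9
  norm_num at this ⊢
  constructor <;> linarith

lemma main_est (x : ℝ) (hx : 512 ≤ x) :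
    x / ln x ^ 2 - x / ln x ^ 3 ≤ ∫ t in (2 : ℝ)..x, theta t / (t * ln t ^ 2) ∧
    ∫ t in (2 : ℝ)..x, theta t / (t * ln t ^ 2) ≤ x / ln x ^ 2 + 16 * x / ln x ^ 3 := by
  obtain ⟨l1, l2⟩ := log512
  have hlog : ∀ t, 512 ≤ t → 6.2379 ≤ ln t := fun t ht => l1.trans (log_le_log (by norm_num) ht)
  have hint : ∀ a b : ℝ, 2 ≤ a → a ≤ b →
      IntervalIntegrable (fun t => theta t / (t * ln t ^ 2)) volume a b := fun a b ha hab =>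
    (intervalIntegrable_iff_integrableOn_Icc_of_le hab).2
      ((Chebyshev.integrableOn_theta_div_id_mul_log_sq b).mono_set (Icc_subset_Icc_left ha))
  rw [← intervalIntegral.integral_add_adjacent_intervals (hint 2 512 le_rfl (by norm_num)) (hint 512 x (by norm_num) hx)]
  have hF : ∀ a : ℝ, IntervalIntegrable (fun t => 1 / ln t ^ 2 + (a - 2) / ln t ^ 3 - 3 * a / ln t ^ 4) volume 512 x ∧
      ∫ t in (512 : ℝ)..x, (1 / ln t ^ 2 + (a - 2) / ln t ^ 3 - 3 * a / ln t ^ 4) =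
      (x / ln x ^ 2 + a * x / ln x ^ 3) - (512 / ln 512 ^ 2 + a * 512 / ln 512 ^ 3) := fun a => by
    have hi : IntervalIntegrable (fun t => 1 / ln t ^ 2 + (a - 2) / ln t ^ 3 - 3 * a / ln t ^ 4) volume 512 x := by
      refine ContinuousOn.intervalIntegrable fun t ht => ContinuousAt.continuousWithinAt ?_
      rw [uIcc_of_le hx] at ht
      have h0 : ln t ≠ 0 := by linarith [hlog t ht.1]
      have h1 : t ≠ 0 := by linarith [ht.1]
      fun_prop (disch := first | assumption | exact pow_ne_zero _ h0)
    refine ⟨hi, integral_eq_sub_of_hasDerivAt (f := fun t => t / ln t ^ 2 + a * t / ln t ^ 3)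
      (fun t ht => ?_) hi⟩
    rw [uIcc_of_le hx] at ht
    exact hasDeriv_F a ht.1
  have hpi := Chebyshev.primeCounting_eq_theta_div_log_add_integral (x := 512) (by norm_num)
  have h512 : ⌊(512 : ℝ)⌋₊ = 512 := by norm_num
  rw [h512, pc_eq 512 (by norm_num), pcs.2.2.2.2.2.2.2] at hpi
  have hth1 : theta 512 ≤ 535.9 := by
    rw [Chebyshev.theta_eq_log_primorial, h512]
    have h1 : ln (primorial 512) ≤ ln (2 ^ 773) :=
      log_le_log (by exact_mod_cast primorial_pos _) (by exact_mod_cast prim512)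
    have h2 := (log_two_mul 773).2
    rw [Nat.cast_ofNat] at h2
    exact (h1.trans h2).trans (by norm_num)
  have hth2 : 320 ≤ theta 512 := by
    refine le_trans ?_ (theta_low 512 le_rfl)
    have : 1 / ln 512 ≤ 1 / 6.2379 := by gcongr
    have h2 : 1 / 6.2388 ≤ 1 / ln 512 := by gcongr
    rw [show 1 - 3 / ln 512 + 5 / ln 512 ^ 2 = 1 - 3 * (1 / ln 512) + 5 * (1 / ln 512) ^ 2 by ring]
    nlinarith
  set I := ∫ t in (2 : ℝ)..512, theta t / (t * ln t ^ 2)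
  set l := ln 512
  have hl0 : 0 < l := by linarith
  have e : ∀ a : ℝ, 512 / l ^ 2 + a * 512 / l ^ 3 = 512 * (l + a) / l ^ 3 := fun a => by field_simp
  have hI : I = (97 - theta 512 / l) := by push_cast at hpi; linarith
  have b1 : 512 / l ^ 2 + -1 * 512 / l ^ 3 ≤ I := by
    rw [hI, e, div_le_iff₀ (by positivity), show (97 - theta 512 / l) * l ^ 3 = (97 * l - theta 512) * l ^ 2 by field_simp]
    have : 69 * 38.9 ≤ (97 * l - theta 512) * l ^ 2 := by
      apply mul_le_mul <;> nlinarith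
    linarith
  have b2 : I ≤ 512 / l ^ 2 + 16 * 512 / l ^ 3 := by
    rw [hI, e, le_div_iff₀ (by positivity), show (97 - theta 512 / l) * l ^ 3 = (97 * l - theta 512) * l ^ 2 by field_simp]
    have : (97 * l - theta 512) * l ^ 2 ≤ 285.2 * 38.93 := by
      apply mul_le_mul <;> nlinarith
    linarith
  constructor
  · have h := intervalIntegral.integral_mono_on hx (hF (-1)).1 (hint 512 x (by norm_num) hx) fun t ht => by
      have h1 := hlog t ht.1
      have h2 := theta_low t ht.1
      have ht0 : 0 < t := by linarith [ht.1]
      have h3 : 0 < ln t := by linarith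
      rw [le_div_iff₀ (by positivity)]
      refine le_trans (le_of_eq ?_) (h2.trans' (mul_le_mul_of_nonneg_left
        (show 1 - 3 / ln t + 3 / ln t ^ 2 ≤ 1 - 3 / ln t + 5 / ln t ^ 2 by gcongr; norm_num) ht0.le))
      field_simp
      ring
    rw [(hF (-1)).2] at h
    have : -1 * x / ln x ^ 3 = - (x / ln x ^ 3) := by ring
    linarith
  · have h := intervalIntegral.integral_mono_on hx (hint 512 x (by norm_num) hx) (hF 16).1 fun t ht => by
      have h1 := hlog t ht.1
      have h2 := theta_up t ht.1
      have ht0 : 0 < t := by linarith [ht.1]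
      have h3 : 0 < ln t := by linarith
      rw [div_le_iff₀ (by positivity)]
      refine h2.trans ?_
      rw [show (1 / ln t ^ 2 + (16 - 2) / ln t ^ 3 - 3 * 16 / ln t ^ 4) * (t * ln t ^ 2) =
        t * (1 + 3 / ln t + (11 * ln t - 48) / ln t ^ 2) by field_simp; ring]
      refine mul_le_mul_of_nonneg_left ?_ ht0.le
      have : 0 ≤ (11 * ln t - 48) / ln t ^ 2 := div_nonneg (by linarith) (by positivity)
      linarith
    rw [(hF 16).2] at h
    linarith

end PNT

theorem stmt_13 (n : ℕ) (hn : 55 ≤ n) :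
    (n : ℝ) / (Real.log n + 2) < (Nat.primeCounting n : ℝ) ∧
      (Nat.primeCounting n : ℝ) < (n : ℝ) / (Real.log n - 4) := by
  rcases le_total n 512 with h | h
  · exact PNT.small_n n hn h
  have hx : (512 : ℝ) ≤ n := by exact_mod_cast h
  have hpi := Chebyshev.primeCounting_eq_theta_div_log_add_integral (x := (n : ℝ)) (by linarith)
  rw [Nat.floor_natCast] at hpi
  obtain ⟨h1, h2⟩ := PNT.main_est n hx
  have h3 := PNT.theta_low n hx
  have h4 := PNT.theta_up n hx
  have hL := PNT.log_gt_four hn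
  rw [hpi]
  generalize (∫ t in (2 : ℝ)..n, Chebyshev.theta t / (t * Real.log t ^ 2)) = I at *
  generalize Chebyshev.theta n = T at *
  generalize Real.log n = L at *
  generalize (n : ℝ) = x at *
  have hL0 : 0 < L := by linarith
  have hx0 : 0 < x := by linarith
  have h3' := div_le_div_of_nonneg_right h3 hL0.le
  have h4' := div_le_div_of_nonneg_right h4 hL0.le
  constructor
  · have : x / (L + 2) = x * (1 - 3 / L + 5 / L ^ 2) / L + (x / L ^ 2 - x / L ^ 3) - 8 * x / (L ^ 3 * (L + 2)) := by
      field_simp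
      ring
    have : 0 < 8 * x / (L ^ 3 * (L + 2)) := by positivity
    linarith
  · have h0 : 0 < L - 4 := by linarith
    have : x / (L - 4) = x * (1 + 3 / L) / L + (x / L ^ 2 + 16 * x / L ^ 3) + 64 * x / (L ^ 3 * (L - 4)) := by
      field_simp
      ring
    have : 0 < 64 * x / (L ^ 3 * (L - 4)) := by positivity
    linarith
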